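/- Let n ≥ 2 be an integer and let 1 ≤ p ≤ 2(n+1)/(n-1). For every ε > 0 there is a constant C_ε ≥ 1 (depending only on n, p, ε) such that for every 0 < δ < 1, every finite nonempty √δ-separated set Λ ⊂ P^{n-1}, every a : Λ → ℂ, every R ≥ δ^{-1} and every Euclidean ball B_R ⊂ ℝⁿ of radius R, one has C_ε^{-1} · δ^{ε} · (Σ_{ξ ∈ Λ} |a_ξ|²)^{1/2} ≤ ( (1/|B_R|) ∫_{B_R} |Σ_{ξ ∈ Λ} a_ξ e(ξ·x)|^p dx )^{1/p} ≤ C_ε · δ^{-ε} · (Σ_{ξ ∈ Λ} |a_ξ|²)^{1/2}. -/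

import Mathlib

open MeasureTheory Real
open scoped RealInnerProductSpace

noncomputable section

abbrev Rsp (m : ℕ) : Type := EuclideanSpace ℝ (Fin m ⊕ Unit)

/-- `e(t) = e^{2πit}`. -/
def ee (t : ℝ) : ℂ := Complex.exp (2 * Real.pi * Complex.I * t)

/-- The truncated elliptic paraboloid `P^{n-1} ⊂ ℝⁿ`. -/
def parabSurf (n : ℕ) : Set (Rsp (n - 1)) :=
  {x | (∀ i, |x (Sum.inl i)| ≤ 1 / 2) ∧
    x (Sum.inr ()) = ∑ i, (x (Sum.inl i)) ^ 2}

namespace DR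
open scoped ENNReal NNReal
open scoped Classical

theorem ee_add (a b : ℝ) : ee (a + b) = ee a * ee b := by
  unfold ee; rw [← Complex.exp_add]; push_cast; ring_nf

@[simp] theorem ee_zero : ee 0 = 1 := by simp [ee]

theorem norm_ee (t : ℝ) : ‖ee t‖ = 1 := by
  unfold ee
  rw [show (2 * (Real.pi:ℂ) * Complex.I * t) = ((2 * Real.pi * t : ℝ) : ℂ) * Complex.I by push_cast; ring]
  exact Complex.norm_exp_ofReal_mul_I _

theorem enorm_ee (t : ℝ) : ‖ee t‖ₑ = 1 := by
  rw [← ofReal_norm, norm_ee]; simp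

theorem continuous_ee : Continuous ee := by
  unfold ee; fun_prop

theorem measurable_ee : Measurable ee := continuous_ee.measurable

theorem ee_neg (t : ℝ) : ee (-t) = (starRingEnd ℂ) (ee t) := by
  unfold ee
  rw [← Complex.exp_conj]; simp [Complex.conj_ofNat]

theorem ee_sum {α : Type*} (s : Finset α) (f : α → ℝ) : ee (∑ i ∈ s, f i) = ∏ i ∈ s, ee (f i) := by
  induction s using Finset.induction_on with
  | empty => simp
  | insert a s h ih => rw [Finset.sum_insert h, Finset.prod_insert h, ee_add, ih]

theorem ee_int (k : ℤ) : ee k = 1 := by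
  unfold ee
  rw [Complex.exp_eq_one_iff]; exact ⟨k, by push_cast; ring⟩

variable {ι : Type} [Fintype ι] {I : Type}

/-- Euclidean pairing. -/
def ph (ζ x : ι → ℝ) : ℝ := ∑ j, ζ j * x j

theorem ph_add_right (ζ x y : ι → ℝ) : ph ζ (x + y) = ph ζ x + ph ζ y := by
  simp [ph, mul_add, Finset.sum_add_distrib]
theorem ph_sub_right (ζ x y : ι → ℝ) : ph ζ (x - y) = ph ζ x - ph ζ y := by
  simp [ph, mul_sub, Finset.sum_sub_distrib]
theorem ph_sub_left (ζ ξ y : ι → ℝ) : ph (ζ - ξ) y = ph ζ y - ph ξ y := by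
  simp [ph, sub_mul, Finset.sum_sub_distrib]
theorem ph_zero_right (ζ : ι → ℝ) : ph ζ 0 = 0 := by simp [ph]

theorem continuous_ph (ζ : ι → ℝ) : Continuous (ph ζ) := by
  unfold ph; fun_prop

/-- exponential sum -/
def es (ζ : I → ι → ℝ) (u : I → ℂ) (S : Finset I) (x : ι → ℝ) : ℂ :=
  ∑ l ∈ S, u l * ee (ph (ζ l) x)

/-- squared modulus of the exponential sum -/
def gg (ζ : I → ι → ℝ) (u : I → ℂ) (S : Finset I) (x : ι → ℝ) : ℝ≥0∞ :=
  ‖es ζ u S x‖ₑ ^ 2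

/-- phase shift of coefficients -/
def sh (ζ : I → ι → ℝ) (x : ι → ℝ) (s : ℝ) (u : I → ℂ) : I → ℂ :=
  fun l => ee (ph (ζ l) x + s) * u l

def Stat (μ : Measure (I → ℂ)) (ζ : I → ι → ℝ) : Prop :=
  ∀ x s, MeasurePreserving (sh ζ x s) μ μ

theorem es_sh (ζ : I → ι → ℝ) (x y : ι → ℝ) (s : ℝ) (u : I → ℂ) (S : Finset I) :
    es ζ (sh ζ x s u) S y = ee s * es ζ u S (x + y) := by
  unfold es sh
  rw [Finset.mul_sum]
  refine Finset.sum_congr rfl fun l _ => ?_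
  rw [ph_add_right, ee_add, ee_add]; ring

theorem gg_sh (ζ : I → ι → ℝ) (x y : ι → ℝ) (u : I → ℂ) (S : Finset I) :
    gg ζ (sh ζ x 0 u) S y = gg ζ u S (x + y) := by
  unfold gg; rw [es_sh]; simp

theorem es_zero (ζ : I → ι → ℝ) (u : I → ℂ) (S : Finset I) : es ζ u S 0 = ∑ l ∈ S, u l := by
  simp [es, ph_zero_right]

theorem continuous_es (ζ : I → ι → ℝ) (S : Finset I) :
    Continuous (fun q : (I → ℂ) × (ι → ℝ) => es ζ q.1 S q.2) := by
  unfold es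
  refine continuous_finset_sum _ fun l _ => ?_
  exact ((continuous_apply l).comp continuous_fst).mul
    (continuous_ee.comp ((continuous_ph _).comp continuous_snd))

theorem continuous_es_right (ζ : I → ι → ℝ) (S : Finset I) (u : I → ℂ) :
    Continuous (fun x => es ζ u S x) :=
  (continuous_es ζ S).comp (Continuous.prodMk continuous_const continuous_id)

theorem measurable_es (ζ : I → ι → ℝ) (S : Finset I) :
    Measurable (fun q : (I → ℂ) × (ι → ℝ) => es ζ q.1 S q.2) := by
  unfold es
  refine Finset.measurable_sum _ fun l _ => ?_
  exact ((measurable_pi_apply l).comp measurable_fst).mul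
    ((continuous_ee.comp (continuous_ph _)).measurable.comp measurable_snd)

theorem measurable_gg (ζ : I → ι → ℝ) (S : Finset I) :
    Measurable (fun q : (I → ℂ) × (ι → ℝ) => gg ζ q.1 S q.2) := by
  unfold gg; exact (measurable_es ζ S).enorm.pow_const 2

theorem measurable_gg' {α : Type*} [MeasurableSpace α] (ζ : I → ι → ℝ) (S : Finset I)
    {f : α → (I → ℂ)} {g : α → (ι → ℝ)} (hf : Measurable f) (hg : Measurable g) :
    Measurable (fun q => gg ζ (f q) S (g q)) := by
  have h := Measurable.comp (measurable_gg ζ S) (hf.prodMk hg)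
  exact h

theorem Stat.lintegral {μ : Measure (I → ℂ)} {ζ : I → ι → ℝ} (h : Stat μ ζ) (x : ι → ℝ)
    {G : (I → ℂ) → ℝ≥0∞} (hG : Measurable G) :
    ∫⁻ u, G (sh ζ x 0 u) ∂μ = ∫⁻ u, G u ∂μ :=
  (h x 0).lintegral_comp hG

/-- squared `L^{2r}` norm. -/
def NN (r : ℝ) (μ : Measure (I → ℂ)) (S : Finset I) : ℝ≥0∞ :=
  (∫⁻ u, (‖∑ l ∈ S, u l‖ₑ ^ 2) ^ r ∂μ) ^ (1 / r)

theorem Stat.lintegral_gg {μ : Measure (I → ℂ)} {ζ : I → ι → ℝ} (h : Stat μ ζ) (x : ι → ℝ)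
    (S : Finset I) (r : ℝ) :
    ∫⁻ u, (gg ζ u S x) ^ r ∂μ = ∫⁻ u, (‖∑ l ∈ S, u l‖ₑ ^ 2) ^ r ∂μ := by
  have hm : Measurable (fun u : I → ℂ => (gg ζ u S 0) ^ r) :=
    (measurable_gg' ζ S measurable_id measurable_const).pow_const r
  rw [show (fun u : I → ℂ => (‖∑ l ∈ S, u l‖ₑ ^ 2) ^ r) = fun u => (gg ζ u S 0) ^ r by
    funext u; simp [gg, es_zero]]
  rw [← h.lintegral x hm]
  simp only [gg_sh, add_zero]

/-- Affine stability of stationarity. -/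
theorem Stat.affine {ι' : Type} [Fintype ι'] {μ : Measure (I → ℂ)} {ζ : I → ι → ℝ} (h : Stat μ ζ)
    (A : ι' → ι → ℝ) (v : ι' → ℝ) :
    Stat μ (fun l j => ph (A j) (ζ l) + v j) := by
  intro x s
  have := h (fun i => ∑ j, A j i * x j) (ph v x + s)
  convert this using 1
  funext u l
  unfold sh
  congr 2
  unfold ph
  simp only [add_mul, Finset.sum_add_distrib, Finset.mul_sum, Finset.sum_mul]
  rw [Finset.sum_comm, add_assoc]
  congr 1
  refine Finset.sum_congr rfl fun i _ => Finset.sum_congr rfl fun j _ => by ring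

section Lq
variable {α : Type*} [MeasurableSpace α]

/-- Minkowski for finite sums. -/
theorem lq_sum_le {β : Type*} (μ : Measure α) {r : ℝ} (hr : 1 ≤ r) (s : Finset β)
    (f : β → α → ℝ≥0∞) (hf : ∀ b ∈ s, Measurable (f b)) :
    (∫⁻ a, (∑ b ∈ s, f b a) ^ r ∂μ) ^ (1 / r) ≤ ∑ b ∈ s, (∫⁻ a, (f b a) ^ r ∂μ) ^ (1 / r) := by
  induction s using Finset.induction_on with
  | empty =>
    have : (0:ℝ) < r := by linarith
    simp [this]
  | insert b s hb ih =>
    simp only [Finset.sum_insert hb]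
    refine (ENNReal.lintegral_Lp_add_le (p := r) (f := f b) (g := fun a => ∑ b ∈ s, f b a)
      (hf b (by simp)).aemeasurable
      (Finset.measurable_sum _ fun c hc => hf c (by simp [hc])).aemeasurable hr).trans ?_
    exact add_le_add le_rfl (ih fun c hc => hf c (by simp [hc]))

/-- Jensen. -/
theorem jensen_le (μ : Measure α) [IsProbabilityMeasure μ] {r : ℝ} (hr : 1 ≤ r)
    {f : α → ℝ≥0∞} (hf : Measurable f) :
    ∫⁻ a, f a ∂μ ≤ (∫⁻ a, (f a) ^ r ∂μ) ^ (1 / r) := by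
  have := ENNReal.lintegral_mul_norm_pow_le (μ := μ) (f := fun a => (f a) ^ r) (g := fun _ => 1)
    (p := 1 / r) (q := 1 - 1 / r) (hf.pow_const r).aemeasurable aemeasurable_const (by positivity)
    (by rw [sub_nonneg, div_le_one (by linarith)]; exact hr) (by ring)
  simpa [← ENNReal.rpow_mul, (by linarith : r ≠ 0), mul_inv_cancel₀ (by linarith : r ≠ 0)] using this

theorem jensen_ge (μ : Measure α) [IsProbabilityMeasure μ] {q : ℝ} (hq0 : 0 ≤ q) (hq : q ≤ 1)
    {f : α → ℝ≥0∞} (hf : Measurable f) :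
    ∫⁻ a, (f a) ^ q ∂μ ≤ (∫⁻ a, f a ∂μ) ^ q := by
  have := ENNReal.lintegral_mul_norm_pow_le (μ := μ) (f := f) (g := fun _ => 1)
    (p := q) (q := 1 - q) hf.aemeasurable aemeasurable_const hq0 (by linarith) (by ring)
  simpa using this

/-- Loomis–Whitney on a product of probability spaces. -/
theorem loomis {ι : Type*} [Fintype ι] (hn : 2 ≤ Fintype.card ι) (μ : ι → Measure ℝ)
    [∀ i, IsProbabilityMeasure (μ i)] (f : ι → (ι → ℝ) → ℝ≥0∞) (hf : ∀ i, Measurable (f i))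
    (hi : ∀ i x t, f i (Function.update x i t) = f i x) :
    ∫⁻ x, ∏ i, (f i x) ^ (1 / ((Fintype.card ι : ℝ) - 1)) ∂(Measure.pi μ) ≤
      ∏ i, (∫⁻ x, f i x ∂(Measure.pi μ)) ^ (1 / ((Fintype.card ι : ℝ) - 1)) := by
  set q : ℝ := 1 / ((Fintype.card ι : ℝ) - 1) with hq
  have hn' : (2:ℝ) ≤ Fintype.card ι := by exact_mod_cast hn
  have hq0 : 0 ≤ q := by rw [hq]; apply div_nonneg <;> linarith
  have key : ∀ s : Finset ι, ∀ x, (∫⋯∫⁻_s, (fun x => ∏ i, (f i x) ^ q) ∂μ) x ≤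
      ∏ i, ((∫⋯∫⁻_s, f i ∂μ) x) ^ q := by
    intro s
    induction s using Finset.induction_on with
    | empty => intro x; simp
    | insert j s hj ih =>
      intro x
      rw [lmarginal_insert _ (Finset.measurable_prod _ fun i _ => (hf i).pow_const q) hj]
      calc _ ≤ ∫⁻ t, ∏ i, ((∫⋯∫⁻_s, f i ∂μ) (Function.update x j t)) ^ q ∂μ j :=
            lintegral_mono fun t => ih _
        _ = ∫⁻ t, ((∫⋯∫⁻_s, f j ∂μ) x) ^ q *
              ∏ i ∈ Finset.univ.erase j, ((∫⋯∫⁻_s, f i ∂μ) (Function.update x j t)) ^ q ∂μ j := by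
            refine lintegral_congr fun t => ?_
            rw [← Finset.mul_prod_erase _ _ (Finset.mem_univ j)]
            congr 2
            rw [lmarginal_update_of_notMem (hf j) hj]
            congr 1
            funext y
            exact hi j y t
        _ = ((∫⋯∫⁻_s, f j ∂μ) x) ^ q *
              ∫⁻ t, ∏ i ∈ Finset.univ.erase j, ((∫⋯∫⁻_s, f i ∂μ) (Function.update x j t)) ^ q ∂μ j := by
            rw [lintegral_const_mul]
            exact Finset.measurable_prod _ fun i _ => (((hf i).lmarginal μ).comp
              (measurable_update x)).pow_const q
        _ ≤ ((∫⋯∫⁻_s, f j ∂μ) x) ^ q *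
              ∏ i ∈ Finset.univ.erase j, (∫⁻ t, (∫⋯∫⁻_s, f i ∂μ) (Function.update x j t) ∂μ j) ^ q := by
            gcongr
            refine ENNReal.lintegral_prod_norm_pow_le _ (fun i _ => (((hf i).lmarginal μ).comp
              (measurable_update x)).aemeasurable) ?_ (fun i _ => hq0)
            rw [Finset.sum_const, Finset.card_erase_of_mem (Finset.mem_univ j), Finset.card_univ,
              nsmul_eq_mul, Nat.cast_sub (by omega), hq]
            push_cast
            rw [mul_one_div, div_self (by linarith)]
        _ = _ := by
            rw [← Finset.mul_prod_erase _ _ (Finset.mem_univ j)]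
            congr 1
            · congr 1
              rw [lmarginal_insert _ (hf j) hj]
              have : ∀ t, (∫⋯∫⁻_s, f j ∂μ) (Function.update x j t) = (∫⋯∫⁻_s, f j ∂μ) x := by
                intro t
                rw [lmarginal_update_of_notMem (hf j) hj]
                congr 1
                funext y
                exact hi j y t
              simp [this]
            · refine Finset.prod_congr rfl fun i _ => ?_
              rw [lmarginal_insert _ (hf i) hj]
  have := key Finset.univ 0
  simpa only [lmarginal_univ] using this

end Lq
end DR

namespace DR
open scoped ENNReal NNReal
open scoped Classical

/-- Polynomially decaying kernel at scale `r`. -/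
def kap (e : ℕ) (r s : ℝ) : ℝ := r⁻¹ * ((1 + (s / r) ^ 2)⁻¹) ^ e

theorem kap_pos (e : ℕ) {r : ℝ} (hr : 0 < r) (s : ℝ) : 0 < kap e r s := by
  unfold kap; positivity

theorem continuous_kap (e : ℕ) (r : ℝ) : Continuous (kap e r) := by
  unfold kap
  refine continuous_const.mul (Continuous.pow (Continuous.inv₀ (by fun_prop) ?_) e)
  intro x; positivity

@[fun_prop] theorem meas_kap (e : ℕ) (r : ℝ) : Measurable (kap e r) := (continuous_kap e r).measurable

theorem measurable_kap (e : ℕ) (r : ℝ) : Measurable (fun s => ENNReal.ofReal (kap e r s)) :=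
  (continuous_kap e r).measurable.ennreal_ofReal

theorem kap_harnack (e : ℕ) {r : ℝ} (hr : 0 < r) {s t : ℝ} (ht : |t| ≤ r) :
    kap e r (s + t) ≤ 3 ^ e * kap e r s := by
  unfold kap
  have h : (1 + ((s + t) / r) ^ 2)⁻¹ ≤ 3 * (1 + (s / r) ^ 2)⁻¹ := by
    rw [← div_eq_mul_inv, le_div_iff₀ (by positivity), inv_mul_le_iff₀ (by positivity)]
    have h1 : (t / r) ^ 2 ≤ 1 := by
      rw [sq_le_one_iff_abs_le_one, abs_div, abs_of_pos hr]; exact (div_le_one hr).2 ht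
    rw [add_div]
    nlinarith [sq_nonneg (s / r + 2 * (t / r)), sq_nonneg (s/r + t/r)]
  calc _ ≤ r⁻¹ * (3 * (1 + (s / r) ^ 2)⁻¹) ^ e := by gcongr
    _ = _ := by rw [mul_pow]; ring

theorem kap_mass {e : ℕ} (he : 1 ≤ e) {r : ℝ} (hr : 0 < r) (b : ℝ) :
    ∫⁻ s, ENNReal.ofReal (kap e r (b - s)) ≤ 4 := by
  have h0 : ∫⁻ s, ENNReal.ofReal (kap e r (b - s)) = ∫⁻ s, ENNReal.ofReal (kap e r s) :=
    lintegral_sub_left_eq_self (fun s => ENNReal.ofReal (kap e r s)) b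
  rw [h0]
  calc ∫⁻ s, ENNReal.ofReal (kap e r s) ≤ ∫⁻ s, ENNReal.ofReal (r⁻¹ * (1 + (s / r) ^ 2)⁻¹) := by
        refine lintegral_mono fun s => ENNReal.ofReal_le_ofReal ?_
        unfold kap
        gcongr
        have : (1 + (s / r) ^ 2)⁻¹ ≤ 1 := inv_le_one_of_one_le₀ (by nlinarith [sq_nonneg (s / r)])
        calc _ ≤ ((1 + (s / r) ^ 2)⁻¹) ^ 1 := pow_le_pow_of_le_one (by positivity) this he
          _ = _ := pow_one _
    _ = ENNReal.ofReal (∫ s, r⁻¹ * (1 + (s / r) ^ 2)⁻¹) := by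
        rw [ofReal_integral_eq_lintegral_ofReal]
        · exact (integrable_inv_one_add_sq.comp_div hr.ne').const_mul _
        · exact Filter.Eventually.of_forall fun s => by positivity
    _ ≤ 4 := by
        rw [integral_const_mul, Measure.integral_comp_div (fun x : ℝ => (1 + x ^ 2)⁻¹) r,
          integral_univ_inv_one_add_sq, abs_of_pos hr, smul_eq_mul, ← mul_assoc,
          inv_mul_cancel₀ hr.ne', one_mul]
        exact (ENNReal.ofReal_le_ofReal Real.pi_le_four).trans (by simp)

theorem kap_avg {e : ℕ} (he : 1 ≤ e) {r R : ℝ} (hr : 0 < r) (hrR : r ≤ R) (b : ℝ) :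
    ∫⁻ q in Set.Icc (-R) R, ENNReal.ofReal (kap e r (b - q)) ≤
      ENNReal.ofReal (4 * 5 ^ e * (R * kap e R b)) := by
  have hR : 0 < R := by linarith
  have hRk : R * kap e R b = ((1 + (b / R) ^ 2)⁻¹) ^ e := by
    unfold kap; rw [← mul_assoc, mul_inv_cancel₀ hR.ne', one_mul]
  rw [hRk]
  by_cases hb : |b| ≤ 2 * R
  · calc _ ≤ ∫⁻ q, ENNReal.ofReal (kap e r (b - q)) := setLIntegral_le_lintegral _ _
      _ ≤ 4 := kap_mass he hr b
      _ = ENNReal.ofReal 4 := by simp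
      _ ≤ _ := by
        refine ENNReal.ofReal_le_ofReal ?_
        rw [mul_assoc, ← mul_pow]
        have : (1:ℝ) ≤ 5 * (1 + (b / R) ^ 2)⁻¹ := by
          rw [← div_eq_mul_inv, le_div_iff₀ (by positivity)]
          have : (b / R) ^ 2 ≤ 4 := by
            rw [div_pow, div_le_iff₀ (by positivity), ← sq_abs b]
            nlinarith [abs_nonneg b]
          linarith
        nlinarith [one_le_pow₀ this (n := e)]
  · push Not at hb
    have hbp : 0 < |b| := by linarith
    have hpt : ∀ q ∈ Set.Icc (-R) R, ENNReal.ofReal (kap e r (b - q)) ≤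
        ENNReal.ofReal (R⁻¹ * 5 ^ e * ((1 + (b / R) ^ 2)⁻¹) ^ e) := by
      intro q hq
      refine ENNReal.ofReal_le_ofReal ?_
      have hq' : |q| ≤ R := abs_le.2 hq
      have h1 : |b| / 2 ≤ |b - q| := by
        have := abs_sub_abs_le_abs_sub b q
        linarith
      have h2 : b ^ 2 / 4 ≤ (b - q) ^ 2 := by
        rw [← sq_abs b, ← sq_abs (b - q)]; nlinarith
      have h3 : R ^ 2 ≤ b ^ 2 / 4 := by rw [← sq_abs b]; nlinarith
      have hX : (1 + ((b - q) / r) ^ 2)⁻¹ ≤ (r / R) ^ 2 * (5 * (1 + (b / R) ^ 2)⁻¹) := by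
        rw [inv_le_iff_one_le_mul₀ (by positivity)]
        have : (R ^ 2 + b ^ 2) / 5 ≤ (b - q) ^ 2 := by linarith
        have e1 : (r / R) ^ 2 * (5 * (1 + (b / R) ^ 2)⁻¹) = 5 * r ^ 2 / (R ^ 2 + b ^ 2) := by
          field_simp
        rw [e1]
        have e2 : 1 + ((b - q) / r) ^ 2 = (r ^ 2 + (b - q) ^ 2) / r ^ 2 := by field_simp
        rw [e2, div_mul_div_comm, le_div_iff₀ (by positivity)]
        nlinarith [sq_nonneg r, mul_nonneg (sq_nonneg r) (sq_nonneg r), mul_le_mul_of_nonneg_left this (sq_nonneg r)]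
      unfold kap
      calc r⁻¹ * ((1 + ((b - q) / r) ^ 2)⁻¹) ^ e
          ≤ r⁻¹ * ((r / R) ^ 2 * (5 * (1 + (b / R) ^ 2)⁻¹)) ^ e := by gcongr
        _ = r⁻¹ * ((r / R) ^ (2 * e)) * (5 ^ e * ((1 + (b / R) ^ 2)⁻¹) ^ e) := by
          rw [mul_pow, mul_pow, ← pow_mul]; ring
        _ ≤ r⁻¹ * (r / R) * (5 ^ e * ((1 + (b / R) ^ 2)⁻¹) ^ e) := by
          gcongr
          calc (r / R) ^ (2 * e) ≤ (r / R) ^ 1 :=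
                pow_le_pow_of_le_one (by positivity) ((div_le_one hR).2 hrR) (by omega)
            _ = _ := pow_one _
        _ = _ := by field_simp
    calc _ ≤ ∫⁻ q in Set.Icc (-R) R, ENNReal.ofReal (R⁻¹ * 5 ^ e * ((1 + (b / R) ^ 2)⁻¹) ^ e) :=
          setLIntegral_mono measurable_const hpt
      _ = ENNReal.ofReal (R⁻¹ * 5 ^ e * ((1 + (b / R) ^ 2)⁻¹) ^ e) * ENNReal.ofReal (2 * R) := by
          rw [setLIntegral_const, Real.volume_Icc]; congr 2; ring
      _ = ENNReal.ofReal (R⁻¹ * 5 ^ e * ((1 + (b / R) ^ 2)⁻¹) ^ e * (2 * R)) := by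
          rw [← ENNReal.ofReal_mul (by positivity)]
      _ ≤ _ := by
          refine ENNReal.ofReal_le_ofReal ?_
          have : R⁻¹ * 5 ^ e * ((1 + (b / R) ^ 2)⁻¹) ^ e * (2 * R) = 2 * (5 ^ e * ((1 + (b / R) ^ 2)⁻¹) ^ e) := by
            field_simp
          rw [this, mul_assoc]
          have : 0 ≤ (5 ^ e * ((1 + (b / R) ^ 2)⁻¹) ^ e) := by positivity
          linarith

open FourierTransform SchwartzMap in
theorem schwartz_bound (f : 𝓢(ℝ, ℂ)) (e : ℕ) : ∃ C > 0, ∀ s, ‖f s‖ ≤ C * kap e 1 s := by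
  obtain ⟨C0, h0⟩ := f.decay 0 0
  obtain ⟨C1, h1⟩ := f.decay (2 * e) 0
  have hC0 : 0 < C0 := h0.1
  have hC1 : 0 < C1 := h1.1
  refine ⟨2 ^ e * (C0 + C1), by positivity, fun s => ?_⟩
  have a0 := h0.2 s
  have a1 := h1.2 s
  simp only [pow_zero, one_mul, norm_iteratedFDeriv_zero] at a0 a1
  unfold kap
  simp only [inv_one, one_mul, div_one]
  rw [inv_pow, ← div_eq_mul_inv, le_div_iff₀ (by positivity)]
  rw [pow_mul, Real.norm_eq_abs, sq_abs] at a1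
  have hb : (1 + s ^ 2) ^ e ≤ 2 ^ e * (1 + (s ^ 2) ^ e) := by
    rcases le_total (s ^ 2) 1 with h | h
    · calc (1 + s ^ 2) ^ e ≤ 2 ^ e := by gcongr; linarith
        _ ≤ _ := by
          have : 0 ≤ (s ^ 2) ^ e := by positivity
          have h2 : (0:ℝ) < 2 ^ e := by positivity
          nlinarith
    · calc (1 + s ^ 2) ^ e ≤ (2 * s ^ 2) ^ e := by gcongr; linarith
        _ = 2 ^ e * (s ^ 2) ^ e := mul_pow _ _ _
        _ ≤ _ := by gcongr; linarith
  calc ‖f s‖ * (1 + s ^ 2) ^ e ≤ ‖f s‖ * (2 ^ e * (1 + (s ^ 2) ^ e)) := by gcongr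
    _ = 2 ^ e * (‖f s‖ + (s ^ 2) ^ e * ‖f s‖) := by ring
    _ ≤ _ := by gcongr

open FourierTransform SchwartzMap in
theorem fourier_eq_ee (f : ℝ → ℂ) (ξ : ℝ) : 𝓕 f ξ = ∫ s, f s * ee (-(ξ * s)) := by
  rw [Real.fourier_real_eq_integral_exp_smul]
  congr 1; funext s
  rw [smul_eq_mul, mul_comm]
  congr 1
  unfold ee
  congr 1
  push_cast; ring

open FourierTransform SchwartzMap in
/-- Reproducing kernel. -/
theorem exists_phi (e : ℕ) {C1 : ℝ} (hC1 : 0 < C1) : ∃ φ : ℝ → ℂ, Continuous φ ∧ Integrable φ ∧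
    (∃ C > 0, ∀ s, ‖φ s‖ ≤ C * kap e 1 s) ∧
    ∀ ξ, |ξ| ≤ C1 → ∫ s, φ s * ee (-(ξ * s)) = 1 := by
  let b : ContDiffBump (0:ℝ) := ⟨C1, 2 * C1, hC1, by linarith⟩
  have hs : ContDiff ℝ (⊤ : ℕ∞) (fun x => ((b x : ℝ) : ℂ)) := Complex.ofRealCLM.contDiff.comp b.contDiff
  have hc : HasCompactSupport (fun x => ((b x : ℝ) : ℂ)) :=
    b.hasCompactSupport.comp_left (g := fun x : ℝ => (x : ℂ)) (by simp)
  let B : 𝓢(ℝ, ℂ) := hc.toSchwartzMap hs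
  let Φ : 𝓢(ℝ, ℂ) := 𝓕⁻ B
  refine ⟨Φ, Φ.continuous, Φ.integrable, schwartz_bound Φ e, fun ξ hξ => ?_⟩
  rw [← fourier_eq_ee, ← fourier_coe]
  have : 𝓕 Φ = B := by simp [Φ]
  rw [this]
  change ((b ξ : ℝ) : ℂ) = 1
  rw [b.one_of_mem_closedBall (by simpa [b] using hξ)]
  simp

open FourierTransform SchwartzMap in
/-- Nonnegative Schwartz-type density with compactly supported Fourier transform. -/
theorem exists_psi (e : ℕ) : ∃ w : ℝ → ℝ, Continuous w ∧ (∀ s, 0 ≤ w s) ∧ 0 < w 0 ∧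
    (∃ C > 0, ∀ s, w s ≤ C * kap e 1 s) ∧
    ∀ ξ, 1 ≤ |ξ| → ∫ s, ee (ξ * s) * (w s : ℂ) = 0 := by
  let b : ContDiffBump (0:ℝ) := ⟨1/4, 1/2, by norm_num, by norm_num⟩
  have hs : ContDiff ℝ (⊤ : ℕ∞) (fun x => ((b x : ℝ) : ℂ)) := Complex.ofRealCLM.contDiff.comp b.contDiff
  have hc : HasCompactSupport (fun x => ((b x : ℝ) : ℂ)) :=
    b.hasCompactSupport.comp_left (g := fun x : ℝ => (x : ℂ)) (by simp)
  let B : 𝓢(ℝ, ℂ) := hc.toSchwartzMap hs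
  obtain ⟨C, hC, hB⟩ := schwartz_bound (𝓕 B) e
  refine ⟨fun s => ‖𝓕 B s‖ ^ 2, by have := (𝓕 B).continuous; fun_prop, fun s => by positivity, ?_, ?_, ?_⟩
  · have : 𝓕 B 0 = ((∫ x, b x : ℝ) : ℂ) := by
      rw [fourier_coe, fourier_eq_ee]
      simp only [zero_mul, neg_zero, ee_zero, mul_one]
      rw [← integral_complex_ofReal]
      rfl
    show 0 < ‖𝓕 B 0‖ ^ 2
    rw [this]
    have hp : 0 < ∫ x, b x := b.integral_pos
    simp only [Complex.norm_real, Real.norm_eq_abs]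
    positivity
  · refine ⟨C ^ 2, by positivity, fun s => ?_⟩
    calc ‖𝓕 B s‖ ^ 2 ≤ (C * kap e 1 s) ^ 2 := by gcongr; exact hB s
      _ = C ^ 2 * kap e 1 s * kap e 1 s := by ring
      _ ≤ C ^ 2 * kap e 1 s * 1 := by
        have := (kap_pos e one_pos s).le
        gcongr
        unfold kap
        simp only [inv_one, one_mul, div_one]
        exact pow_le_one₀ (by positivity) (inv_le_one_of_one_le₀ (by nlinarith [sq_nonneg s]))
      _ = _ := mul_one _
  · intro ξ hξ
    have hs' : ContDiff ℝ (⊤ : ℕ∞) (fun x => ((b (x + ξ) : ℝ) : ℂ)) :=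
      hs.comp (contDiff_id.add contDiff_const)
    have hc' : HasCompactSupport (fun x => ((b (x + ξ) : ℝ) : ℂ)) :=
      hc.comp_homeomorph (Homeomorph.addRight ξ)
    let G : 𝓢(ℝ, ℂ) := hc'.toSchwartzMap hs'
    have hG : ∀ s, 𝓕 G s = ee (ξ * s) * 𝓕 B s := by
      intro s
      rw [fourier_coe, fourier_coe, fourier_eq_ee, fourier_eq_ee]
      rw [← integral_const_mul]
      rw [← integral_sub_right_eq_self _ ξ]
      refine integral_congr_ae (Filter.Eventually.of_forall fun x => ?_)
      change ((b (x - ξ + ξ) : ℝ) : ℂ) * _ = ee (ξ * s) * (((b x : ℝ) : ℂ) * _)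
      rw [sub_add_cancel, show -(s * (x - ξ)) = ξ * s + -(s * x) by ring, ee_add]
      ring
    have := integral_inner_fourier_fourier B G
    calc ∫ s, ee (ξ * s) * ((‖𝓕 B s‖ ^ 2 : ℝ) : ℂ) = ∫ s, inner ℂ (𝓕 B s) (𝓕 G s) := by
          congr 1; funext s
          rw [hG]
          simp only [RCLike.inner_apply]
          rw [mul_assoc]
          congr 1
          rw [Complex.mul_conj, Complex.normSq_eq_norm_sq]
      _ = ∫ s, inner ℂ (B s) (G s) := this
      _ = ∫ s : ℝ, (0:ℂ) := by
          congr 1; funext s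
          have hBs : B s = ((b s : ℝ) : ℂ) := rfl
          have hGs : G s = ((b (s + ξ) : ℝ) : ℂ) := rfl
          rw [hBs, hGs]
          by_cases h : |s| < 1 / 2
          · have : b (s + ξ) = 0 := by
              apply b.zero_of_le_dist
              simp only [b, dist_zero_right, Real.norm_eq_abs]
              have := abs_sub_abs_le_abs_sub ξ (-s)
              rw [abs_neg, sub_neg_eq_add, add_comm ξ s] at this
              linarith
            simp [this]
          · have : b s = 0 := by
              apply b.zero_of_le_dist
              simp only [b, dist_zero_right, Real.norm_eq_abs]
              linarith
            simp [this]
      _ = 0 := by simp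

end DR

namespace DR
open scoped ENNReal NNReal
open scoped Classical

theorem lintegral_scale {L : ℝ} (hL : 0 < L) {g : ℝ → ℝ≥0∞} (hg : Measurable g) :
    ∫⁻ t, g (L * t) = ENNReal.ofReal L⁻¹ * ∫⁻ s, g s := by
  have h1 : ∫⁻ s, g s ∂(Measure.map (L * ·) volume) = ∫⁻ t, g (L * t) :=
    lintegral_map hg (measurable_const_mul L)
  rw [← h1, Real.map_volume_mul_left hL.ne', lintegral_smul_measure, abs_of_pos (inv_pos.2 hL)]
  rfl

theorem kap_scale (e : ℕ) {L : ℝ} (hL : 0 < L) (t : ℝ) : kap e L (L * t) = L⁻¹ * kap e 1 t := by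
  unfold kap
  rw [mul_div_cancel_left₀ _ hL.ne']; simp

theorem lintegral_kap_scale (e : ℕ) {L : ℝ} (hL : 0 < L) {g : ℝ → ℝ≥0∞} (hg : Measurable g) :
    ∫⁻ s, ENNReal.ofReal (kap e L s) * g s = ∫⁻ t, ENNReal.ofReal (kap e 1 t) * g (L * t) := by
  have h := lintegral_scale hL (g := fun s => ENNReal.ofReal (kap e L s) * g s)
    ((measurable_kap e L).mul hg)
  have hLp : ENNReal.ofReal L * ENNReal.ofReal L⁻¹ = 1 := by
    rw [← ENNReal.ofReal_mul hL.le, mul_inv_cancel₀ hL.ne']; simp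
  calc _ = ENNReal.ofReal L * (ENNReal.ofReal L⁻¹ * ∫⁻ s, ENNReal.ofReal (kap e L s) * g s) := by
        rw [← mul_assoc, hLp, one_mul]
    _ = ENNReal.ofReal L * ∫⁻ t, ENNReal.ofReal (kap e L (L * t)) * g (L * t) := by rw [h]
    _ = _ := by
        have hk := measurable_kap e L
        rw [← lintegral_const_mul _ (by fun_prop)]
        refine lintegral_congr fun t => ?_
        rw [kap_scale e hL, ENNReal.ofReal_mul (inv_pos.2 hL).le, ← mul_assoc, ← mul_assoc, hLp, one_mul]

/-- The orthogonality measures. -/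
theorem exists_om {e : ℕ} (he : 1 ≤ e) : ∃ (om : ℝ → Measure ℝ) (C : ℝ≥0∞), C ≠ ⊤ ∧ ∀ L, 0 < L →
    IsProbabilityMeasure (om L) ∧
    (∀ ξ, 1 / L ≤ |ξ| → ∫ s, ee (ξ * s) ∂(om L) = 0) ∧
    (∀ g : ℝ → ℝ≥0∞, Measurable g →
      ∫⁻ s, ENNReal.ofReal (kap e L s) * g s ≤ C * ∫⁻ s, g s ∂(om L)) ∧
    (∀ g : ℝ → ℝ≥0∞, Measurable g →
      ∫⁻ s, g s ∂(om L) ≤ C * ∫⁻ s, ENNReal.ofReal (kap e L s) * g s) := by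
  obtain ⟨w, hwc, hw0, hwp, ⟨Cw, hCw, hwb⟩, hwf⟩ := exists_psi (e + 1)
  set W : ℝ → ℝ≥0∞ := fun s => ENNReal.ofReal (w s) with hW
  set K : ℝ → ℝ≥0∞ := fun s => ENNReal.ofReal (kap e 1 s) with hK
  have hWm : Measurable W := hwc.measurable.ennreal_ofReal
  have hKm : Measurable K := measurable_kap e 1
  set Z := ∫⁻ s, W s with hZ
  set Y := ∫⁻ s, K s with hY
  have mass_pos : ∀ (f : ℝ → ℝ), Continuous f → 0 < f 0 →
      (∫⁻ s in Set.Icc (-1) 1, ENNReal.ofReal (f s)) ≠ 0 := by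
    intro f hf hf0 hh
    rw [lintegral_eq_zero_iff hf.measurable.ennreal_ofReal, Filter.EventuallyEq,
      ae_restrict_iff' measurableSet_Icc] at hh
    have ho : IsOpen {s : ℝ | 0 < f s ∧ s ∈ Set.Ioo (-1:ℝ) 1} :=
      (isOpen_lt continuous_const hf).inter isOpen_Ioo
    have hpos := ho.measure_pos volume ⟨0, hf0, by norm_num⟩
    refine hpos.ne' (measure_mono_null ?_ hh)
    intro s hs
    simp only [Set.mem_compl_iff, Set.mem_setOf_eq, Pi.zero_apply, ENNReal.ofReal_eq_zero, not_forall, not_le]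
    exact ⟨Set.Ioo_subset_Icc_self hs.2, hs.1⟩
  have kap1 : ∫⁻ s, ENNReal.ofReal (kap 1 1 s) ≤ 4 := by
    have := kap_mass (le_refl 1) one_pos 0
    rwa [lintegral_sub_left_eq_self (fun s => ENNReal.ofReal (kap 1 1 s)) 0] at this
  have hinv1 : ∀ s : ℝ, (1 + s ^ 2)⁻¹ ≤ 1 := fun s => inv_le_one_of_one_le₀ (by nlinarith [sq_nonneg s])
  set V := ∫⁻ s, ENNReal.ofReal ((1 + s ^ 2) ^ e * w s) with hV
  have hVtop : V ≠ ⊤ := by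
    refine ne_top_of_le_ne_top (b := ENNReal.ofReal Cw * 4) (by finiteness) ?_
    refine le_trans ?_ (mul_le_mul_right kap1 (ENNReal.ofReal Cw))
    rw [← lintegral_const_mul _ (measurable_kap 1 1)]
    refine lintegral_mono fun s => ?_
    rw [← ENNReal.ofReal_mul hCw.le]
    refine ENNReal.ofReal_le_ofReal ?_
    calc (1 + s ^ 2) ^ e * w s ≤ (1 + s ^ 2) ^ e * (Cw * kap (e + 1) 1 s) := by gcongr; exact hwb s
      _ = _ := by
        unfold kap
        simp only [inv_one, one_mul, div_one, pow_one]
        rw [pow_succ, inv_pow]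
        have : (1 + s ^ 2) ^ e ≠ 0 := by positivity
        field_simp
        ring
  have hZV : Z ≤ V := lintegral_mono fun s => ENNReal.ofReal_le_ofReal (by
    have : 1 ≤ (1 + s ^ 2) ^ e := one_le_pow₀ (by nlinarith [sq_nonneg s])
    nlinarith [hw0 s])
  have hZtop : Z ≠ ⊤ := ne_top_of_le_ne_top hVtop hZV
  set Z1 := ∫⁻ s in Set.Icc (-1) 1, W s with hZ1
  have hZ1p : Z1 ≠ 0 := mass_pos w hwc hwp
  have hZ1le : Z1 ≤ Z := setLIntegral_le_lintegral _ _
  have hZ0 : Z ≠ 0 := fun h => hZ1p (le_antisymm (h ▸ hZ1le) bot_le)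
  have hYtop : Y ≠ ⊤ := by
    have := kap_mass he one_pos 0
    rw [lintegral_sub_left_eq_self (fun s => ENNReal.ofReal (kap e 1 s)) 0] at this
    exact ne_top_of_le_ne_top (by norm_num) this
  have hY0 : Y ≠ 0 := fun h => mass_pos _ (continuous_kap e 1) (kap_pos e one_pos 0)
    (le_antisymm (h ▸ setLIntegral_le_lintegral _ _) bot_le)
  set ψ : Measure ℝ := Z⁻¹ • volume.withDensity W with hψ
  set κ : Measure ℝ := Y⁻¹ • volume.withDensity K with hκ
  have pψ : IsProbabilityMeasure ψ := ⟨by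
    simp [hψ, withDensity_apply, ← hZ, ENNReal.inv_mul_cancel hZ0 hZtop]⟩
  have pκ : IsProbabilityMeasure κ := ⟨by
    simp [hκ, withDensity_apply, ← hY, ENNReal.inv_mul_cancel hY0 hYtop]⟩
  have hform : ∀ L, 0 < L → ∀ g : ℝ → ℝ≥0∞, Measurable g →
      ∫⁻ s, g s ∂(Measure.map (fun q : ℝ × ℝ => L * (q.1 + q.2)) (ψ.prod κ)) =
        Z⁻¹ * (Y⁻¹ * ∫⁻ x, W x * ∫⁻ t, K (t - x) * g (L * t)) := by
    intro L hL g hg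
    rw [lintegral_map hg (by fun_prop), lintegral_prod _ (by fun_prop)]
    have h1 : ∀ x, ∫⁻ y, g (L * (x + y)) ∂κ = Y⁻¹ * ∫⁻ t, K (t - x) * g (L * t) := by
      intro x
      rw [hκ, lintegral_smul_measure, lintegral_withDensity_eq_lintegral_mul _ hKm (by fun_prop)]
      rw [smul_eq_mul]
      congr 1
      rw [← lintegral_sub_right_eq_self _ x]
      simp only [Pi.mul_apply, add_sub_cancel]
    simp only [h1]
    have hmm : Measurable fun x => ∫⁻ t, K (t - x) * g (L * t) := by
      apply Measurable.lintegral_prod_right' (f := fun q : ℝ × ℝ => K (q.2 - q.1) * g (L * q.2))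
      fun_prop
    rw [hψ, lintegral_smul_measure, lintegral_withDensity_eq_lintegral_mul _ hWm (by fun_prop)]
    rw [smul_eq_mul]
    congr 1
    rw [← lintegral_const_mul _ (by fun_prop)]
    refine lintegral_congr fun x => ?_
    simp only [Pi.mul_apply]
    ring
  have hinvZ : Z⁻¹ ≠ ⊤ := ENNReal.inv_ne_top.2 hZ0
  have hinvY : Y⁻¹ ≠ ⊤ := ENNReal.inv_ne_top.2 hY0
  refine ⟨fun L => Measure.map (fun q : ℝ × ℝ => L * (q.1 + q.2)) (ψ.prod κ),
    3 ^ e * Z1⁻¹ * (Z * Y) + Z⁻¹ * (Y⁻¹ * (2 ^ e * V)), ?_, fun L hL => ⟨?_, ?_, ?_, ?_⟩⟩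
  · have : Z1⁻¹ ≠ ⊤ := ENNReal.inv_ne_top.2 hZ1p
    finiteness
  · exact Measure.isProbabilityMeasure_map (by fun_prop)
  · intro ξ hξ
    rw [integral_map (by fun_prop) (by
      exact (continuous_ee.comp (continuous_const_mul ξ)).aestronglyMeasurable)]
    have : ∀ q : ℝ × ℝ, ee (ξ * (L * (q.1 + q.2))) = ee ((ξ * L) * q.1) * ee ((ξ * L) * q.2) := by
      intro q; rw [← ee_add]; congr 1; ring
    simp only [this]
    rw [integral_prod_mul (fun x => ee ((ξ * L) * x)) (fun x => ee ((ξ * L) * x))]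
    have h0 : ∫ x, ee (ξ * L * x) ∂ψ = 0 := by
      rw [hψ, integral_smul_measure]
      rw [integral_withDensity_eq_integral_toReal_smul hWm (Filter.Eventually.of_forall fun s => by simp [hW])]
      have := hwf (ξ * L) (by
        rw [abs_mul, abs_of_pos hL]; rwa [div_le_iff₀ hL] at hξ)
      rw [show (∫ x, (W x).toReal • ee (ξ * L * x)) = ∫ s, ee (ξ * L * s) * (w s : ℂ) from ?_, this, smul_zero]
      congr 1; funext s
      rw [hW]; simp only [ENNReal.toReal_ofReal (hw0 s)]
      rw [Complex.real_smul, mul_comm]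
    rw [h0, zero_mul]
  · intro g hg
    rw [hform L hL g hg, lintegral_kap_scale e hL hg]
    have hmm : Measurable fun x => ∫⁻ t, K (t - x) * g (L * t) := by
      apply Measurable.lintegral_prod_right' (f := fun q : ℝ × ℝ => K (q.2 - q.1) * g (L * q.2))
      fun_prop
    have hlow : Z1 * ∫⁻ t, K t * g (L * t) ≤ 3 ^ e * ∫⁻ x, W x * ∫⁻ t, K (t - x) * g (L * t) := by
      calc Z1 * ∫⁻ t, K t * g (L * t) = ∫⁻ x in Set.Icc (-1) 1, W x * ∫⁻ t, K t * g (L * t) := by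
            rw [hZ1, lintegral_mul_const _ hWm]
        _ ≤ ∫⁻ x in Set.Icc (-1) 1, 3 ^ e * (W x * ∫⁻ t, K (t - x) * g (L * t)) := by
            refine setLIntegral_mono (by fun_prop) fun x hx => ?_
            rw [mul_left_comm]
            gcongr
            rw [← lintegral_const_mul _ (by fun_prop)]
            refine lintegral_mono fun t => ?_
            rw [← mul_assoc]
            gcongr
            have := kap_harnack e one_pos (s := t - x) (t := x) (abs_le.2 hx)
            rw [sub_add_cancel] at this
            rw [hK]
            calc ENNReal.ofReal (kap e 1 t) ≤ ENNReal.ofReal (3 ^ e * kap e 1 (t - x)) := ENNReal.ofReal_le_ofReal this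
              _ = _ := by rw [ENNReal.ofReal_mul (by positivity), ENNReal.ofReal_pow (by norm_num)]; norm_num
        _ ≤ ∫⁻ x, 3 ^ e * (W x * ∫⁻ t, K (t - x) * g (L * t)) := setLIntegral_le_lintegral _ _
        _ = _ := lintegral_const_mul _ (by fun_prop)
    set A := ∫⁻ t, K t * g (L * t) with hA
    set D := ∫⁻ x, W x * ∫⁻ t, K (t - x) * g (L * t) with hD
    have hZ1top : Z1 ≠ ⊤ := ne_top_of_le_ne_top hZtop hZ1le
    calc A = Z1⁻¹ * (Z1 * A) := by rw [← mul_assoc, ENNReal.inv_mul_cancel hZ1p hZ1top, one_mul]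
      _ ≤ Z1⁻¹ * (3 ^ e * D) := by gcongr
      _ = 3 ^ e * Z1⁻¹ * ((Z * Z⁻¹) * (Y * Y⁻¹)) * D := by
          rw [ENNReal.mul_inv_cancel hZ0 hZtop, ENNReal.mul_inv_cancel hY0 hYtop]; ring
      _ = (3 ^ e * Z1⁻¹ * (Z * Y)) * (Z⁻¹ * (Y⁻¹ * D)) := by ring
      _ ≤ _ := by gcongr; exact le_self_add
  · intro g hg
    rw [hform L hL g hg, lintegral_kap_scale e hL hg]
    have hmm : Measurable fun x => ∫⁻ t, K (t - x) * g (L * t) := by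
      apply Measurable.lintegral_prod_right' (f := fun q : ℝ × ℝ => K (q.2 - q.1) * g (L * q.2))
      fun_prop
    have hup : ∫⁻ x, W x * ∫⁻ t, K (t - x) * g (L * t) ≤ 2 ^ e * V * ∫⁻ t, K t * g (L * t) := by
      calc _ ≤ ∫⁻ x, (2 ^ e * ENNReal.ofReal ((1 + x ^ 2) ^ e * w x)) * ∫⁻ t, K t * g (L * t) := by
            refine lintegral_mono fun x => ?_
            simp only
            rw [← lintegral_const_mul _ (by fun_prop), ← lintegral_const_mul _ (by fun_prop)]
            refine lintegral_mono fun t => ?_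
            simp only
            rw [← mul_assoc, ← mul_assoc]
            refine mul_le_mul_left ?_ _
            rw [hW, hK]
            simp only
            rw [show (2:ℝ≥0∞) ^ e = ENNReal.ofReal (2 ^ e) by rw [ENNReal.ofReal_pow (by norm_num)]; norm_num]
            have hk := (kap_pos e one_pos t).le
            rw [← ENNReal.ofReal_mul (hw0 x), ← ENNReal.ofReal_mul (by positivity), ← ENNReal.ofReal_mul (by have := hw0 x; positivity)]
            refine ENNReal.ofReal_le_ofReal ?_
            have hq : kap e 1 (t - x) ≤ 2 ^ e * (1 + x ^ 2) ^ e * kap e 1 t := by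
              unfold kap
              simp only [inv_one, one_mul, div_one]
              rw [← mul_pow, ← mul_pow]
              apply pow_le_pow_left₀ (by positivity)
              rw [← div_eq_mul_inv, le_div_iff₀ (by positivity), inv_mul_le_iff₀ (by positivity)]
              nlinarith [sq_nonneg (t - 2 * x), sq_nonneg ((t - x) * x), sq_nonneg (t-x)]
            calc w x * kap e 1 (t - x) ≤ w x * (2 ^ e * (1 + x ^ 2) ^ e * kap e 1 t) :=
                  mul_le_mul_of_nonneg_left hq (hw0 x)
              _ = _ := by ring
        _ = (∫⁻ x, (2 ^ e * ENNReal.ofReal ((1 + x ^ 2) ^ e * w x))) * ∫⁻ t, K t * g (L * t) := by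
            rw [lintegral_mul_const _ (by fun_prop)]
        _ = _ := by rw [lintegral_const_mul _ (by fun_prop)]
    calc _ ≤ Z⁻¹ * (Y⁻¹ * (2 ^ e * V * ∫⁻ t, K t * g (L * t))) := by gcongr
      _ = Z⁻¹ * (Y⁻¹ * (2 ^ e * V)) * ∫⁻ t, K t * g (L * t) := by ring
      _ ≤ _ := by gcongr; exact le_add_self

end DR

namespace DR
open scoped ENNReal NNReal
open scoped Classical

variable {ι : Type} [Fintype ι] {I : Type}

theorem lmarginal_const_mul' {ι : Type} (μ : ι → Measure ℝ) [∀ i, SigmaFinite (μ i)] (s : Finset ι)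
    (c : ℝ≥0∞) (f : (ι → ℝ) → ℝ≥0∞) (hf : Measurable f) (x : ι → ℝ) :
    (∫⋯∫⁻_s, (fun x => c * f x) ∂μ) x = c * (∫⋯∫⁻_s, f ∂μ) x := by
  unfold lmarginal
  rw [lintegral_const_mul]
  exact hf.comp (measurable_updateFinset)

theorem lintegral_pi_prod (μ : ι → Measure ℝ) [∀ i, SigmaFinite (μ i)] (f : ι → ℝ → ℝ≥0∞)
    (hf : ∀ i, Measurable (f i)) :
    ∫⁻ x, ∏ j, f j (x j) ∂(Measure.pi μ) = ∏ j, ∫⁻ t, f j t ∂(μ j) := by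
  have hm : ∀ s : Finset ι, Measurable fun x : ι → ℝ => ∏ j ∈ s, f j (x j) := fun s =>
    Finset.measurable_prod _ fun j _ => (hf j).comp (measurable_pi_apply j)
  have key : ∀ s : Finset ι, ∀ x, (∫⋯∫⁻_s, (fun x => ∏ j ∈ s, f j (x j)) ∂μ) x =
      ∏ j ∈ s, ∫⁻ t, f j t ∂(μ j) := by
    intro s
    induction s using Finset.induction_on with
    | empty => intro x; simp
    | insert i s hi ih =>
      intro x
      rw [lmarginal_insert' _ (hm _) hi]
      have : (fun x : ι → ℝ => ∫⁻ t, (∏ j ∈ insert i s, f j (Function.update x i t j)) ∂(μ i)) =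
          fun x => (∫⁻ t, f i t ∂(μ i)) * ∏ j ∈ s, f j (x j) := by
        funext x
        rw [← lintegral_mul_const _ (hf i)]
        refine lintegral_congr fun t => ?_
        rw [Finset.prod_insert hi, Function.update_self]
        congr 1
        refine Finset.prod_congr rfl fun j hj => ?_
        rw [Function.update_of_ne (show j ≠ i from fun h => hi (h ▸ hj))]
      rw [this, lmarginal_const_mul' _ _ _ _ (hm s), ih, Finset.prod_insert hi]
  have := key Finset.univ 0
  simpa only [lmarginal_univ] using this

theorem pi_compare (μ ν : ι → Measure ℝ) [∀ i, SigmaFinite (μ i)] [∀ i, SigmaFinite (ν i)]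
    (k k' : ι → ℝ → ℝ≥0∞) (hk : ∀ i, Measurable (k i)) (hk' : ∀ i, Measurable (k' i)) (C : ℝ≥0∞)
    (h : ∀ i, ∀ g : ℝ → ℝ≥0∞, Measurable g →
      ∫⁻ s, k i s * g s ∂(μ i) ≤ C * ∫⁻ s, k' i s * g s ∂(ν i))
    (g : (ι → ℝ) → ℝ≥0∞) (hg : Measurable g) :
    ∫⁻ x, (∏ j, k j (x j)) * g x ∂(Measure.pi μ) ≤
      C ^ (Fintype.card ι) * ∫⁻ x, (∏ j, k' j (x j)) * g x ∂(Measure.pi ν) := by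
  have hm : ∀ k : ι → ℝ → ℝ≥0∞, (∀ i, Measurable (k i)) → ∀ s : Finset ι,
      Measurable fun x : ι → ℝ => ∏ j ∈ s, k j (x j) := fun k hk s =>
    Finset.measurable_prod _ fun j _ => (hk j).comp (measurable_pi_apply j)
  have key : ∀ s : Finset ι, ∀ g : (ι → ℝ) → ℝ≥0∞, Measurable g → ∀ x,
      (∫⋯∫⁻_s, (fun x => (∏ j ∈ s, k j (x j)) * g x) ∂μ) x ≤
      C ^ s.card * (∫⋯∫⁻_s, (fun x => (∏ j ∈ s, k' j (x j)) * g x) ∂ν) x := by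
    intro s
    induction s using Finset.induction_on with
    | empty => intro g hg x; simp
    | insert i s hi ih =>
      intro g hg x
      have heq : ∀ k : ι → ℝ → ℝ≥0∞, (∀ i, Measurable (k i)) → ∀ ρ : Measure ℝ,
          (fun x : ι → ℝ => ∫⁻ t, (∏ j ∈ insert i s, k j (Function.update x i t j)) *
            g (Function.update x i t) ∂ρ) =
          fun x => (∏ j ∈ s, k j (x j)) * ∫⁻ t, k i t * g (Function.update x i t) ∂ρ := by
        intro k hk ρ
        funext x
        have hmeas : Measurable fun t => k i t * g (Function.update x i t) :=
          (hk i).mul (hg.comp (measurable_update x))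
        rw [← lintegral_const_mul _ hmeas]
        refine lintegral_congr fun t => ?_
        rw [Finset.prod_insert hi, Function.update_self]
        rw [show ∏ j ∈ s, k j (Function.update x i t j) = ∏ j ∈ s, k j (x j) from
          Finset.prod_congr rfl fun j hj => by
            rw [Function.update_of_ne (show j ≠ i from fun h => hi (h ▸ hj))]]
        ring
      have hm1 : Measurable fun x : ι → ℝ => (∏ j ∈ insert i s, k j (x j)) * g x := (hm k hk _).mul hg
      have hm2 : Measurable fun x : ι → ℝ => (∏ j ∈ insert i s, k' j (x j)) * g x := (hm k' hk' _).mul hg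
      rw [lmarginal_insert' _ hm1 hi, lmarginal_insert' _ hm2 hi]
      rw [heq k hk, heq k' hk', Finset.card_insert_of_notMem hi]
      have hg1 : Measurable fun x : ι → ℝ => ∫⁻ t, k' i t * g (Function.update x i t) ∂(ν i) := by
        apply Measurable.lintegral_prod_right' (f := fun q : (ι → ℝ) × ℝ => k' i q.2 * g (Function.update q.1 i q.2))
        exact ((hk' i).comp measurable_snd).mul (hg.comp measurable_update')
      calc _ ≤ (∫⋯∫⁻_s, (fun x => C * ((∏ j ∈ s, k j (x j)) *
              ∫⁻ t, k' i t * g (Function.update x i t) ∂(ν i))) ∂μ) x := by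
            refine lmarginal_mono (fun y => ?_) x
            simp only
            rw [mul_left_comm]
            gcongr
            exact h i _ (hg.comp (measurable_update y))
        _ = C * (∫⋯∫⁻_s, (fun x => ((∏ j ∈ s, k j (x j)) *
              ∫⁻ t, k' i t * g (Function.update x i t) ∂(ν i))) ∂μ) x :=
            lmarginal_const_mul' _ _ _ _ ((hm k hk s).mul hg1) _
        _ ≤ C * (C ^ s.card * _) := by gcongr; exact ih _ hg1 x
        _ = _ := by rw [pow_succ]; ring
  have := key Finset.univ g hg 0
  simpa only [lmarginal_univ, Finset.card_univ] using this

/-- Product kernel. -/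
def kk (e : ℕ) (rr : ι → ℝ) (s : ι → ℝ) : ℝ≥0∞ := ∏ j, ENNReal.ofReal (kap e (rr j) (s j))

@[fun_prop] theorem measurable_kk (e : ℕ) (rr : ι → ℝ) : Measurable (kk e rr) := by
  unfold kk
  exact Finset.measurable_prod _ fun j _ => (measurable_kap e _).comp (measurable_pi_apply j)

/-- Shear. -/
def Um (i : ι) (v s : ι → ℝ) : ι → ℝ := fun j => s j + s i * v j

theorem Um_add (i : ι) (v s t : ι → ℝ) : Um i v (s + t) = Um i v s + Um i v t := by
  funext j; simp [Um]; ring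

theorem continuous_Um (i : ι) (v : ι → ℝ) : Continuous (Um i v) := by
  unfold Um; fun_prop
@[fun_prop] theorem measurable_Um (i : ι) (v : ι → ℝ) : Measurable (Um i v) :=
  (continuous_Um i v).measurable

/-- Averaged function along a tube. -/
def HH (e : ℕ) (rr : ι → ℝ) (i : ι) (v : ι → ℝ) (g : (ι → ℝ) → ℝ≥0∞) (y : ι → ℝ) : ℝ≥0∞ :=
  ∫⁻ s, kk e rr s * g (y + Um i v s)

theorem kk_harnack (e : ℕ) {rr : ι → ℝ} (hr : ∀ j, 0 < rr j) {q : ι → ℝ} (hq : ∀ j, |q j| ≤ rr j)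
    (s : ι → ℝ) : kk e rr (s + q) ≤ (3 ^ e) ^ (Fintype.card ι) * kk e rr s := by
  unfold kk
  rw [← Finset.card_univ, ← Finset.prod_const, ← Finset.prod_mul_distrib]
  refine Finset.prod_le_prod' fun j _ => ?_
  calc ENNReal.ofReal (kap e (rr j) ((s + q) j)) ≤ ENNReal.ofReal (3 ^ e * kap e (rr j) (s j)) :=
        ENNReal.ofReal_le_ofReal (kap_harnack e (hr j) (hq j))
    _ = _ := by rw [ENNReal.ofReal_mul (by positivity), ENNReal.ofReal_pow (by norm_num)]; norm_num

theorem HH_harnack (e : ℕ) {rr : ι → ℝ} (hr : ∀ j, 0 < rr j) (i : ι) (v : ι → ℝ)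
    {g : (ι → ℝ) → ℝ≥0∞} (hg : Measurable g) (y : ι → ℝ) {q : ι → ℝ} (hq : ∀ j, |q j| ≤ rr j) :
    HH e rr i v g (y + Um i v q) ≤ (3 ^ e) ^ (Fintype.card ι) * HH e rr i v g y := by
  unfold HH
  rw [← lintegral_const_mul _ (by fun_prop)]
  rw [← lintegral_sub_right_eq_self _ q]
  refine lintegral_mono fun s => ?_
  rw [add_assoc, ← Um_add, add_sub_cancel, ← mul_assoc]
  gcongr
  rw [sub_eq_add_neg]
  exact kk_harnack e hr (fun j => by simpa using hq j) s

theorem HH_harnack_axis (e : ℕ) {rr : ι → ℝ} (hr : ∀ j, 0 < rr j) (i : ι) {v : ι → ℝ} (hv : v i = 0)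
    {g : (ι → ℝ) → ℝ≥0∞} (hg : Measurable g) (y : ι → ℝ) (h1 : |y i| ≤ rr i)
    (h2 : ∀ j, |y i * v j| ≤ rr j) :
    HH e rr i v g y ≤ (3 ^ e) ^ (Fintype.card ι) * HH e rr i v g (Function.update y i 0) := by
  have := HH_harnack e hr i v hg (Function.update y i 0)
    (q := fun j => if j = i then y i else - (y i * v j)) (by
      intro j; by_cases h : j = i
      · subst h; simpa using h1
      · simpa [h] using h2 j)
  convert this using 2
  funext j
  by_cases h : j = i
  · subst h; simp [Um, hv]
  · simp [Um, h]

/-- Normalised Lebesgue measure on an interval. -/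
def lam (R : ℝ) : Measure ℝ := (ENNReal.ofReal (2 * R))⁻¹ • volume.restrict (Set.Icc (-R) R)

theorem lam_prob {R : ℝ} (hR : 0 < R) : IsProbabilityMeasure (lam R) := ⟨by
  have h : (ENNReal.ofReal (2 * R)) ≠ 0 := by simp [hR]
  simp only [lam, Measure.smul_apply, Measure.restrict_apply MeasurableSet.univ, Set.univ_inter,
    Real.volume_Icc, smul_eq_mul]
  rw [show R - -R = 2 * R by ring]
  exact ENNReal.inv_mul_cancel h ENNReal.ofReal_ne_top⟩

theorem lam_ae {R : ℝ} : ∀ᵐ x ∂(lam R), |x| ≤ R := by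
  unfold lam
  refine Measure.ae_smul_measure ?_ _
  filter_upwards [ae_restrict_mem measurableSet_Icc] with x hx
  exact abs_le.2 hx

theorem lam_pi_ae {R : ℝ} (hR : 0 < R) : ∀ᵐ x ∂(Measure.pi (fun _ : ι => lam R)), ∀ j, |x j| ≤ R := by
  have := lam_prob hR
  rw [ae_all_iff]
  intro j
  exact (Measure.quasiMeasurePreserving_eval (fun _ : ι => lam R) j).ae (lam_ae (R := R))

theorem lam_kap {e : ℕ} (he : 1 ≤ e) {r R : ℝ} (hr : 0 < r) (hrR : r ≤ R) (b : ℝ) :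
    ∫⁻ q, ENNReal.ofReal (kap e r (b - q)) ∂(lam R) ≤ 4 * 5 ^ e * ENNReal.ofReal (kap e R b) := by
  have hR : 0 < R := by linarith
  unfold lam
  rw [lintegral_smul_measure, smul_eq_mul]
  have hk := (kap_pos e hR b).le
  calc _ ≤ (ENNReal.ofReal (2 * R))⁻¹ * ENNReal.ofReal (4 * 5 ^ e * (R * kap e R b)) := by
        gcongr; exact kap_avg he hr hrR b
    _ = ENNReal.ofReal ((2 * R)⁻¹ * (4 * 5 ^ e * (R * kap e R b))) := by
        rw [← ENNReal.ofReal_inv_of_pos (by positivity), ← ENNReal.ofReal_mul (by positivity)]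
    _ ≤ ENNReal.ofReal (4 * 5 ^ e * kap e R b) := by
        refine ENNReal.ofReal_le_ofReal ?_
        have : (2 * R)⁻¹ * (4 * 5 ^ e * (R * kap e R b)) = (4 * 5 ^ e * kap e R b) / 2 := by field_simp
        rw [this]
        exact half_le_self (by positivity)
    _ = _ := by
        rw [ENNReal.ofReal_mul (by positivity), ENNReal.ofReal_mul (by positivity), ENNReal.ofReal_pow (by norm_num)]
        norm_num

theorem HH_avg {e : ℕ} (he : 1 ≤ e) {rr rr' : ι → ℝ} (hr : ∀ j, 0 < rr j) (i : ι) {R : ℝ}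
    (h1 : ∀ j, j ≠ i → rr j ≤ R) (h2 : ∀ j, j ≠ i → rr' j = R) (h3 : rr' i = rr i) (hR : 0 < R)
    (v : ι → ℝ) {g : (ι → ℝ) → ℝ≥0∞} (hg : Measurable g) :
    ∫⁻ y, HH e rr i v g (Function.update y i 0) ∂(Measure.pi (fun _ : ι => lam R)) ≤
      (4 * 5 ^ e) ^ (Fintype.card ι) * HH e rr' i v g 0 := by
  have := lam_prob hR
  have hU : ∀ y : ι → ℝ, Um i v (Function.update y i 0) = Function.update y i 0 := by
    intro y; funext j; simp [Um]
  have hup : Measurable fun y : ι → ℝ => Function.update y i (0:ℝ) := by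
    exact measurable_update_left
  have e1 : ∀ y, HH e rr i v g (Function.update y i 0) =
      ∫⁻ s, kk e rr (s - Function.update y i 0) * g (Um i v s) := by
    intro y
    unfold HH
    rw [← lintegral_sub_right_eq_self _ (Function.update y i 0)]
    refine lintegral_congr fun s => ?_
    congr 2
    nth_rw 1 [← hU y]
    rw [← Um_add, add_sub_cancel]
  simp only [e1]
  rw [lintegral_lintegral_swap (by
    apply Measurable.aemeasurable
    exact ((measurable_kk e rr).comp (measurable_snd.sub (hup.comp measurable_fst))).mul
      (hg.comp ((measurable_Um i v).comp measurable_snd)))]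
  unfold HH
  rw [← lintegral_const_mul _ (by fun_prop)]
  refine lintegral_mono fun s => ?_
  simp only
  rw [lintegral_mul_const _ (by
    exact (measurable_kk e rr).comp (measurable_const.sub hup)), zero_add, ← mul_assoc]
  gcongr
  have e2 : ∀ y : ι → ℝ, kk e rr (s - Function.update y i 0) =
      ∏ j, (fun q => ENNReal.ofReal (kap e (rr j) (s j - if j = i then 0 else q))) (y j) := by
    intro y
    unfold kk
    refine Finset.prod_congr rfl fun j _ => ?_
    by_cases h : j = i
    · subst h; simp
    · simp [h]
  simp only [e2]
  rw [lintegral_pi_prod (fun _ : ι => lam R)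
    (fun j q => ENNReal.ofReal (kap e (rr j) (s j - if j = i then 0 else q))) (by
      intro j; by_cases h : j = i
      · simp only [h, if_true]; exact measurable_const
      · simp only [h, if_false]; fun_prop)]
  unfold kk
  rw [← Finset.card_univ, ← Finset.prod_const, ← Finset.prod_mul_distrib]
  refine Finset.prod_le_prod' fun j _ => ?_
  by_cases h : j = i
  · subst h
    simp only [if_true, sub_zero, lintegral_const, measure_univ, mul_one, h3]
    have : (1:ℝ≥0∞) ≤ 4 * 5 ^ e := by
      have h5 : (1:ℝ≥0∞) ≤ 5 ^ e := one_le_pow₀ (by norm_num)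
      calc (1:ℝ≥0∞) ≤ 4 * 1 := by norm_num
        _ ≤ _ := by gcongr
    calc _ = 1 * ENNReal.ofReal (kap e (rr j) (s j)) := (one_mul _).symm
      _ ≤ _ := by gcongr
  · simp only [h, if_false, h2 j h]
    exact lam_kap he (hr j) (h1 j h) (s j)

theorem shear_preserving (i : ι) {v : ι → ℝ} (hv : v i = 0) :
    MeasurePreserving (Um i v) (volume : Measure (ι → ℝ)) volume := by
  refine ⟨measurable_Um i v, ?_⟩
  let M : Matrix ι ι ℝ := 1 + Matrix.replicateCol Unit v * Matrix.replicateRow Unit (Pi.single i (1:ℝ) : ι → ℝ)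
  have hdet : M.det = 1 := by
    show (1 + Matrix.replicateCol Unit v * Matrix.replicateRow Unit (Pi.single i (1:ℝ) : ι → ℝ)).det = 1
    rw [Matrix.det_one_add_replicateCol_mul_replicateRow]
    simp [hv]
  have := Real.map_matrix_volume_pi_eq_smul_volume_pi (M := M) (by rw [hdet]; norm_num)
  rw [hdet] at this
  simp only [inv_one, abs_one, ENNReal.ofReal_one, one_smul] at this
  have hfun : Um i v = ⇑(Matrix.toLin' M) := by
   funext s j
   simp only [Matrix.toLin'_apply, M, Matrix.add_mulVec, Matrix.one_mulVec, Pi.add_apply, Um]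
   congr 1
   simp [Matrix.mulVec, dotProduct, Matrix.mul_apply, Pi.single_apply, mul_comm]
  rw [hfun]; exact this

theorem kk_shear {L : ℝ} (hL : 0 < L) (i : ι) {v : ι → ℝ} (hv : v i = 0) (hv1 : ∀ j, |v j| ≤ 1)
    {e : ℕ} (he : Fintype.card ι ≤ e) (s : ι → ℝ) :
    kk e (fun _ => L) s ≤ 2 ^ (Fintype.card ι) * kk 1 (fun _ => L) (Um i v s) := by
  have hn : 1 ≤ Fintype.card ι := Fintype.card_pos_iff.2 ⟨i⟩
  have hle1 : ∀ x : ℝ, (1 + x ^ 2)⁻¹ ≤ 1 := fun x => inv_le_one_of_one_le₀ (by nlinarith [sq_nonneg x])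
  have hreal : (∏ j, kap e L (s j)) ≤ 2 ^ (Fintype.card ι) * ∏ j, kap 1 L (Um i v s j) := by
    set X := (1 + (s i / L) ^ 2)⁻¹ with hX
    have hX0 : 0 < X := by positivity
    have hother : ∀ j ∈ Finset.univ.erase i, kap e L (s j) ≤ 2 * X⁻¹ * kap 1 L (Um i v s j) := by
      intro j hj
      unfold kap
      rw [pow_one]
      calc L⁻¹ * ((1 + (s j / L) ^ 2)⁻¹) ^ e ≤ L⁻¹ * (1 + (s j / L) ^ 2)⁻¹ := by
            gcongr
            calc _ ≤ ((1 + (s j / L) ^ 2)⁻¹) ^ 1 :=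
                  pow_le_pow_of_le_one (by positivity) (hle1 _) (by omega)
              _ = _ := pow_one _
        _ ≤ L⁻¹ * (2 * X⁻¹ * (1 + (Um i v s j / L) ^ 2)⁻¹) := by
            gcongr
            rw [hX, inv_inv, ← div_eq_mul_inv, le_div_iff₀ (by positivity), inv_mul_le_iff₀ (by positivity)]
            unfold Um
            rw [add_div, mul_div_right_comm]
            set a := s j / L
            set b := s i / L
            have hv2 : (v j) ^ 2 ≤ 1 := by rw [sq_le_one_iff_abs_le_one]; exact hv1 j
            have : (b * v j) ^ 2 ≤ b ^ 2 := by rw [mul_pow]; nlinarith [sq_nonneg b]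
            nlinarith [sq_nonneg (a - b * v j), sq_nonneg (a * b)]
        _ = _ := by ring
    have hi : kap e L (s i) ≤ X ^ (Fintype.card ι - 1) * kap 1 L (Um i v s i) := by
      have hui : Um i v s i = s i := by simp [Um, hv]
      rw [hui]
      unfold kap
      rw [← hX, pow_one]
      calc L⁻¹ * X ^ e ≤ L⁻¹ * X ^ (Fintype.card ι) := by
            exact mul_le_mul_of_nonneg_left (pow_le_pow_of_le_one hX0.le (hle1 _) he) (by positivity)
        _ = L⁻¹ * X ^ (Fintype.card ι - 1 + 1) := by rw [Nat.sub_add_cancel hn]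
        _ = _ := by rw [pow_succ]; ring
    rw [← Finset.mul_prod_erase _ _ (Finset.mem_univ i), ← Finset.mul_prod_erase _ (fun j => kap 1 L (Um i v s j)) (Finset.mem_univ i)]
    calc _ ≤ (X ^ (Fintype.card ι - 1) * kap 1 L (Um i v s i)) *
          ∏ j ∈ Finset.univ.erase i, (2 * X⁻¹ * kap 1 L (Um i v s j)) := by
          have p1 := (kap_pos e hL (s i)).le
          have p2 := (kap_pos 1 hL (Um i v s i)).le
          refine mul_le_mul hi (Finset.prod_le_prod (fun j _ => (kap_pos e hL _).le) hother) ?_ (by positivity)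
          exact Finset.prod_nonneg fun j _ => (kap_pos e hL _).le
      _ = (X ^ (Fintype.card ι - 1) * (2 * X⁻¹) ^ (Fintype.card ι - 1)) * (kap 1 L (Um i v s i) *
          ∏ j ∈ Finset.univ.erase i, kap 1 L (Um i v s j)) := by
          rw [Finset.prod_mul_distrib, Finset.prod_const, Finset.card_erase_of_mem (Finset.mem_univ i), Finset.card_univ]
          ring
      _ ≤ _ := by
          have p2 := (kap_pos 1 hL (Um i v s i)).le
          have p3 : 0 ≤ ∏ j ∈ Finset.univ.erase i, kap 1 L (Um i v s j) :=
            Finset.prod_nonneg fun j _ => (kap_pos 1 hL _).le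
          refine mul_le_mul_of_nonneg_right ?_ (by positivity)
          rw [← mul_pow, show X * (2 * X⁻¹) = 2 by field_simp]
          exact pow_le_pow_right₀ (by norm_num) (Nat.sub_le _ _)
  unfold kk
  rw [← ENNReal.ofReal_prod_of_nonneg fun j _ => (kap_pos e hL _).le,
    ← ENNReal.ofReal_prod_of_nonneg fun j _ => (kap_pos 1 hL _).le]
  calc _ ≤ ENNReal.ofReal (2 ^ (Fintype.card ι) * ∏ j, kap 1 L (Um i v s j)) := ENNReal.ofReal_le_ofReal hreal
    _ = _ := by rw [ENNReal.ofReal_mul (by positivity), ENNReal.ofReal_pow (by norm_num)]; norm_num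

theorem HH_final {L : ℝ} (hL : 0 < L) (i : ι) {v : ι → ℝ} (hv : v i = 0) (hv1 : ∀ j, |v j| ≤ 1)
    {e : ℕ} (he : Fintype.card ι ≤ e) {g : (ι → ℝ) → ℝ≥0∞} (hg : Measurable g) (y : ι → ℝ) :
    HH e (fun _ => L) i v g y ≤ 2 ^ (Fintype.card ι) * ∫⁻ s, kk 1 (fun _ => L) s * g (y + s) := by
  unfold HH
  rw [← (shear_preserving i hv).lintegral_comp (f := fun s => kk 1 (fun _ => L) s * g (y + s)) (by fun_prop), ← lintegral_const_mul _ (by fun_prop)]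
  refine lintegral_mono fun s => ?_
  rw [← mul_assoc]
  gcongr
  exact kk_shear hL i hv hv1 he s

end DR

namespace DR
open scoped ENNReal NNReal
open scoped Classical

variable {ι : Type} [Fintype ι] {I : Type}

theorem weighted_jensen {α : Type*} [MeasurableSpace α] (μ : Measure α) {w f : α → ℝ≥0∞}
    (hw : Measurable w) (hf : Measurable f) {M : ℝ≥0∞} (hM : ∫⁻ a, w a ∂μ ≤ M) {t : ℝ} (ht : 1 < t) :
    (∫⁻ a, w a * f a ∂μ) ^ t ≤ M ^ (t - 1) * ∫⁻ a, w a * (f a) ^ t ∂μ := by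
  have hpq : t.HolderConjugate (t / (t - 1)) := Real.HolderConjugate.conjExponent ht
  have h := ENNReal.lintegral_mul_le_Lp_mul_Lq (μ.withDensity w) hpq hf.aemeasurable
    (measurable_const (a := (1:ℝ≥0∞))).aemeasurable
  have e1 : ∀ g : α → ℝ≥0∞, Measurable g → ∫⁻ a, g a ∂(μ.withDensity w) = ∫⁻ a, w a * g a ∂μ := by
    intro g hg
    rw [lintegral_withDensity_eq_lintegral_mul _ hw hg]; rfl
  simp only [Pi.mul_apply, mul_one, ENNReal.one_rpow] at h
  rw [e1 f hf, e1 _ (hf.pow_const t), e1 _ measurable_const] at h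
  simp only [mul_one] at h
  have ht0 : 0 < t := by linarith
  have ht1 : t - 1 ≠ 0 := by linarith
  calc _ ≤ ((∫⁻ a, w a * (f a) ^ t ∂μ) ^ (1 / t) * (∫⁻ a, w a ∂μ) ^ (1 / (t / (t - 1)))) ^ t := by
        gcongr
    _ = (∫⁻ a, w a * (f a) ^ t ∂μ) * (∫⁻ a, w a ∂μ) ^ (t - 1) := by
        rw [ENNReal.mul_rpow_of_nonneg _ _ ht0.le, ← ENNReal.rpow_mul, ← ENNReal.rpow_mul]
        rw [show 1 / t * t = 1 by field_simp, show 1 / (t / (t - 1)) * t = t - 1 by field_simp, ENNReal.rpow_one]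
    _ ≤ _ := by
        rw [mul_comm]
        gcongr

/-- Frequencies seen in sheared coordinates. -/
def tw (i : ι) (v ζ : ι → ℝ) (j : ι) : ℝ := ζ j + if j = i then ph ζ v else 0

theorem ph_Um (i : ι) (v ζ s : ι → ℝ) : ph ζ (Um i v s) = ∑ j, tw i v ζ j * s j := by
  unfold ph Um tw
  simp only [add_mul, mul_add, Finset.sum_add_distrib, ite_mul, zero_mul, Finset.sum_ite_eq',
    Finset.mem_univ, if_true]
  congr 1
  unfold ph
  rw [Finset.sum_mul]
  refine Finset.sum_congr rfl fun j _ => by ring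

theorem tw_sub (i : ι) (v ζ ξ : ι → ℝ) (j : ι) : tw i v (ζ - ξ) j = tw i v ζ j - tw i v ξ j := by
  unfold tw
  rw [ph_sub_left]
  by_cases h : j = i
  · simp only [h, if_true, Pi.sub_apply]; ring
  · simp [h]

theorem kk_mass {e : ℕ} (he : 1 ≤ e) {rr : ι → ℝ} (hr : ∀ j, 0 < rr j) :
    ∫⁻ s, kk e rr s ≤ 4 ^ (Fintype.card ι) := by
  unfold kk
  have h := lintegral_pi_prod (fun _ : ι => (volume : Measure ℝ))
    (fun j t => ENNReal.ofReal (kap e (rr j) t)) (fun j => measurable_kap e _)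
  rw [volume_pi, h, ← Finset.card_univ, ← Finset.prod_const]
  refine Finset.prod_le_prod' fun j _ => ?_
  calc _ = ∫⁻ t, ENNReal.ofReal (kap e (rr j) (0 - t)) := by
        refine lintegral_congr fun t => ?_
        unfold kap; simp [neg_div]
    _ ≤ 4 := kap_mass he (hr j) 0

theorem repro {e : ℕ} (he : 1 ≤ e) {C1 : ℝ} (hC1 : 0 < C1) {σ : ℝ} (hσ : 1 ≤ σ) :
    ∃ C : ℝ≥0∞, C ≠ ⊤ ∧ ∀ (I : Type) (ζ : I → ι → ℝ) (u : I → ℂ) (S : Finset I) (c v : ι → ℝ) (i : ι)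
      (rr : ι → ℝ), (∀ j, 0 < rr j) → (∀ l ∈ S, ∀ j, |tw i v (ζ l - c) j| ≤ C1 / rr j) →
      ∀ y, (gg ζ u S y) ^ σ ≤ C * HH e rr i v (fun z => (gg ζ u S z) ^ σ) y := by
  obtain ⟨φ, hφc, hφi, ⟨C0, hC0, hφb⟩, hφ1⟩ := exists_phi e hC1
  set n := Fintype.card ι
  refine ⟨(ENNReal.ofReal C0 ^ n) ^ (2 * σ) * (4 ^ n) ^ (2 * σ - 1), ?_, ?_⟩
  · refine ENNReal.mul_ne_top (ENNReal.rpow_ne_top_of_nonneg (by linarith) (by simp))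
      (ENNReal.rpow_ne_top_of_nonneg (by linarith) (by simp))
  intro I ζ u S c v i rr hr hS y
  -- one-dim kernels
  let f : ι → ℝ → ℂ := fun j s => ((rr j)⁻¹ : ℝ) * φ (s / rr j) * ee (-(tw i v c j * s))
  have hfc : ∀ j, Continuous (f j) := fun j => by
    have := continuous_ee
    fun_prop
  have hfb : ∀ j s, ‖f j s‖ₑ ≤ ENNReal.ofReal C0 * ENNReal.ofReal (kap e (rr j) s) := by
    intro j s
    rw [← ENNReal.ofReal_mul hC0.le, ← ofReal_norm]
    refine ENNReal.ofReal_le_ofReal ?_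
    simp only [f, norm_mul, norm_ee, mul_one]
    rw [Complex.norm_real, Real.norm_of_nonneg (inv_pos.2 (hr j)).le]
    calc (rr j)⁻¹ * ‖φ (s / rr j)‖ ≤ (rr j)⁻¹ * (C0 * kap e 1 (s / rr j)) := by
          have := (inv_pos.2 (hr j)).le
          gcongr; exact hφb _
      _ = _ := by unfold kap; simp; ring
  have hone : ∀ l ∈ S, ∀ j, Integrable (fun s => f j s * ee (tw i v (ζ l) j * s)) ∧
      ∫ s, f j s * ee (tw i v (ζ l) j * s) = 1 := by
    intro l hl j
    have hrj := hr j
    let g : ℝ → ℂ := fun t => φ t * ee (-(-(rr j * tw i v (ζ l - c) j) * t))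
    have hg : (fun s => f j s * ee (tw i v (ζ l) j * s)) = fun s => ((rr j)⁻¹ : ℝ) * g (s / rr j) := by
      funext s
      simp only [f, g]
      rw [mul_assoc, ← ee_add, mul_assoc]
      congr 3
      rw [tw_sub]; field_simp; ring
    have hgi : Integrable g := by
      refine hφi.mul_bdd (c := 1) ?_ ?_
      · exact (continuous_ee.comp (by fun_prop)).aestronglyMeasurable
      · exact Filter.Eventually.of_forall fun t => by simp [norm_ee]
    refine ⟨?_, ?_⟩
    · rw [hg]
      exact (hgi.comp_div hrj.ne').const_mul _
    · rw [hg, integral_const_mul, Measure.integral_comp_div g, hφ1]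
      · rw [abs_of_pos hrj]; simp [hrj.ne']
      · rw [abs_neg, abs_mul, abs_of_pos hrj]
        have := hS l hl j
        rw [le_div_iff₀ hrj] at this
        linarith
  have hes : ∀ s, (∏ j, f j (s j)) * es ζ u S (y + Um i v s) =
      ∑ l ∈ S, (u l * ee (ph (ζ l) y)) * ∏ j, (f j (s j) * ee (tw i v (ζ l) j * s j)) := by
    intro s
    unfold es
    rw [Finset.mul_sum]
    refine Finset.sum_congr rfl fun l _ => ?_
    rw [ph_add_right, ph_Um, ee_add, ee_sum]
    rw [show ∏ j, (f j (s j) * ee (tw i v (ζ l) j * s j)) =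
      (∏ j, f j (s j)) * ∏ j, ee (tw i v (ζ l) j * s j) from Finset.prod_mul_distrib]
    generalize (∏ j, f j (s j)) = X
    ring
  have hintg : ∫ s : ι → ℝ, (∏ j, f j (s j)) * es ζ u S (y + Um i v s) = es ζ u S y := by
    simp only [hes]
    rw [integral_finsetSum]
    · unfold es
      refine Finset.sum_congr rfl fun l hl => ?_
      rw [integral_const_mul, integral_fintype_prod_volume_eq_prod
        (fun j s => f j s * ee (tw i v (ζ l) j * s))]
      rw [Finset.prod_congr rfl fun j _ => (hone l hl j).2]
      simp
    · intro l hl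
      refine Integrable.const_mul ?_ _
      exact Integrable.fintype_prod (f := fun j s => f j s * ee (tw i v (ζ l) j * s)) (fun j => (hone l hl j).1)
  have hesm : Measurable fun s => ‖es ζ u S (y + Um i v s)‖ₑ := by
    have := (continuous_es_right ζ S u).comp ((continuous_const (y := y)).add (continuous_Um i v))
    exact this.enorm.measurable
  have hle : ‖es ζ u S y‖ₑ ≤ ENNReal.ofReal C0 ^ n * ∫⁻ s, kk e rr s * ‖es ζ u S (y + Um i v s)‖ₑ := by
    have hm2 : Measurable fun s => kk e rr s * ‖es ζ u S (y + Um i v s)‖ₑ := (measurable_kk e rr).mul hesm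
    rw [← hintg, ← lintegral_const_mul _ hm2]
    refine (enorm_integral_le_lintegral_enorm _).trans (lintegral_mono fun s => ?_)
    rw [enorm_mul, ← mul_assoc]
    gcongr
    have : ‖∏ j, f j (s j)‖ₑ = ∏ j, ‖f j (s j)‖ₑ := by
      simp only [enorm_eq_nnnorm, nnnorm_prod]; push_cast; rfl
    rw [this]
    unfold kk
    rw [show n = (Finset.univ : Finset ι).card from Finset.card_univ.symm, ← Finset.prod_const, ← Finset.prod_mul_distrib]
    exact Finset.prod_le_prod' fun j _ => hfb j _
  have hsq : ∀ z, (gg ζ u S z) ^ σ = ‖es ζ u S z‖ₑ ^ (2 * σ) := by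
    intro z; unfold gg; rw [← ENNReal.rpow_natCast, ← ENNReal.rpow_mul]; norm_num
  simp only [hsq]
  unfold HH
  calc _ ≤ (ENNReal.ofReal C0 ^ n * ∫⁻ s, kk e rr s * ‖es ζ u S (y + Um i v s)‖ₑ) ^ (2 * σ) := by gcongr
    _ = (ENNReal.ofReal C0 ^ n) ^ (2 * σ) * (∫⁻ s, kk e rr s * ‖es ζ u S (y + Um i v s)‖ₑ) ^ (2 * σ) :=
        ENNReal.mul_rpow_of_nonneg _ _ (by linarith)
    _ ≤ (ENNReal.ofReal C0 ^ n) ^ (2 * σ) * ((4 ^ n) ^ (2 * σ - 1) *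
          ∫⁻ s, kk e rr s * ‖es ζ u S (y + Um i v s)‖ₑ ^ (2 * σ)) := by
        gcongr
        exact weighted_jensen _ (measurable_kk e rr) hesm (kk_mass he hr) (by linarith)
    _ = _ := by ring

end DR

namespace DR
open scoped ENNReal NNReal
open scoped Classical

variable {ι : Type} [Fintype ι] {I : Type}

/-- Radii of a tube in direction `i`. -/
def rad (i : ι) (L r : ℝ) : ι → ℝ := fun j => if j = i then L else r

theorem measurable_HH (e : ℕ) (rr : ι → ℝ) (i : ι) (v : ι → ℝ) {g : (ι → ℝ) → ℝ≥0∞} (hg : Measurable g) :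
    Measurable (HH e rr i v g) := by
  unfold HH
  refine Measurable.lintegral_prod_right' (f := fun q : (ι → ℝ) × (ι → ℝ) => kk e rr q.2 * g (q.1 + Um i v q.2)) ?_
  exact ((measurable_kk e rr).comp measurable_snd).mul
    (hg.comp (measurable_fst.add ((measurable_Um i v).comp measurable_snd)))

theorem infl_step {e : ℕ} (he : 1 ≤ e) (hn : 2 ≤ Fintype.card ι) {q σ : ℝ} (hq : 1 ≤ q)
    (hσ1 : 1 ≤ σ) (hσ : σ * (q + 1) = 2 * q)
    (hqn : (q + 1) * ((Fintype.card ι : ℝ) - 1) ≤ 2 * (Fintype.card ι : ℝ)) :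
    ∃ C : ℝ≥0∞, C ≠ ⊤ ∧ ∀ (Λ : Type) (T : ι → Finset Λ) (v : ι → Λ → ι → ℝ)
      (h : ι → Λ → (ι → ℝ) → ℝ≥0∞) (r W L : ℝ), (∀ i J, Measurable (h i J)) → 0 < r → 1 ≤ W →
      W * r ≤ L → (∀ i, ∀ J ∈ T i, v i J i = 0 ∧ ∀ j, |v i J j| ≤ 1 / W) →
      ∫⁻ y, ∏ i, (∑ J ∈ T i, (HH e (rad i L r) i (v i J) (h i J) y) ^ (1 / σ)) ^ (q / Fintype.card ι)
        ∂(Measure.pi fun _ : ι => lam (W * r)) ≤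
      C * ∏ i, (∑ J ∈ T i, (HH e (rad i L (W * r)) i (v i J) (h i J) 0) ^ (1 / σ)) ^ (q / Fintype.card ι) := by
  set n := Fintype.card ι with hndef
  have hn0 : (2:ℝ) ≤ n := by exact_mod_cast hn
  have hqn0 : 0 ≤ q / n := by positivity
  have hσi : 0 ≤ 1 / σ := by positivity
  set c1 : ℝ≥0∞ := ((3:ℝ≥0∞) ^ e) ^ n with hc1
  set c2 : ℝ≥0∞ := (4 * (5:ℝ≥0∞) ^ e) ^ n with hc2
  have hc1t : c1 ≠ ⊤ := by simp [hc1]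
  have hc2t : c2 ≠ ⊤ := by
    refine ENNReal.pow_ne_top (ENNReal.mul_ne_top (by simp) (ENNReal.pow_ne_top (by simp)))
  refine ⟨((c1 ^ (1 / σ)) ^ (q / n)) ^ n * ((c2 ^ (1 / σ)) ^ (q / n)) ^ n, ?_, ?_⟩
  · refine ENNReal.mul_ne_top (ENNReal.pow_ne_top ?_) (ENNReal.pow_ne_top ?_) <;>
    · refine ENNReal.rpow_ne_top_of_nonneg hqn0 (ENNReal.rpow_ne_top_of_nonneg hσi ‹_›)
  intro Λ T v h r W L hm hr hW hWL hv
  have hWr : 0 < W * r := by positivity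
  have hL : 0 < L := by linarith
  have hrW : r ≤ W * r := by nlinarith
  have := lam_prob hWr
  have hrad : ∀ i j : ι, 0 < rad i L r j := by intro i j; unfold rad; split_ifs <;> assumption
  let F : ι → Λ → (ι → ℝ) → ℝ≥0∞ := fun i J y => HH e (rad i L r) i (v i J) (h i J) (Function.update y i 0)
  have hFm : ∀ i J, Measurable (F i J) := fun i J =>
    (measurable_HH e _ i _ (hm i J)).comp measurable_update_left
  let B : ι → (ι → ℝ) → ℝ≥0∞ := fun i y => ∑ J ∈ T i, (F i J y) ^ (1 / σ)
  have hBm : ∀ i, Measurable (B i) := fun i =>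
    Finset.measurable_fun_sum _ fun J _ => (hFm i J).pow_const _
  let B' : ι → ℝ≥0∞ := fun i => ∑ J ∈ T i, (HH e (rad i L (W * r)) i (v i J) (h i J) 0) ^ (1 / σ)
  set lamb : ℝ := (q + 1) * ((n:ℝ) - 1) / (2 * n) with hlamb
  have hl0 : 0 ≤ lamb := by
    have : (0:ℝ) ≤ (n:ℝ) - 1 := by linarith
    positivity
  have hl1 : lamb ≤ 1 := by rw [hlamb, div_le_one (by positivity)]; exact hqn
  have hexp : σ * (1 / ((n:ℝ) - 1) * lamb) = q / n := by
    have : (n:ℝ) - 1 ≠ 0 := by linarith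
    rw [hlamb]; field_simp; linarith
  have hexp2 : 1 / ((n:ℝ) - 1) * lamb = 1 / σ * (q / n) := by
    rw [← hexp]; field_simp
  -- pointwise
  have hpt : ∀ᵐ y ∂(Measure.pi fun _ : ι => lam (W * r)),
      ∏ i, (∑ J ∈ T i, (HH e (rad i L r) i (v i J) (h i J) y) ^ (1 / σ)) ^ (q / n) ≤
      ((c1 ^ (1 / σ)) ^ (q / n)) ^ n * (∏ i, ((B i y) ^ σ) ^ (1 / ((n:ℝ) - 1))) ^ lamb := by
    filter_upwards [lam_pi_ae hWr] with y hy
    rw [← ENNReal.prod_rpow_of_nonneg hl0, show ((c1 ^ (1 / σ)) ^ (q / n)) ^ n =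
      ∏ i : ι, ((c1 ^ (1 / σ)) ^ (q / n)) by rw [Finset.prod_const, Finset.card_univ], ← Finset.prod_mul_distrib]
    refine Finset.prod_le_prod' fun i _ => ?_
    have hBe : (((B i y) ^ σ) ^ (1 / ((n:ℝ) - 1))) ^ lamb = (B i y) ^ (q / n) := by
      rw [← ENNReal.rpow_mul, ← ENNReal.rpow_mul, hexp]
    rw [hBe, ← ENNReal.mul_rpow_of_nonneg _ _ hqn0]
    gcongr
    simp only [B]
    rw [Finset.mul_sum]
    refine Finset.sum_le_sum fun J hJ => ?_
    rw [← ENNReal.mul_rpow_of_nonneg _ _ hσi]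
    gcongr
    refine HH_harnack_axis e (hrad i) i (hv i J hJ).1 (hm i J) y ?_ ?_
    · simp only [rad, if_true]; exact (hy i).trans hWL
    · intro j
      by_cases hj : j = i
      · subst hj; rw [(hv j J hJ).1]; simp [rad, hL.le]
      · simp only [rad, hj, if_false]
        rw [abs_mul]
        calc |y i| * |v i J j| ≤ (W * r) * (1 / W) := by
              gcongr
              · exact hy i
              · exact (hv i J hJ).2 j
          _ = r := by field_simp
  calc _ ≤ ∫⁻ y, ((c1 ^ (1 / σ)) ^ (q / n)) ^ n * (∏ i, ((B i y) ^ σ) ^ (1 / ((n:ℝ) - 1))) ^ lamb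
          ∂(Measure.pi fun _ : ι => lam (W * r)) := lintegral_mono_ae hpt
    _ = ((c1 ^ (1 / σ)) ^ (q / n)) ^ n * ∫⁻ y, (∏ i, ((B i y) ^ σ) ^ (1 / ((n:ℝ) - 1))) ^ lamb
          ∂(Measure.pi fun _ : ι => lam (W * r)) := by
        rw [lintegral_const_mul]
        exact (Finset.measurable_prod _ fun i _ => ((hBm i).pow_const _).pow_const _).pow_const _
    _ ≤ ((c1 ^ (1 / σ)) ^ (q / n)) ^ n * (∫⁻ y, (∏ i, ((B i y) ^ σ) ^ (1 / ((n:ℝ) - 1)))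
          ∂(Measure.pi fun _ : ι => lam (W * r))) ^ lamb := by
        gcongr
        exact jensen_ge _ hl0 hl1 (Finset.measurable_prod _ fun i _ => ((hBm i).pow_const _).pow_const _)
    _ ≤ ((c1 ^ (1 / σ)) ^ (q / n)) ^ n * (∏ i, (∫⁻ y, (B i y) ^ σ
          ∂(Measure.pi fun _ : ι => lam (W * r))) ^ (1 / ((n:ℝ) - 1))) ^ lamb := by
        gcongr
        refine loomis hn (fun _ => lam (W * r)) (fun i y => (B i y) ^ σ) (fun i => (hBm i).pow_const _) ?_
        intro i x t
        simp only [B, F, Function.update_idem]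
    _ ≤ ((c1 ^ (1 / σ)) ^ (q / n)) ^ n * (((c2 ^ (1 / σ)) ^ (q / n)) ^ n * ∏ i, (B' i) ^ (q / n)) := by
        gcongr
        rw [← ENNReal.prod_rpow_of_nonneg hl0, show ((c2 ^ (1 / σ)) ^ (q / n)) ^ n =
          ∏ i : ι, ((c2 ^ (1 / σ)) ^ (q / n)) by rw [Finset.prod_const, Finset.card_univ], ← Finset.prod_mul_distrib]
        refine Finset.prod_le_prod' fun i _ => ?_
        rw [← ENNReal.rpow_mul, hexp2, ENNReal.rpow_mul, ← ENNReal.mul_rpow_of_nonneg _ _ hqn0]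
        gcongr
        refine (lq_sum_le _ hσ1 (T i) (fun J y => (F i J y) ^ (1 / σ)) fun J _ => (hFm i J).pow_const _).trans ?_
        simp only [B']
        rw [Finset.mul_sum]
        refine Finset.sum_le_sum fun J hJ => ?_
        rw [← ENNReal.mul_rpow_of_nonneg _ _ hσi]
        gcongr
        have : ∀ y, (F i J y ^ (1 / σ)) ^ σ = F i J y := by
          intro y; rw [← ENNReal.rpow_mul, one_div_mul_cancel (by linarith), ENNReal.rpow_one]
        simp only [this]
        refine HH_avg he (hrad i) i (R := W * r) ?_ ?_ ?_ hWr _ (hm i J)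
        · intro j hj; simpa [rad, hj] using hrW
        · intro j hj; simp [rad, hj]
        · simp [rad]
    _ = _ := by rw [mul_assoc]

set_option maxHeartbeats 1000000
/-- averaged power of a piece -/
def hh (ζ : I → ι → ℝ) (ν : Measure (ι → ℝ)) (σ : ℝ) (S : Finset I) (u : I → ℂ) (y : ι → ℝ) : ℝ≥0∞ :=
  ∫⁻ x, (gg ζ u S (x + y)) ^ σ ∂ν

theorem measurable_hh (ζ : I → ι → ℝ) (ν : Measure (ι → ℝ)) [SFinite ν] (σ : ℝ) (S : Finset I) :
    Measurable (fun q : (I → ℂ) × (ι → ℝ) => hh ζ ν σ S q.1 q.2) := by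
  unfold hh
  refine Measurable.lintegral_prod_right'
    (f := fun q : ((I → ℂ) × (ι → ℝ)) × (ι → ℝ) => (gg ζ q.1.1 S (q.2 + q.1.2)) ^ σ) ?_
  exact (measurable_gg' ζ S (measurable_fst.comp measurable_fst)
    (measurable_snd.add (measurable_snd.comp measurable_fst))).pow_const _

theorem measurable_hh_right (ζ : I → ι → ℝ) (ν : Measure (ι → ℝ)) [SFinite ν] (σ : ℝ) (S : Finset I) (u : I → ℂ) :
    Measurable (hh ζ ν σ S u) := by
  have h1 : Measurable (fun y : ι → ℝ => (u, y)) := measurable_prodMk_left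
  have h2 := (measurable_hh ζ ν σ S).comp h1
  exact h2

theorem measurable_HHhh (ζ : I → ι → ℝ) (ν : Measure (ι → ℝ)) [SFinite ν] (σ : ℝ) (S : Finset I)
    (e : ℕ) (rr : ι → ℝ) (i : ι) (v : ι → ℝ) :
    Measurable (fun q : (I → ℂ) × (ι → ℝ) => HH e rr i v (hh ζ ν σ S q.1) q.2) := by
  unfold HH
  refine Measurable.lintegral_prod_right'
    (f := fun q : ((I → ℂ) × (ι → ℝ)) × (ι → ℝ) => kk e rr q.2 * hh ζ ν σ S q.1.1 (q.1.2 + Um i v q.2)) ?_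
  refine ((measurable_kk e rr).comp measurable_snd).mul ?_
  have h1 : Measurable (fun q : ((I → ℂ) × (ι → ℝ)) × (ι → ℝ) => (q.1.1, q.1.2 + Um i v q.2)) :=
    (measurable_fst.comp measurable_fst).prodMk
    ((measurable_snd.comp measurable_fst).add ((measurable_Um i v).comp measurable_snd))
  have h2 := (measurable_hh ζ ν σ S).comp h1
  exact h2

theorem HH_hh_sh (ζ : I → ι → ℝ) (ν : Measure (ι → ℝ)) (σ : ℝ) (S : Finset I)
    (e : ℕ) (rr : ι → ℝ) (i : ι) (v : ι → ℝ) (u : I → ℂ) (y : ι → ℝ) :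
    HH e rr i v (hh ζ ν σ S (sh ζ y 0 u)) 0 = HH e rr i v (hh ζ ν σ S u) y := by
  unfold HH hh
  simp only [gg_sh]
  refine lintegral_congr fun s => ?_
  congr 1
  refine lintegral_congr fun x => ?_
  congr 2
  abel

/-- The Kakeya functional. -/
def PhiK {Λ : Type} (e : ℕ) (q σ : ℝ) (μ : Measure (I → ℂ)) (ζ : I → ι → ℝ) (ν : Measure (ι → ℝ))
    (T : ι → Finset Λ) (P : ι → Λ → Finset I) (v : ι → Λ → ι → ℝ) (L r : ℝ) : ℝ≥0∞ :=
  ∫⁻ u, ∏ i, (∑ J ∈ T i, (HH e (rad i L r) i (v i J) (hh ζ ν σ (P i J) u) 0) ^ (1 / σ)) ^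
    (q / Fintype.card ι) ∂μ

theorem kak_iter {e : ℕ} (he : 1 ≤ e) (hn : 2 ≤ Fintype.card ι) {q σ : ℝ} (hq : 1 ≤ q)
    (hσ1 : 1 ≤ σ) (hσ : σ * (q + 1) = 2 * q)
    (hqn : (q + 1) * ((Fintype.card ι : ℝ) - 1) ≤ 2 * (Fintype.card ι : ℝ)) :
    ∃ C : ℝ≥0∞, C ≠ ⊤ ∧ ∀ (I Λ : Type) (μ : Measure (I → ℂ)) (_ : SFinite μ) (ζ : I → ι → ℝ)
      (ν : Measure (ι → ℝ)) (_ : SFinite ν) (T : ι → Finset Λ) (P : ι → Λ → Finset I) (v : ι → Λ → ι → ℝ)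
      (ρ W : ℝ) (s : ℕ), Stat μ ζ → 0 < ρ → 1 ≤ W →
      (∀ i, ∀ J ∈ T i, v i J i = 0 ∧ ∀ j, |v i J j| ≤ 1 / W) →
      PhiK e q σ μ ζ ν T P v (W ^ s * ρ) ρ ≤ C ^ s * PhiK e q σ μ ζ ν T P v (W ^ s * ρ) (W ^ s * ρ) := by
  obtain ⟨C, hC, H⟩ := infl_step he hn hq hσ1 hσ hqn
  refine ⟨C, hC, ?_⟩
  intro I Λ μ _ ζ ν _ T P v ρ W s hst hρ hW hv
  have step : ∀ r L, 0 < r → W * r ≤ L → PhiK e q σ μ ζ ν T P v L r ≤ C * PhiK e q σ μ ζ ν T P v L (W * r) := by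
    intro r L hr hL
    have := lam_prob (R := W * r) (by positivity)
    have hmeas : Measurable fun p : (I → ℂ) × (ι → ℝ) => ∏ i, (∑ J ∈ T i,
        (HH e (rad i L r) i (v i J) (hh ζ ν σ (P i J) p.1) p.2) ^ (1 / σ)) ^ (q / Fintype.card ι) :=
      Finset.measurable_prod _ fun i _ => (Finset.measurable_fun_sum _ fun J _ =>
        (measurable_HHhh ζ ν σ (P i J) e _ i _).pow_const _).pow_const _
    have hmeas' : ∀ r, Measurable fun u : I → ℂ => ∏ i, (∑ J ∈ T i,
        (HH e (rad i L r) i (v i J) (hh ζ ν σ (P i J) u) 0) ^ (1 / σ)) ^ (q / Fintype.card ι) := fun r =>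
      Finset.measurable_prod _ fun i _ => (Finset.measurable_fun_sum _ fun J _ =>
        (Measurable.comp (g := fun q : (I → ℂ) × (ι → ℝ) => HH e (rad i L r) i (v i J) (hh ζ ν σ (P i J) q.1) q.2)
          (f := fun u => (u, 0)) (measurable_HHhh ζ ν σ (P i J) e _ i _) measurable_prodMk_right).pow_const _).pow_const _
    calc PhiK e q σ μ ζ ν T P v L r
        = ∫⁻ y, PhiK e q σ μ ζ ν T P v L r ∂(Measure.pi fun _ : ι => lam (W * r)) := by simp
      _ = ∫⁻ y, ∫⁻ u, ∏ i, (∑ J ∈ T i,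
            (HH e (rad i L r) i (v i J) (hh ζ ν σ (P i J) u) y) ^ (1 / σ)) ^ (q / Fintype.card ι) ∂μ
            ∂(Measure.pi fun _ : ι => lam (W * r)) := by
          refine lintegral_congr fun y => ?_
          unfold PhiK
          rw [← hst.lintegral y (hmeas' r)]
          simp only [HH_hh_sh]
      _ = ∫⁻ u, ∫⁻ y, ∏ i, (∑ J ∈ T i,
            (HH e (rad i L r) i (v i J) (hh ζ ν σ (P i J) u) y) ^ (1 / σ)) ^ (q / Fintype.card ι)
            ∂(Measure.pi fun _ : ι => lam (W * r)) ∂μ := by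
          refine lintegral_lintegral_swap ?_
          exact (hmeas.comp measurable_swap).aemeasurable
      _ ≤ ∫⁻ u, C * ∏ i, (∑ J ∈ T i,
            (HH e (rad i L (W * r)) i (v i J) (hh ζ ν σ (P i J) u) 0) ^ (1 / σ)) ^ (q / Fintype.card ι) ∂μ := by
          refine lintegral_mono fun u => ?_
          exact H Λ T v (fun i J => hh ζ ν σ (P i J) u) r W L
            (fun i J => measurable_hh_right ζ ν σ (P i J) u) hr hW hL hv
      _ = _ := by rw [lintegral_const_mul _ (hmeas' _)]; rfl
  have key : ∀ k ≤ s, PhiK e q σ μ ζ ν T P v (W ^ s * ρ) ρ ≤ C ^ k * PhiK e q σ μ ζ ν T P v (W ^ s * ρ) (W ^ k * ρ) := by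
    intro k
    induction k with
    | zero => intro _; simp
    | succ k ih =>
      intro hk
      refine (ih (by omega)).trans ?_
      rw [pow_succ, mul_assoc]
      gcongr
      have h1 := step (W ^ k * ρ) (W ^ s * ρ) (by positivity) (by
        rw [← mul_assoc, ← pow_succ']
        gcongr)
      rwa [← mul_assoc, ← pow_succ'] at h1
  exact key s le_rfl

end DR

namespace DR
open scoped ENNReal NNReal
open scoped Classical

variable {ι : Type} [Fintype ι] {I : Type}

/-- Measures with compactly supported Fourier transform. -/
def om : ℝ → Measure ℝ := Classical.choose (exists_om (e := 1) le_rfl)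
def omC : ℝ≥0∞ := Classical.choose (Classical.choose_spec (exists_om (e := 1) le_rfl))
theorem omC_ne : omC ≠ ⊤ := (Classical.choose_spec (Classical.choose_spec (exists_om (e := 1) le_rfl))).1
theorem om_spec {L : ℝ} (hL : 0 < L) : IsProbabilityMeasure (om L) ∧
    (∀ ξ, 1 / L ≤ |ξ| → ∫ s, ee (ξ * s) ∂(om L) = 0) ∧
    (∀ g : ℝ → ℝ≥0∞, Measurable g →
      ∫⁻ s, ENNReal.ofReal (kap 1 L s) * g s ≤ omC * ∫⁻ s, g s ∂(om L)) ∧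
    (∀ g : ℝ → ℝ≥0∞, Measurable g →
      ∫⁻ s, g s ∂(om L) ≤ omC * ∫⁻ s, ENNReal.ofReal (kap 1 L s) * g s) :=
  (Classical.choose_spec (Classical.choose_spec (exists_om (e := 1) le_rfl))).2 L hL

/-- Product measure. -/
def omp (L : ℝ) : Measure (ι → ℝ) := Measure.pi (fun _ : ι => om L)

theorem omp_prob {L : ℝ} (hL : 0 < L) : IsProbabilityMeasure (omp L : Measure (ι → ℝ)) := by
  have := (om_spec hL).1
  unfold omp; infer_instance

theorem omp_ge {L : ℝ} (hL : 0 < L) {g : (ι → ℝ) → ℝ≥0∞} (hg : Measurable g) :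
    ∫⁻ s, kk 1 (fun _ => L) s * g s ≤ omC ^ (Fintype.card ι) * ∫⁻ s, g s ∂(omp L) := by
  have := (om_spec hL).1
  have h := pi_compare (fun _ : ι => (volume : Measure ℝ)) (fun _ => om L)
    (fun _ s => ENNReal.ofReal (kap 1 L s)) (fun _ _ => 1) (fun _ => measurable_kap 1 L)
    (fun _ => measurable_const) omC (by
      intro i g hg; simpa using (om_spec hL).2.2.1 g hg) g hg
  simpa [kk, omp, volume_pi] using h

/-- Integral of a power of a piece. -/
def gi (ζ : I → ι → ℝ) (ν : Measure (ι → ℝ)) (t : ℝ) (S : Finset I) (u : I → ℂ) : ℝ≥0∞ :=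
  ∫⁻ x, (gg ζ u S x) ^ t ∂ν

@[fun_prop] theorem measurable_gi (ζ : I → ι → ℝ) (ν : Measure (ι → ℝ)) [SFinite ν] (t : ℝ) (S : Finset I) :
    Measurable (gi ζ ν t S) := by
  unfold gi
  refine Measurable.lintegral_prod_right' (f := fun q : (I → ℂ) × (ι → ℝ) => (gg ζ q.1 S q.2) ^ t) ?_
  exact (measurable_gg ζ S).pow_const _

theorem measurable_gg_right (ζ : I → ι → ℝ) (S : Finset I) (u : I → ℂ) : Measurable (gg ζ u S) := by
  have h1 : Measurable (fun y : ι → ℝ => (u, y)) := measurable_prodMk_left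
  have h2 := (measurable_gg ζ S).comp h1
  exact h2

theorem prodsum_mono {Λ : Type} {κ σ' : ℝ} (hκ : 0 ≤ κ) (hσ : 0 ≤ σ') (T : ι → Finset Λ) {X Y : ι → Λ → ℝ≥0∞}
    {c : ℝ≥0∞} (h : ∀ i, ∀ J ∈ T i, X i J ≤ c * Y i J) :
    ∏ i, (∑ J ∈ T i, (X i J) ^ σ') ^ κ ≤
      ((c ^ σ') ^ κ) ^ (Fintype.card ι) * ∏ i, (∑ J ∈ T i, (Y i J) ^ σ') ^ κ := by
  rw [← Finset.card_univ, ← Finset.prod_const, ← Finset.prod_mul_distrib]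
  refine Finset.prod_le_prod' fun i _ => ?_
  rw [← ENNReal.mul_rpow_of_nonneg _ _ hκ, Finset.mul_sum]
  gcongr with J hJ
  rw [← ENNReal.mul_rpow_of_nonneg _ _ hσ]
  gcongr
  exact h i J hJ

theorem hh_le_HH {e : ℕ} {σ : ℝ} {ζ : I → ι → ℝ} {ν : Measure (ι → ℝ)} [SFinite ν] {S : Finset I}
    {u : I → ℂ} {rr : ι → ℝ} {i : ι} {v : ι → ℝ} {C : ℝ≥0∞}
    (h : ∀ y, (gg ζ u S y) ^ σ ≤ C * HH e rr i v (fun z => (gg ζ u S z) ^ σ) y) :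
    gi ζ ν σ S u ≤ C * HH e rr i v (hh ζ ν σ S u) 0 := by
  have hgm := (measurable_gg_right ζ S u).pow_const σ
  have e1 : HH e rr i v (hh ζ ν σ S u) 0 = ∫⁻ x, HH e rr i v (fun z => (gg ζ u S z) ^ σ) x ∂ν := by
    unfold HH hh
    rw [lintegral_lintegral_swap]
    · refine lintegral_congr fun s => ?_
      rw [lintegral_const_mul]
      · simp
      · exact hgm.comp (measurable_id.add_const _)
    · apply Measurable.aemeasurable
      exact ((measurable_kk e rr).comp measurable_snd).mul
        (hgm.comp (measurable_fst.add ((measurable_Um i v).comp measurable_snd)))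
  rw [e1, ← lintegral_const_mul _ (measurable_HH e rr i v hgm)]
  exact lintegral_mono h

theorem HH_le_conv {e : ℕ} (he : Fintype.card ι ≤ e) {σ : ℝ} {ζ : I → ι → ℝ} {ν : Measure (ι → ℝ)} [SFinite ν]
    {S : Finset I} {u : I → ℂ} {i : ι} {v : ι → ℝ} (hv : v i = 0) (hv1 : ∀ j, |v j| ≤ 1) {L : ℝ} (hL : 0 < L) :
    HH e (fun _ => L) i v (hh ζ ν σ S u) 0 ≤
      (2 * omC) ^ (Fintype.card ι) * gi ζ (ν.conv (omp L)) σ S u := by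
  have := (omp_prob hL : IsProbabilityMeasure (omp L : Measure (ι → ℝ)))
  have hgm := (measurable_gg_right ζ S u).pow_const σ
  have hm := measurable_hh_right ζ ν σ S u
  have e1 : gi ζ (ν.conv (omp L)) σ S u = ∫⁻ s, hh ζ ν σ S u s ∂(omp L) := by
    unfold gi hh
    rw [Measure.lintegral_conv hgm, lintegral_lintegral_swap]
    apply Measurable.aemeasurable
    exact hgm.comp (measurable_fst.add measurable_snd)
  refine (HH_final hL i hv hv1 he hm 0).trans ?_
  rw [e1, mul_pow, mul_assoc]
  gcongr
  simpa using omp_ge hL hm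

/-- Multilinear functional with power `σ` inside. -/
def MM {Λ : Type} (q σ : ℝ) (μ : Measure (I → ℂ)) (ζ : I → ι → ℝ) (ν : Measure (ι → ℝ))
    (T : ι → Finset Λ) (P : ι → Λ → Finset I) : ℝ≥0∞ :=
  ∫⁻ u, ∏ i, (∑ J ∈ T i, (gi ζ ν σ (P i J) u) ^ (1 / σ)) ^ (q / Fintype.card ι) ∂μ

theorem infl (hn : 2 ≤ Fintype.card ι) {q σ : ℝ} (hq : 1 ≤ q)
    (hσ1 : 1 ≤ σ) (hσ : σ * (q + 1) = 2 * q)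
    (hqn : (q + 1) * ((Fintype.card ι : ℝ) - 1) ≤ 2 * (Fintype.card ι : ℝ)) {C1 : ℝ} (hC1 : 0 < C1) :
    ∃ C : ℝ≥0∞, C ≠ ⊤ ∧ ∀ (I Λ : Type) (μ : Measure (I → ℂ)) (_ : SFinite μ) (ζ : I → ι → ℝ)
      (ν : Measure (ι → ℝ)) (_ : IsProbabilityMeasure ν) (T : ι → Finset Λ) (P : ι → Λ → Finset I) (v c : ι → Λ → ι → ℝ)
      (ρ W : ℝ) (s : ℕ), Stat μ ζ → 0 < ρ → 1 ≤ W →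
      (∀ i, ∀ J ∈ T i, v i J i = 0 ∧ ∀ j, |v i J j| ≤ 1 / W) →
      (∀ i, ∀ J ∈ T i, ∀ l ∈ P i J, ∀ j, |tw i (v i J) (ζ l - c i J) j| ≤ C1 / rad i (W ^ s * ρ) ρ j) →
      MM q 1 μ ζ ν T P ≤ C ^ (s + 1) * MM q σ μ ζ (ν.conv (omp (W ^ s * ρ))) T P := by
  set n := Fintype.card ι with hndef
  have hn1 : 1 ≤ n := by omega
  have hκ : 0 ≤ q / n := by positivity
  have hσi : 0 ≤ 1 / σ := by positivity
  obtain ⟨C0, hC0, H0⟩ := repro (ι := ι) hn1 hC1 hσ1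
  obtain ⟨C2, hC2, H2⟩ := kak_iter (ι := ι) (e := n) hn1 hn hq hσ1 hσ hqn
  set a0 := ((C0 ^ (1 / σ)) ^ (q / n)) ^ n with ha0
  set a1 := ((((2 * omC) ^ n) ^ (1 / σ)) ^ (q / n)) ^ n with ha1
  have h0t : a0 ≠ ⊤ := ENNReal.pow_ne_top (ENNReal.rpow_ne_top_of_nonneg hκ (ENNReal.rpow_ne_top_of_nonneg hσi hC0))
  have h1t : a1 ≠ ⊤ := ENNReal.pow_ne_top (ENNReal.rpow_ne_top_of_nonneg hκ (ENNReal.rpow_ne_top_of_nonneg hσi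
    (ENNReal.pow_ne_top (ENNReal.mul_ne_top (by simp) omC_ne))))
  refine ⟨max 1 (max C2 (a0 * a1)), ?_, ?_⟩
  · simp [hC2, ENNReal.mul_ne_top h0t h1t]
  intro I Λ μ _ ζ ν _ T P v c ρ W s hst hρ hW hv htw
  set L := W ^ s * ρ with hL
  have hL0 : 0 < L := by positivity
  have := (omp_prob hL0 : IsProbabilityMeasure (omp L : Measure (ι → ℝ)))
  have hrad : ∀ i j : ι, 0 < rad i L ρ j := by intro i j; unfold rad; split_ifs <;> assumption
  have s1 : MM q 1 μ ζ ν T P ≤ a0 * PhiK n q σ μ ζ ν T P v L ρ := by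
    unfold MM PhiK
    have hms : Measurable fun u : I → ℂ => ∏ i, (∑ J ∈ T i,
        (HH n (rad i L ρ) i (v i J) (hh ζ ν σ (P i J) u) 0) ^ (1 / σ)) ^ (q / (n : ℝ)) := by
      refine Finset.measurable_prod _ fun i _ => (Finset.measurable_fun_sum _ fun J _ => Measurable.pow_const ?_ _).pow_const _
      have h1 : Measurable (fun u : I → ℂ => (u, (0 : ι → ℝ))) := measurable_prodMk_right
      have h2 := (measurable_HHhh ζ ν σ (P i J) n (rad i L ρ) i (v i J)).comp h1
      exact h2
    rw [← lintegral_const_mul _ hms]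
    refine lintegral_mono fun u => ?_
    refine le_trans ?_ (prodsum_mono (c := C0) hκ hσi T (X := fun i J => gi ζ ν σ (P i J) u) ?_)
    · refine Finset.prod_le_prod' fun i _ => ?_
      gcongr with J hJ
      have := jensen_le ν hσ1 (measurable_gg_right ζ (P i J) u)
      simpa [gi] using this
    · intro i J hJ
      exact hh_le_HH (H0 I ζ u (P i J) (c i J) (v i J) i _ (hrad i) (htw i J hJ))
  have s2 : PhiK n q σ μ ζ ν T P v L L ≤ a1 * MM q σ μ ζ (ν.conv (omp L)) T P := by
    unfold MM PhiK
    rw [← lintegral_const_mul _ (Finset.measurable_prod _ fun i _ => (Finset.measurable_fun_sum _ fun J _ =>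
        (measurable_gi ζ _ σ (P i J)).pow_const _).pow_const _)]
    refine lintegral_mono fun u => ?_
    refine prodsum_mono hκ hσi T ?_
    intro i J hJ
    have hr : rad i L L = fun _ => L := by funext j; simp [rad]
    rw [hr]
    refine HH_le_conv le_rfl (hv i J hJ).1 (fun j => ((hv i J hJ).2 j).trans ?_) hL0
    rw [div_le_one (by linarith)]; exact hW
  set C := max 1 (max C2 (a0 * a1)) with hC
  calc _ ≤ a0 * PhiK n q σ μ ζ ν T P v L ρ := s1
    _ ≤ a0 * (C2 ^ s * PhiK n q σ μ ζ ν T P v L L) := by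
        gcongr; exact H2 I Λ μ inferInstance ζ ν inferInstance T P v ρ W s hst hρ hW hv
    _ ≤ a0 * (C2 ^ s * (a1 * MM q σ μ ζ (ν.conv (omp L)) T P)) := by gcongr
    _ = C2 ^ s * (a0 * a1) * MM q σ μ ζ (ν.conv (omp L)) T P := by ring
    _ ≤ C ^ s * C * MM q σ μ ζ (ν.conv (omp L)) T P := by
        gcongr
        · exact (le_max_left _ _).trans (le_max_right _ _)
        · exact (le_max_right _ _).trans (le_max_right _ _)
    _ = _ := by rw [pow_succ]

end DR

namespace DR
open scoped ENNReal NNReal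
open scoped Classical

variable {ι : Type} [Fintype ι] {I : Type}

theorem enorm_sq_eq (z : ℂ) : ‖z‖ₑ ^ 2 = ENNReal.ofReal (‖z‖ ^ 2) := by
  rw [← ofReal_norm, ENNReal.ofReal_pow (norm_nonneg _)]

theorem enorm_sum_sq {κ : Type*} (s : Finset κ) (z : κ → ℂ) :
    ‖∑ c ∈ s, z c‖ₑ ^ 2 ≤ s.card * ∑ c ∈ s, ‖z c‖ₑ ^ 2 := by
  simp_rw [enorm_sq_eq]
  rw [← ENNReal.ofReal_sum_of_nonneg (fun _ _ => by positivity), ← ENNReal.ofReal_natCast,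
    ← ENNReal.ofReal_mul (by positivity)]
  apply ENNReal.ofReal_le_ofReal
  calc ‖∑ c ∈ s, z c‖ ^ 2 ≤ (∑ c ∈ s, ‖z c‖) ^ 2 := by gcongr; exact norm_sum_le _ _
    _ ≤ _ := sq_sum_le_card_mul_sum_sq

theorem lintegral_orth {α Λ : Type*} [MeasurableSpace α] (μ : Measure α) [IsFiniteMeasure μ] (T : Finset Λ)
    (F : Λ → α → ℂ) (hF : ∀ J, Measurable (F J)) (B : ℝ) (hB : ∀ J a, ‖F J a‖ ≤ B)
    (h : ∀ J ∈ T, ∀ J' ∈ T, J ≠ J' → ∫ a, F J a * (starRingEnd ℂ) (F J' a) ∂μ = 0) :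
    ∫⁻ a, ‖∑ J ∈ T, F J a‖ₑ ^ 2 ∂μ = ∑ J ∈ T, ∫⁻ a, ‖F J a‖ₑ ^ 2 ∂μ := by
  have hi : ∀ J J', Integrable (fun a => F J a * (starRingEnd ℂ) (F J' a)) μ := by
    intro J J'
    refine Integrable.of_bound (C := B * B) ?_ ?_
    · exact ((hF J).mul (Complex.continuous_conj.measurable.comp (hF J'))).aestronglyMeasurable
    · refine Filter.Eventually.of_forall fun a => ?_
      rw [norm_mul, RCLike.norm_conj]
      exact mul_le_mul (hB J a) (hB J' a) (norm_nonneg _) ((norm_nonneg _).trans (hB J a))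
  have key : ∀ G : α → ℂ, Measurable G → (∃ B', ∀ a, ‖G a‖ ≤ B') →
      Integrable (fun a => ‖G a‖ ^ 2) μ := by
    rintro G hG ⟨B', hB'⟩
    refine Integrable.of_bound (C := B' ^ 2) (hG.norm.pow_const 2).aestronglyMeasurable ?_
    refine Filter.Eventually.of_forall fun a => ?_
    simp; gcongr; exact hB' a
  have e1 : ∀ G : α → ℂ, Measurable G → (∃ B', ∀ a, ‖G a‖ ≤ B') →
      ∫⁻ a, ‖G a‖ₑ ^ 2 ∂μ = ENNReal.ofReal (∫ a, ‖G a‖ ^ 2 ∂μ) := by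
    intro G hG hb
    rw [ofReal_integral_eq_lintegral_ofReal (key G hG hb) (Filter.Eventually.of_forall fun a => by positivity)]
    simp_rw [enorm_sq_eq]
  have hsb : ∃ B', ∀ a, ‖∑ J ∈ T, F J a‖ ≤ B' := by
    refine ⟨∑ J ∈ T, B, fun a => (norm_sum_le _ _).trans (Finset.sum_le_sum fun J _ => hB J a)⟩
  rw [e1 _ (Finset.measurable_sum _ fun J _ => hF J) hsb]
  simp_rw [fun J => e1 (F J) (hF J) ⟨B, hB J⟩]
  rw [← ENNReal.ofReal_sum_of_nonneg (fun _ _ => by positivity)]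
  congr 1
  have c1 : ((∫ a, ‖∑ J ∈ T, F J a‖ ^ 2 ∂μ : ℝ) : ℂ) = ((∑ J ∈ T, ∫ a, ‖F J a‖ ^ 2 ∂μ : ℝ) : ℂ) := by
    push_cast
    rw [← integral_complex_ofReal]
    simp_rw [← integral_complex_ofReal, Complex.ofReal_pow, ← Complex.mul_conj', map_sum, Finset.sum_mul_sum]
    rw [integral_finset_sum _ (fun J _ => integrable_finset_sum _ fun J' _ => hi J J')]
    refine Finset.sum_congr rfl fun J hJ => ?_
    rw [integral_finset_sum _ (fun J' _ => hi J J')]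
    rw [Finset.sum_eq_single_of_mem J hJ]
    intro J' hJ' hne
    exact h J hJ J' hJ' hne.symm
  exact_mod_cast c1

theorem omp_ee {L : ℝ} (hL : 0 < L) (ξ : ι → ℝ) (h : ∃ j, 1 / L ≤ |ξ j|) :
    ∫ s, ee (ph ξ s) ∂(omp L : Measure (ι → ℝ)) = 0 := by
  have := (om_spec hL).1
  obtain ⟨j, hj⟩ := h
  unfold ph omp
  simp_rw [ee_sum]
  rw [integral_fintype_prod_eq_prod (𝕜 := ℂ) (f := fun j (t : ℝ) => ee (ξ j * t))]
  exact Finset.prod_eq_zero (Finset.mem_univ j) ((om_spec hL).2.1 _ hj)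

theorem es_norm_le (ζ : I → ι → ℝ) (u : I → ℂ) (S : Finset I) (x : ι → ℝ) :
    ‖es ζ u S x‖ ≤ ∑ l ∈ S, ‖u l‖ := by
  unfold es
  refine (norm_sum_le _ _).trans (Finset.sum_le_sum fun l _ => ?_)
  rw [norm_mul, norm_ee, mul_one]

theorem es_fiber {Λ : Type*} (ζ : I → ι → ℝ) (u : I → ℂ) (S : Finset I) (k : I → Λ) (x : ι → ℝ) :
    es ζ u S x = ∑ J ∈ S.image k, es ζ u (S.filter (k · = J)) x := by
  unfold es
  exact (Finset.sum_fiberwise_of_maps_to (fun l hl => Finset.mem_image_of_mem k hl) _).symm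

theorem orth1 {Λ : Type*} {L : ℝ} (hL : 0 < L) (ζ : I → ι → ℝ) (u : I → ℂ) (S : Finset I) (k : I → Λ)
    (hsep : ∀ l ∈ S, ∀ l' ∈ S, k l ≠ k l' → ∃ j, 1 / L ≤ |ζ l j - ζ l' j|) (x : ι → ℝ) :
    ∫⁻ s, gg ζ u S (x + s) ∂(omp L) =
      ∑ J ∈ S.image k, ∫⁻ s, gg ζ u (S.filter (k · = J)) (x + s) ∂(omp L) := by
  have := (omp_prob hL : IsProbabilityMeasure (omp L : Measure (ι → ℝ)))
  have hc : ∀ S' : Finset I, Continuous (fun s => es ζ u S' (x + s)) := fun S' =>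
    (continuous_es_right ζ S' u).comp (continuous_const.add continuous_id)
  have := lintegral_orth (omp L : Measure (ι → ℝ)) (S.image k) (fun J s => es ζ u (S.filter (k · = J)) (x + s))
    (fun J => (hc _).measurable)
    (∑ l ∈ S, ‖u l‖) (fun J a => (es_norm_le _ _ _ _).trans
      (Finset.sum_le_sum_of_subset_of_nonneg (Finset.filter_subset _ _) (fun _ _ _ => norm_nonneg _))) ?_
  · unfold gg
    simp_rw [es_fiber ζ u S k]
    exact this
  · intro J hJ J' hJ' hne
    unfold es
    simp_rw [map_sum, Finset.sum_mul_sum]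
    have e2 : ∀ l l' s, u l * ee (ph (ζ l) (x + s)) * (starRingEnd ℂ) (u l' * ee (ph (ζ l') (x + s))) =
        (u l * (starRingEnd ℂ) (u l') * ee (ph (ζ l - ζ l') x)) * ee (ph (ζ l - ζ l') s) := by
      intro l l' s
      rw [map_mul, ← ee_neg, mul_mul_mul_comm, ← ee_add, mul_assoc _ (ee _), ← ee_add]
      congr 2
      simp only [ph_add_right, ph_sub_left]; ring
    simp_rw [e2]
    have hintg : ∀ (c : ℂ) l l', Integrable (fun s => c * ee (ph (ζ l - ζ l') s)) (omp L : Measure (ι → ℝ)) := by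
      intro c l l'
      refine Integrable.of_bound (C := ‖c‖) ?_ (Filter.Eventually.of_forall fun a => ?_)
      · exact (continuous_const.mul (continuous_ee.comp (continuous_ph _))).measurable.aestronglyMeasurable
      · rw [norm_mul, norm_ee, mul_one]
    rw [integral_finset_sum _ (fun l _ => integrable_finset_sum _ fun l' _ => hintg _ l l')]
    refine Finset.sum_eq_zero fun l hl => ?_
    rw [integral_finset_sum _ (fun l' _ => hintg _ l l')]
    refine Finset.sum_eq_zero fun l' hl' => ?_
    rw [integral_const_mul, omp_ee hL, mul_zero]
    simp only [Finset.mem_filter] at hl hl'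
    exact hsep l hl.1 l' hl'.1 (by rw [hl.2, hl'.2]; exact hne)

theorem orth {Λ κ : Type*} [Fintype κ] {L : ℝ} (hL : 0 < L) (ζ : I → ι → ℝ) (u : I → ℂ) (S : Finset I)
    (k : I → Λ) (col : Λ → κ)
    (hsep : ∀ l ∈ S, ∀ l' ∈ S, k l ≠ k l' → col (k l) = col (k l') → ∃ j, 1 / L ≤ |ζ l j - ζ l' j|)
    (ν : Measure (ι → ℝ)) [SFinite ν] :
    gi ζ (ν.conv (omp L)) 1 S u ≤ Fintype.card κ *
      ∑ J ∈ S.image k, gi ζ (ν.conv (omp L)) 1 (S.filter (k · = J)) u := by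
  have := (omp_prob hL : IsProbabilityMeasure (omp L : Measure (ι → ℝ)))
  have hgc : ∀ S' : Finset I, ∀ x : ι → ℝ, Measurable fun s : ι → ℝ => gg ζ u S' (x + s) := fun S' x =>
    (measurable_gg_right ζ S' u).comp (measurable_const.add measurable_id)
  have main : ∀ x : ι → ℝ, ∫⁻ s, gg ζ u S (x + s) ∂(omp L) ≤ Fintype.card κ *
      ∑ J ∈ S.image k, ∫⁻ s, gg ζ u (S.filter (k · = J)) (x + s) ∂(omp L) := by
    intro x
    have p1 : ∀ s, gg ζ u S (x + s) ≤ Fintype.card κ *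
        ∑ c : κ, gg ζ u (S.filter (fun l => col (k l) = c)) (x + s) := by
      intro s
      unfold gg
      have : es ζ u S (x + s) = ∑ c : κ, es ζ u (S.filter (fun l => col (k l) = c)) (x + s) := by
        unfold es
        exact (Finset.sum_fiberwise _ _ _).symm
      rw [this]
      exact enorm_sum_sq _ _
    calc _ ≤ ∫⁻ s, Fintype.card κ *
        ∑ c : κ, gg ζ u (S.filter (fun l => col (k l) = c)) (x + s) ∂(omp L) := lintegral_mono p1
      _ = Fintype.card κ * ∑ c : κ, ∫⁻ s, gg ζ u (S.filter (fun l => col (k l) = c)) (x + s) ∂(omp L) := by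
          rw [lintegral_const_mul _ (Finset.measurable_fun_sum _ fun c _ => hgc _ x),
            lintegral_finset_sum _ fun c _ => hgc _ x]
      _ = _ := by
          congr 1
          rw [← Finset.sum_fiberwise (S.image k) col]
          refine Finset.sum_congr rfl fun c _ => ?_
          rw [orth1 hL ζ u (S.filter (fun l => col (k l) = c)) k]
          · have e1 : (S.filter (fun l => col (k l) = c)).image k = (S.image k).filter (col · = c) := by
              ext J; simp only [Finset.mem_image, Finset.mem_filter]
              constructor
              · rintro ⟨l, ⟨h1, h2⟩, rfl⟩; exact ⟨⟨l, h1, rfl⟩, h2⟩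
              · rintro ⟨⟨l, h1, rfl⟩, h2⟩; exact ⟨l, ⟨h1, h2⟩, rfl⟩
            rw [e1]
            refine Finset.sum_congr rfl fun J hJ => ?_
            have e3 : (S.filter (fun l => col (k l) = c)).filter (k · = J) = S.filter (k · = J) := by
              ext l; simp only [Finset.mem_filter] at hJ ⊢
              constructor
              · rintro ⟨⟨h1, h2⟩, h3⟩; exact ⟨h1, h3⟩
              · rintro ⟨h1, rfl⟩; exact ⟨⟨h1, hJ.2⟩, rfl⟩
            rw [e3]
          · intro l hl l' hl' hne
            simp only [Finset.mem_filter] at hl hl'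
            exact hsep l hl.1 l' hl'.1 hne (hl.2.trans hl'.2.symm)
  have hgi : ∀ S' : Finset I, gi ζ (ν.conv (omp L)) 1 S' u = ∫⁻ x, ∫⁻ s, gg ζ u S' (x + s) ∂(omp L) ∂ν := by
    intro S'
    unfold gi
    rw [Measure.lintegral_conv ((measurable_gg_right ζ S' u).pow_const 1)]
    simp
  have hmm : ∀ S' : Finset I, Measurable fun x => ∫⁻ s, gg ζ u S' (x + s) ∂(omp L) := by
    intro S'
    refine Measurable.lintegral_prod_right' (f := fun q : (ι → ℝ) × (ι → ℝ) => gg ζ u S' (q.1 + q.2)) ?_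
    exact (measurable_gg_right ζ S' u).comp (measurable_fst.add measurable_snd)
  simp_rw [hgi]
  rw [← lintegral_finset_sum _ (fun J _ => hmm _), ← lintegral_const_mul _ (Finset.measurable_fun_sum _ fun J _ => hmm _)]
  exact lintegral_mono main

theorem ennreal_cs {Λ : Type*} (T : Finset Λ) (X Z : Λ → ℝ≥0∞) :
    ∑ J ∈ T, (X J) ^ (1 / 2 : ℝ) * (Z J) ^ (1 / 2 : ℝ) ≤
      (∑ J ∈ T, X J) ^ (1 / 2 : ℝ) * (∑ J ∈ T, Z J) ^ (1 / 2 : ℝ) := by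
  have := ENNReal.inner_le_Lp_mul_Lq T (fun J => (X J) ^ (1 / 2 : ℝ)) (fun J => (Z J) ^ (1 / 2 : ℝ))
    Real.HolderConjugate.two_two
  refine this.trans (le_of_eq ?_)
  simp_rw [← ENNReal.rpow_mul]
  norm_num

theorem lintegral_cs {α : Type*} [MeasurableSpace α] (μ : Measure α) {X Z : α → ℝ≥0∞}
    (hX : Measurable X) (hZ : Measurable Z) :
    ∫⁻ a, (X a) ^ (1 / 2 : ℝ) * (Z a) ^ (1 / 2 : ℝ) ∂μ ≤
      (∫⁻ a, X a ∂μ) ^ (1 / 2 : ℝ) * (∫⁻ a, Z a ∂μ) ^ (1 / 2 : ℝ) :=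
  ENNReal.lintegral_mul_norm_pow_le hX.aemeasurable hZ.aemeasurable (by norm_num) (by norm_num) (by norm_num)

theorem gi_interp {q σ : ℝ} (hq : 1 ≤ q) (hσ : σ * (q + 1) = 2 * q) (ζ : I → ι → ℝ) (ν : Measure (ι → ℝ))
    (S : Finset I) (u : I → ℂ) :
    (gi ζ ν σ S u) ^ (1 / σ) ≤ (gi ζ ν 1 S u) ^ (1 / 2 : ℝ) * ((gi ζ ν q S u) ^ (1 / q)) ^ (1 / 2 : ℝ) := by
  have hq1 : 0 < q + 1 := by linarith
  have hσe : σ = 2 * q / (q + 1) := by field_simp; exact hσ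
  have hσ0 : 0 < σ := by rw [hσe]; positivity
  have hg := measurable_gg_right ζ S u
  have h := ENNReal.lintegral_mul_norm_pow_le (μ := ν) (f := fun x => (gg ζ u S x) ^ (1:ℝ))
    (g := fun x => (gg ζ u S x) ^ q) (p := q / (q + 1)) (q := 1 / (q + 1))
    (hg.pow_const _).aemeasurable (hg.pow_const _).aemeasurable (by positivity) (by positivity) (by field_simp)
  have e1 : ∀ x, ((gg ζ u S x) ^ (1:ℝ)) ^ (q / (q + 1)) * ((gg ζ u S x) ^ q) ^ (1 / (q + 1)) = (gg ζ u S x) ^ σ := by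
    intro x
    rw [← ENNReal.rpow_mul, ← ENNReal.rpow_mul, ← ENNReal.rpow_add_of_nonneg _ _ (by positivity) (by positivity)]
    congr 1
    rw [hσe]; field_simp; ring
  simp_rw [e1] at h
  unfold gi
  refine (ENNReal.rpow_le_rpow h (by positivity)).trans (le_of_eq ?_)
  rw [ENNReal.mul_rpow_of_nonneg _ _ (by positivity), ← ENNReal.rpow_mul, ← ENNReal.rpow_mul, ← ENNReal.rpow_mul]
  congr 2 <;> · rw [hσe]; field_simp

/-- Multilinear quantity at a labelling. -/
def AA {Λ : Type} (q : ℝ) (μ : Measure (I → ℂ)) (ζ : I → ι → ℝ) (ν : Measure (ι → ℝ))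
    (S : ι → Finset I) (lab : I → Λ) : ℝ≥0∞ :=
  MM q 1 μ ζ ν (fun i => (S i).image lab) (fun i J => (S i).filter (lab · = J))

theorem lintegral_sumgi {Λ : Type} {q : ℝ} (hq : 1 ≤ q) {μ : Measure (I → ℂ)} [SFinite μ] {ζ : I → ι → ℝ}
    (hst : Stat μ ζ) (ν : Measure (ι → ℝ)) [IsProbabilityMeasure ν] (T : Finset Λ) (P : Λ → Finset I) :
    ∫⁻ u, (∑ J ∈ T, (gi ζ ν q (P J) u) ^ (1 / q)) ^ q ∂μ ≤ (∑ J ∈ T, NN q μ (P J)) ^ q := by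
  have hq0 : 0 < q := by linarith
  have h := lq_sum_le μ hq T (fun J u => (gi ζ ν q (P J) u) ^ (1 / q))
    (fun J _ => (measurable_gi ζ ν q (P J)).pow_const _)
  have e : ∀ J, (∫⁻ u, ((gi ζ ν q (P J) u) ^ (1 / q)) ^ q ∂μ) ^ (1 / q) = NN q μ (P J) := by
    intro J
    unfold NN gi
    simp_rw [← ENNReal.rpow_mul, one_div_mul_cancel hq0.ne', ENNReal.rpow_one]
    rw [lintegral_lintegral_swap]
    · simp_rw [hst.lintegral_gg]; simp
    · exact ((measurable_gg ζ (P J)).pow_const q).aemeasurable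
  simp_rw [e] at h
  have h2 := ENNReal.rpow_le_rpow h hq0.le
  rwa [← ENNReal.rpow_mul, one_div_mul_cancel hq0.ne', ENNReal.rpow_one] at h2

theorem prod_pow_div {n : ℕ} (hn : 0 < n) (hc : Fintype.card ι = n) {q : ℝ} (hq : 0 ≤ q) (a : ℝ≥0∞) :
    ∏ _i : ι, a ^ (q / n) = a ^ q := by
  rw [Finset.prod_const, Finset.card_univ, hc, ← ENNReal.rpow_natCast, ← ENNReal.rpow_mul]
  congr 1; field_simp

theorem MM_le_NN {Λ : Type} {q : ℝ} (hq : 1 ≤ q) (hn : 1 ≤ Fintype.card ι) {μ : Measure (I → ℂ)} [SFinite μ]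
    {ζ : I → ι → ℝ}
    (hst : Stat μ ζ) (ν : Measure (ι → ℝ)) [IsProbabilityMeasure ν] (T : ι → Finset Λ) (P : ι → Λ → Finset I)
    (B : ℝ≥0∞) (hB : ∀ i, ∑ J ∈ T i, NN q μ (P i J) ≤ B) :
    MM q q μ ζ ν T P ≤ B ^ q := by
  unfold MM
  set n := Fintype.card ι with hnd
  have hn0 : (0:ℝ) < n := by exact_mod_cast hn
  have h := ENNReal.lintegral_prod_norm_pow_le (μ := μ) Finset.univ
    (f := fun i u => (∑ J ∈ T i, (gi ζ ν q (P i J) u) ^ (1 / q)) ^ q) (p := fun _ => 1 / (n:ℝ))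
    (fun i _ => ((Finset.measurable_fun_sum _ fun J _ => (measurable_gi ζ ν q (P i J)).pow_const _).pow_const _).aemeasurable)
    (by simp [← hnd, hn0.ne']) (fun i _ => by positivity)
  simp_rw [← ENNReal.rpow_mul, mul_one_div] at h
  refine h.trans ?_
  calc _ ≤ ∏ i : ι, (B ^ q) ^ (1 / (n:ℝ)) := by
        refine Finset.prod_le_prod' fun i _ => ?_
        gcongr
        exact (lintegral_sumgi hq hst ν (T i) (P i)).trans (by gcongr; exact hB i)
    _ = B ^ q := by
        simp_rw [← ENNReal.rpow_mul, mul_one_div]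
        exact prod_pow_div (by omega) hnd.symm (by linarith) B

theorem MM_interp {Λ : Type} {q σ : ℝ} (hq : 1 ≤ q) (hσ : σ * (q + 1) = 2 * q)
    {μ : Measure (I → ℂ)} [SFinite μ] {ζ : I → ι → ℝ} (ν : Measure (ι → ℝ)) [IsProbabilityMeasure ν]
    (T : ι → Finset Λ) (P : ι → Λ → Finset I) :
    MM q σ μ ζ ν T P ≤ (MM q 1 μ ζ ν T P) ^ (1 / 2 : ℝ) * (MM q q μ ζ ν T P) ^ (1 / 2 : ℝ) := by
  unfold MM
  have hκ : 0 ≤ q / (Fintype.card ι : ℝ) := by positivity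
  refine le_trans ?_ (lintegral_cs μ
    (Finset.measurable_prod _ fun i _ => (Finset.measurable_fun_sum _ fun J _ => (measurable_gi ζ ν 1 (P i J)).pow_const _).pow_const _)
    (Finset.measurable_prod _ fun i _ => (Finset.measurable_fun_sum _ fun J _ => (measurable_gi ζ ν q (P i J)).pow_const _).pow_const _))
  refine lintegral_mono fun u => ?_
  rw [← ENNReal.prod_rpow_of_nonneg (by norm_num), ← ENNReal.prod_rpow_of_nonneg (by norm_num), ← Finset.prod_mul_distrib]
  refine Finset.prod_le_prod' fun i _ => ?_
  rw [← ENNReal.rpow_mul, ← ENNReal.rpow_mul, mul_comm (q / _), ENNReal.rpow_mul, ENNReal.rpow_mul,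
    ← ENNReal.mul_rpow_of_nonneg _ _ hκ]
  gcongr
  refine le_trans ?_ (ennreal_cs _ _ _)
  refine Finset.sum_le_sum fun J _ => ?_
  simpa using gi_interp hq hσ ζ ν (P i J) u

theorem AA_refine {Λ Λ' κ : Type} [Fintype κ] {q L : ℝ} (hq : 1 ≤ q) (hL : 0 < L) (hn : 1 ≤ Fintype.card ι)
    {μ : Measure (I → ℂ)} [SFinite μ] {ζ : I → ι → ℝ} (ν : Measure (ι → ℝ)) [IsProbabilityMeasure ν]
    (S : ι → Finset I) (lab : I → Λ) (lab' : I → Λ') (pr : Λ' → Λ) (hpr : ∀ l, lab l = pr (lab' l))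
    (col : Λ' → κ)
    (hsep : ∀ i, ∀ l ∈ S i, ∀ l' ∈ S i, lab l = lab l' → lab' l ≠ lab' l' → col (lab' l) = col (lab' l') →
      ∃ j, 1 / L ≤ |ζ l j - ζ l' j|) :
    AA q μ ζ (ν.conv (omp L)) S lab ≤ (Fintype.card κ : ℝ≥0∞) ^ q * AA q μ ζ (ν.conv (omp L)) S lab' := by
  have := (omp_prob hL : IsProbabilityMeasure (omp L : Measure (ι → ℝ)))
  unfold AA MM
  have hκ : 0 ≤ q / (Fintype.card ι : ℝ) := by positivity
  rw [← lintegral_const_mul _ (Finset.measurable_prod _ fun i _ => (Finset.measurable_fun_sum _ fun J _ => (measurable_gi ζ _ 1 _).pow_const _).pow_const _)]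
  refine lintegral_mono fun u => ?_
  rw [← prod_pow_div hn rfl (by linarith : 0 ≤ q) (Fintype.card κ : ℝ≥0∞), ← Finset.prod_mul_distrib]
  refine Finset.prod_le_prod' fun i _ => ?_
  rw [← ENNReal.mul_rpow_of_nonneg _ _ hκ]
  gcongr
  simp only [div_one, ENNReal.rpow_one]
  rw [← Finset.sum_fiberwise_of_maps_to (s := (S i).image lab') (t := (S i).image lab) (g := pr), Finset.mul_sum]
  · refine Finset.sum_le_sum fun J hJ => ?_
    have ho := orth hL ζ u ((S i).filter (lab · = J)) lab' col (by
      intro l hl l' hl' h1 h2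
      simp only [Finset.mem_filter] at hl hl'
      exact hsep i l hl.1 l' hl'.1 (hl.2.trans hl'.2.symm) h1 h2) ν
    refine ho.trans (le_of_eq ?_)
    congr 1
    have e1 : ((S i).filter (lab · = J)).image lab' = ((S i).image lab').filter (pr · = J) := by
      ext J'; simp only [Finset.mem_image, Finset.mem_filter]
      constructor
      · rintro ⟨l, ⟨h1, h2⟩, rfl⟩; exact ⟨⟨l, h1, rfl⟩, by rw [← hpr, h2]⟩
      · rintro ⟨⟨l, h1, rfl⟩, h2⟩; exact ⟨l, ⟨h1, by rw [hpr, h2]⟩, rfl⟩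
    rw [e1]
    refine Finset.sum_congr rfl fun J' hJ' => ?_
    congr 1
    ext l; simp only [Finset.mem_filter] at hJ' ⊢
    constructor
    · rintro ⟨⟨h1, h2⟩, h3⟩; exact ⟨h1, h3⟩
    · rintro ⟨h1, rfl⟩; exact ⟨⟨h1, (hpr l).trans hJ'.2⟩, rfl⟩
  · intro J' hJ'
    simp only [Finset.mem_image] at hJ' ⊢
    obtain ⟨l, hl, rfl⟩ := hJ'
    exact ⟨l, hl, hpr l⟩

theorem onestep (hn : 2 ≤ Fintype.card ι) {q : ℝ} (hq : 1 ≤ q)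
    (hqn : (q + 1) * ((Fintype.card ι : ℝ) - 1) ≤ 2 * (Fintype.card ι : ℝ)) {C1 : ℝ} (hC1 : 0 < C1) (N : ℕ) :
    ∃ C : ℝ≥0∞, C ≠ ⊤ ∧ 1 ≤ C ∧ ∀ (I Λ Λ' κ : Type) (_ : Fintype κ) (μ : Measure (I → ℂ)) (_ : SFinite μ) (ζ : I → ι → ℝ)
      (ν : Measure (ι → ℝ)) (_ : IsProbabilityMeasure ν) (S : ι → Finset I)
      (lab : I → Λ) (lab' : I → Λ') (pr : Λ' → Λ) (col : Λ' → κ) (v c : ι → Λ → ι → ℝ)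
      (ρ W : ℝ) (s : ℕ) (B : ℝ≥0∞), Fintype.card κ ≤ N → Stat μ ζ → 0 < ρ → 1 ≤ W →
      (∀ i, ∀ l ∈ S i, v i (lab l) i = 0 ∧ ∀ j, |v i (lab l) j| ≤ 1 / W) →
      (∀ i, ∀ l ∈ S i, ∀ j, |tw i (v i (lab l)) (ζ l - c i (lab l)) j| ≤ C1 / rad i (W ^ s * ρ) ρ j) →
      (∀ l, lab l = pr (lab' l)) →
      (∀ i, ∀ l ∈ S i, ∀ l' ∈ S i, lab l = lab l' → lab' l ≠ lab' l' → col (lab' l) = col (lab' l') →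
        ∃ j, 1 / (W ^ s * ρ) ≤ |ζ l j - ζ l' j|) →
      (∀ i, ∑ J ∈ (S i).image lab, NN q μ ((S i).filter (lab · = J)) ≤ B) →
      AA q μ ζ ν S lab ≤ C ^ (s + 1) *
        (AA q μ ζ (ν.conv (omp (W ^ s * ρ))) S lab') ^ (1 / 2 : ℝ) * (B ^ q) ^ (1 / 2 : ℝ) := by
  have hq1 : 0 < q + 1 := by linarith
  set σ := 2 * q / (q + 1) with hσe
  have hσ : σ * (q + 1) = 2 * q := by rw [hσe]; field_simp
  have hσ1 : 1 ≤ σ := by rw [hσe, le_div_iff₀ hq1]; linarith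
  obtain ⟨C0, hC0, H⟩ := infl (ι := ι) hn hq hσ1 hσ hqn hC1
  set d : ℝ≥0∞ := ((N : ℝ≥0∞) ^ q) ^ (1 / 2 : ℝ) with hd
  have hdt : d ≠ ⊤ := ENNReal.rpow_ne_top_of_nonneg (by norm_num)
    (ENNReal.rpow_ne_top_of_nonneg (by linarith) (by simp))
  refine ⟨max 1 C0 * max 1 d, ENNReal.mul_ne_top (by simp [hC0]) (by simp [hdt]), ?_, ?_⟩
  · exact one_le_mul (le_max_left _ _) (le_max_left _ _)
  intro I Λ Λ' κ _ μ _ ζ ν _ S lab lab' pr col v c ρ W s B hN hst hρ hW hv htw hpr hsep hB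
  set L := W ^ s * ρ with hL
  have hL0 : 0 < L := by positivity
  have := (omp_prob hL0 : IsProbabilityMeasure (omp L : Measure (ι → ℝ)))
  have h1 := H I Λ μ inferInstance ζ ν inferInstance (fun i => (S i).image lab) (fun i J => (S i).filter (lab · = J)) v c
    ρ W s hst hρ hW (by
      intro i J hJ; obtain ⟨l, hl, rfl⟩ := Finset.mem_image.1 hJ; exact hv i l hl) (by
      intro i J hJ l hl; obtain ⟨hl1, rfl⟩ := Finset.mem_filter.1 hl; exact htw i l hl1)
  have h2 := MM_interp hq hσ (μ := μ) (ζ := ζ) (ν.conv (omp L)) (fun i => (S i).image lab) (fun i J => (S i).filter (lab · = J))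
  have h3 := MM_le_NN hq (by omega) hst (ν.conv (omp L)) (fun i => (S i).image lab) (fun i J => (S i).filter (lab · = J)) B hB
  have h4 := AA_refine (κ := κ) hq hL0 (by omega) (μ := μ) (ζ := ζ) ν S lab lab' pr hpr col hsep
  have hs0 : s + 1 ≠ 0 := by omega
  calc AA q μ ζ ν S lab ≤ C0 ^ (s + 1) * ((AA q μ ζ (ν.conv (omp L)) S lab) ^ (1 / 2 : ℝ) * (B ^ q) ^ (1 / 2 : ℝ)) := by
        refine h1.trans ?_
        gcongr
        refine h2.trans ?_
        gcongr
        exact le_rfl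
    _ ≤ C0 ^ (s + 1) * (((N : ℝ≥0∞) ^ q * AA q μ ζ (ν.conv (omp L)) S lab') ^ (1 / 2 : ℝ) * (B ^ q) ^ (1 / 2 : ℝ)) := by
        gcongr
        refine h4.trans ?_
        gcongr
    _ = C0 ^ (s + 1) * d * (AA q μ ζ (ν.conv (omp L)) S lab') ^ (1 / 2 : ℝ) * (B ^ q) ^ (1 / 2 : ℝ) := by
        rw [ENNReal.mul_rpow_of_nonneg _ _ (by norm_num)]; ring
    _ ≤ _ := by
        gcongr
        rw [mul_pow]
        gcongr
        · exact le_max_right _ _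
        · exact (le_max_right 1 d).trans (le_self_pow (le_max_left _ _) hs0)

end DR

namespace DR
open scoped ENNReal NNReal
open scoped Classical

variable {ι : Type} [Fintype ι] {I : Type}

/-- Admissible configurations: frequencies near the paraboloid, labelled at scale `2^-m`. -/
structure Adm (d : ℕ) (B : ℝ) (m : ℕ) (ζ : I → Fin d ⊕ Unit → ℝ) (S : Finset I) (k : I → Fin d → ℤ) : Prop where
  k0 : ∀ l ∈ S, ∀ j, 0 ≤ k l j
  k1 : ∀ l ∈ S, ∀ j, k l j < 2 ^ m
  hη : ∀ l ∈ S, ∀ j, |2 ^ m * ζ l (Sum.inl j) - k l j| ≤ B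
  hτ : ∀ l ∈ S, 4 ^ m * |ζ l (Sum.inr ()) - ∑ j, ζ l (Sum.inl j) ^ 2| ≤ B

theorem Adm.mono {d : ℕ} {B : ℝ} {m : ℕ} {ζ : I → Fin d ⊕ Unit → ℝ} {S S' : Finset I} {k : I → Fin d → ℤ}
    (h : Adm d B m ζ S k) (hs : S' ⊆ S) : Adm d B m ζ S' k :=
  ⟨fun l hl => h.k0 l (hs hl), fun l hl => h.k1 l (hs hl), fun l hl => h.hη l (hs hl), fun l hl => h.hτ l (hs hl)⟩

/-- Fibre of a labelling. -/
def fib {Λ : Type*} (S : Finset I) (k : I → Λ) (J : Λ) : Finset I := S.filter (k · = J)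

theorem mem_fib {Λ : Type*} {S : Finset I} {k : I → Λ} {J : Λ} {l : I} : l ∈ fib S k J ↔ l ∈ S ∧ k l = J :=
  Finset.mem_filter

theorem fib_sub {Λ : Type*} {S : Finset I} {k : I → Λ} {J : Λ} : fib S k J ⊆ S := Finset.filter_subset _ _

/-- Image of a labelling. -/
def img {Λ : Type*} (S : Finset I) (k : I → Λ) : Finset Λ := S.image k

theorem mem_img {Λ : Type*} {S : Finset I} {k : I → Λ} {J : Λ} : J ∈ img S k ↔ ∃ l ∈ S, k l = J :=
  Finset.mem_image

/-- Sum of squared norms of pieces. -/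
def S2 {Λ : Type*} (q : ℝ) (μ : Measure (I → ℂ)) (S : Finset I) (k : I → Λ) : ℝ≥0∞ :=
  ∑ J ∈ img S k, NN q μ (fib S k J)

/-- Decoupling inequality with constant `D` at scale `2^-m`. -/
def DecB (d : ℕ) (q B : ℝ) (m : ℕ) (D : ℝ≥0∞) : Prop :=
  ∀ (I : Type) (μ : Measure (I → ℂ)) (_ : SFinite μ) (ζ : I → Fin d ⊕ Unit → ℝ) (S : Finset I) (k : I → Fin d → ℤ),
    Stat μ ζ → Adm d B m ζ S k → NN q μ S ≤ D * S2 q μ S k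

/-- Coarse labels. -/
def lab {d : ℕ} (m a : ℕ) (k : I → Fin d → ℤ) (l : I) : Fin d → ℤ := fun j => k l j / 2 ^ (m - a)

theorem lab_self {d : ℕ} (m : ℕ) (k : I → Fin d → ℤ) : lab m m k = k := by
  funext l j; simp [lab]

theorem lab_nest {d : ℕ} {m a a' : ℕ} (h1 : a ≤ a') (h2 : a' ≤ m) (k : I → Fin d → ℤ) (l : I) :
    lab m a k l = (fun J j => J j / 2 ^ (a' - a)) (lab m a' k l) := by
  funext j
  simp only [lab]
  rw [Int.ediv_ediv_of_nonneg (by positivity), ← pow_add]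
  congr 2; omega

theorem S2_fiber {Λ Λ' : Type*} (q : ℝ) (μ : Measure (I → ℂ)) (S : Finset I) (k : I → Λ) (f : Λ → Λ') (la : I → Λ')
    (hf : ∀ l, la l = f (k l)) :
    ∑ J ∈ img S la, S2 q μ (fib S la J) k = S2 q μ S k := by
  unfold S2
  rw [← Finset.sum_fiberwise_of_maps_to (s := img S k) (t := img S la) (g := f)]
  · refine Finset.sum_congr rfl fun J hJ => ?_
    have e1 : img (fib S la J) k = (img S k).filter (f · = J) := by
      ext J'; simp only [Finset.mem_filter, mem_img, mem_fib]
      constructor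
      · rintro ⟨l, ⟨h1, h2⟩, rfl⟩; exact ⟨⟨l, h1, rfl⟩, by rw [← hf, h2]⟩
      · rintro ⟨⟨l, h1, rfl⟩, h2⟩; exact ⟨l, ⟨h1, by rw [hf, h2]⟩, rfl⟩
    rw [e1]
    refine Finset.sum_congr rfl fun J' hJ' => ?_
    congr 1
    ext l; simp only [Finset.mem_filter, mem_fib] at hJ' ⊢
    constructor
    · rintro ⟨⟨h1, h2⟩, h3⟩; exact ⟨h1, h3⟩
    · rintro ⟨h1, rfl⟩; exact ⟨⟨h1, (hf l).trans hJ'.2⟩, rfl⟩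
  · intro J' hJ'
    simp only [mem_img] at hJ' ⊢
    obtain ⟨l, hl, rfl⟩ := hJ'
    exact ⟨l, hl, hf l⟩

theorem S2_le_of_fiber {Λ Λ' : Type*} (q : ℝ) (μ : Measure (I → ℂ)) (S : Finset I) (k : I → Λ) (f : Λ → Λ') (la : I → Λ')
    (hf : ∀ l, la l = f (k l)) (J : Λ') : S2 q μ (fib S la J) k ≤ S2 q μ S k := by
  by_cases hJ : J ∈ img S la
  · rw [← S2_fiber q μ S k f la hf]
    exact Finset.single_le_sum (f := fun J => S2 q μ (fib S la J) k) (fun _ _ => bot_le) hJ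
  · have : fib S la J = ∅ := by
      ext l; simp only [mem_fib, Finset.notMem_empty, iff_false, not_and]
      rintro h1 rfl; exact hJ (mem_img.2 ⟨l, h1, rfl⟩)
    rw [this]; simp [S2, img]

theorem S2_congr_inj {Λ Λ' : Type} (q : ℝ) (μ : Measure (I → ℂ)) (S : Finset I) (k : I → Λ) (k' : I → Λ')
    (h : ∀ l ∈ S, ∀ l' ∈ S, k l = k l' ↔ k' l = k' l') : S2 q μ S k = S2 q μ S k' := by
  unfold S2
  have key : ∀ {Λ : Type} (k : I → Λ), ∑ J ∈ img S k, NN q μ (fib S k J) =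
      ∑ T ∈ S.image (fun l => fib S k (k l)), NN q μ T := by
    intro Λ k
    have e : S.image (fun l => fib S k (k l)) = (img S k).image (fun J => fib S k J) := by
      unfold img; rw [Finset.image_image]; rfl
    rw [e]
    refine (Finset.sum_image ?_).symm
    intro J hJ J' hJ' he
    simp only [Finset.mem_coe, mem_img] at hJ hJ'
    obtain ⟨l, hl, rfl⟩ := hJ
    have : l ∈ fib S k (k l) := mem_fib.2 ⟨hl, rfl⟩
    change fib S k (k l) = fib S k J' at he
    rw [he] at this
    exact (mem_fib.1 this).2
  rw [key k, key k']
  congr 1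
  refine Finset.image_congr fun l hl => ?_
  ext l'
  simp only [mem_fib]
  exact and_congr_right fun h' => h l' h' l hl

theorem rescale {d : ℕ} {q B : ℝ} {m a : ℕ} (ha : a ≤ m) {D : ℝ≥0∞} (hD : DecB d q B (m - a) D)
    {μ : Measure (I → ℂ)} [SFinite μ] {ζ : I → Fin d ⊕ Unit → ℝ} {S : Finset I} {k : I → Fin d → ℤ}
    (hst : Stat μ ζ) (hA : Adm d B m ζ S k) (J : Fin d → ℤ) :
    NN q μ (fib S (lab m a k) J) ≤ D * S2 q μ (fib S (lab m a k) J) k := by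
  set S' := fib S (lab m a k) J with hS'
  have hA' : Adm d B m ζ S' k := hA.mono fib_sub
  have hJ : ∀ l ∈ S', ∀ j, k l j / 2 ^ (m - a) = J j := by
    intro l hl j
    exact congrFun (mem_fib.1 hl).2 j
  set k' : I → Fin d → ℤ := fun l j => k l j - 2 ^ (m - a) * J j with hk'
  set A : Fin d ⊕ Unit → Fin d ⊕ Unit → ℝ := fun i j => Sum.elim
    (fun i' => if j = Sum.inl i' then 2 ^ a else 0)
    (fun _ => Sum.elim (fun j' => - 2 * 2 ^ a * (J j' : ℝ)) (fun _ => 4 ^ a) j) i with hAdef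
  set w : Fin d ⊕ Unit → ℝ := Sum.elim (fun i' => - (J i' : ℝ)) (fun _ => ∑ j, (J j : ℝ) ^ 2) with hw
  have hst' := hst.affine A w
  set ζ' : I → Fin d ⊕ Unit → ℝ := fun l j => ph (A j) (ζ l) + w j with hζ'
  have z1 : ∀ l j, ζ' l (Sum.inl j) = 2 ^ a * ζ l (Sum.inl j) - J j := by
    intro l j
    simp [hζ', hAdef, hw, ph, sub_eq_add_neg]
  have z2 : ∀ l, ζ' l (Sum.inr ()) = 4 ^ a * ζ l (Sum.inr ()) - 2 * 2 ^ a * ∑ j, J j * ζ l (Sum.inl j) + ∑ j, (J j : ℝ) ^ 2 := by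
    intro l
    simp [hζ', hAdef, hw, ph, Finset.mul_sum, Finset.sum_neg_distrib]
    have : ∑ x, 2 * 2 ^ a * (J x : ℝ) * ζ l (Sum.inl x) = ∑ i, 2 * 2 ^ a * ((J i : ℝ) * ζ l (Sum.inl i)) :=
      Finset.sum_congr rfl fun j _ => by ring
    rw [this]; ring
  have hpw : (2:ℝ) ^ (m - a) * 2 ^ a = 2 ^ m := by rw [← pow_add]; congr 1; omega
  have hpw4 : (4:ℝ) ^ (m - a) * 4 ^ a = 4 ^ m := by rw [← pow_add]; congr 1; omega
  have h24 : ((2:ℝ) ^ a) ^ 2 = 4 ^ a := by rw [← pow_mul, mul_comm, pow_mul]; norm_num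
  have adm : Adm d B (m - a) ζ' S' k' := by
    refine ⟨?_, ?_, ?_, ?_⟩
    · intro l hl j
      have := Int.ediv_mul_le (k l j) (b := 2 ^ (m - a)) (by positivity)
      rw [hJ l hl j] at this
      simp only [hk']; linarith
    · intro l hl j
      have := Int.lt_ediv_add_one_mul_self (k l j) (b := 2 ^ (m - a)) (by positivity)
      rw [hJ l hl j] at this
      simp only [hk']; linarith
    · intro l hl j
      rw [z1]
      convert hA'.hη l hl j using 2
      simp only [hk']; push_cast; rw [← hpw]; ring
    · intro l hl
      have := hA'.hτ l hl
      rw [← hpw4, mul_assoc] at this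
      convert this using 2
      rw [← abs_of_pos (show (0:ℝ) < 4 ^ a by positivity), ← abs_mul, z2]
      congr 1
      simp_rw [z1, sub_sq, mul_pow, h24]
      rw [Finset.sum_add_distrib, Finset.sum_sub_distrib, mul_sub, Finset.mul_sum, Finset.mul_sum]
      have : ∑ i, 2 * 2 ^ a * ((J i : ℝ) * ζ l (Sum.inl i)) = ∑ x, 2 * (2 ^ a * ζ l (Sum.inl x)) * (J x : ℝ) :=
        Finset.sum_congr rfl fun j _ => by ring
      rw [this]; ring
  refine (hD I μ inferInstance ζ' S' k' hst' adm).trans (le_of_eq ?_)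
  congr 1
  refine S2_congr_inj q μ S' k' k fun l hl l' hl' => ?_
  simp only [hk', funext_iff]
  exact forall_congr' fun j => by constructor <;> intro h <;> linarith

theorem rescale_sum {d : ℕ} {q B : ℝ} {m a : ℕ} (ha : a ≤ m) {D : ℝ≥0∞} (hD : DecB d q B (m - a) D)
    {μ : Measure (I → ℂ)} [SFinite μ] {ζ : I → Fin d ⊕ Unit → ℝ} {S : Finset I} {k : I → Fin d → ℤ}
    (hst : Stat μ ζ) (hA : Adm d B m ζ S k) :
    S2 q μ S (lab m a k) ≤ D * S2 q μ S k := by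
  have hf := lab_nest ha le_rfl k
  simp_rw [lab_self] at hf
  rw [← S2_fiber q μ S k (fun J j => J j / 2 ^ (m - a)) (lab m a k) hf, Finset.mul_sum]
  exact Finset.sum_le_sum fun J _ => rescale ha hD hst hA J

end DR

namespace DR
open scoped ENNReal NNReal
open scoped Classical

variable {ι : Type} [Fintype ι] {I : Type}

theorem AA_le_NN {Λ : Type} {q : ℝ} (hq : 1 ≤ q) (hn : 1 ≤ Fintype.card ι) {μ : Measure (I → ℂ)} [SFinite μ]
    {ζ : I → ι → ℝ} (hst : Stat μ ζ) (ν : Measure (ι → ℝ)) [IsProbabilityMeasure ν] (S : ι → Finset I) (la : I → Λ)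
    (B : ℝ≥0∞) (hB : ∀ i, S2 q μ (S i) la ≤ B) :
    AA q μ ζ ν S la ≤ B ^ q := by
  refine le_trans ?_ (MM_le_NN hq hn hst ν (fun i => (S i).image la) (fun i J => (S i).filter (la · = J)) B hB)
  unfold AA MM
  have hκ : 0 ≤ q / (Fintype.card ι : ℝ) := by positivity
  refine lintegral_mono fun u => Finset.prod_le_prod' fun i _ => ?_
  gcongr with J hJ
  have := jensen_le ν hq (measurable_gg_right ζ ((S i).filter (la · = J)) u)
  simpa [gi] using this

theorem two_rpow_add (x y : ℝ) : (2:ℝ≥0∞) ^ (x + y) = 2 ^ x * 2 ^ y :=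
  ENNReal.rpow_add _ _ (by simp) (by simp)

theorem two_rpow_mono {x y : ℝ} (h : x ≤ y) : (2:ℝ≥0∞) ^ x ≤ 2 ^ y :=
  ENNReal.rpow_le_rpow_of_exponent_le (by norm_num) h

theorem two_rpow_ne_top (x : ℝ) : (2:ℝ≥0∞) ^ x ≠ ⊤ := by
  simp [ENNReal.rpow_eq_top_iff]

theorem mult_iter (hn : 2 ≤ Fintype.card ι) {q : ℝ} (hq : 1 ≤ q)
    (hqn : (q + 1) * ((Fintype.card ι : ℝ) - 1) ≤ 2 * (Fintype.card ι : ℝ)) {C1 : ℝ} (hC1 : 0 < C1) (N : ℕ) :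
    ∃ C : ℝ≥0∞, C ≠ ⊤ ∧ 1 ≤ C ∧ ∀ (I κ : Type) (_ : Fintype κ) (μ : Measure (I → ℂ)) (_ : SFinite μ) (ζ : I → ι → ℝ)
      (S : ι → Finset I) (d m : ℕ) (k : I → Fin d → ℤ) (b k2 : ℕ) (col : (Fin d → ℤ) → κ)
      (v c : ℕ → ι → (Fin d → ℤ) → ι → ℝ) (G : ℝ≥0∞) (η : ℝ), 0 < b →
      Fintype.card κ ≤ N → Stat μ ζ →
      (∀ a, k2 ≤ a → a ≤ m → ∀ i, ∀ l ∈ S i, v a i (lab m a k l) i = 0 ∧ ∀ j, |v a i (lab m a k l) j| ≤ 1 / 2 ^ b) →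
      (∀ a, k2 ≤ a → a ≤ m → ∀ i, ∀ l ∈ S i, ∀ j, |tw i (v a i (lab m a k l)) (ζ l - c a i (lab m a k l)) j|
        ≤ C1 / rad i (4 ^ a) (2 ^ a) j) →
      (∀ a, a ≤ m → ∀ i, ∀ l ∈ S i, ∀ l' ∈ S i, lab m a k l ≠ lab m a k l' → col (lab m a k l) = col (lab m a k l') →
        ∃ j, 1 / 2 ^ a ≤ |ζ l j - ζ l' j|) →
      (∀ a, a ≤ m → ∀ i, S2 q μ (S i) (lab m a k) ≤ G * 2 ^ (η * ((m : ℝ) - a))) →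
      ∀ (M s : ℕ) (ν : Measure (ι → ℝ)) (_ : IsProbabilityMeasure ν), k2 ≤ b * s → 2 ^ M * (b * s) ≤ m →
      AA q μ ζ ν S (lab m (b * s) k) ≤ C ^ (M * s + 2) * (G ^ q * 2 ^ (q * η * ((m : ℝ) - (b * s) * (1 + M / 2)))) := by
  obtain ⟨C, hC, hC1', H⟩ := onestep (ι := ι) hn hq hqn hC1 N
  refine ⟨C, hC, hC1', ?_⟩
  intro I κ _ μ _ ζ S d m k b k2 col v c G η hb hN hst H1 H2 H3 H4 M
  have hq0 : 0 ≤ q := by linarith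
  induction M with
  | zero =>
    intro s ν _ hk2 hm
    have ham : b * s ≤ m := by simpa using hm
    have := AA_le_NN hq (by omega) hst ν S (lab m (b * s) k) _ (H4 _ ham)
    refine this.trans ?_
    rw [ENNReal.mul_rpow_of_nonneg _ _ hq0, ← ENNReal.rpow_mul]
    calc G ^ q * 2 ^ (η * ((m:ℝ) - (b * s : ℕ)) * q) = 1 * (G ^ q * 2 ^ (q * η * ((m : ℝ) - (b * s) * (1 + (0:ℕ) / 2)))) := by
          rw [one_mul]; push_cast; congr 2; ring
      _ ≤ _ := by
          gcongr
          exact one_le_pow₀ hC1'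
  | succ M ih =>
    intro s ν _ hk2 hm
    have hm' : 2 ^ M * (b * (2 * s)) ≤ m := by rw [pow_succ] at hm; linarith
    have ham2 : b * (2 * s) ≤ m := le_trans (Nat.le_mul_of_pos_left _ (by positivity)) hm'
    have ham : b * s ≤ m := le_trans (by nlinarith) ham2
    have hWρ : ((2:ℝ) ^ b) ^ s * 2 ^ (b * s) = 4 ^ (b * s) := by
      rw [← pow_mul, ← mul_pow]; norm_num
    have hWρ' : ((2:ℝ) ^ b) ^ s * 2 ^ (b * s) = 2 ^ (b * (2 * s)) := by
      rw [← pow_mul, ← pow_add]; congr 1; ring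
    have hst1 := H I (Fin d → ℤ) (Fin d → ℤ) κ inferInstance μ inferInstance ζ ν inferInstance S
      (lab m (b * s) k) (lab m (b * (2 * s)) k) (fun J j => J j / 2 ^ (b * (2 * s) - b * s)) col
      (v (b * s)) (c (b * s)) (2 ^ (b * s)) (2 ^ b) s (G * 2 ^ (η * ((m : ℝ) - (b * s : ℕ)))) hN hst (by positivity)
      (one_le_pow₀ (by norm_num)) (H1 _ hk2 ham) (by rw [hWρ]; exact H2 _ hk2 ham)
      (lab_nest (by nlinarith) ham2 k) (by
        intro i l hl l' hl' _ h1 h2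
        rw [hWρ']
        exact H3 _ ham2 i l hl l' hl' h1 h2) (H4 _ ham)
    have hL0 : (0:ℝ) < ((2:ℝ) ^ b) ^ s * 2 ^ (b * s) := by positivity
    have := (omp_prob hL0 : IsProbabilityMeasure (omp _ : Measure (ι → ℝ)))
    have ih' := ih (2 * s) (ν.conv (omp (((2:ℝ) ^ b) ^ s * 2 ^ (b * s)))) inferInstance (by nlinarith) hm'
    refine hst1.trans ?_
    calc _ ≤ C ^ (s + 1) * (C ^ (M * (2 * s) + 2) * (G ^ q * 2 ^ (q * η * ((m : ℝ) - (b * (2 * s : ℕ)) * (1 + M / 2))))) ^ (1 / 2 : ℝ)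
          * ((G * 2 ^ (η * ((m : ℝ) - (b * s : ℕ)))) ^ q) ^ (1 / 2 : ℝ) := by gcongr
      _ = C ^ (s + 1) * C ^ (M * s + 1) * ((G ^ q) ^ (1 / 2 : ℝ) * (G ^ q) ^ (1 / 2 : ℝ)) *
          (2 ^ (q * η * ((m : ℝ) - (b * (2 * s : ℕ)) * (1 + M / 2)) * (1 / 2)) * 2 ^ (η * ((m : ℝ) - (b * s : ℕ)) * q * (1 / 2))) := by
          rw [ENNReal.mul_rpow_of_nonneg _ _ (by norm_num), ENNReal.mul_rpow_of_nonneg _ _ (by norm_num),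
            ENNReal.mul_rpow_of_nonneg _ _ hq0, ENNReal.mul_rpow_of_nonneg _ _ (by norm_num)]
          rw [show M * (2 * s) + 2 = (M * s + 1) * 2 by ring, pow_mul, ← ENNReal.rpow_natCast (C ^ (M * s + 1)), ← ENNReal.rpow_mul]
          rw [← ENNReal.rpow_mul 2, ← ENNReal.rpow_mul 2, ← ENNReal.rpow_mul 2]
          norm_num
          ring
      _ = _ := by
          rw [← pow_add, ← ENNReal.rpow_add_of_nonneg _ _ (by norm_num) (by norm_num), ← two_rpow_add, mul_assoc]
          norm_num
          congr 2
          · ring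
          · congr 1
            ring

end DR

namespace DR
open scoped ENNReal NNReal
open scoped Classical

variable {ι : Type} [Fintype ι] {I : Type}

/-- Quantitative linear independence. -/
def TR (Θ : ℝ) (b : ι → ι → ℝ) : Prop := ∀ u : ι → ℝ, ∀ i, |u i| ≤ Θ * ‖∑ i', u i' • b i'‖

theorem TR.exists_inv {Θ : ℝ} {b : ι → ι → ℝ} (h : TR Θ b) :
    ∃ R : (ι → ℝ) → (ι → ℝ), Measurable R ∧ (∀ w, ∑ i, R w i • b i = w) ∧ ∀ w i, |R w i| ≤ Θ * ‖w‖ := by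
  set f : (ι → ℝ) →ₗ[ℝ] (ι → ℝ) := Fintype.linearCombination ℝ b with hf
  have hfa : ∀ u, f u = ∑ i, u i • b i := fun u => by simp [hf, Fintype.linearCombination_apply]
  have hinj : Function.Injective f := by
    rw [← LinearMap.ker_eq_bot, LinearMap.ker_eq_bot']
    intro u hu
    rw [hfa] at hu
    funext i
    have := h u i
    rw [hu, norm_zero, mul_zero] at this
    exact abs_eq_zero.1 (le_antisymm this (abs_nonneg _))
  set e := LinearEquiv.ofInjectiveEndo f hinj with he
  have hR : ∀ w, ∑ i, e.symm w i • b i = w := by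
    intro w
    rw [← hfa]
    exact e.apply_symm_apply w
  refine ⟨fun w => e.symm w, ?_, hR, fun w i => ?_⟩
  · exact (LinearMap.continuous_of_finiteDimensional (e.symm : (ι → ℝ) →ₗ[ℝ] (ι → ℝ))).measurable
  · have := h (e.symm w) i
    rwa [hR] at this

theorem ph_sum_smul {b : ι → ι → ℝ} (u ζ : ι → ℝ) : ph (∑ i, u i • b i) ζ = ∑ i, u i * ph (b i) ζ := by
  unfold ph
  simp only [Finset.sum_apply, Pi.smul_apply, smul_eq_mul, Finset.sum_mul, Finset.mul_sum]
  rw [Finset.sum_comm]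
  simp only [mul_assoc]

theorem abs_ph_le (b ζ : ι → ℝ) {x y : ℝ} (hx : 0 ≤ x) (hb : ∀ j, |b j| ≤ x) (hζ : ∀ j, |ζ j| ≤ y) :
    |ph b ζ| ≤ Fintype.card ι * (x * y) := by
  unfold ph
  refine (Finset.abs_sum_le_sum_abs _ _).trans ?_
  calc ∑ i, |b i * ζ i| ≤ ∑ i : ι, x * y := Finset.sum_le_sum fun i _ => by
        rw [abs_mul]; exact mul_le_mul (hb i) (hζ i) (abs_nonneg _) hx
    _ = _ := by simp

/-- Tube direction attached to a point of the base. -/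
def bvec {d : ℕ} (c : Fin d → ℝ) : Fin d ⊕ Unit → ℝ := Sum.elim (fun j => -2 * c j) (fun _ => 1)

/-- Corner of a dyadic cube. -/
def cen {d : ℕ} (a : ℕ) (J : Fin d → ℤ) : Fin d → ℝ := fun j => J j / 2 ^ a

/-- Lift to the paraboloid. -/
def lft {d : ℕ} (c : Fin d → ℝ) : Fin d ⊕ Unit → ℝ := Sum.elim c (fun _ => ∑ j, c j ^ 2)

theorem Adm.near {d : ℕ} {B : ℝ} {m : ℕ} {ζ : I → Fin d ⊕ Unit → ℝ} {S : Finset I} {k : I → Fin d → ℤ}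
    (h : Adm d B m ζ S k) (hB : 0 ≤ B) {a : ℕ} (ha : a ≤ m) {l : I} (hl : l ∈ S) (j : Fin d) :
    |ζ l (Sum.inl j) - cen a (lab m a k l) j| ≤ (B + 1) / 2 ^ a := by
  have h1 := h.hη l hl j
  have h2 := Int.ediv_mul_le (k l j) (b := 2 ^ (m - a)) (by positivity)
  have h3 := Int.lt_ediv_add_one_mul_self (k l j) (b := 2 ^ (m - a)) (by positivity)
  have h2' : ((k l j / 2 ^ (m - a) : ℤ) : ℝ) * 2 ^ (m - a) ≤ k l j := by exact_mod_cast h2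
  have h3' : (k l j : ℝ) < (((k l j / 2 ^ (m - a) : ℤ) : ℝ) + 1) * 2 ^ (m - a) := by exact_mod_cast h3
  have hpw : (2:ℝ) ^ (m - a) * 2 ^ a = 2 ^ m := by rw [← pow_add]; congr 1; omega
  have hp1 : (1:ℝ) ≤ 2 ^ (m - a) := one_le_pow₀ (by norm_num)
  have hpa : (0:ℝ) < 2 ^ a := by positivity
  unfold cen lab
  set z := ζ l (Sum.inl j)
  set J : ℝ := ((k l j / 2 ^ (m - a) : ℤ) : ℝ)
  set P : ℝ := 2 ^ (m - a)
  rw [← hpw] at h1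
  have h4 : |P * (2 ^ a * z - J)| ≤ P * (B + 1) := by
    rw [abs_le] at h1 ⊢
    constructor <;> nlinarith
  rw [abs_mul, abs_of_pos (by positivity : 0 < P)] at h4
  have h5 := le_of_mul_le_mul_left h4 (by positivity)
  rw [le_div_iff₀ hpa, ← abs_of_pos hpa, ← abs_mul, abs_of_pos hpa]
  convert h5 using 2
  field_simp

theorem Adm.cen_mem {d : ℕ} {B : ℝ} {m : ℕ} {ζ : I → Fin d ⊕ Unit → ℝ} {S : Finset I} {k : I → Fin d → ℤ}
    (h : Adm d B m ζ S k) {a : ℕ} (ha : a ≤ m) {l : I} (hl : l ∈ S) (j : Fin d) :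
    0 ≤ lab m a k l j ∧ lab m a k l j < 2 ^ a := by
  unfold lab
  refine ⟨Int.ediv_nonneg (h.k0 l hl j) (by positivity), ?_⟩
  rw [Int.ediv_lt_iff_lt_mul (by positivity), ← pow_add]
  convert h.k1 l hl j using 2; omega

theorem cen_abs {d : ℕ} {a : ℕ} {J : Fin d → ℤ} {j : Fin d} (h : 0 ≤ J j ∧ J j < 2 ^ a) : |cen a J j| ≤ 1 := by
  unfold cen
  have h0 : (0:ℝ) ≤ J j := by exact_mod_cast h.1
  have h1 : (J j : ℝ) ≤ 2 ^ a := by exact_mod_cast h.2.le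
  rw [abs_of_nonneg (by positivity)]
  exact div_le_one_of_le₀ h1 (by positivity)

theorem Adm.tau_near {d : ℕ} {B : ℝ} {m : ℕ} {ζ : I → Fin d ⊕ Unit → ℝ} {S : Finset I} {k : I → Fin d → ℤ}
    (h : Adm d B m ζ S k) (hB : 0 ≤ B) {a : ℕ} (ha : a ≤ m) {l : I} (hl : l ∈ S) :
    |ζ l (Sum.inr ()) - ∑ j, ζ l (Sum.inl j) ^ 2| ≤ B / 4 ^ a := by
  have := h.hτ l hl
  rw [le_div_iff₀ (by positivity), mul_comm]
  refine le_trans ?_ this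
  gcongr
  norm_num

theorem Adm.tube {d : ℕ} {B : ℝ} {m : ℕ} {ζ : I → Fin d ⊕ Unit → ℝ} {S : Finset I} {k : I → Fin d → ℤ}
    (h : Adm d B m ζ S k) (hB : 0 ≤ B) {a : ℕ} (ha : a ≤ m) {l : I} (hl : l ∈ S) :
    |ph (bvec (cen a (lab m a k l))) (ζ l - lft (cen a (lab m a k l)))| ≤ (d * (B + 1) ^ 2 + B) / 4 ^ a := by
  have h1 := h.tau_near hB ha hl
  have h2 := fun j => h.near hB ha hl j
  set c := cen a (lab m a k l) with hc
  have e1 : ph (bvec c) (ζ l - lft c) = (ζ l (Sum.inr ()) - ∑ j, ζ l (Sum.inl j) ^ 2) + ∑ j, (ζ l (Sum.inl j) - c j) ^ 2 := by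
    simp only [ph, bvec, lft, Fintype.sum_sum_type, Sum.elim_inl, Sum.elim_inr, Pi.sub_apply, Finset.univ_unique, Finset.sum_singleton, one_mul]
    have : ∑ j, (ζ l (Sum.inl j) - c j) ^ 2 = ∑ j, ζ l (Sum.inl j) ^ 2 + ∑ j, -2 * c j * (ζ l (Sum.inl j) - c j) - ∑ j, c j ^ 2 := by
      rw [← Finset.sum_add_distrib, ← Finset.sum_sub_distrib]
      exact Finset.sum_congr rfl fun j _ => by ring
    rw [this]
    ring
  rw [e1, add_div, add_comm]
  refine (abs_add_le _ _).trans (add_le_add ?_ h1)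
  rw [abs_of_nonneg (by positivity)]
  calc ∑ j, (ζ l (Sum.inl j) - c j) ^ 2 ≤ ∑ j : Fin d, ((B + 1) / 2 ^ a) ^ 2 := by
        refine Finset.sum_le_sum fun j _ => ?_
        exact sq_le_sq' (by linarith [(abs_le.1 (h2 j)).1]) (abs_le.1 (h2 j)).2
    _ = _ := by
        have h24 : ((2:ℝ) ^ a) ^ 2 = 4 ^ a := by rw [← pow_mul, mul_comm, pow_mul]; norm_num
        rw [Finset.sum_const, Finset.card_univ, Fintype.card_fin, nsmul_eq_mul, div_pow, h24]; ring

theorem Adm.full_near {d : ℕ} {B : ℝ} {m : ℕ} {ζ : I → Fin d ⊕ Unit → ℝ} {S : Finset I} {k : I → Fin d → ℤ}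
    (h : Adm d B m ζ S k) (hB : 0 ≤ B) {a : ℕ} (ha : a ≤ m) {l : I} (hl : l ∈ S) (j : Fin d ⊕ Unit) :
    |(ζ l - lft (cen a (lab m a k l))) j| ≤ (2 * B + 1 + d * (B + 1) * (B + 3)) / 2 ^ a := by
  have h1 := h.tau_near hB ha hl
  have h2 := fun j => h.near hB ha hl j
  have h3 := fun j => cen_abs (h.cen_mem ha hl j)
  set c := cen a (lab m a k l) with hc
  have hpa : (1:ℝ) ≤ 2 ^ a := one_le_pow₀ (by norm_num)
  rcases j with j | ⟨⟩
  · refine (h2 j).trans (div_le_div_of_nonneg_right ?_ (by positivity))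
    have : 0 ≤ d * (B + 1) * (B + 3) := by positivity
    linarith
  · simp only [lft, Pi.sub_apply, Sum.elim_inr]
    have e1 : ζ l (Sum.inr ()) - ∑ j, c j ^ 2 = (ζ l (Sum.inr ()) - ∑ j, ζ l (Sum.inl j) ^ 2) +
        ∑ j, (ζ l (Sum.inl j) - c j) * (ζ l (Sum.inl j) - c j + 2 * c j) := by
      have : ∑ j, (ζ l (Sum.inl j) - c j) * (ζ l (Sum.inl j) - c j + 2 * c j) = ∑ j, ζ l (Sum.inl j) ^ 2 - ∑ j, c j ^ 2 := by
        rw [← Finset.sum_sub_distrib]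
        exact Finset.sum_congr rfl fun j _ => by ring
      rw [this]; ring
    rw [e1, add_div]
    refine (abs_add_le _ _).trans (add_le_add ?_ ?_)
    · refine h1.trans ?_
      calc B / 4 ^ a ≤ B / 2 ^ a := by gcongr; norm_num
        _ ≤ _ := by gcongr; linarith
    · refine (Finset.abs_sum_le_sum_abs _ _).trans ?_
      calc ∑ j, |(ζ l (Sum.inl j) - c j) * (ζ l (Sum.inl j) - c j + 2 * c j)| ≤ ∑ j : Fin d, (B + 1) / 2 ^ a * (B + 3) := by
            refine Finset.sum_le_sum fun j _ => ?_
            rw [abs_mul]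
            refine mul_le_mul (h2 j) ?_ (abs_nonneg _) (by positivity)
            refine (abs_add_le _ _).trans ?_
            have : (B + 1) / 2 ^ a ≤ B + 1 := div_le_self (by linarith) hpa
            rw [abs_mul, abs_two]
            linarith [h2 j, h3 j]
        _ = _ := by simp; ring

theorem bvec_abs {d : ℕ} {c : Fin d → ℝ} (h : ∀ j, |c j| ≤ 1) (j : Fin d ⊕ Unit) : |bvec c j| ≤ 2 := by
  rcases j with j | ⟨⟩
  · simp only [bvec, Sum.elim_inl]; rw [abs_mul]; norm_num; linarith [h j]
  · simp [bvec]

/-- Geometric verification of the hypotheses of the multilinear iteration. -/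
theorem geom_v {d : ℕ} {B Θ : ℝ} (hB : 0 ≤ B) {m k2 b : ℕ} (hk2b : 4 * Θ * 2 ^ b ≤ 2 ^ k2) (hΘ : 0 ≤ Θ)
    {ζ : I → Fin d ⊕ Unit → ℝ} {S : Finset I} {k : I → Fin d → ℤ}
    (h : Adm d B m ζ S k) {α : Fin d ⊕ Unit → Fin d → ℤ} (hα : ∀ i j, 0 ≤ α i j ∧ α i j < 2 ^ k2)
    (hTR : TR Θ (fun i => bvec (cen k2 (α i)))) :
    ∃ v c : ℕ → (Fin d ⊕ Unit) → (Fin d → ℤ) → (Fin d ⊕ Unit) → ℝ,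
    (∀ a, k2 ≤ a → a ≤ m → ∀ i, ∀ l ∈ fib S (lab m k2 k) (α i), v a i (lab m a k l) i = 0 ∧
      ∀ j, |v a i (lab m a k l) j| ≤ 1 / 2 ^ b) ∧
    (∀ a, k2 ≤ a → a ≤ m → ∀ i, ∀ l ∈ fib S (lab m k2 k) (α i), ∀ j,
      |tw i (v a i (lab m a k l)) ((fun j => ph (bvec (cen k2 (α j))) (ζ l)) - c a i (lab m a k l)) j|
        ≤ (2 * (d + 1) * (2 * B + 1 + d * (B + 1) * (B + 3)) + 2 * (d * (B + 1) ^ 2 + B) + 1) / rad i (4 ^ a) (2 ^ a) j) := by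
  obtain ⟨R, hRm, hR, hRb⟩ := hTR.exists_inv
  set w : ℕ → (Fin d ⊕ Unit) → (Fin d → ℤ) → (Fin d ⊕ Unit) → ℝ := fun a i J =>
    R (bvec (cen a J) - bvec (cen k2 (α i))) with hw
  set v : ℕ → (Fin d ⊕ Unit) → (Fin d → ℤ) → (Fin d ⊕ Unit) → ℝ := fun a i J i' =>
    if i' = i then 0 else w a i J i' / (1 + w a i J i) with hv
  have hwb : ∀ a, k2 ≤ a → a ≤ m → ∀ i, ∀ l ∈ fib S (lab m k2 k) (α i), ∀ j,
      |w a i (lab m a k l) j| ≤ 1 / (2 * 2 ^ b) := by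
    intro a h1 h2 i l hl j
    obtain ⟨hlS, hlα⟩ := mem_fib.1 hl
    have hn : ‖bvec (cen a (lab m a k l)) - bvec (cen k2 (α i))‖ ≤ 2 / 2 ^ k2 := by
      rw [pi_norm_le_iff_of_nonneg (by positivity)]
      rintro (j | ⟨⟩)
      · have hj := congrFun (lab_nest h1 h2 k l) j
        rw [hlα] at hj
        simp only at hj
        set J := lab m a k l j with hJ
        have q1 := Int.ediv_mul_le J (b := 2 ^ (a - k2)) (by positivity)
        have q2 := Int.lt_ediv_add_one_mul_self J (b := 2 ^ (a - k2)) (by positivity)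
        rw [← hj] at q1 q2
        have q1' : (α i j : ℝ) * 2 ^ (a - k2) ≤ J := by exact_mod_cast q1
        have q2' : (J : ℝ) < ((α i j : ℝ) + 1) * 2 ^ (a - k2) := by exact_mod_cast q2
        have hpw : (2:ℝ) ^ (a - k2) * 2 ^ k2 = 2 ^ a := by rw [← pow_add]; congr 1; omega
        simp only [bvec, cen, Pi.sub_apply, Sum.elim_inl, Real.norm_eq_abs]
        rw [← hJ, ← hpw, abs_le]
        have hP : (0:ℝ) < 2 ^ (a - k2) := by positivity
        have hQ : (0:ℝ) < 2 ^ k2 := by positivity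
        constructor
        · field_simp; nlinarith
        · field_simp; nlinarith
      · simp [bvec]; positivity
    refine (hRb _ j).trans ?_
    calc Θ * ‖bvec (cen a (lab m a k l)) - bvec (cen k2 (α i))‖ ≤ Θ * (2 / 2 ^ k2) := by gcongr
      _ ≤ _ := by
        rw [mul_div_assoc', div_le_div_iff₀ (by positivity) (by positivity)]
        linarith
  have hpb : (1:ℝ) ≤ 2 ^ b := one_le_pow₀ (by norm_num)
  have h12 : 1 / (2 * 2 ^ b) ≤ (1/2 : ℝ) := by
    rw [div_le_div_iff₀ (by positivity) (by positivity)]; linarith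
  refine ⟨v, fun a i J j => ph (bvec (cen k2 (α j))) (lft (cen a J)), ?_, ?_⟩
  · intro a h1 h2 i l hl
    refine ⟨by simp [hv], fun j => ?_⟩
    by_cases hj : j = i
    · simp [hv, hj]
    · simp only [hv, if_neg hj]
      have w1 := hwb a h1 h2 i l hl j
      have w2 := abs_le.1 ((hwb a h1 h2 i l hl i).trans h12)
      have hpos : (1/2:ℝ) ≤ 1 + w a i (lab m a k l) i := by linarith
      rw [abs_div, abs_of_pos (by linarith : 0 < 1 + w a i (lab m a k l) i), div_le_iff₀ (by linarith)]
      calc _ ≤ _ := w1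
        _ = 1 / 2 ^ b * (1 / 2) := by field_simp
        _ ≤ _ := by gcongr
  · intro a h1 h2 i l hl j
    obtain ⟨hlS, hlα⟩ := mem_fib.1 hl
    have w2 := abs_le.1 ((hwb a h1 h2 i l hl i).trans h12)
    have hpos : (1/2:ℝ) ≤ 1 + w a i (lab m a k l) i := by linarith
    have ed : ((fun j => ph (bvec (cen k2 (α j))) (ζ l)) - fun j => ph (bvec (cen k2 (α j))) (lft (cen a (lab m a k l))))
        = fun j => ph (bvec (cen k2 (α j))) (ζ l - lft (cen a (lab m a k l))) := by
      funext j; simp [ph_sub_right]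
    rw [ed]
    set Δ := ζ l - lft (cen a (lab m a k l)) with hΔ
    have nn1 : 0 ≤ (2 * B + 1 + d * (B + 1) * (B + 3)) := by positivity
    have nn2 : 0 ≤ (d * (B + 1) ^ 2 + B) := by positivity
    by_cases hj : j = i
    · subst hj
      simp only [tw, if_true, rad]
      have e2 : ph (bvec (cen a (lab m a k l))) Δ = ∑ i', ((if i' = j then 1 else 0) + w a j (lab m a k l) i') * ph (bvec (cen k2 (α i'))) Δ := by
        rw [← ph_sum_smul]
        congr 1
        have := hR (bvec (cen a (lab m a k l)) - bvec (cen k2 (α j)))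
        simp only [add_smul, Finset.sum_add_distrib, ite_smul, one_smul, zero_smul, Finset.sum_ite_eq', Finset.mem_univ, if_true]
        simp only [hw]
        rw [this]; abel
      have e3 : ph (bvec (cen k2 (α j))) Δ + ph (fun j => ph (bvec (cen k2 (α j))) Δ) (v a j (lab m a k l)) =
          ph (bvec (cen a (lab m a k l))) Δ / (1 + w a j (lab m a k l) j) := by
        rw [eq_div_iff (by linarith), e2, ← Finset.add_sum_erase _ _ (Finset.mem_univ j)]
        have hph : ph (fun j => ph (bvec (cen k2 (α j))) Δ) (v a j (lab m a k l)) =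
          ∑ i', ph (bvec (cen k2 (α i'))) Δ * v a j (lab m a k l) i' := rfl
        rw [hph, ← Finset.add_sum_erase _ _ (Finset.mem_univ j)]
        simp only [hv, if_true, mul_zero, zero_add]
        rw [add_mul, Finset.sum_mul, mul_comm]
        congr 1
        refine Finset.sum_congr rfl fun i' hi' => ?_
        have : i' ≠ j := Finset.ne_of_mem_erase hi'
        simp only [if_neg this]
        have : 1 + w a j (lab m a k l) j ≠ 0 := by linarith
        field_simp
        ring
      rw [e3, abs_div, abs_of_pos (by linarith : 0 < 1 + w a j (lab m a k l) j), div_le_iff₀ (by linarith)]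
      calc _ ≤ (d * (B + 1) ^ 2 + B) / 4 ^ a := h.tube hB h2 hlS
        _ = (2 * (d * (B + 1) ^ 2 + B)) / 4 ^ a * (1/2) := by ring
        _ ≤ _ := by
            gcongr
            have : 0 ≤ 2 * ((d:ℝ) + 1) * (2 * B + 1 + d * (B + 1) * (B + 3)) := by positivity
            linarith
    · simp only [tw, if_neg hj, rad, add_zero]
      have := abs_ph_le (bvec (cen k2 (α j))) Δ (x := 2) (by norm_num) (bvec_abs fun j' => cen_abs (hα j j')) (h.full_near hB h2 hlS)
      refine this.trans ?_
      simp only [Fintype.card_sum, Fintype.card_fin, Fintype.card_unit]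
      push_cast
      calc _ = (2 * (d + 1) * (2 * B + 1 + d * (B + 1) * (B + 3))) / 2 ^ a := by ring
        _ ≤ _ := by gcongr; linarith

theorem geom_sep {d : ℕ} {B Θ : ℝ} (hB : 0 ≤ B) {m k2 N0 : ℕ} (hN0 : 2 * (B + 1) + (d + 1) * Θ < N0) (hΘ : 0 ≤ Θ)
    (hN0p : 0 < N0)
    {ζ : I → Fin d ⊕ Unit → ℝ} {S : Finset I} {k : I → Fin d → ℤ}
    (h : Adm d B m ζ S k) {b : Fin d ⊕ Unit → Fin d ⊕ Unit → ℝ} (hTR : TR Θ b)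
    {a : ℕ} (ha : a ≤ m) {l l' : I} (hl : l ∈ S) (hl' : l' ∈ S) (hne : lab m a k l ≠ lab m a k l')
    (hcol : ∀ j, ((lab m a k l j : ℤ) : ZMod N0) = (lab m a k l' j : ℤ)) :
    ∃ j, 1 / 2 ^ a ≤ |ph (b j) (ζ l) - ph (b j) (ζ l')| := by
  obtain ⟨R, hRm, hR, hRb⟩ := hTR.exists_inv
  by_contra! hcon
  obtain ⟨j, hj⟩ := Function.ne_iff.1 hne
  have hd : (N0 : ℤ) ≤ |lab m a k l j - lab m a k l' j| := by
    have := (ZMod.intCast_eq_intCast_iff_dvd_sub _ _ _).1 (hcol j)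
    have h2 := Int.le_of_dvd (abs_pos.2 (sub_ne_zero.2 hj.symm)) ((dvd_abs _ _).2 this)
    rwa [abs_sub_comm] at h2
  have hd' : (N0 : ℝ) ≤ |(lab m a k l j : ℝ) - lab m a k l' j| := by exact_mod_cast hd
  have n1 := h.near hB ha hl j
  have n2 := h.near hB ha hl' j
  have e1 : ζ l (Sum.inl j) - ζ l' (Sum.inl j) = ∑ i, R (Pi.single (Sum.inl j) 1) i * (ph (b i) (ζ l) - ph (b i) (ζ l')) := by
    have : ∑ i, R (Pi.single (Sum.inl j) 1) i * ph (b i) (ζ l - ζ l') = ph (Pi.single (Sum.inl j) 1) (ζ l - ζ l') := by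
      rw [← ph_sum_smul, hR]
    simp_rw [← ph_sub_right]
    rw [this]
    simp [ph, Pi.single_apply]
  have e2 : |ζ l (Sum.inl j) - ζ l' (Sum.inl j)| ≤ (d + 1) * Θ * (1 / 2 ^ a) := by
    rw [e1]
    refine (Finset.abs_sum_le_sum_abs _ _).trans ?_
    calc _ ≤ ∑ i : Fin d ⊕ Unit, Θ * (1 / 2 ^ a) := by
          refine Finset.sum_le_sum fun i _ => ?_
          rw [abs_mul]
          refine mul_le_mul ?_ (hcon i).le (abs_nonneg _) hΘ
          refine (hRb _ i).trans ?_
          have : ‖(Pi.single (Sum.inl j) 1 : Fin d ⊕ Unit → ℝ)‖ ≤ 1 := by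
            rw [pi_norm_le_iff_of_nonneg (by norm_num)]
            intro i'
            by_cases hi : i' = Sum.inl j
            · subst hi; simp
            · simp [hi]
          nlinarith
      _ = _ := by simp; ring
  have hpa : (0:ℝ) < 2 ^ a := by positivity
  have e4 : |(lab m a k l j : ℝ) - lab m a k l' j| / 2 ^ a ≤ ((d + 1) * Θ + 2 * (B + 1)) / 2 ^ a := by
    have : |(lab m a k l j : ℝ) - lab m a k l' j| / 2 ^ a = |cen a (lab m a k l) j - cen a (lab m a k l') j| := by
      simp only [cen]
      rw [← sub_div, abs_div, abs_of_pos hpa]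
    rw [this]
    have e5 : ((d + 1) * Θ + 2 * (B + 1)) / 2 ^ a = (d + 1) * Θ * (1 / 2 ^ a) + (B + 1) / 2 ^ a + (B + 1) / 2 ^ a := by ring
    rw [e5]
    rw [abs_le] at n1 n2 e2 ⊢
    constructor <;> linarith [n1.1, n1.2, n2.1, n2.2, e2.1, e2.2]
  have := (div_le_div_iff_of_pos_right hpa).1 e4
  linarith

end DR

namespace DR
open scoped ENNReal NNReal
open scoped Classical

variable {ι : Type} [Fintype ι] {I : Type}

theorem ph_comm (a b : ι → ℝ) : ph a b = ph b a := by
  unfold ph; exact Finset.sum_congr rfl fun j _ => mul_comm _ _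

theorem gi_map {Θ : ℝ} {b : ι → ι → ℝ} {R : (ι → ℝ) → (ι → ℝ)} (hRm : Measurable R)
    (hR : ∀ w, ∑ i, R w i • b i = w) (ζ : I → ι → ℝ) (ν : Measure (ι → ℝ)) (S : Finset I) (u : I → ℂ) :
    gi (fun l j => ph (b j) (ζ l)) (ν.map R) 1 S u = gi ζ ν 1 S u := by
  unfold gi
  rw [lintegral_map ((measurable_gg_right _ _ _).pow_const _) hRm]
  refine lintegral_congr fun w => ?_
  have : ∀ l, ph (fun j => ph (b j) (ζ l)) (R w) = ph (ζ l) w := by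
    intro l
    rw [ph_comm, ph_comm (ζ l) w]
    conv_rhs => rw [← hR w, ph_sum_smul]
    rfl
  simp only [gg, es, this]

theorem gi_le_card {Λ : Type} (ζ : I → ι → ℝ) (ν : Measure (ι → ℝ)) (S : Finset I) (u : I → ℂ) (la : I → Λ) (N : ℕ)
    (hN : (img S la).card ≤ N) :
    gi ζ ν 1 S u ≤ N * ∑ J ∈ img S la, gi ζ ν 1 (fib S la J) u := by
  unfold gi
  simp only [ENNReal.rpow_one]
  rw [← lintegral_finsetSum _ (fun J _ => measurable_gg_right _ _ _)]
  have hm : Measurable fun x => ∑ J ∈ img S la, gg ζ u (fib S la J) x :=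
    Finset.measurable_sum _ fun J _ => measurable_gg_right _ _ _
  rw [← lintegral_const_mul _ hm]
  refine lintegral_mono fun x => ?_
  have : gg ζ u S x ≤ (img S la).card * ∑ J ∈ img S la, gg ζ u (fib S la J) x := by
    unfold gg
    rw [es_fiber ζ u S la x]
    exact enorm_sum_sq _ _
  refine this.trans ?_
  gcongr

theorem X_le_AA {Λ : Type} {q : ℝ} (hq : 1 ≤ q) (hn : 1 ≤ Fintype.card ι) (μ : Measure (I → ℂ))
    (ζ : I → ι → ℝ) (ν : Measure (ι → ℝ)) [SFinite ν] (S : ι → Finset I) (la : I → Λ) (N : ℕ)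
    (hN : ∀ i, (img (S i) la).card ≤ N) :
    ∫⁻ u, ∏ i, (gi ζ ν 1 (S i) u) ^ (q / Fintype.card ι) ∂μ ≤ (N : ℝ≥0∞) ^ q * AA q μ ζ ν S la := by
  unfold AA MM
  have hm : Measurable fun u : I → ℂ => ∏ i, (∑ J ∈ (S i).image la, (gi ζ ν 1 ((S i).filter (la · = J)) u) ^ (1 / (1:ℝ))) ^ (q / Fintype.card ι) := by
    refine Finset.measurable_prod _ fun i _ => Measurable.pow_const ?_ _
    exact Finset.measurable_sum _ fun J _ => (measurable_gi _ _ _ _).pow_const _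
  rw [← lintegral_const_mul _ hm]
  refine lintegral_mono fun u => ?_
  simp only [div_one, ENNReal.rpow_one]
  rw [← prod_pow_div (ι := ι) hn rfl (by linarith : 0 ≤ q) (N : ℝ≥0∞), ← Finset.prod_mul_distrib]
  refine Finset.prod_le_prod' fun i _ => ?_
  rw [← ENNReal.mul_rpow_of_nonneg _ _ (by positivity)]
  refine ENNReal.rpow_le_rpow ?_ (by positivity)
  exact gi_le_card ζ ν (S i) u la N (hN i)

theorem Adm.card_img {d : ℕ} {B : ℝ} {m : ℕ} {ζ : I → Fin d ⊕ Unit → ℝ} {S : Finset I} {k : I → Fin d → ℤ}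
    (h : Adm d B m ζ S k) {a : ℕ} (ha : a ≤ m) : (img S (lab m a k)).card ≤ 2 ^ (a * d) := by
  have hsub : img S (lab m a k) ⊆ Fintype.piFinset (fun _ : Fin d => Finset.Ico (0:ℤ) (2 ^ a)) := by
    intro J hJ
    obtain ⟨l, hl, rfl⟩ := mem_img.1 hJ
    rw [Fintype.mem_piFinset]
    intro j
    rw [Finset.mem_Ico]
    exact h.cen_mem ha hl j
  refine (Finset.card_le_card hsub).trans ?_
  rw [Fintype.card_piFinset]
  simp only [Int.card_Ico, sub_zero, Finset.prod_const, Finset.card_univ, Fintype.card_fin, pow_mul]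
  have : ((2:ℤ) ^ a).toNat = 2 ^ a := by
    have h2 : ((2:ℤ) ^ a) = ((2 ^ a : ℕ) : ℤ) := by push_cast; rfl
    rw [h2, Int.toNat_natCast]
  rw [this]

theorem S2_const {Λ : Type} {q : ℝ} {μ : Measure (I → ℂ)} {S : Finset I} {k : I → Λ}
    (h : ∀ l ∈ S, ∀ l' ∈ S, k l = k l') : S2 q μ S k ≤ NN q μ S := by
  rcases S.eq_empty_or_nonempty with rfl | ⟨l, hl⟩
  · simp [S2, img]
  · have h1 : img S k = {k l} := by
      ext J; rw [mem_img, Finset.mem_singleton]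
      constructor
      · rintro ⟨l', hl', rfl⟩; exact h _ hl' _ hl
      · rintro rfl; exact ⟨l, hl, rfl⟩
    have h2 : fib S k (k l) = S := by
      ext l'; rw [mem_fib]; exact ⟨fun h => h.1, fun h' => ⟨h', h _ h' _ hl⟩⟩
    rw [S2, h1, Finset.sum_singleton, h2]

theorem NN_fib_le {Λ : Type} {q : ℝ} (hq : 0 < q) {μ : Measure (I → ℂ)} {S : Finset I} {k : I → Λ} (J : Λ) :
    NN q μ (fib S k J) ≤ S2 q μ S k := by
  by_cases hJ : J ∈ img S k
  · exact Finset.single_le_sum (f := fun J => NN q μ (fib S k J)) (fun _ _ => bot_le) hJ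
  · have : fib S k J = ∅ := by
      ext l; rw [mem_fib]; constructor
      · rintro ⟨h, rfl⟩; exact absurd (mem_img.2 ⟨l, h, rfl⟩) hJ
      · simp
    rw [this]
    simp [NN, hq, hq.ne', ENNReal.zero_rpow_of_pos]

theorem S2_fib_bound {d : ℕ} {q : ℝ} (hq : 0 < q) {μ : Measure (I → ℂ)} {S : Finset I} {k : I → Fin d → ℤ} {m k2 : ℕ}
    (hk2 : k2 ≤ m) {G : ℝ≥0∞} {η : ℝ} (hη : 0 ≤ η)
    (hG : ∀ a, a ≤ m → S2 q μ S (lab m a k) ≤ G * 2 ^ (η * ((m : ℝ) - a))) (J : Fin d → ℤ) (a : ℕ) (ha : a ≤ m) :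
    S2 q μ (fib S (lab m k2 k) J) (lab m a k) ≤ G * 2 ^ (η * ((m : ℝ) - a)) := by
  rcases le_total k2 a with h | h
  · exact (S2_le_of_fiber q μ S (lab m a k) (fun J j => J j / 2 ^ (a - k2)) (lab m k2 k) (lab_nest h ha k) J).trans (hG a ha)
  · refine (S2_const ?_).trans ((NN_fib_le hq J).trans ((hG k2 hk2).trans ?_))
    · intro l hl l' hl'
      rw [lab_nest h hk2 k l, lab_nest h hk2 k l', (mem_fib.1 hl).2, (mem_fib.1 hl').2]
    · refine mul_le_mul_right (two_rpow_mono ?_) _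
      have : (a : ℝ) ≤ k2 := by exact_mod_cast h
      nlinarith

/-- Multilinear estimate. -/
theorem mult {d : ℕ} (hd : 1 ≤ d) {q : ℝ} (hq : 1 ≤ q) (hqd : q * d ≤ d + 2) {B : ℝ} (hB : 0 ≤ B) {η0 : ℝ} (hη0 : 0 < η0) :
    ∃ c : ℝ, 0 < c ∧ ∀ Θ : ℝ, 0 ≤ Θ → ∀ kmin : ℕ, ∃ k2 : ℕ, kmin ≤ k2 ∧ ∃ C : ℝ≥0∞, C ≠ ⊤ ∧
      ∀ (I : Type) (μ : Measure (I → ℂ)) (_ : SFinite μ) (ζ : I → Fin d ⊕ Unit → ℝ) (S : Finset I) (k : I → Fin d → ℤ) (m : ℕ)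
        (α : Fin d ⊕ Unit → Fin d → ℤ), Stat μ ζ → Adm d B m ζ S k → k2 ≤ m →
        (∀ i j, 0 ≤ α i j ∧ α i j < 2 ^ k2) → TR Θ (fun i => bvec (cen k2 (α i))) →
        ∀ (η : ℝ) (G : ℝ≥0∞), η0 ≤ η → (∀ a, a ≤ m → S2 q μ S (lab m a k) ≤ G * 2 ^ (η * ((m : ℝ) - a))) →
        ∀ (ν : Measure (Fin d ⊕ Unit → ℝ)) (_ : IsProbabilityMeasure ν),
        ∫⁻ u, ∏ i, (gi ζ ν 1 (fib S (lab m k2 k) (α i)) u) ^ (q / Fintype.card (Fin d ⊕ Unit)) ∂μ ≤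
          C * (G ^ q * 2 ^ (q * (η - c) * m)) := by
  obtain ⟨M, hM⟩ := exists_nat_ge (4 * ((d:ℝ) + 1) / η0)
  have hM' : 4 * ((d:ℝ) + 1) ≤ η0 * M := by
    rw [div_le_iff₀ hη0] at hM; linarith
  refine ⟨1 / 2 ^ M, by positivity, fun Θ hΘ kmin => ?_⟩
  have hcard : Fintype.card (Fin d ⊕ Unit) = d + 1 := by simp
  set C1 : ℝ := (2 * (d + 1) * (2 * B + 1 + d * (B + 1) * (B + 3)) + 2 * (d * (B + 1) ^ 2 + B) + 1) with hC1
  obtain ⟨N0, hN0⟩ := exists_nat_gt (2 * (B + 1) + (d + 1) * Θ)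
  have hN0p : 0 < N0 := by
    have : (0:ℝ) < N0 := lt_of_le_of_lt (by positivity) hN0
    exact_mod_cast this
  haveI : NeZero N0 := ⟨hN0p.ne'⟩
  obtain ⟨C, hCt, hC1', hit⟩ := mult_iter (ι := Fin d ⊕ Unit) (by rw [hcard]; omega) hq
    (by rw [hcard]; push_cast; nlinarith) (C1 := C1) (by positivity) (Fintype.card (Fin d → ZMod N0))
  obtain ⟨b, hb0, hbC⟩ : ∃ b : ℕ, 0 < b ∧ C ≤ 2 ^ (η0 / 4 * (b:ℝ)) := by
    obtain ⟨b, hb⟩ := exists_nat_ge (max 1 (Real.logb 2 C.toReal / (η0 / 4)))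
    refine ⟨b, by have := (le_max_left _ _).trans hb; exact_mod_cast this, ?_⟩
    have h2 := (le_max_right _ _).trans hb
    rw [div_le_iff₀ (by positivity)] at h2
    have hCp : 0 < C.toReal := ENNReal.toReal_pos (by intro h; simp [h] at hC1') hCt
    rw [← ENNReal.ofReal_toReal hCt, show (2:ℝ≥0∞) = ENNReal.ofReal 2 by simp, ENNReal.ofReal_rpow_of_pos (by norm_num)]
    refine ENNReal.ofReal_le_ofReal ?_
    rw [← Real.logb_le_iff_le_rpow (by norm_num) hCp]
    linarith
  obtain ⟨k2, hk2⟩ : ∃ k2 : ℕ, kmin ≤ k2 ∧ 4 * Θ * 2 ^ b ≤ 2 ^ k2 := by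
    obtain ⟨k', hk'⟩ := pow_unbounded_of_one_lt (4 * Θ * 2 ^ b) (by norm_num : (1:ℝ) < 2)
    exact ⟨max kmin k', le_max_left _ _, hk'.le.trans (pow_le_pow_right₀ (by norm_num) (le_max_right _ _))⟩
  refine ⟨k2, hk2.1, C ^ 2 * 2 ^ (q * b) + 2 ^ (q * ((b:ℝ) + k2)), ?_, ?_⟩
  · exact ENNReal.add_ne_top.2 ⟨ENNReal.mul_ne_top (ENNReal.pow_ne_top hCt) (two_rpow_ne_top _), two_rpow_ne_top _⟩
  intro I μ _ ζ S k m α hst hA hkm hα hTR η G hη hG ν _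
  have hη00 : 0 ≤ η := hη0.le.trans hη
  obtain ⟨R, hRm, hR, hRb⟩ := hTR.exists_inv
  set bb : Fin d ⊕ Unit → Fin d ⊕ Unit → ℝ := fun i => bvec (cen k2 (α i)) with hbb
  set ζ' : I → Fin d ⊕ Unit → ℝ := fun l j => ph (bb j) (ζ l) with hζ'
  have hst' : Stat μ ζ' := by
    have := hst.affine bb (fun _ => 0)
    simpa only [add_zero] using this
  set ν' := ν.map R with hν'
  haveI : IsProbabilityMeasure ν' := Measure.isProbabilityMeasure_map hRm.aemeasurable
  set Si : Fin d ⊕ Unit → Finset I := fun i => fib S (lab m k2 k) (α i) with hSi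
  have hX : ∫⁻ u, ∏ i, (gi ζ ν 1 (fib S (lab m k2 k) (α i)) u) ^ (q / Fintype.card (Fin d ⊕ Unit)) ∂μ =
      ∫⁻ u, ∏ i, (gi ζ' ν' 1 (Si i) u) ^ (q / Fintype.card (Fin d ⊕ Unit)) ∂μ := by
    refine lintegral_congr fun u => Finset.prod_congr rfl fun i _ => ?_
    rw [hζ', hν', gi_map (Θ := Θ) hRm hR]
  rw [hX]
  have hH4 : ∀ a, a ≤ m → ∀ i, S2 q μ (Si i) (lab m a k) ≤ G * 2 ^ (η * ((m : ℝ) - a)) := fun a ha i =>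
    S2_fib_bound (by linarith) hkm hη00 hG (α i) a ha
  have hn1 : 1 ≤ Fintype.card (Fin d ⊕ Unit) := by rw [hcard]; omega
  set s : ℕ := m / (2 ^ M * b) with hs
  have hpM : (0:ℝ) < 2 ^ M := by positivity
  have hs1 : 2 ^ M * (b * s) ≤ m := by
    rw [← mul_assoc]; exact Nat.mul_div_le m _
  have hs2 : (m:ℝ) ≤ 2 ^ M * (b * s + b) := by
    have := Nat.lt_mul_div_succ m (b := 2 ^ M * b) (by positivity)
    rw [← hs] at this
    have h' : (m:ℝ) ≤ ((2 ^ M * b) * (s + 1) : ℕ) := by exact_mod_cast this.le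
    push_cast at h'
    linarith
  have hs3 : 1 / 2 ^ M * (m:ℝ) ≤ b * s + b := by
    rw [div_mul_eq_mul_div, one_mul, div_le_iff₀ hpM]; linarith
  rcases lt_or_ge (b * s) k2 with hlt | hge
  · -- small m
    have hlt' : ((b:ℝ) * s) ≤ k2 := by exact_mod_cast hlt.le
    have h1 := X_le_AA hq hn1 μ ζ' ν' Si (lab m k2 k) 1 (by
      intro i
      refine Finset.card_le_one.2 fun J hJ J' hJ' => ?_
      obtain ⟨l, hl, rfl⟩ := mem_img.1 hJ
      obtain ⟨l', hl', rfl⟩ := mem_img.1 hJ'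
      rw [(mem_fib.1 hl).2, (mem_fib.1 hl').2])
    rw [Nat.cast_one, ENNReal.one_rpow, one_mul] at h1
    refine h1.trans ((AA_le_NN hq hn1 hst' ν' Si _ _ (hH4 k2 hkm)).trans ?_)
    rw [ENNReal.mul_rpow_of_nonneg _ _ (by linarith), ← ENNReal.rpow_mul]
    calc G ^ q * 2 ^ (η * ((m:ℝ) - k2) * q) ≤ G ^ q * (2 ^ (q * ((b:ℝ) + k2)) * 2 ^ (q * (η - 1 / 2 ^ M) * m)) := by
          rw [← two_rpow_add]
          refine mul_le_mul_right (two_rpow_mono ?_) _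
          have e1 : q * (1 / 2 ^ M * (m:ℝ)) ≤ q * (b + k2) := by
            refine mul_le_mul_of_nonneg_left ?_ (by linarith)
            linarith
          have e2 : 0 ≤ η * k2 * q := by positivity
          nlinarith
      _ = 2 ^ (q * ((b:ℝ) + k2)) * (G ^ q * 2 ^ (q * (η - 1 / 2 ^ M) * m)) := by ring
      _ ≤ _ := by gcongr; exact le_add_self
  · have hbs : b * s ≤ m := le_trans (Nat.le_mul_of_pos_left _ (by positivity)) hs1
    obtain ⟨v, c, hv1, hv2⟩ := geom_v hB hk2.2 hΘ hA hα hTR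
    have h1 := X_le_AA hq hn1 μ ζ' ν' Si (lab m (b * s) k) (2 ^ ((b * s) * d)) (by
      intro i
      exact (hA.mono fib_sub).card_img hbs)
    have h2 := hit I (Fin d → ZMod N0) inferInstance μ inferInstance ζ' Si d m k b k2 (fun J j => (J j : ZMod N0)) v c G η hb0 le_rfl hst' hv1 hv2
      (by
        intro a ha i l hl l' hl' hne hcol
        exact geom_sep (k2 := 0) hB hN0 hΘ hN0p hA hTR ha (fib_sub hl) (fib_sub hl') hne (fun j => congrFun hcol j))
      hH4 M s ν' inferInstance hge hs1
    refine h1.trans ((mul_le_mul_right h2 _).trans ?_)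
    have e1 : ((2 ^ (b * s * d) : ℕ) : ℝ≥0∞) ^ q = 2 ^ (q * ((b:ℝ) * s * d)) := by
      push_cast
      rw [← ENNReal.rpow_natCast, ← ENNReal.rpow_mul]
      congr 1; push_cast; ring
    have e2 : C ^ (M * s + 2) ≤ C ^ 2 * 2 ^ (η0 / 4 * b * (M * s)) := by
      rw [pow_add, mul_comm]
      refine mul_le_mul_right ?_ _
      calc C ^ (M * s) ≤ (2 ^ (η0 / 4 * (b:ℝ))) ^ (M * s) := pow_le_pow_left' hbC _
        _ = _ := by rw [← ENNReal.rpow_natCast, ← ENNReal.rpow_mul]; push_cast; rfl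
    rw [e1]
    calc 2 ^ (q * ((b:ℝ) * s * d)) * (C ^ (M * s + 2) * (G ^ q * 2 ^ (q * η * ((m : ℝ) - (b * s) * (1 + M / 2)))))
        ≤ 2 ^ (q * ((b:ℝ) * s * d)) * ((C ^ 2 * 2 ^ (η0 / 4 * b * (M * s))) * (G ^ q * 2 ^ (q * η * ((m : ℝ) - (b * s) * (1 + M / 2))))) := by gcongr
      _ = C ^ 2 * G ^ q * 2 ^ (q * ((b:ℝ) * s * d) + η0 / 4 * b * (M * s) + q * η * ((m : ℝ) - (b * s) * (1 + M / 2))) := by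
          rw [two_rpow_add, two_rpow_add]; ring
      _ ≤ C ^ 2 * G ^ q * 2 ^ (q * b + q * (η - 1 / 2 ^ M) * m) := by
          refine mul_le_mul_right (two_rpow_mono ?_) _
          have ha0 : (0:ℝ) ≤ b * s := by positivity
          have g1 : η0 / 4 * b * (M * s) ≤ q * ((b * s) * (η0 * M / 4)) := by
            have : (0:ℝ) ≤ (b * s) * (η0 * M / 4) := by positivity
            nlinarith
          have g2 : (b * s) * (η0 * M / 2) ≤ (b * s) * (η * (1 + M / 2)) := by
            refine mul_le_mul_of_nonneg_left ?_ ha0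
            have : (0:ℝ) ≤ M := by positivity
            nlinarith
          have g3 : (b * s : ℝ) * (d + 1) ≤ (b * s) * (η0 * M / 4) := by
            refine mul_le_mul_of_nonneg_left ?_ ha0
            linarith
          have g4 : (b * s) * d + (b * s) * (η0 * M / 4) + η * m - (b * s) * (η * (1 + M / 2)) ≤ b + η * m - 1 / 2 ^ M * m := by
            linarith
          have g5 := mul_le_mul_of_nonneg_left g4 (by linarith : 0 ≤ q)
          linarith
      _ = (C ^ 2 * 2 ^ (q * b)) * (G ^ q * 2 ^ (q * (η - 1 / 2 ^ M) * m)) := by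
          rw [two_rpow_add]; ring
      _ ≤ _ := by gcongr; exact le_self_add

end DR

namespace DR
open scoped ENNReal NNReal
open scoped Classical

variable {ι : Type} [Fintype ι] {I : Type}

/-- Normalized Dirichlet kernel. -/
def dk (N : ℕ) (t : ℝ) : ℂ := ∑ k : Fin N, (1 / N : ℂ) * ee (k * t)

theorem ee_sub_one_le (s : ℝ) : ‖ee s - 1‖ ≤ 2 * Real.pi * |s| := by
  have := Real.norm_exp_I_mul_ofReal_sub_one_le (x := 2 * Real.pi * s)
  unfold ee
  rw [show (2 * Real.pi * Complex.I * s : ℂ) = Complex.I * ((2 * Real.pi * s : ℝ) : ℂ) by push_cast; ring]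
  refine this.trans ?_
  rw [Real.norm_eq_abs, abs_mul, abs_of_pos (by positivity : 0 < 2 * Real.pi)]

theorem ee_sub_one_ge {s : ℝ} (hs : |s| ≤ 1 / 2) : 4 * |s| ≤ ‖ee s - 1‖ := by
  have := Complex.norm_exp_I_mul_ofReal_sub_one (2 * Real.pi * s)
  unfold ee
  rw [show (2 * Real.pi * Complex.I * s : ℂ) = Complex.I * ((2 * Real.pi * s : ℝ) : ℂ) by push_cast; ring, this]
  rw [Real.norm_eq_abs, abs_mul, abs_two, show 2 * Real.pi * s / 2 = Real.pi * s by ring]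
  have h2 := Real.mul_abs_le_abs_sin (x := Real.pi * s) (by
    rw [abs_mul, abs_of_pos Real.pi_pos]; nlinarith [Real.pi_pos])
  rw [abs_mul, abs_of_pos Real.pi_pos] at h2
  have : 2 / Real.pi * (Real.pi * |s|) = 2 * |s| := by field_simp
  linarith

theorem dk_le_one {N : ℕ} (hN : 0 < N) (t : ℝ) : ‖dk N t‖ ≤ 1 := by
  unfold dk
  refine (norm_sum_le _ _).trans ?_
  have : (N:ℝ) ≠ 0 := by positivity
  simp [norm_ee, this]

theorem dk_decay {N : ℕ} (hN : 0 < N) {t : ℝ} (ht : |t| ≤ 1 / 2) : ‖dk N t‖ * (2 * N * |t|) ≤ 1 := by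
  have h1 : dk N t * (ee t - 1) = (1 / N : ℂ) * (ee (N * t) - 1) := by
    unfold dk
    rw [← Finset.mul_sum, mul_assoc]
    congr 1
    have : ∀ k : ℕ, ee (k * t) = (ee t) ^ k := by
      intro k
      unfold ee
      rw [← Complex.exp_nat_mul]; congr 1; push_cast; ring
    rw [Fin.sum_univ_eq_sum_range (fun k => ee (k * t)) N]
    simp_rw [this]
    exact geom_sum_mul _ _
  have h2 : ‖dk N t‖ * ‖ee t - 1‖ ≤ 2 / N := by
    rw [← norm_mul, h1, norm_mul]
    have : ‖ee (N * t) - 1‖ ≤ 2 := by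
      refine (norm_sub_le _ _).trans ?_
      rw [norm_ee, norm_one]; norm_num
    have e : ‖(1 / N : ℂ)‖ = 1 / N := by simp
    rw [e]
    calc 1 / (N:ℝ) * _ ≤ 1 / N * 2 := by gcongr
      _ = _ := by ring
  have h3 := ee_sub_one_ge ht
  have h4 : ‖dk N t‖ * (4 * |t|) ≤ 2 / N := le_trans (by gcongr) h2
  rw [le_div_iff₀ (by positivity)] at h4
  nlinarith

theorem dk_lower {N : ℕ} (hN : 0 < N) {t : ℝ} (ht : N * |t| ≤ 1 / 16) : 1 / 2 ≤ ‖dk N t‖ := by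
  have hN' : (0:ℝ) < N := by positivity
  have h1 : ‖dk N t - 1‖ ≤ 1 / 2 := by
    have : dk N t - 1 = ∑ k : Fin N, (1 / N : ℂ) * (ee (k * t) - 1) := by
      simp only [mul_sub, Finset.sum_sub_distrib]
      have : (N:ℂ) ≠ 0 := by exact_mod_cast hN.ne'
      simp [dk, this]
    rw [this]
    refine (norm_sum_le _ _).trans ?_
    calc ∑ k : Fin N, ‖(1 / N : ℂ) * (ee (k * t) - 1)‖ ≤ ∑ k : Fin N, 1 / (N:ℝ) * (1 / 2) := by
          refine Finset.sum_le_sum fun k _ => ?_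
          rw [norm_mul]
          have e : ‖(1 / N : ℂ)‖ = 1 / N := by simp
          rw [e]
          gcongr
          refine (ee_sub_one_le _).trans ?_
          rw [abs_mul]
          have hk : |((k:ℕ):ℝ)| ≤ N := by rw [abs_of_nonneg (by positivity)]; exact_mod_cast k.2.le
          have : |((k:ℕ):ℝ)| * |t| ≤ 1 / 16 := le_trans (by gcongr) ht
          have h4 := Real.pi_le_four
          nlinarith [Real.pi_pos, mul_nonneg (abs_nonneg ((k:ℕ):ℝ)) (abs_nonneg t)]
      _ = 1 / 2 := by simp; field_simp
  have := norm_sub_norm_le (1:ℂ) (dk N t)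
  rw [norm_one, norm_sub_rev] at this
  linarith

theorem fourier_add_arg {T : ℝ} (n : ℤ) (x y : AddCircle T) : (fourier n (x + y) : ℂ) = fourier n x * fourier n y := by
  simp [fourier_apply, smul_add, AddCircle.toCircle_add]

theorem fourier_ee {T : ℝ} (n : ℤ) (x : ℝ) : (fourier n (x : AddCircle T) : ℂ) = ee (n / T * x) := by
  rw [fourier_coe_apply, ee]; congr 1; push_cast; ring

/-- Torus box. -/
def tbox (L : ℝ) : Set (ι → ℝ) := Set.pi Set.univ fun _ => Set.Ioc (-L / 2) (-L / 2 + L)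

/-- Stationary process of an exponential sum with frequencies in a lattice. -/
theorem torus_proc {L : ℝ} (hL : 0 < L) (n : I → ι → ℤ) (c : I → ℂ) :
    ∃ μ : Measure (I → ℂ), SFinite μ ∧ Stat μ (fun l j => (n l j : ℝ) / L) ∧
      ∀ (S : Finset I) (q : ℝ), 0 < q → NN q μ S = (∫⁻ x in tbox (ι := ι) L, (gg (fun l j => (n l j : ℝ) / L) c S x) ^ q) ^ (1 / q) := by
  haveI : Fact (0 < L) := ⟨hL⟩
  set U : (ι → AddCircle L) × UnitAddCircle → I → ℂ := fun θ l => (∏ j, (fourier (n l j) (θ.1 j) : ℂ)) * fourier 1 θ.2 * c l with hU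
  have hUm : Measurable U := by
    refine measurable_pi_lambda _ fun l => ?_
    refine ((Finset.measurable_prod _ fun j _ => ?_).mul ?_).mul_const _
    · exact (fourier (n l j)).continuous.measurable.comp ((measurable_pi_apply j).comp measurable_fst)
    · exact (fourier 1).continuous.measurable.comp measurable_snd
  refine ⟨Measure.map U volume, inferInstance, ?_, ?_⟩
  · intro x s
    have hsm : Measurable (sh (fun l j => (n l j : ℝ) / L) x s) := by
      refine measurable_pi_lambda _ fun l => ?_
      exact (measurable_pi_apply l).const_mul _
    refine ⟨hsm, ?_⟩
    rw [Measure.map_map hsm hUm]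
    have e : sh (fun l j => (n l j : ℝ) / L) x s ∘ U = U ∘ (fun θ => θ + ((fun j => (x j : AddCircle L)), (s : UnitAddCircle))) := by
      funext θ l
      simp only [Function.comp, sh, hU, Prod.fst_add, Prod.snd_add, Pi.add_apply, fourier_add_arg, fourier_ee, ee_add, ph, ee_sum,
        Finset.prod_mul_distrib]
      have : ((1:ℤ):ℝ) / 1 * s = s := by simp
      rw [this]
      ring
    rw [e]
    have htr : MeasurePreserving (fun θ : (ι → AddCircle L) × UnitAddCircle => θ + ((fun j => (x j : AddCircle L)), (s : UnitAddCircle))) volume volume :=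
      MeasurePreserving.prod (μa := (volume : Measure (ι → AddCircle L))) (μb := (volume : Measure (ι → AddCircle L)))
        (μc := (volume : Measure UnitAddCircle)) (μd := (volume : Measure UnitAddCircle))
        (f := fun θ : ι → AddCircle L => θ + fun j => (x j : AddCircle L)) (g := fun t : UnitAddCircle => t + (s : UnitAddCircle))
        (measurePreserving_pi _ _ fun j => measurePreserving_add_right (volume : Measure (AddCircle L)) (x j : AddCircle L))
        (measurePreserving_add_right (volume : Measure UnitAddCircle) (s : UnitAddCircle))
    rw [← Measure.map_map hUm htr.measurable, htr.map_eq]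
  · intro S q hq
    unfold NN
    congr 1
    have hm1 : Measurable fun u : I → ℂ => (‖∑ l ∈ S, u l‖ₑ ^ 2) ^ q := by
      have : Measurable fun u : I → ℂ => ∑ l ∈ S, u l := Finset.measurable_sum _ fun l _ => measurable_pi_apply l
      exact (this.enorm.pow_const 2).pow_const q
    rw [lintegral_map hm1 hUm]
    set H : (ι → AddCircle L) → ℝ≥0∞ := fun θ => (‖∑ l ∈ S, (∏ j, (fourier (n l j) (θ j) : ℂ)) * c l‖ₑ ^ 2) ^ q with hH
    have hHm : Measurable H := by
      have : Measurable fun θ : ι → AddCircle L => ∑ l ∈ S, (∏ j, (fourier (n l j) (θ j) : ℂ)) * c l := by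
        refine Finset.measurable_sum _ fun l _ => (Finset.measurable_prod _ fun j _ => ?_).mul_const _
        exact (fourier (n l j)).continuous.measurable.comp (measurable_pi_apply j)
      exact (this.enorm.pow_const 2).pow_const q
    have e1 : ∀ θ : (ι → AddCircle L) × UnitAddCircle, (‖∑ l ∈ S, U θ l‖ₑ ^ 2) ^ q = H θ.1 := by
      intro θ
      have : ∑ l ∈ S, U θ l = (fourier 1 θ.2 : ℂ) * ∑ l ∈ S, (∏ j, (fourier (n l j) (θ.1 j) : ℂ)) * c l := by
        rw [Finset.mul_sum]; exact Finset.sum_congr rfl fun l _ => by simp only [hU]; ring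
      rw [this, enorm_mul, hH]
      have : ‖(fourier 1 θ.2 : ℂ)‖ₑ = 1 := by
        rw [fourier_apply, ← ofReal_norm, Circle.norm_coe]; simp
      rw [this, one_mul]
    simp_rw [e1]
    have hHm' : Measurable fun a : (ι → AddCircle L) × UnitAddCircle => H a.1 := hHm.comp measurable_fst
    rw [Measure.volume_eq_prod, lintegral_prod _ hHm'.aemeasurable]
    simp only [lintegral_const, UnitAddCircle.measure_univ, mul_one]
    have hmp : MeasurePreserving (fun (x : ι → ℝ) (j : ι) => (x j : AddCircle L)) (Measure.pi fun _ : ι => volume.restrict (Set.Ioc (-L / 2) (-L / 2 + L)))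
        (Measure.pi fun _ : ι => (volume : Measure (AddCircle L))) :=
      measurePreserving_pi _ _ fun _ => AddCircle.measurePreserving_mk L (-L / 2)
    rw [show (volume : Measure (ι → AddCircle L)) = Measure.pi fun _ : ι => (volume : Measure (AddCircle L)) from rfl]
    rw [← hmp.lintegral_comp hHm, ← Measure.restrict_pi_pi]
    refine lintegral_congr fun x => ?_
    simp only [hH, gg, es, ph, ee_sum, fourier_ee]
    simp_rw [mul_comm]

end DR

namespace DR
open scoped ENNReal NNReal
open scoped Classical
variable {ι : Type} [Fintype ι] {I : Type}

/-- Uniform probability measure on the cube of half-side `R`. -/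
def ub (R : ℝ) : Measure (ι → ℝ) := Measure.pi (fun _ : ι => lam R)

theorem ub_prob {R : ℝ} (hR : 0 < R) : IsProbabilityMeasure (ub R : Measure (ι → ℝ)) := by
  haveI := lam_prob hR
  unfold ub; infer_instance

theorem lam_le {R : ℝ} (g : ℝ → ℝ≥0∞) :
    ∫⁻ s, g s ∂(lam R) = (ENNReal.ofReal (2 * R))⁻¹ * ∫⁻ s, (Set.Icc (-R) R).indicator 1 s * g s := by
  unfold lam
  rw [lintegral_smul_measure, ← lintegral_indicator measurableSet_Icc]
  rw [smul_eq_mul]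
  congr 1
  refine lintegral_congr fun s => ?_
  by_cases h : s ∈ Set.Icc (-R) R <;> simp [h]

theorem ub_le {R : ℝ} (hR : 0 < R) {g : (ι → ℝ) → ℝ≥0∞} (hg : Measurable g) :
    ∫⁻ s, g s ∂(ub R) ≤ (ENNReal.ofReal (2 * R))⁻¹ ^ (Fintype.card ι) *
      ∫⁻ s, (∏ j, (Set.Icc (-R) R).indicator 1 (s j)) * g s := by
  haveI := lam_prob hR
  have := pi_compare (ι := ι) (fun _ => lam R) (fun _ => volume) (fun _ _ => 1) (fun _ => (Set.Icc (-R) R).indicator 1)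
    (fun _ => measurable_const) (fun _ => measurable_one.indicator measurableSet_Icc) ((ENNReal.ofReal (2 * R))⁻¹)
    (fun i g hg => by simp only [one_mul]; exact (lam_le g).le) g hg
  simp only [one_mul, Finset.prod_const_one] at this
  exact this

theorem es_norm_le' (ζ : I → ι → ℝ) (u : I → ℂ) (S : Finset I) (x : ι → ℝ) : ‖es ζ u S x‖ₑ ≤ ∑ l ∈ S, ‖u l‖ₑ := by
  unfold es
  refine (enorm_sum_le _ _).trans (Finset.sum_le_sum fun l _ => ?_)
  rw [enorm_mul, enorm_ee, mul_one]

theorem gg_tendsto {q : ℝ} (hq : 0 < q) (ν : Measure (ι → ℝ)) [IsFiniteMeasure ν] {ζ : I → ι → ℝ} {ζN : ℕ → I → ι → ℝ}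
    (h : ∀ l j, Filter.Tendsto (fun N => ζN N l j) Filter.atTop (nhds (ζ l j))) (c : I → ℂ) (S : Finset I) :
    Filter.Tendsto (fun N => gi (ζN N) ν q S c) Filter.atTop (nhds (gi ζ ν q S c)) := by
  unfold gi
  refine tendsto_lintegral_of_dominated_convergence (fun _ => ((∑ l ∈ S, ‖c l‖ₑ) ^ 2) ^ q) (fun N => ?_) (fun N => ?_) ?_ ?_
  · exact (measurable_gg_right _ _ _).pow_const q
  · refine Filter.Eventually.of_forall fun x => ?_
    unfold gg
    have := es_norm_le' (ζN N) c S x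
    exact ENNReal.rpow_le_rpow (pow_le_pow_left' this 2) hq.le
  · rw [lintegral_const]
    refine ENNReal.mul_ne_top (ENNReal.rpow_ne_top_of_nonneg hq.le (ENNReal.pow_ne_top ?_)) (measure_ne_top _ _)
    exact ENNReal.sum_ne_top.2 fun l _ => enorm_ne_top
  · refine Filter.Eventually.of_forall fun x => ?_
    refine (ENNReal.continuous_rpow_const.tendsto _).comp ?_
    unfold gg
    refine ((ENNReal.continuous_pow 2).tendsto _).comp ?_
    refine (continuous_enorm.tendsto _).comp ?_
    unfold es
    refine tendsto_finset_sum _ fun l _ => Filter.Tendsto.const_mul _ ?_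
    refine (continuous_ee.tendsto _).comp ?_
    unfold ph
    exact tendsto_finset_sum _ fun j _ => (h l j).mul_const _

/-- Localization hypothesis. -/
def LocH {Λ : Type*} (q R : ℝ) (D : ℝ≥0∞) (ζ : I → ι → ℝ) (S : Finset I) (k : I → Λ) : Prop :=
  ∀ (I' : Type) (pr : I' → I) (ζ' : I' → ι → ℝ) (S' : Finset I') (μ' : Measure (I' → ℂ)), SFinite μ' → Stat μ' ζ' →
    (∀ l' ∈ S', pr l' ∈ S) → (∀ l' ∈ S', ∀ j, |ζ' l' j - ζ (pr l') j| ≤ 1 / R) →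
    NN q μ' S' ≤ D * S2 q μ' S' (fun l => k (pr l))

/-- Localization constant. -/
def locC (ι : Type) [Fintype ι] (q : ℝ) : ℝ≥0∞ :=
  4 ^ (Fintype.card ι) * ((65 ^ (Fintype.card ι)) ^ (1 / q) * (omC ^ (Fintype.card ι)) ^ (1 / q))

theorem locC_ne {q : ℝ} (hq : 1 ≤ q) : locC ι q ≠ ⊤ := by
  unfold locC
  have : (0:ℝ) ≤ 1 / q := by positivity
  refine ENNReal.mul_ne_top (by simp) (ENNReal.mul_ne_top (ENNReal.rpow_ne_top_of_nonneg this (by simp)) (ENNReal.rpow_ne_top_of_nonneg this ?_))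
  exact ENNReal.pow_ne_top omC_ne

/-- rounded frequencies -/
def rz (L : ℝ) (ζ : I → ι → ℝ) : I → ι → ℝ := fun l j => (⌊L * ζ l j⌋ : ℝ) / L

/-- window -/
def WW (N : ℕ) (L : ℝ) (x : ι → ℝ) : ℝ≥0∞ := ‖∏ j, dk N (x j / L)‖ₑ ^ 2

theorem measurable_dk (N : ℕ) : Measurable (dk N) := by
  unfold dk
  exact Finset.measurable_sum _ fun k _ => (measurable_ee.comp (measurable_id.const_mul _)).const_mul _

theorem measurable_WW (N : ℕ) (L : ℝ) : Measurable (WW (ι := ι) N L) := by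
  unfold WW
  refine (Finset.measurable_prod _ fun j _ => ?_).enorm.pow_const 2
  exact (measurable_dk N).comp ((measurable_pi_apply j).div_const _)

theorem es_win {N : ℕ} {L : ℝ} (ζ : I → ι → ℝ) (c : I → ℂ) (S : Finset I) (x : ι → ℝ) :
    gg (fun (l : I × (ι → Fin N)) j => ((⌊L * ζ l.1 j⌋ + (l.2 j : ℕ) : ℤ) : ℝ) / L) (fun l => c l.1 * ∏ j : ι, (1 / N : ℂ)) (S ×ˢ Finset.univ) x
      = gg (rz L ζ) c S x * WW N L x := by
  unfold gg WW
  rw [← mul_pow, ← enorm_mul]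
  congr 2
  unfold es
  rw [Finset.sum_product, Finset.sum_mul]
  refine Finset.sum_congr rfl fun l _ => ?_
  simp only [dk]
  rw [Finset.prod_univ_sum, Finset.mul_sum, Fintype.piFinset_univ]
  refine Finset.sum_congr rfl fun κ _ => ?_
  rw [Finset.prod_mul_distrib, ← ee_sum]
  have : ph (fun j => ((⌊L * ζ l j⌋ + (κ j : ℕ) : ℤ) : ℝ) / L) x = ph (rz L ζ l) x + ∑ j, ((κ j : ℕ) : ℝ) * (x j / L) := by
    unfold ph rz
    rw [← Finset.sum_add_distrib]
    refine Finset.sum_congr rfl fun j _ => ?_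
    push_cast; ring
  rw [this, ee_add]
  ring

theorem WW_lower {N : ℕ} (hN : 0 < N) {R : ℝ} (hR : 0 < R) {x : ι → ℝ} (hx : ∀ j, |x j| ≤ R) :
    1 ≤ 4 ^ (Fintype.card ι) * WW N (16 * R * N) x := by
  have hN' : (0:ℝ) < N := by positivity
  have h1 : (1:ℝ) ≤ 2 ^ (Fintype.card ι) * ‖∏ j, dk N (x j / (16 * R * N))‖ := by
    rw [norm_prod, ← Finset.card_univ, ← Finset.prod_const, ← Finset.prod_mul_distrib]
    rw [← Finset.prod_const_one (s := (Finset.univ : Finset ι))]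
    refine Finset.prod_le_prod (fun _ _ => zero_le_one) fun j _ => ?_
    have := dk_lower (N := N) hN (t := x j / (16 * R * N)) (by
      rw [abs_div, abs_of_pos (by positivity : 0 < 16 * R * N)]
      have := hx j
      rw [mul_div_assoc', div_le_div_iff₀ (by positivity) (by norm_num)]
      nlinarith)
    show (1:ℝ) ≤ 2 * _
    linarith
  have h2 : (1:ℝ) ≤ 4 ^ (Fintype.card ι) * ‖∏ j, dk N (x j / (16 * R * N))‖ ^ 2 := by
    have : (4:ℝ) ^ (Fintype.card ι) = (2 ^ (Fintype.card ι)) ^ 2 := by rw [← pow_mul, mul_comm, pow_mul]; norm_num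
    rw [this, ← mul_pow]
    exact one_le_pow₀ h1
  have h3 := ENNReal.ofReal_le_ofReal h2
  rw [ENNReal.ofReal_one, ENNReal.ofReal_mul (by positivity), ENNReal.ofReal_pow (by positivity), ENNReal.ofReal_pow (by positivity), ofReal_norm] at h3
  simpa [WW] using h3

theorem WW_le_one {N : ℕ} (hN : 0 < N) (L : ℝ) (x : ι → ℝ) : WW N L x ≤ 1 := by
  unfold WW
  refine pow_le_one₀ bot_le ?_
  rw [← ofReal_norm]
  refine ENNReal.ofReal_le_one.2 ?_
  rw [norm_prod]
  exact Finset.prod_le_one (fun _ _ => norm_nonneg _) fun j _ => dk_le_one hN _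

theorem WW_upper {N : ℕ} (hN : 0 < N) {R : ℝ} (hR : 0 < R) {x : ι → ℝ} (hx : x ∈ tbox (ι := ι) (16 * R * N)) :
    WW N (16 * R * N) x ≤ ENNReal.ofReal (65 * R) ^ (Fintype.card ι) * kk 1 (fun _ => R) x := by
  have hN' : (0:ℝ) < N := by positivity
  have hL : 0 < 16 * R * N := by positivity
  unfold WW kk
  rw [← ofReal_norm, norm_prod, ← ENNReal.ofReal_pow (Finset.prod_nonneg fun _ _ => norm_nonneg _), ← Finset.prod_pow,
    ENNReal.ofReal_prod_of_nonneg (fun _ _ => by positivity), ← Finset.card_univ, ← Finset.prod_const, ← Finset.prod_mul_distrib]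
  refine Finset.prod_le_prod' fun j _ => ?_
  rw [← ENNReal.ofReal_mul (by positivity)]
  refine ENNReal.ofReal_le_ofReal ?_
  have hxj := hx j trivial
  simp only [Set.mem_Ioc] at hxj
  have hab : |x j| ≤ 16 * R * N / 2 := abs_le.2 ⟨by linarith [hxj.1], by linarith [hxj.2]⟩
  have h1 := dk_decay (N := N) hN (t := x j / (16 * R * N)) (by
    rw [abs_div, abs_of_pos hL, div_le_iff₀ hL]; linarith)
  have h2 := dk_le_one hN (x j / (16 * R * N))
  set w := ‖dk N (x j / (16 * R * N))‖ with hw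
  have hw0 : 0 ≤ w := norm_nonneg _
  have h3 : w * (|x j| / R) ≤ 8 := by
    rw [abs_div, abs_of_pos hL] at h1
    have : w * (2 * N * (|x j| / (16 * R * N))) = w * (|x j| / R) / 8 := by field_simp; ring
    linarith
  unfold kap
  have h4 : 65 * R * (R⁻¹ * ((1 + (x j / R) ^ 2)⁻¹) ^ 1) = 65 / (1 + (x j / R) ^ 2) := by field_simp
  rw [h4, le_div_iff₀ (by positivity)]
  have h5 : (x j / R) ^ 2 = (|x j| / R) ^ 2 := by rw [div_pow, div_pow, sq_abs]
  rw [h5]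
  have h6 : 0 ≤ w * (|x j| / R) := by positivity
  nlinarith

theorem rz_near {N : ℕ} (hN : 0 < N) {R : ℝ} (hR : 0 < R) (ζ : I → ι → ℝ) (l : I) (j : ι) {κ : ℕ} (hκ : κ < N) :
    |((⌊16 * R * N * ζ l j⌋ + (κ : ℕ) : ℤ) : ℝ) / (16 * R * N) - ζ l j| ≤ 1 / R := by
  have hN' : (1:ℝ) ≤ N := by exact_mod_cast hN
  have hL : 0 < 16 * R * N := by positivity
  have h1 := Int.floor_le (16 * R * N * ζ l j)
  have h2 := Int.lt_floor_add_one (16 * R * N * ζ l j)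
  have hκ' : (κ:ℝ) ≤ N := by exact_mod_cast hκ.le
  have hκ0 : (0:ℝ) ≤ κ := by positivity
  have e : ((⌊16 * R * N * ζ l j⌋ + (κ : ℕ) : ℤ) : ℝ) / (16 * R * N) - ζ l j
     = ((⌊16 * R * N * ζ l j⌋ : ℝ) + κ - 16 * R * N * ζ l j) / (16 * R * N) := by
    push_cast; field_simp
  rw [e, abs_div, abs_of_pos hL, div_le_div_iff₀ hL hR]
  have : |(⌊16 * R * N * ζ l j⌋ : ℝ) + κ - 16 * R * N * ζ l j| ≤ 2 * N := abs_le.2 ⟨by linarith, by linarith⟩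
  nlinarith

theorem rz_tendsto {R : ℝ} (hR : 0 < R) (ζ : I → ι → ℝ) (l : I) (j : ι) :
    Filter.Tendsto (fun N : ℕ => rz (16 * R * ((N + 1 : ℕ) : ℝ)) ζ l j) Filter.atTop (nhds (ζ l j)) := by
  have h0 : Filter.Tendsto (fun N : ℕ => ζ l j - 1 / (16 * R) * (1 / ((N:ℝ) + 1))) Filter.atTop (nhds (ζ l j)) := by
    have := ((tendsto_one_div_add_atTop_nhds_zero_nat (𝕜 := ℝ)).const_mul (1 / (16 * R))).const_sub (ζ l j)
    simpa using this
  refine tendsto_of_tendsto_of_tendsto_of_le_of_le h0 tendsto_const_nhds (fun N => ?_) (fun N => ?_)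
  · have hL : 0 < 16 * R * ((N + 1 : ℕ) : ℝ) := by positivity
    have h2 := Int.lt_floor_add_one (16 * R * ((N + 1 : ℕ) : ℝ) * ζ l j)
    show _ ≤ (⌊16 * R * ((N + 1 : ℕ) : ℝ) * ζ l j⌋ : ℝ) / _
    rw [le_div_iff₀ hL]
    have : (ζ l j - 1 / (16 * R) * (1 / ((N:ℝ) + 1))) * (16 * R * ((N + 1 : ℕ) : ℝ)) = 16 * R * ((N + 1 : ℕ) : ℝ) * ζ l j - 1 := by
      push_cast; field_simp
    rw [this]; linarith
  · have hL : 0 < 16 * R * ((N + 1 : ℕ) : ℝ) := by positivity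
    have h1 := Int.floor_le (16 * R * ((N + 1 : ℕ) : ℝ) * ζ l j)
    show (⌊16 * R * ((N + 1 : ℕ) : ℝ) * ζ l j⌋ : ℝ) / _ ≤ _
    rw [div_le_iff₀ hL]; linarith

theorem loc_N {Λ : Type*} {q : ℝ} (hq : 1 ≤ q) {R : ℝ} (hR : 0 < R) {ζ : I → ι → ℝ} {S : Finset I} {k : I → Λ} {D : ℝ≥0∞}
    (h : LocH q R D ζ S k) (c : I → ℂ) {N : ℕ} (hN : 0 < N) :
    (gi (rz (16 * R * N) ζ) (ub R) q S c) ^ (1 / q) ≤ 4 ^ (Fintype.card ι) * (65 ^ (Fintype.card ι)) ^ (1 / q) * D *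
      ∑ J ∈ img S k, (∫⁻ x, kk 1 (fun _ => R) x * (gg (rz (16 * R * N) ζ) c (fib S k J) x) ^ q) ^ (1 / q) := by
  have hN' : (0:ℝ) < N := by positivity
  have hq0 : 0 < q := by linarith
  have hq1 : 0 ≤ 1 / q := by positivity
  set L := 16 * R * N with hLd
  have hL : 0 < L := by positivity
  set n := Fintype.card ι with hn
  obtain ⟨μ, hμ, hst, hNN⟩ := torus_proc (ι := ι) hL (fun (l : I × (ι → Fin N)) j => ⌊L * ζ l.1 j⌋ + (l.2 j : ℕ)) (fun l => c l.1 * ∏ j : ι, (1 / N : ℂ))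
  have key := h (I × (ι → Fin N)) Prod.fst _ (S ×ˢ Finset.univ) μ hμ hst (fun l hl => (Finset.mem_product.1 hl).1)
    (fun l _ j => rz_near hN hR ζ l.1 j (l.2 j).2)
  have hNT : ∀ T : Finset I, NN q μ (T ×ˢ Finset.univ) = (∫⁻ x in tbox (ι := ι) L, (gg (rz L ζ) c T x * WW N L x) ^ q) ^ (1 / q) := by
    intro T
    rw [hNN _ q hq0]
    simp_rw [es_win]
  have hmt : MeasurableSet (tbox (ι := ι) L) := MeasurableSet.univ_pi fun _ => measurableSet_Ioc
  have hmg : ∀ T, Measurable fun x => (gg (rz L ζ) c T x) ^ q := fun T => (measurable_gg_right _ _ _).pow_const q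
  have hmw : ∀ T, Measurable fun x => (gg (rz L ζ) c T x * WW N L x) ^ q := fun T =>
    ((measurable_gg_right _ _ _).mul (measurable_WW N L)).pow_const q
  -- lower bound
  set a := (ENNReal.ofReal (2 * R))⁻¹ with ha
  set b := ENNReal.ofReal (65 * R) with hb
  have low : (gi (rz L ζ) (ub R) q S c) ^ (1 / q) ≤ (a ^ n) ^ (1 / q) * (4 ^ n * NN q μ (S ×ˢ Finset.univ)) := by
    have h1 : gi (rz L ζ) (ub R) q S c ≤ a ^ n * ((4 ^ n) ^ q * ∫⁻ x in tbox (ι := ι) L, (gg (rz L ζ) c S x * WW N L x) ^ q) := by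
      refine (ub_le hR (hmg S)).trans ?_
      gcongr
      rw [← lintegral_const_mul _ (hmw S), ← lintegral_indicator hmt]
      refine lintegral_mono fun x => ?_
      by_cases hx : ∀ j, |x j| ≤ R
      · have hxt : x ∈ tbox (ι := ι) L := by
          intro j _
          have := abs_le.1 (hx j)
          have hN1 : (1:ℝ) ≤ N := by exact_mod_cast hN
          have : 16 * R ≤ L := by rw [hLd]; nlinarith
          constructor <;> linarith
        rw [Set.indicator_of_mem hxt, ← ENNReal.mul_rpow_of_nonneg _ _ hq0.le]
        have hp : (∏ j, (Set.Icc (-R) R).indicator (1 : ℝ → ℝ≥0∞) (x j)) ≤ 1 := by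
          refine Finset.prod_le_one' fun j _ => ?_
          exact Set.indicator_le_self' (fun _ _ => bot_le) _ |>.trans (by simp)
        calc _ ≤ 1 * (gg (rz L ζ) c S x) ^ q := by gcongr
          _ ≤ _ := by
            rw [one_mul]
            gcongr
            calc gg (rz L ζ) c S x = gg (rz L ζ) c S x * 1 := (mul_one _).symm
              _ ≤ gg (rz L ζ) c S x * (4 ^ n * WW N L x) := by
                gcongr
                exact WW_lower hN hR hx
              _ = _ := by ring
      · push Not at hx
        obtain ⟨j, hj⟩ := hx
        have : (∏ j, (Set.Icc (-R) R).indicator (1 : ℝ → ℝ≥0∞) (x j)) = 0 := by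
          refine Finset.prod_eq_zero (Finset.mem_univ j) (Set.indicator_of_notMem (fun hm => ?_) _)
          exact absurd (abs_le.2 hm) (not_le.2 hj)
        rw [this, zero_mul]; exact bot_le
    rw [hNT]
    calc _ ≤ _ := ENNReal.rpow_le_rpow h1 hq1
      _ = _ := by
        rw [ENNReal.mul_rpow_of_nonneg _ _ hq1, ENNReal.mul_rpow_of_nonneg _ _ hq1, ← ENNReal.rpow_mul, mul_one_div_cancel hq0.ne', ENNReal.rpow_one]
  -- upper bound
  have upp : ∀ T : Finset I, NN q μ (T ×ˢ Finset.univ) ≤ (b ^ n) ^ (1 / q) * (∫⁻ x, kk 1 (fun _ => R) x * (gg (rz L ζ) c T x) ^ q) ^ (1 / q) := by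
    intro T
    rw [hNT, ← ENNReal.mul_rpow_of_nonneg _ _ hq1]
    refine ENNReal.rpow_le_rpow ?_ hq1
    have hm : Measurable fun x => kk 1 (fun _ : ι => R) x * (gg (rz L ζ) c T x) ^ q := by
      refine Measurable.mul ?_ (hmg T)
      unfold kk
      exact Finset.measurable_prod _ fun j _ => (measurable_kap 1 R).comp (measurable_pi_apply j)
    rw [← lintegral_const_mul _ hm]
    refine le_trans (setLIntegral_mono' hmt (g := fun x => b ^ n * (kk 1 (fun _ => R) x * (gg (rz L ζ) c T x) ^ q)) fun x hx => ?_) (setLIntegral_le_lintegral _ _)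
    rw [ENNReal.mul_rpow_of_nonneg _ _ hq0.le, mul_comm, ← mul_assoc]
    gcongr
    calc WW N L x ^ q ≤ WW N L x ^ (1:ℝ) := ENNReal.rpow_le_rpow_of_exponent_ge (WW_le_one hN _ _) hq
      _ = WW N L x := ENNReal.rpow_one _
      _ ≤ _ := WW_upper hN hR hx
  have hS2 : S2 q μ (S ×ˢ Finset.univ) (fun l : I × (ι → Fin N) => k l.1) ≤ (b ^ n) ^ (1 / q) * ∑ J ∈ img S k, (∫⁻ x, kk 1 (fun _ => R) x * (gg (rz L ζ) c (fib S k J) x) ^ q) ^ (1 / q) := by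
    unfold S2
    rw [Finset.mul_sum]
    refine (Finset.sum_le_sum_of_subset (t := img S k) fun J hJ => ?_).trans (Finset.sum_le_sum fun J _ => ?_)
    · obtain ⟨l, hl, e⟩ := mem_img.1 hJ
      exact mem_img.2 ⟨l.1, (Finset.mem_product.1 hl).1, e⟩
    · have : fib (S ×ˢ (Finset.univ : Finset (ι → Fin N))) (fun l => k l.1) J = fib S k J ×ˢ Finset.univ := by
        ext l; simp [mem_fib, Finset.mem_product]
      rw [this]; exact upp _
  have hab : a * b ≤ 65 := by
    rw [ha, hb, ENNReal.ofReal_mul (p := 65) (by norm_num), ENNReal.ofReal_ofNat]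
    calc (ENNReal.ofReal (2 * R))⁻¹ * (65 * ENNReal.ofReal R) ≤ (ENNReal.ofReal (2 * R))⁻¹ * (65 * ENNReal.ofReal (2 * R)) := by
          gcongr; linarith
      _ = 65 * ((ENNReal.ofReal (2 * R))⁻¹ * ENNReal.ofReal (2 * R)) := by ring
      _ = 65 := by rw [ENNReal.inv_mul_cancel (by simpa using hR) ENNReal.ofReal_ne_top, mul_one]
  have hab' : (a ^ n) ^ (1 / q) * (b ^ n) ^ (1 / q) ≤ (65 ^ n) ^ (1 / q) := by
    rw [← ENNReal.mul_rpow_of_nonneg _ _ hq1, ← mul_pow]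
    gcongr
  calc _ ≤ _ := low
    _ ≤ (a ^ n) ^ (1 / q) * (4 ^ n * (D * ((b ^ n) ^ (1 / q) * ∑ J ∈ img S k, (∫⁻ x, kk 1 (fun _ => R) x * (gg (rz L ζ) c (fib S k J) x) ^ q) ^ (1 / q)))) := by
      gcongr
      exact key.trans (by gcongr)
    _ = ((a ^ n) ^ (1 / q) * (b ^ n) ^ (1 / q)) * (4 ^ n * D * ∑ J ∈ img S k, (∫⁻ x, kk 1 (fun _ => R) x * (gg (rz L ζ) c (fib S k J) x) ^ q) ^ (1 / q)) := by ring
    _ ≤ (65 ^ n) ^ (1 / q) * (4 ^ n * D * ∑ J ∈ img S k, (∫⁻ x, kk 1 (fun _ => R) x * (gg (rz L ζ) c (fib S k J) x) ^ q) ^ (1 / q)) := by gcongr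
    _ = _ := by ring

/-- Localization: decoupling for stationary processes implies decoupling on cubes. -/
theorem loc {Λ : Type*} {q : ℝ} (hq : 1 ≤ q) {R : ℝ} (hR : 0 < R) {ζ : I → ι → ℝ} {S : Finset I} {k : I → Λ} {D : ℝ≥0∞} (hD : D ≠ ⊤)
    (h : LocH q R D ζ S k) (c : I → ℂ) :
    (gi ζ (ub R) q S c) ^ (1 / q) ≤ locC ι q * D * ∑ J ∈ img S k, (gi ζ (omp R) q (fib S k J) c) ^ (1 / q) := by
  have hq0 : 0 < q := by linarith
  have hq1 : 0 ≤ 1 / q := by positivity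
  haveI := ub_prob (ι := ι) hR
  have hkm : Measurable (kk 1 (fun _ : ι => R)) := by
    unfold kk
    exact Finset.measurable_prod _ fun j _ => (measurable_kap 1 R).comp (measurable_pi_apply j)
  set ν : Measure (ι → ℝ) := volume.withDensity (kk 1 (fun _ => R)) with hν
  haveI : IsFiniteMeasure ν := isFiniteMeasure_withDensity (ne_top_of_le_ne_top (by simp) (kk_mass le_rfl (fun _ => hR)))
  have hconv : ∀ (ζ' : I → ι → ℝ) T, ∫⁻ x, kk 1 (fun _ => R) x * (gg ζ' c T x) ^ q = gi ζ' ν q T c := by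
    intro ζ' T
    unfold gi
    rw [hν, lintegral_withDensity_eq_lintegral_mul _ hkm ((measurable_gg_right _ _ _).pow_const q)]
    rfl
  have hlim : (gi ζ (ub R) q S c) ^ (1 / q) ≤ 4 ^ (Fintype.card ι) * (65 ^ (Fintype.card ι)) ^ (1 / q) * D *
      ∑ J ∈ img S k, (gi ζ ν q (fib S k J) c) ^ (1 / q) := by
    refine le_of_tendsto_of_tendsto' (f := fun N : ℕ => (gi (rz (16 * R * ((N + 1 : ℕ) : ℝ)) ζ) (ub R) q S c) ^ (1 / q))
      (g := fun N : ℕ => 4 ^ (Fintype.card ι) * (65 ^ (Fintype.card ι)) ^ (1 / q) * D *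
        ∑ J ∈ img S k, (gi (rz (16 * R * ((N + 1 : ℕ) : ℝ)) ζ) ν q (fib S k J) c) ^ (1 / q)) (b := Filter.atTop) ?_ ?_ ?_
    · exact (ENNReal.continuous_rpow_const.tendsto _).comp (gg_tendsto hq0 _ (rz_tendsto hR ζ) c S)
    · refine ENNReal.Tendsto.const_mul ?_ (Or.inr (ENNReal.mul_ne_top (ENNReal.mul_ne_top (by simp) (ENNReal.rpow_ne_top_of_nonneg hq1 (by simp))) hD))
      refine tendsto_finset_sum _ fun J _ => ?_
      exact (ENNReal.continuous_rpow_const.tendsto _).comp (gg_tendsto hq0 _ (rz_tendsto hR ζ) c _)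
    · intro N
      have := loc_N hq hR h c (N := N + 1) (Nat.succ_pos N)
      simp only [hconv] at this
      exact this
  refine hlim.trans ?_
  have : ∑ J ∈ img S k, (gi ζ ν q (fib S k J) c) ^ (1 / q) ≤ (omC ^ (Fintype.card ι)) ^ (1 / q) * ∑ J ∈ img S k, (gi ζ (omp R) q (fib S k J) c) ^ (1 / q) := by
    rw [Finset.mul_sum]
    refine Finset.sum_le_sum fun J _ => ?_
    rw [← ENNReal.mul_rpow_of_nonneg _ _ hq1, ← hconv]
    refine ENNReal.rpow_le_rpow ?_ hq1
    exact omp_ge hR ((measurable_gg_right _ _ _).pow_const q)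
  calc _ ≤ 4 ^ (Fintype.card ι) * (65 ^ (Fintype.card ι)) ^ (1 / q) * D * ((omC ^ (Fintype.card ι)) ^ (1 / q) * ∑ J ∈ img S k, (gi ζ (omp R) q (fib S k J) c) ^ (1 / q)) := by gcongr
    _ = _ := by unfold locC; ring

theorem lintegral_gi {q : ℝ} {μ : Measure (I → ℂ)} [SFinite μ] {ζ : I → ι → ℝ} (hst : Stat μ ζ) (hq : 0 < q)
    (ν : Measure (ι → ℝ)) [IsProbabilityMeasure ν] (S : Finset I) :
    ∫⁻ u, gi ζ ν q S u ∂μ = (NN q μ S) ^ q := by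
  unfold gi NN
  rw [lintegral_lintegral_swap]
  · simp_rw [hst.lintegral_gg]
    rw [lintegral_const, measure_univ, mul_one, ← ENNReal.rpow_mul, one_div_mul_cancel hq.ne', ENNReal.rpow_one]
  · exact ((measurable_gg ζ S).pow_const q).aemeasurable

end DR

namespace DR
open scoped ENNReal NNReal
open scoped Classical
variable {ι : Type} [Fintype ι] {I : Type}

theorem ph_smul_left (t : ℝ) (a b : ι → ℝ) : ph (t • a) b = t * ph a b := by
  unfold ph; rw [Finset.mul_sum]; exact Finset.sum_congr rfl fun j _ => by simp; ring

theorem ph_add_left (a a' b : ι → ℝ) : ph (a + a') b = ph a b + ph a' b := by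
  unfold ph; rw [← Finset.sum_add_distrib]; exact Finset.sum_congr rfl fun j _ => by simp; ring

theorem unit_abs_le {N : ι → ℝ} (h : ∑ j, N j ^ 2 = 1) (j : ι) : |N j| ≤ 1 := by
  rw [← sq_le_one_iff_abs_le_one, ← h]
  exact Finset.single_le_sum (f := fun j => N j ^ 2) (fun _ _ => sq_nonneg _) (Finset.mem_univ j)

theorem exists_unit_perp {k : ℕ} (hk : k < Fintype.card ι) (b : Fin k → ι → ℝ) :
    ∃ N : ι → ℝ, ∑ j, N j ^ 2 = 1 ∧ ∀ i, ph N (b i) = 0 := by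
  let Φ : (ι → ℝ) →ₗ[ℝ] (Fin k → ℝ) :=
    { toFun := fun N i => ph N (b i)
      map_add' := fun x y => by funext i; exact ph_add_left x y _
      map_smul' := fun t x => by funext i; exact ph_smul_left t x _ }
  have h : LinearMap.ker Φ ≠ ⊥ := LinearMap.ker_ne_bot_of_finrank_lt (by simpa using hk)
  obtain ⟨N, hN, hN0⟩ := (Submodule.ne_bot_iff _).1 h
  have hs : 0 < ∑ j, N j ^ 2 := by
    obtain ⟨j, hj⟩ := Function.ne_iff.1 hN0
    exact Finset.sum_pos' (fun _ _ => sq_nonneg _) ⟨j, Finset.mem_univ _, by simp at hj; positivity⟩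
  refine ⟨(√(∑ j, N j ^ 2))⁻¹ • N, ?_, fun i => ?_⟩
  · simp only [Pi.smul_apply, smul_eq_mul, mul_pow]
    rw [← Finset.mul_sum, inv_pow, Real.sq_sqrt hs.le, inv_mul_cancel₀ hs.ne']
  · rw [ph_smul_left]
    have : ph N (b i) = 0 := congrFun (LinearMap.mem_ker.1 hN) i
    rw [this, mul_zero]

theorem abs_ph_norm {N : ι → ℝ} (h : ∀ j, |N j| ≤ 1) (w : ι → ℝ) : |ph N w| ≤ Fintype.card ι * ‖w‖ := by
  have := abs_ph_le N w zero_le_one h (fun j => norm_le_pi_norm w j)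
  simpa using this

theorem ph_sum_smul' {κ : Type} [Fintype κ] {b : κ → ι → ℝ} (u : κ → ℝ) (ζ : ι → ℝ) : ph (∑ i, u i • b i) ζ = ∑ i, u i * ph (b i) ζ := by
  unfold ph
  simp only [Finset.sum_apply, Pi.smul_apply, smul_eq_mul, Finset.sum_mul, Finset.mul_sum]
  rw [Finset.sum_comm]
  exact Finset.sum_congr rfl fun i _ => Finset.sum_congr rfl fun j _ => by ring

theorem tr_sel_aux {τ : ℝ} (hτ : 0 < τ) (k : ℕ) : k ≤ Fintype.card ι → ∃ Θ : ℝ, 0 ≤ Θ ∧ ∀ X : Set (ι → ℝ), (∀ x ∈ X, ∀ j, |x j| ≤ 2) →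
    (∃ N : ι → ℝ, ∑ j, N j ^ 2 = 1 ∧ ∀ x ∈ X, |ph N x| ≤ τ) ∨
    ∃ b : Fin k → ι → ℝ, (∀ i, b i ∈ X) ∧ ∀ u : Fin k → ℝ, ∀ i, |u i| ≤ Θ * ‖∑ i', u i' • b i'‖ := by
  induction k with
  | zero => intro _; exact ⟨0, le_rfl, fun X _ => Or.inr ⟨fun i => i.elim0, fun i => i.elim0, fun u i => i.elim0⟩⟩
  | succ k ih =>
    intro hk
    obtain ⟨Θ, hΘ, H⟩ := ih (by omega)
    set n : ℝ := (Fintype.card ι : ℝ) with hn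
    have hn0 : 0 ≤ n := by positivity
    refine ⟨n / τ + Θ * (1 + 2 * (n / τ)), by positivity, fun X hX => ?_⟩
    rcases H X hX with h | ⟨b, hb, hu⟩
    · exact Or.inl h
    · obtain ⟨N, hN, hNb⟩ := exists_unit_perp (by omega) b
      by_cases hall : ∀ x ∈ X, |ph N x| ≤ τ
      · exact Or.inl ⟨N, hN, hall⟩
      · push Not at hall
        obtain ⟨x, hx, hxτ⟩ := hall
        refine Or.inr ⟨Fin.cons x b, fun i => ?_, fun u i => ?_⟩
        · refine Fin.cases ?_ (fun i => ?_) i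
          · exact hx
          · exact hb i
        · rw [Fin.sum_univ_succ]
          simp only [Fin.cons_zero, Fin.cons_succ]
          set v := ∑ i' : Fin k, u i'.succ • b i' with hv
          set w := u 0 • x + v with hw
          have e1 : ph N w = u 0 * ph N x := by
            rw [hw, ph_add_right, ph_comm N (u 0 • x), ph_smul_left, ph_comm x, ph_comm N v, hv, ph_sum_smul']
            have : ∀ i : Fin k, ph (b i) N = 0 := fun i => by rw [ph_comm, hNb]
            simp [this]
          have e2 := abs_ph_norm (unit_abs_le hN) w
          rw [e1, abs_mul] at e2
          have e3 : |u 0| ≤ n / τ * ‖w‖ := by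
            rw [div_mul_eq_mul_div, le_div_iff₀ hτ]
            exact le_trans (by gcongr) e2
          have e4 : ‖v‖ ≤ (1 + 2 * (n / τ)) * ‖w‖ := by
            have : v = w - u 0 • x := by rw [hw]; simp
            have hx2 : ‖x‖ ≤ 2 := (pi_norm_le_iff_of_nonneg (by norm_num)).2 fun j => hX x hx j
            calc ‖v‖ ≤ ‖w‖ + ‖u 0 • x‖ := by rw [this]; exact norm_sub_le _ _
              _ ≤ ‖w‖ + (n / τ * ‖w‖) * 2 := by rw [norm_smul, Real.norm_eq_abs]; gcongr
              _ = _ := by ring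
          refine Fin.cases ?_ (fun i => ?_) i
          · have : 0 ≤ Θ * (1 + 2 * (n / τ)) * ‖w‖ := by positivity
            linarith
          · have h5 := hu (fun i => u i.succ) i
            have h6 : Θ * ‖v‖ ≤ Θ * ((1 + 2 * (n / τ)) * ‖w‖) := by gcongr
            have : 0 ≤ n / τ * ‖w‖ := by positivity
            linarith

theorem tr_sel {τ : ℝ} (hτ : 0 < τ) : ∃ Θ : ℝ, 0 ≤ Θ ∧ ∀ X : Set (ι → ℝ), (∀ x ∈ X, ∀ j, |x j| ≤ 2) →
    (∃ N : ι → ℝ, ∑ j, N j ^ 2 = 1 ∧ ∀ x ∈ X, |ph N x| ≤ τ) ∨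
    ∃ b : ι → ι → ℝ, (∀ i, b i ∈ X) ∧ TR Θ b := by
  obtain ⟨Θ, hΘ, H⟩ := tr_sel_aux (ι := ι) hτ _ le_rfl
  refine ⟨Θ, hΘ, fun X hX => ?_⟩
  rcases H X hX with h | ⟨b, hb, hu⟩
  · exact Or.inl h
  · let e := Fintype.equivFin ι
    refine Or.inr ⟨fun i => b (e i), fun i => hb _, fun u i => ?_⟩
    have := hu (fun i => u (e.symm i)) (e i)
    simp only [Equiv.symm_apply_apply] at this
    refine this.trans_eq ?_
    rw [← e.sum_comp]
    simp

theorem exists_onb {d : ℕ} (N : Fin (d + 1) → ℝ) (hN : ∑ j, N j ^ 2 = 1) :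
    ∃ v : Fin d → Fin (d + 1) → ℝ, (∀ i, ∑ j, v i j ^ 2 = 1) ∧
      ∀ η : Fin (d + 1) → ℝ, ∑ j, η j ^ 2 = ph N η ^ 2 + ∑ i, ph (v i) η ^ 2 := by
  let w : Fin (d + 1) → EuclideanSpace ℝ (Fin (d + 1)) := fun _ => WithLp.toLp 2 N
  have hw : Orthonormal ℝ (Set.restrict ({0} : Set (Fin (d + 1))) w) := by
    constructor
    · intro i
      have : ‖(WithLp.toLp 2 N : EuclideanSpace ℝ (Fin (d + 1)))‖ ^ 2 = 1 := by rw [EuclideanSpace.norm_sq_eq]; simpa using hN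
      have h0 : 0 ≤ ‖(WithLp.toLp 2 N : EuclideanSpace ℝ (Fin (d + 1)))‖ := norm_nonneg _
      show ‖(WithLp.toLp 2 N : EuclideanSpace ℝ (Fin (d + 1)))‖ = 1
      nlinarith
    · intro i j hij
      exact absurd (Subsingleton.elim i j) hij
  obtain ⟨b, hb⟩ := hw.exists_orthonormalBasis_extension_of_card_eq (by simp)
  have hb0 : b 0 = WithLp.toLp 2 N := hb 0 rfl
  have hin : ∀ (x : EuclideanSpace ℝ (Fin (d + 1))) (η : Fin (d + 1) → ℝ), inner ℝ x (WithLp.toLp 2 η : EuclideanSpace ℝ (Fin (d + 1))) = ph (fun j => x j) η := by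
    intro x η
    simp [ph, PiLp.inner_apply, mul_comm]
  refine ⟨fun i j => b i.succ j, fun i => ?_, fun η => ?_⟩
  · have := b.orthonormal.1 i.succ
    have h2 := EuclideanSpace.norm_sq_eq (b i.succ)
    rw [this] at h2
    simpa using h2.symm
  · have := b.sum_sq_norm_inner_right (WithLp.toLp 2 η : EuclideanSpace ℝ (Fin (d + 1)))
    rw [EuclideanSpace.norm_sq_eq, Fin.sum_univ_succ, hb0] at this
    simp only [hin] at this
    simp at this
    exact this.symm

theorem NN_triv {Λ : Type} {q : ℝ} (hq : 1 ≤ q) (μ : Measure (I → ℂ)) (T : Finset I) (k : I → Λ) {M : ℕ}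
    (hM : (img T k).card ≤ M) : NN q μ T ≤ M * S2 q μ T k := by
  have hq0 : 0 < q := by linarith
  have hq1 : 0 ≤ 1 / q := by positivity
  have hm : ∀ T' : Finset I, Measurable fun u : I → ℂ => ‖∑ l ∈ T', u l‖ₑ ^ 2 := fun T' => by
    have : Measurable fun u : I → ℂ => ∑ l ∈ T', u l := Finset.measurable_sum _ fun l _ => measurable_pi_apply l
    exact this.enorm.pow_const 2
  unfold NN S2
  have h1 : ∀ u : I → ℂ, ‖∑ l ∈ T, u l‖ₑ ^ 2 ≤ M * ∑ J ∈ img T k, ‖∑ l ∈ fib T k J, u l‖ₑ ^ 2 := by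
    intro u
    have : ∑ l ∈ T, u l = ∑ J ∈ img T k, ∑ l ∈ fib T k J, u l := by
      unfold img fib
      exact (Finset.sum_fiberwise_of_maps_to (fun l hl => Finset.mem_image_of_mem k hl) _).symm
    rw [this]
    refine (enorm_sum_sq _ _).trans ?_
    gcongr
  have hms : Measurable fun u : I → ℂ => (∑ J ∈ img T k, ‖∑ l ∈ fib T k J, u l‖ₑ ^ 2) ^ q :=
    (Finset.measurable_sum _ fun J _ => hm _).pow_const q
  calc (∫⁻ u, (‖∑ l ∈ T, u l‖ₑ ^ 2) ^ q ∂μ) ^ (1 / q)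
      ≤ (∫⁻ u, (M:ℝ≥0∞) ^ q * (∑ J ∈ img T k, ‖∑ l ∈ fib T k J, u l‖ₑ ^ 2) ^ q ∂μ) ^ (1 / q) := by
        refine ENNReal.rpow_le_rpow (lintegral_mono fun u => ?_) hq1
        rw [← ENNReal.mul_rpow_of_nonneg _ _ hq0.le]
        exact ENNReal.rpow_le_rpow (h1 u) hq0.le
    _ = M * (∫⁻ u, (∑ J ∈ img T k, ‖∑ l ∈ fib T k J, u l‖ₑ ^ 2) ^ q ∂μ) ^ (1 / q) := by
        rw [lintegral_const_mul _ hms, ENNReal.mul_rpow_of_nonneg _ _ hq1, ← ENNReal.rpow_mul, mul_one_div_cancel hq0.ne', ENNReal.rpow_one]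
    _ ≤ _ := by
        gcongr
        exact lq_sum_le μ hq (img T k) (fun J u => ‖∑ l ∈ fib T k J, u l‖ₑ ^ 2) fun J _ => hm _

end DR

namespace DR
open scoped ENNReal NNReal
open scoped Classical
variable {ι : Type} [Fintype ι] {I : Type}

/-- The decoupling theorem in dimension `d` with exponent `q`. -/
def TT (d : ℕ) (q : ℝ) : Prop := ∀ B : ℝ, 0 ≤ B → ∀ ε : ℝ, 0 < ε → ∃ C : ℝ≥0∞, C ≠ ⊤ ∧ ∀ m : ℕ, DecB d q B m (C * 2 ^ (ε * (m:ℝ)))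

theorem ph_sumtype {d : ℕ} (a : Fin d → ℝ) (t : ℝ) (ζ : Fin d ⊕ Unit → ℝ) :
    ph (Sum.elim a (fun _ => t)) ζ = ph a (fun j => ζ (Sum.inl j)) + t * ζ (Sum.inr ()) := by
  unfold ph; rw [Fintype.sum_sum_type]; simp

theorem card_near {d : ℕ} {T : Finset I} {k : I → Fin d → ℤ} {M : ℕ} (h : ∀ l ∈ T, ∀ l' ∈ T, ∀ j, |k l j - k l' j| ≤ M) :
    (img T k).card ≤ (2 * M + 1) ^ d := by
  rcases T.eq_empty_or_nonempty with rfl | ⟨l0, hl0⟩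
  · simp [img]
  · have : img T k ⊆ Fintype.piFinset fun j => Finset.Icc (k l0 j - M) (k l0 j + M) := by
      intro J hJ
      obtain ⟨l, hl, rfl⟩ := mem_img.1 hJ
      rw [Fintype.mem_piFinset]
      intro j
      have := abs_le.1 (h l hl l0 hl0 j)
      rw [Finset.mem_Icc]; constructor <;> linarith
    refine (Finset.card_le_card this).trans ?_
    rw [Fintype.card_piFinset]
    have : ∀ j, (Finset.Icc (k l0 j - M) (k l0 j + M)).card = 2 * M + 1 := by
      intro j; rw [Int.card_Icc]; omega
    simp [this]

theorem slab {d : ℕ} {q : ℝ} (hq : 1 ≤ q) (hT : TT d q) {B Cs ε : ℝ} (hB : 0 ≤ B) (hCs : 0 ≤ Cs) (hε : 0 < ε) :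
    ∃ C : ℝ≥0∞, C ≠ ⊤ ∧ ∀ (m : ℕ) (I : Type) (μ : Measure (I → ℂ)) (_ : SFinite μ) (ζ : I → Fin (d + 1) ⊕ Unit → ℝ) (S : Finset I)
      (k : I → Fin (d + 1) → ℤ), Stat μ ζ → Adm (d + 1) B m ζ S k → ∀ (N : Fin (d + 1) → ℝ) (c0 : ℝ), ∑ j, N j ^ 2 = 1 →
      (∀ l ∈ S, |ph N (fun j => ζ l (Sum.inl j)) - c0| ≤ Cs / 2 ^ m) → NN q μ S ≤ C * 2 ^ (ε * (m:ℝ)) * S2 q μ S k := by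
  set a0 : ℕ := d + 3 with ha0
  set B' : ℝ := 1 + (d + 1) * B + (B + Cs ^ 2) with hB'
  obtain ⟨C, hC, hDec⟩ := hT B' (by positivity) ε hε
  obtain ⟨M, hM⟩ := exists_nat_ge (d + (2 * Cs + 2 * ((d + 1) * B)) ^ 2 + 1)
  refine ⟨C * 2 ^ (ε * (a0 : ℝ)) * ((2 * M + 1) ^ (d + 1) : ℕ), ?_, ?_⟩
  · exact ENNReal.mul_ne_top (ENNReal.mul_ne_top hC (by simp)) (ENNReal.natCast_ne_top _)
  intro m I μ hμ ζ S k hst hA N c0 hN hs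
  obtain ⟨v, hv1, hv⟩ := exists_onb N hN
  set A : ℝ := 2 ^ (d + 2) with hAd
  have hA2 : (2:ℝ) ^ a0 = 2 * A := by rw [ha0, hAd]; ring
  have hA0 : 0 < A := by positivity
  have hAd' : (d + 1 : ℝ) < A := by
    rw [hAd]
    have : d + 1 < 2 ^ (d + 2) := lt_of_lt_of_le Nat.lt_two_pow_self (Nat.pow_le_pow_right (by norm_num) (by omega))
    exact_mod_cast this
  have h4A : (4:ℝ) ^ a0 = (2 * A) ^ 2 := by rw [← hA2, ← pow_mul, mul_comm, pow_mul]; norm_num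
  set η : I → Fin (d + 1) → ℝ := fun l j => ζ l (Sum.inl j) with hη
  set AM : Fin d ⊕ Unit → Fin (d + 1) ⊕ Unit → ℝ := Sum.elim (fun i => Sum.elim ((2 * A)⁻¹ • v i) (fun _ => 0))
    (fun _ => Sum.elim (((2 * A) ^ 2)⁻¹ • ((-2 * c0) • N + ∑ i, (2 * A) • v i)) (fun _ => ((2 * A) ^ 2)⁻¹)) with hAM
  set vv : Fin d ⊕ Unit → ℝ := Sum.elim (fun _ => A / (2 * A)) (fun _ => (c0 ^ 2 + d * A ^ 2) / (2 * A) ^ 2) with hvv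
  set ζ2 : I → Fin d ⊕ Unit → ℝ := fun l j => ph (AM j) (ζ l) + vv j with hζ2
  have hst2 : Stat μ ζ2 := hst.affine AM vv
  have z1 : ∀ l i, ζ2 l (Sum.inl i) = (ph (v i) (η l) + A) / (2 * A) := by
    intro l i
    simp only [hζ2, hAM, hvv, Sum.elim_inl]
    rw [ph_sumtype, ph_smul_left]
    field_simp; ring
  have z2 : ∀ l, ζ2 l (Sum.inr ()) = (ζ l (Sum.inr ()) - 2 * c0 * ph N (η l) + c0 ^ 2 + ∑ i, 2 * A * ph (v i) (η l) + d * A ^ 2) / (2 * A) ^ 2 := by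
    intro l
    simp only [hζ2, hAM, hvv, Sum.elim_inr]
    rw [ph_sumtype, ph_smul_left, ph_add_left, ph_smul_left, ph_sum_smul' (fun _ => 2 * A)]
    field_simp; ring
  set f : (Fin (d + 1) → ℤ) → Fin d → ℤ := fun J i => ⌊2 ^ m * (ph (v i) (cen m J) + A)⌋ with hf
  have hcl : ∀ l ∈ S, ∀ j, |η l j - cen m (k l) j| ≤ B / 2 ^ m := by
    intro l hl j
    have := hA.hη l hl j
    have e : η l j - cen m (k l) j = (2 ^ m * ζ l (Sum.inl j) - k l j) / 2 ^ m := by simp only [hη, cen]; field_simp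
    rw [e, abs_div, abs_of_pos (by positivity : (0:ℝ) < 2 ^ m)]
    gcongr
  have hca : ∀ l ∈ S, ∀ j, |cen m (k l) j| ≤ 1 := fun l hl j => cen_abs ⟨hA.k0 l hl j, hA.k1 l hl j⟩
  have hphd : ∀ l ∈ S, ∀ (w : Fin (d + 1) → ℝ), (∀ j, |w j| ≤ 1) → |ph w (η l) - ph w (cen m (k l))| ≤ (d + 1) * B / 2 ^ m := by
    intro l hl w hw
    rw [← ph_sub_right]
    have := abs_ph_le w (η l - cen m (k l)) zero_le_one hw (fun j => hcl l hl j)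
    refine this.trans_eq ?_
    rw [Fintype.card_fin]; push_cast; ring
  have hphc : ∀ l ∈ S, ∀ i, |ph (v i) (cen m (k l))| ≤ d + 1 := by
    intro l hl i
    have := abs_ph_le (v i) (cen m (k l)) zero_le_one (unit_abs_le (hv1 i)) (fun j => hca l hl j)
    refine this.trans_eq ?_
    rw [Fintype.card_fin]; push_cast; ring
  have hA' : Adm d B' (m + a0) ζ2 S (fun l => f (k l)) := by
    refine ⟨fun l hl i => ?_, fun l hl i => ?_, fun l hl i => ?_, fun l hl => ?_⟩
    · have := abs_le.1 (hphc l hl i)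
      refine Int.floor_nonneg.2 (mul_nonneg (by positivity) (by linarith))
    · have := abs_le.1 (hphc l hl i)
      refine Int.floor_lt.2 ?_
      push_cast
      rw [pow_add, hA2]
      have : ph (v i) (cen m (k l)) + A < 2 * A := by linarith
      gcongr
    · rw [z1, pow_add, hA2]
      have e : 2 ^ m * (2 * A) * ((ph (v i) (η l) + A) / (2 * A)) = 2 ^ m * (ph (v i) (cen m (k l)) + A) + 2 ^ m * (ph (v i) (η l) - ph (v i) (cen m (k l))) := by
        field_simp; ring
      rw [e]
      have h1 := hphd l hl (v i) (unit_abs_le (hv1 i))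
      have h2 := Int.floor_le (2 ^ m * (ph (v i) (cen m (k l)) + A))
      have h3 := Int.lt_floor_add_one (2 ^ m * (ph (v i) (cen m (k l)) + A))
      have h4 : |2 ^ m * (ph (v i) (η l) - ph (v i) (cen m (k l)))| ≤ (d + 1) * B := by
        rw [abs_mul, abs_of_pos (by positivity : (0:ℝ) < 2 ^ m)]
        calc _ ≤ 2 ^ m * ((d + 1) * B / 2 ^ m) := by gcongr
          _ = _ := by field_simp
      have h5 := abs_le.1 h4
      have h6 : 0 ≤ B + Cs ^ 2 := by positivity
      show |_ - ((⌊2 ^ m * (ph (v i) (cen m (k l)) + A)⌋ : ℤ) : ℝ)| ≤ _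
      rw [abs_le]; constructor <;> linarith
    · have h1 := hA.hτ l hl
      have h2 := hs l hl
      have e : ζ2 l (Sum.inr ()) - ∑ j, ζ2 l (Sum.inl j) ^ 2 =
          ((ζ l (Sum.inr ()) - ∑ j, ζ l (Sum.inl j) ^ 2) + (ph N (η l) - c0) ^ 2) / (2 * A) ^ 2 := by
        have e1 : ∑ j, ζ l (Sum.inl j) ^ 2 = _ := hv (η l)
        have e2 : ∑ i, ζ2 l (Sum.inl i) ^ 2 = (∑ i, ph (v i) (η l) ^ 2 + ∑ i, 2 * A * ph (v i) (η l) + d * A ^ 2) / (2 * A) ^ 2 := by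
          simp only [z1, div_pow]
          rw [← Finset.sum_div, ← Finset.sum_add_distrib]
          congr 1
          have : (d:ℝ) * A ^ 2 = ∑ i : Fin d, A ^ 2 := by simp
          rw [this, ← Finset.sum_add_distrib]
          exact Finset.sum_congr rfl fun i _ => by ring
        rw [z2, e2, e1]
        ring
      rw [e, pow_add, h4A, abs_div, abs_of_pos (by positivity : 0 < (2 * A) ^ 2), mul_assoc, mul_div_cancel₀ _ (by positivity)]
      have h3 : |ph N (η l) - c0| ^ 2 ≤ (Cs / 2 ^ m) ^ 2 := pow_le_pow_left₀ (abs_nonneg _) h2 2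
      have h4 : (4:ℝ) ^ m * (Cs / 2 ^ m) ^ 2 = Cs ^ 2 := by
        have : (4:ℝ) ^ m = (2 ^ m) ^ 2 := by rw [← pow_mul, mul_comm, pow_mul]; norm_num
        rw [this]; field_simp
      calc 4 ^ m * |(ζ l (Sum.inr ()) - ∑ j, ζ l (Sum.inl j) ^ 2) + (ph N (η l) - c0) ^ 2|
          ≤ 4 ^ m * (|ζ l (Sum.inr ()) - ∑ j, ζ l (Sum.inl j) ^ 2| + |ph N (η l) - c0| ^ 2) := by
            gcongr
            refine (abs_add_le _ _).trans ?_
            rw [abs_pow]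
        _ = 4 ^ m * |ζ l (Sum.inr ()) - ∑ j, ζ l (Sum.inl j) ^ 2| + 4 ^ m * |ph N (η l) - c0| ^ 2 := by ring
        _ ≤ B + 4 ^ m * (Cs / 2 ^ m) ^ 2 := by gcongr
        _ = B + Cs ^ 2 := by rw [h4]
        _ ≤ B' := by rw [hB']; linarith [show 0 ≤ (d + 1) * B by positivity]
  have hmain := hDec (m + a0) I μ hμ ζ2 S (fun l => f (k l)) hst2 hA'
  have hfib : ∀ J, NN q μ (fib S (fun l => f (k l)) J) ≤ ((2 * M + 1) ^ (d + 1) : ℕ) * S2 q μ (fib S (fun l => f (k l)) J) k := by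
    intro J
    refine NN_triv hq μ _ k (card_near fun l hl l' hl' j => ?_)
    obtain ⟨hl, el⟩ := mem_fib.1 hl
    obtain ⟨hl', el'⟩ := mem_fib.1 hl'
    set w : Fin (d + 1) → ℝ := cen m (k l) - cen m (k l') with hw
    have hp2 : (0:ℝ) < 2 ^ m := by positivity
    have hi : ∀ i, (2 ^ m * ph (v i) w) ^ 2 ≤ 1 := by
      intro i
      have e1 : ⌊2 ^ m * (ph (v i) (cen m (k l)) + A)⌋ = ⌊2 ^ m * (ph (v i) (cen m (k l')) + A)⌋ := congrFun (el.trans el'.symm) i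
      have h1 := Int.abs_sub_lt_one_of_floor_eq_floor e1
      have e2 : 2 ^ m * (ph (v i) (cen m (k l)) + A) - 2 ^ m * (ph (v i) (cen m (k l')) + A) = 2 ^ m * ph (v i) w := by
        rw [hw, ph_sub_right]; ring
      rw [e2] at h1
      exact (sq_le_one_iff_abs_le_one _).2 h1.le
    have h0 : (2 ^ m * ph N w) ^ 2 ≤ (2 * Cs + 2 * ((d + 1) * B)) ^ 2 := by
      rw [← sq_abs]
      refine pow_le_pow_left₀ (abs_nonneg _) ?_ 2
      have a1 := hphd l hl N (unit_abs_le hN)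
      have a2 := hphd l' hl' N (unit_abs_le hN)
      have a3 := hs l hl
      have a4 := hs l' hl'
      have : |ph N w| ≤ 2 * (Cs / 2 ^ m) + 2 * ((d + 1) * B / 2 ^ m) := by
        rw [hw, ph_sub_right]
        rw [abs_le] at *
        constructor <;> linarith
      rw [abs_mul, abs_of_pos hp2]
      calc _ ≤ 2 ^ m * (2 * (Cs / 2 ^ m) + 2 * ((d + 1) * B / 2 ^ m)) := by gcongr
        _ = _ := by field_simp
    have hsum : ∑ j, (2 ^ m * w j) ^ 2 ≤ d + (2 * Cs + 2 * ((d + 1) * B)) ^ 2 := by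
      have := hv w
      simp only [mul_pow] at h0 hi ⊢
      rw [← Finset.mul_sum, this, mul_add, Finset.mul_sum]
      have h7 : ∑ i, (2 ^ m) ^ 2 * ph (v i) w ^ 2 ≤ ∑ i : Fin d, (1:ℝ) := Finset.sum_le_sum fun i _ => hi i
      simp at h7
      rw [← mul_pow] at *
      linarith
    have hj : (2 ^ m * w j) ^ 2 ≤ d + (2 * Cs + 2 * ((d + 1) * B)) ^ 2 :=
      (Finset.single_le_sum (f := fun j => (2 ^ m * w j) ^ 2) (fun _ _ => sq_nonneg _) (Finset.mem_univ j)).trans hsum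
    have hwj : 2 ^ m * w j = ((k l j - k l' j : ℤ) : ℝ) := by
      simp only [hw, cen, Pi.sub_apply]; push_cast; field_simp
    rw [hwj] at hj
    have hM1 : (1:ℝ) ≤ M := le_trans (by nlinarith [sq_nonneg (2 * Cs + 2 * ((d + 1) * B)), (Nat.cast_nonneg d : (0:ℝ) ≤ d)]) hM
    have h8 : (((k l j - k l' j : ℤ) : ℝ)) ^ 2 ≤ (M:ℝ) ^ 2 := by nlinarith
    have h9 := abs_le_of_sq_le_sq h8 (by positivity)
    rw [← Int.cast_abs] at *
    exact_mod_cast h9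
  calc NN q μ S ≤ C * 2 ^ (ε * ((m + a0 : ℕ) : ℝ)) * S2 q μ S (fun l => f (k l)) := hmain
    _ ≤ C * 2 ^ (ε * ((m + a0 : ℕ) : ℝ)) * (((2 * M + 1) ^ (d + 1) : ℕ) * S2 q μ S k) := by
      gcongr
      rw [← S2_fiber q μ S k f (fun l => f (k l)) (fun _ => rfl), Finset.mul_sum]
      exact Finset.sum_le_sum fun J _ => hfib J
    _ = _ := by
      rw [Nat.cast_add, mul_add, add_comm, ENNReal.rpow_add _ _ (by simp) (by simp)]
      ring

end DR

namespace DR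
open scoped ENNReal NNReal
open scoped Classical
variable {ι : Type} [Fintype ι] {I : Type}

theorem Um_zero (i : ι) (s : ι → ℝ) : Um i 0 s = s := by
  funext j; simp [Um]

/-- Bernstein inequality on the cube. -/
theorem bern [Nonempty ι] {R Z : ℝ} (hR : 0 < R) (hZ : 0 < Z) : ∃ C : ℝ≥0∞, C ≠ ⊤ ∧ ∀ (I : Type) (ζ : I → ι → ℝ) (u : I → ℂ) (S : Finset I),
    (∀ l ∈ S, ∀ j, |ζ l j| ≤ Z) → ∀ x : ι → ℝ, (∀ j, |x j| ≤ R) → gg ζ u S x ≤ C * gi ζ (omp R) 1 S u := by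
  obtain ⟨C, hC, h⟩ := repro (ι := ι) (e := 1) le_rfl (C1 := Z * R) (by positivity) (σ := 1) le_rfl
  obtain ⟨i⟩ := ‹Nonempty ι›
  refine ⟨C * ((3 ^ 1) ^ (Fintype.card ι) * omC ^ (Fintype.card ι)), ENNReal.mul_ne_top hC (ENNReal.mul_ne_top (by simp) (ENNReal.pow_ne_top omC_ne)), ?_⟩
  intro I ζ u S hζ x hx
  have h1 := h I ζ u S 0 0 i (fun _ => R) (fun _ => hR) (fun l hl j => by
    have : tw i 0 (ζ l - 0) j = ζ l j := by simp [tw, ph]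
    rw [this]; refine (hζ l hl j).trans_eq ?_; field_simp) x
  simp only [ENNReal.rpow_one] at h1
  have h2 := HH_harnack 1 (rr := fun _ : ι => R) (fun _ => hR) i 0 (measurable_gg_right ζ S u) 0 (q := x) hx
  rw [Um_zero, zero_add] at h2
  have h3 : HH 1 (fun _ => R) i 0 (gg ζ u S) 0 ≤ omC ^ (Fintype.card ι) * gi ζ (omp R) 1 S u := by
    unfold HH gi
    simp only [Um_zero, zero_add, ENNReal.rpow_one]
    exact omp_ge hR (measurable_gg_right ζ S u)
  calc gg ζ u S x ≤ C * HH 1 (fun _ => R) i 0 (gg ζ u S) x := h1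
    _ ≤ C * ((3 ^ 1) ^ (Fintype.card ι) * (omC ^ (Fintype.card ι) * gi ζ (omp R) 1 S u)) := by
      gcongr; exact h2.trans (by gcongr)
    _ = _ := by ring

theorem four_eq (k : ℕ) : (4:ℝ) ^ k = 2 ^ k * 2 ^ k := by rw [← mul_pow]; norm_num

theorem Adm.abs_le {d : ℕ} {B : ℝ} {m : ℕ} {ζ : I → Fin d ⊕ Unit → ℝ} {S : Finset I} {k : I → Fin d → ℤ}
    (h : Adm d B m ζ S k) (hB : 0 ≤ B) {l : I} (hl : l ∈ S) (j : Fin d) : |ζ l (Sum.inl j)| ≤ B + 2 := by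
  have h1 := h.near hB le_rfl hl j
  have h2 := cen_abs (h.cen_mem le_rfl hl j)
  have h3 : (B + 1) / 2 ^ m ≤ B + 1 := div_le_self (by linarith) (one_le_pow₀ (by norm_num))
  rw [_root_.abs_le] at *
  constructor <;> linarith

theorem Adm.abs_le' {d : ℕ} {B : ℝ} {m : ℕ} {ζ : I → Fin d ⊕ Unit → ℝ} {S : Finset I} {k : I → Fin d → ℤ}
    (h : Adm d B m ζ S k) (hB : 0 ≤ B) {l : I} (hl : l ∈ S) (j : Fin d ⊕ Unit) : |ζ l j| ≤ B + 2 + d * (B + 2) ^ 2 := by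
  rcases j with j | j
  · have := h.abs_le hB hl j
    have h2 : 0 ≤ d * (B + 2) ^ 2 := by positivity
    linarith
  · have h1 := h.tau_near hB (Nat.zero_le m) hl
    have h2 : ∑ j, ζ l (Sum.inl j) ^ 2 ≤ ∑ j : Fin d, (B + 2) ^ 2 := by
      refine Finset.sum_le_sum fun j _ => ?_
      rw [← sq_abs]
      exact pow_le_pow_left₀ (abs_nonneg _) (h.abs_le hB hl j) 2
    have h3 : 0 ≤ ∑ j, ζ l (Sum.inl j) ^ 2 := Finset.sum_nonneg fun _ _ => sq_nonneg _
    simp at h1 h2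
    rw [_root_.abs_le] at *
    constructor <;> linarith

theorem Adm.perturb {d : ℕ} {B : ℝ} {m : ℕ} {ζ : I → Fin d ⊕ Unit → ℝ} {S : Finset I} {k : I → Fin d → ℤ}
    (h : Adm d B m ζ S k) (hB : 0 ≤ B) {k1 : ℕ} (hk1 : k1 ≤ m) {I' : Type} {pr : I' → I} {ζ' : I' → Fin d ⊕ Unit → ℝ} {S' : Finset I'}
    {R : ℝ} (hR : 4 ^ k1 ≤ R)
    (hS : ∀ l' ∈ S', pr l' ∈ S) (hζ : ∀ l' ∈ S', ∀ j, |ζ' l' j - ζ (pr l') j| ≤ 1 / R) :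
    Adm d (B + 2 + d * (2 * B + 5)) k1 ζ' S' (fun l' => lab m k1 k (pr l')) := by
  have h1R : 1 / R ≤ 1 / 4 ^ k1 := one_div_le_one_div_of_le (by positivity) hR
  have hp2 : (1:ℝ) ≤ 2 ^ k1 := one_le_pow₀ (by norm_num)
  have hp4 : (1:ℝ) ≤ 4 ^ k1 := one_le_pow₀ (by norm_num)
  have h5 : 0 ≤ d * (2 * B + 5) := by positivity
  refine ⟨fun l hl j => (h.cen_mem hk1 (hS l hl) j).1, fun l hl j => (h.cen_mem hk1 (hS l hl) j).2, fun l hl j => ?_, fun l hl => ?_⟩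
  · have h1 := h.near hB hk1 (hS l hl) j
    have h2 := hζ l hl (Sum.inl j)
    have e : 2 ^ k1 * ζ' l (Sum.inl j) - (lab m k1 k (pr l) j : ℝ) = 2 ^ k1 * ((ζ' l (Sum.inl j) - ζ (pr l) (Sum.inl j)) + (ζ (pr l) (Sum.inl j) - cen k1 (lab m k1 k (pr l)) j)) := by
      unfold cen; field_simp; ring
    rw [e, abs_mul, abs_of_pos (by positivity)]
    calc _ ≤ 2 ^ k1 * (1 / 4 ^ k1 + (B + 1) / 2 ^ k1) := by
          gcongr; exact (abs_add_le _ _).trans (add_le_add (h2.trans h1R) h1)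
      _ = 1 / 2 ^ k1 + (B + 1) := by rw [four_eq]; field_simp
      _ ≤ 1 + (B + 1) := by gcongr; rw [div_le_one (by positivity)]; exact hp2
      _ ≤ _ := by linarith
  · have h1 := h.tau_near hB hk1 (hS l hl)
    have h2 := (hζ l hl (Sum.inr ())).trans h1R
    have h3 : |∑ j, ζ (pr l) (Sum.inl j) ^ 2 - ∑ j, ζ' l (Sum.inl j) ^ 2| ≤ d * ((2 * B + 5) / 4 ^ k1) := by
      rw [← Finset.sum_sub_distrib]
      refine (Finset.abs_sum_le_sum_abs _ _).trans ?_
      calc _ ≤ ∑ j : Fin d, (2 * B + 5) / 4 ^ k1 := by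
            refine Finset.sum_le_sum fun j _ => ?_
            have a1 := (hζ l hl (Sum.inl j)).trans h1R
            have a2 := h.abs_le hB (hS l hl) j
            have a3 : (1:ℝ) / 4 ^ k1 ≤ 1 := by rw [div_le_one (by positivity)]; exact hp4
            have e : ζ (pr l) (Sum.inl j) ^ 2 - ζ' l (Sum.inl j) ^ 2 =
              (ζ (pr l) (Sum.inl j) - ζ' l (Sum.inl j)) * (2 * ζ (pr l) (Sum.inl j) + (ζ' l (Sum.inl j) - ζ (pr l) (Sum.inl j))) := by ring
            rw [e, abs_mul, abs_sub_comm]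
            have a4 : |2 * ζ (pr l) (Sum.inl j) + (ζ' l (Sum.inl j) - ζ (pr l) (Sum.inl j))| ≤ 2 * B + 5 := by
              refine (abs_add_le _ _).trans ?_
              rw [abs_mul, abs_two]; linarith
            calc _ ≤ 1 / 4 ^ k1 * (2 * B + 5) := by gcongr
              _ = _ := by ring
        _ = _ := by simp
    have e : ζ' l (Sum.inr ()) - ∑ j, ζ' l (Sum.inl j) ^ 2 = (ζ' l (Sum.inr ()) - ζ (pr l) (Sum.inr ())) +
      ((ζ (pr l) (Sum.inr ()) - ∑ j, ζ (pr l) (Sum.inl j) ^ 2) + (∑ j, ζ (pr l) (Sum.inl j) ^ 2 - ∑ j, ζ' l (Sum.inl j) ^ 2)) := by ring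
    rw [e]
    calc _ ≤ 4 ^ k1 * (1 / 4 ^ k1 + (B / 4 ^ k1 + d * ((2 * B + 5) / 4 ^ k1))) := by
          gcongr
          refine (abs_add_le _ _).trans (add_le_add h2 ((abs_add_le _ _).trans (add_le_add h1 h3)))
      _ = 1 + (B + d * (2 * B + 5)) := by field_simp
      _ ≤ _ := by linarith

theorem narrow_loc {d : ℕ} {q : ℝ} (hq : 1 ≤ q) (hT : TT d q) {B Cs ε : ℝ} (hB : 0 ≤ B) (hCs : 0 ≤ Cs) (hε : 0 < ε) :
    ∃ C : ℝ≥0∞, C ≠ ⊤ ∧ ∀ (k1 m : ℕ) (I : Type) (ζ : I → Fin (d + 1) ⊕ Unit → ℝ) (S : Finset I)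
      (k : I → Fin (d + 1) → ℤ), Adm (d + 1) B m ζ S k → k1 ≤ m → ∀ (N : Fin (d + 1) → ℝ) (c0 : ℝ), ∑ j, N j ^ 2 = 1 →
      (∀ l ∈ S, |ph N (fun j => ζ l (Sum.inl j)) - c0| ≤ Cs / 2 ^ k1) → ∀ u : I → ℂ,
      (gi ζ (ub (4 ^ k1)) q S u) ^ (1 / q) ≤ C * 2 ^ (ε * (k1:ℝ)) *
        ∑ J ∈ img S (lab m k1 k), (gi ζ (omp (4 ^ k1)) q (fib S (lab m k1 k) J) u) ^ (1 / q) := by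
  obtain ⟨C, hC, h⟩ := slab (d := d) hq hT (B := B + 2 + ((d + 1 : ℕ) : ℝ) * (2 * B + 5)) (Cs := Cs + (d + 1)) (ε := ε) (by positivity) (by positivity) hε
  refine ⟨locC (Fin (d + 1) ⊕ Unit) q * C, ENNReal.mul_ne_top (locC_ne hq) hC, ?_⟩
  intro k1 m I ζ S k hA hk1 N c0 hN hs u
  have := loc hq (R := 4 ^ k1) (by positivity) (ζ := ζ) (S := S) (k := lab m k1 k) (D := C * 2 ^ (ε * (k1:ℝ))) (ENNReal.mul_ne_top hC (by simp)) ?_ u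
  · rwa [← mul_assoc] at this
  · intro I' pr ζ' S' μ' hμ hst hS hζ
    refine h k1 I' μ' hμ ζ' S' _ hst (hA.perturb hB hk1 le_rfl hS hζ) N c0 hN ?_
    intro l hl
    have h1 := hs (pr l) (hS l hl)
    have h2 := abs_ph_le N (fun j => ζ' l (Sum.inl j) - ζ (pr l) (Sum.inl j)) zero_le_one (unit_abs_le hN) (fun j => hζ l hl (Sum.inl j))
    have e : ph N (fun j => ζ' l (Sum.inl j)) - c0 = (ph N (fun j => ζ (pr l) (Sum.inl j)) - c0) + ph N (fun j => ζ' l (Sum.inl j) - ζ (pr l) (Sum.inl j)) := by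
      have := ph_sub_right N (fun j => ζ' l (Sum.inl j)) (fun j => ζ (pr l) (Sum.inl j))
      have e2 : ph N (fun j => ζ' l (Sum.inl j) - ζ (pr l) (Sum.inl j)) = ph N ((fun j => ζ' l (Sum.inl j)) - (fun j => ζ (pr l) (Sum.inl j))) := rfl
      rw [e2, this]; ring
    rw [e]
    refine (abs_add_le _ _).trans ((add_le_add h1 h2).trans ?_)
    have hp2 : (1:ℝ) ≤ 2 ^ k1 := one_le_pow₀ (by norm_num)
    rw [add_div, Fintype.card_fin]
    gcongr
    push_cast
    rw [one_mul, mul_one_div]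
    gcongr
    norm_num

/-- From a degenerate direction to a slab. -/
theorem slab_geom {d : ℕ} {τ : ℝ} (hτ0 : 0 ≤ τ) (hτ : τ ≤ 1 / 2) {N : Fin d ⊕ Unit → ℝ} (hN : ∑ j, N j ^ 2 = 1)
    {X : Set (Fin d → ℝ)} (hX : X.Nonempty) (hX1 : ∀ c ∈ X, ∀ j, |c j| ≤ 1) (h : ∀ c ∈ X, |ph N (bvec c)| ≤ τ) :
    ∃ (N' : Fin d → ℝ) (c0 : ℝ), ∑ j, N' j ^ 2 = 1 ∧ ∀ c ∈ X, |ph N' c - c0| ≤ (1 + 2 * d) * τ := by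
  have e : ∀ c, ph N (bvec c) = N (Sum.inr ()) - 2 * ph (fun j => N (Sum.inl j)) c := by
    intro c
    rw [ph_comm, bvec, ph_sumtype (fun j => -2 * c j) 1 N]
    have : ph (fun j => -2 * c j) (fun j => N (Sum.inl j)) = -2 * ph (fun j => N (Sum.inl j)) c := by
      rw [ph_comm]; unfold ph; rw [Finset.mul_sum]; exact Finset.sum_congr rfl fun j _ => by ring
    rw [this]; ring
  set Q := ∑ j, N (Sum.inl j) ^ 2 with hQ
  have hQ0 : 0 ≤ Q := Finset.sum_nonneg fun _ _ => sq_nonneg _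
  have hN1 : Q + N (Sum.inr ()) ^ 2 = 1 := by rw [← hN, Fintype.sum_sum_type]; simp [hQ]
  set s := √Q with hs
  have hs2 : s ^ 2 = Q := Real.sq_sqrt hQ0
  have hs0 : 0 ≤ s := Real.sqrt_nonneg _
  have hNj : ∀ j, |N (Sum.inl j)| ≤ s := by
    intro j
    refine Real.abs_le_sqrt ?_
    exact Finset.single_le_sum (f := fun j => N (Sum.inl j) ^ 2) (fun _ _ => sq_nonneg _) (Finset.mem_univ j)
  obtain ⟨c, hc⟩ := hX
  have h1 := h c hc
  rw [e] at h1
  have h2 := abs_ph_le (fun j => N (Sum.inl j)) c hs0 hNj (hX1 c hc)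
  rw [Fintype.card_fin, mul_one] at h2
  have h3 : |N (Sum.inr ())| ≤ τ + 2 * (d * s) := by
    rw [abs_le] at *; constructor <;> linarith
  have h4 : 1 ≤ s + |N (Sum.inr ())| := by
    have := abs_nonneg (N (Sum.inr ()))
    have h5 : |N (Sum.inr ())| ^ 2 = N (Sum.inr ()) ^ 2 := sq_abs _
    nlinarith [mul_nonneg hs0 this]
  have h5 : 1 / 2 ≤ (1 + 2 * d) * s := by linarith
  have hsp : 0 < s := by
    by_contra hcon
    have : s = 0 := le_antisymm (not_lt.1 hcon) hs0
    rw [this] at h5; norm_num at h5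
  refine ⟨s⁻¹ • (fun j => N (Sum.inl j)), N (Sum.inr ()) / (2 * s), ?_, fun c hc => ?_⟩
  · simp only [Pi.smul_apply, smul_eq_mul, mul_pow]
    rw [← Finset.mul_sum, ← hQ, ← hs2]; field_simp
  · have h1 := h c hc
    rw [e, abs_sub_comm] at h1
    rw [ph_smul_left]
    have e2 : s⁻¹ * ph (fun j => N (Sum.inl j)) c - N (Sum.inr ()) / (2 * s) = (2 * ph (fun j => N (Sum.inl j)) c - N (Sum.inr ())) / (2 * s) := by
      field_simp
    rw [e2, abs_div, abs_of_pos (by positivity : 0 < 2 * s), div_le_iff₀ (by positivity)]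
    nlinarith

end DR

namespace DR
open scoped ENNReal NNReal
open scoped Classical
variable {ι : Type} [Fintype ι] {I : Type}

theorem gg_le_card {Λ : Type} (ζ : I → ι → ℝ) (S : Finset I) (u : I → ℂ) (la : I → Λ) (N : ℕ)
    (hN : (img S la).card ≤ N) (x : ι → ℝ) :
    gg ζ u S x ≤ N * ∑ J ∈ img S la, gg ζ u (fib S la J) x := by
  unfold gg
  rw [es_fiber ζ u S la x]
  refine (enorm_sum_sq _ _).trans ?_
  have : ((S.image la).card : ℝ≥0∞) ≤ N := by exact_mod_cast hN
  exact mul_le_mul' this le_rfl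

theorem gi_split {q : ℝ} (hq : 1 ≤ q) (ζ : I → ι → ℝ) (ν : Measure (ι → ℝ)) (S S0 S1 : Finset I) (u : I → ℂ)
    (e : ∀ x, es ζ u S x = es ζ u S0 x + es ζ u S1 x) :
    (gi ζ ν q S u) ^ (1 / q) ≤ 2 * ((gi ζ ν q S0 u) ^ (1 / q) + (gi ζ ν q S1 u) ^ (1 / q)) := by
  have hq0 : 0 < q := by linarith
  set F : Bool → Finset I := fun b => cond b S0 S1 with hF
  have key : ∀ x, gg ζ u S x ≤ ∑ b : Bool, 2 * gg ζ u (F b) x := by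
    intro x
    have h := enorm_sum_sq (Finset.univ : Finset Bool) (fun b => es ζ u (F b) x)
    rw [Fintype.sum_bool, Fintype.sum_bool, Finset.card_univ, Fintype.card_bool] at h
    rw [Fintype.sum_bool, ← mul_add]
    unfold gg; rw [e]; exact_mod_cast h
  unfold gi
  calc (∫⁻ x, gg ζ u S x ^ q ∂ν) ^ (1 / q)
      ≤ (∫⁻ x, (∑ b : Bool, 2 * gg ζ u (F b) x) ^ q ∂ν) ^ (1 / q) := by
        gcongr with x; exact key x
    _ ≤ ∑ b : Bool, (∫⁻ x, (2 * gg ζ u (F b) x) ^ q ∂ν) ^ (1 / q) :=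
        lq_sum_le ν hq Finset.univ (fun b x => 2 * gg ζ u (F b) x)
          (fun b _ => (measurable_gg_right ζ _ u).const_mul 2)
    _ = ∑ b : Bool, 2 * (∫⁻ x, (gg ζ u (F b) x) ^ q ∂ν) ^ (1 / q) := by
        refine Finset.sum_congr rfl fun b _ => ?_
        have hm : Measurable (fun x => gg ζ u (F b) x ^ q) :=
          (measurable_gg_right ζ _ u).pow_const q
        simp_rw [ENNReal.mul_rpow_of_nonneg _ _ hq0.le]
        rw [lintegral_const_mul _ hm, ENNReal.mul_rpow_of_nonneg _ _ (by positivity), ← ENNReal.rpow_mul,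
          mul_one_div_cancel hq0.ne', ENNReal.rpow_one]
    _ = _ := by
        rw [Fintype.sum_bool, ← mul_add, hF]; rfl

theorem gi_le_const {q : ℝ} (hq : 0 ≤ q) {ζ : I → ι → ℝ} {ν : Measure (ι → ℝ)} [IsProbabilityMeasure ν] {S : Finset I} {u : I → ℂ}
    {M : ℝ≥0∞} (h : ∀ᵐ x ∂ν, gg ζ u S x ≤ M) : gi ζ ν q S u ≤ M ^ q := by
  unfold gi
  calc ∫⁻ x, gg ζ u S x ^ q ∂ν ≤ ∫⁻ x, M ^ q ∂ν := by
        refine lintegral_mono_ae (h.mono fun x hx => ?_)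
        exact ENNReal.rpow_le_rpow hx hq
    _ = _ := by simp

theorem ex_max {Λ : Type} (s : Finset Λ) (hs : s.Nonempty) (f : Λ → ℝ≥0∞) {N : ℕ} (hN : s.card ≤ N) :
    ∃ a ∈ s, ∑ b ∈ s, f b ≤ N * f a := by
  obtain ⟨a, ha, h⟩ := Finset.exists_max_image s f hs
  refine ⟨a, ha, (Finset.sum_le_card_nsmul s f (f a) h).trans ?_⟩
  rw [nsmul_eq_mul]
  have : (s.card : ℝ≥0∞) ≤ N := by exact_mod_cast hN
  gcongr

theorem sum_small {Λ : Type} (s : Finset Λ) (f : Λ → ℝ≥0∞) {N : ℕ} (hN : s.card ≤ N) (hN0 : 0 < N) {M : ℝ≥0∞}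
    (h : ∀ a ∈ s, N * f a ≤ M) : ∑ b ∈ s, f b ≤ M := by
  have hn0 : (N : ℝ≥0∞) ≠ 0 := by exact_mod_cast hN0.ne'
  have h2 : ∀ a ∈ s, f a ≤ M / N := fun a ha => by
    rw [ENNReal.le_div_iff_mul_le (Or.inl hn0) (Or.inl (ENNReal.natCast_ne_top N)), mul_comm]; exact h a ha
  refine (Finset.sum_le_card_nsmul s f _ h2).trans ?_
  rw [nsmul_eq_mul]
  have : (s.card : ℝ≥0∞) ≤ N := by exact_mod_cast hN
  calc (s.card : ℝ≥0∞) * (M / N) ≤ N * (M / N) := by gcongr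
    _ = M := ENNReal.mul_div_cancel hn0 (ENNReal.natCast_ne_top N)

def tup (d : ℕ) (Θ : ℝ) (k2 : ℕ) : Finset (Fin d ⊕ Unit → Fin d → ℤ) :=
  (Fintype.piFinset (fun _ => Fintype.piFinset (fun _ => Finset.Ico 0 (2 ^ k2)))).filter
    (fun α => TR Θ (fun i => bvec (cen k2 (α i))))

theorem mem_tup {d : ℕ} {Θ : ℝ} {k2 : ℕ} {α : Fin d ⊕ Unit → Fin d → ℤ} :
    α ∈ tup d Θ k2 ↔ (∀ i j, 0 ≤ α i j ∧ α i j < 2 ^ k2) ∧ TR Θ (fun i => bvec (cen k2 (α i))) := by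
  simp only [tup, Finset.mem_filter, Fintype.mem_piFinset, Finset.mem_Ico]

theorem ub_ae {R : ℝ} (hR : 0 < R) : ∀ᵐ x ∂(ub R : Measure (ι → ℝ)), ∀ j, |x j| ≤ R := lam_pi_ae hR

theorem bn {d : ℕ} {q : ℝ} (hq : 1 ≤ q) (hT : TT d q) {B ε : ℝ} (hB : 0 ≤ B) (hε : 0 < ε) :
    ∃ C' : ℝ≥0∞, C' ≠ ⊤ ∧ ∀ k1 : ℕ, ∃ Θ : ℝ, 0 ≤ Θ ∧ ∀ k2, k1 ≤ k2 → ∃ CB : ℝ≥0∞, CB ≠ ⊤ ∧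
      ∀ (I : Type) (ζ : I → Fin (d + 1) ⊕ Unit → ℝ) (S : Finset I) (k : I → Fin (d + 1) → ℤ) (m : ℕ),
        Adm (d + 1) B m ζ S k → k2 ≤ m → ∀ u : I → ℂ,
        gi ζ (ub (4 ^ k1)) q S u ≤
          (C' * 2 ^ (ε * (k1:ℝ)) * ∑ J ∈ img S (lab m k1 k), (gi ζ (omp (4 ^ k1)) q (fib S (lab m k1 k) J) u) ^ (1 / q)) ^ q
          + CB * ∑ α ∈ tup (d + 1) Θ k2, ∏ i, (gi ζ (omp (4 ^ k1)) 1 (fib S (lab m k2 k) (α i)) u) ^ (q / Fintype.card (Fin (d + 1) ⊕ Unit)) := by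
  have hq0 : 0 < q := by linarith
  set Cs : ℝ := (1 + 2 * ((d + 1 : ℕ) : ℝ)) + (d + 1 : ℕ) * (3 * (B + 1)) with hCs
  have hCs0 : 0 ≤ Cs := by positivity
  obtain ⟨C, hC, hnar⟩ := narrow_loc hq hT hB hCs0 hε
  refine ⟨2 * (C + 1), ENNReal.mul_ne_top (by simp) (by simp [hC]), fun k1 => ?_⟩
  have hτ : (0:ℝ) < 1 / 2 ^ k1 / 2 := by positivity
  obtain ⟨Θ, hΘ, hsel⟩ := tr_sel (ι := Fin (d + 1) ⊕ Unit) hτ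
  refine ⟨Θ, hΘ, fun k2 hk12 => ?_⟩
  have hR : (0:ℝ) < 4 ^ k1 := by positivity
  set Z : ℝ := B + 2 + (d + 1 : ℕ) * (B + 2) ^ 2 with hZ
  have hZ0 : 0 < Z := by positivity
  obtain ⟨CK, hCK, hbern⟩ := bern (ι := Fin (d + 1) ⊕ Unit) hR hZ0
  set N1 : ℕ := 2 ^ (k1 * (d + 1)) with hN1
  set N2 : ℕ := 2 ^ (k2 * (d + 1)) with hN2
  have hN1p : 0 < N1 := by positivity
  set T : ℝ≥0∞ := N1 * (N1 * CK) with hTdef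
  have hTtop : T ≠ ⊤ := ENNReal.mul_ne_top (by simp) (ENNReal.mul_ne_top (by simp) hCK)
  refine ⟨(N1 * CK) ^ q * (T * (N2 * N2)) ^ q, ?_, ?_⟩
  · refine ENNReal.mul_ne_top (ENNReal.rpow_ne_top_of_nonneg hq0.le (ENNReal.mul_ne_top (by simp) hCK))
      (ENNReal.rpow_ne_top_of_nonneg hq0.le (ENNReal.mul_ne_top hTtop (ENNReal.mul_ne_top (by simp) (by simp))))
  intro I ζ S k m hA hk2 u
  have hk1 : k1 ≤ m := hk12.trans hk2
  haveI := omp_prob (ι := Fin (d + 1) ⊕ Unit) hR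
  haveI := ub_prob (ι := Fin (d + 1) ⊕ Unit) hR
  set l1 := lab m k1 k with hl1
  set l2 := lab m k2 k with hl2
  set ν : Measure (Fin (d + 1) ⊕ Unit → ℝ) := omp (4 ^ k1) with hν
  set b : (Fin (d + 1) → ℤ) → ℝ≥0∞ := fun β => gi ζ ν 1 (fib S l1 β) u with hb
  set Bm : ℝ≥0∞ := ∑ β ∈ img S l1, b β with hBm
  set Y : ℝ≥0∞ := ∑ J ∈ img S l1, (gi ζ ν q (fib S l1 J) u) ^ (1 / q) with hY
  have hBY : Bm ≤ Y := by
    refine Finset.sum_le_sum fun β _ => ?_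
    have := jensen_le ν hq (measurable_gg_right ζ (fib S l1 β) u)
    simp only [hb, gi, ENNReal.rpow_one]
    exact this
  have hc1 : (img S l1).card ≤ N1 := hA.card_img hk1
  have hSb : ∀ S' : Finset I, S' ⊆ S → ∀ l ∈ S', ∀ j, |ζ l j| ≤ Z := fun S' hS' l hl j => hA.abs_le' hB (hS' hl) j
  set sig : (Fin (d + 1) → ℤ) → Prop := fun β => Bm ≤ T * b β with hsig
  set S0 := S.filter (fun l => sig (l1 l)) with hS0
  set S1 := S.filter (fun l => ¬ sig (l1 l)) with hS1
  -- the selected caps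
  have hA2 : ∀ β, ∃ α, β ∈ img S l1 → (∃ l0 ∈ S, l1 l0 = β ∧ l2 l0 = α) ∧ b β ≤ N2 * N2 * gi ζ ν 1 (fib S l2 α) u := by
    intro β
    by_cases hβ : β ∈ img S l1
    swap
    · exact ⟨0, fun h => absurd h hβ⟩
    have hne : (img (fib S l1 β) l2).Nonempty := by
      obtain ⟨l, hl, h⟩ := mem_img.1 hβ
      exact ⟨l2 l, mem_img.2 ⟨l, mem_fib.2 ⟨hl, h⟩, rfl⟩⟩
    have hcard : (img (fib S l1 β) l2).card ≤ N2 := (hA.mono fib_sub).card_img hk2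
    obtain ⟨α, hα, hle⟩ := ex_max _ hne (fun α => gi ζ ν 1 (fib (fib S l1 β) l2 α) u) hcard
    obtain ⟨l0, hl0, h0⟩ := mem_img.1 hα
    rw [mem_fib] at hl0
    refine ⟨α, fun _ => ⟨⟨l0, hl0.1, hl0.2, h0⟩, ?_⟩⟩
    have hff : fib (fib S l1 β) l2 α = fib S l2 α := by
      ext l
      simp only [mem_fib]
      constructor
      · rintro ⟨⟨h1, _⟩, h2⟩; exact ⟨h1, h2⟩
      · rintro ⟨h1, h2⟩
        refine ⟨⟨h1, ?_⟩, h2⟩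
        rw [← hl0.2, hl1, lab_nest hk12 hk2 k l, lab_nest hk12 hk2 k l0, ← hl2, h2, h0]
    rw [hff] at hle
    calc b β ≤ N2 * ∑ J ∈ img (fib S l1 β) l2, gi ζ ν 1 (fib (fib S l1 β) l2 J) u := gi_le_card _ _ _ _ _ _ hcard
      _ ≤ N2 * (N2 * gi ζ ν 1 (fib S l2 α) u) := by gcongr
      _ = _ := by ring
  choose A hAA using hA2
  set X : Set (Fin (d + 1) → ℝ) := {x | ∃ β ∈ img S l1, sig β ∧ x = cen k2 (A β)} with hX
  have hmemA : ∀ β ∈ img S l1, ∀ j, 0 ≤ A β j ∧ A β j < 2 ^ k2 := by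
    intro β hβ j
    obtain ⟨⟨l0, hl0, _, h⟩, _⟩ := hAA β hβ
    rw [← h]
    exact hA.cen_mem hk2 hl0 j
  have hX1 : ∀ x ∈ X, ∀ j, |x j| ≤ 1 := by
    rintro x ⟨β, hβ, _, rfl⟩ j
    exact cen_abs (hmemA β hβ j)
  have hboxae : ∀ᵐ x ∂(ub (4 ^ k1) : Measure (Fin (d + 1) ⊕ Unit → ℝ)), ∀ j, |x j| ≤ 4 ^ k1 := ub_ae hR
  rcases hsel (bvec '' X) (by rintro _ ⟨x, hx, rfl⟩ j; exact bvec_abs (hX1 x hx) j) with ⟨N, hN, hslab⟩ | ⟨bb, hbb, hTR⟩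
  · -- narrow case
    refine le_add_of_le_of_nonneg ?_ bot_le
    have hS1b : (gi ζ (ub (4 ^ k1)) q S1 u) ^ (1 / q) ≤ Y := by
      have h1 : gi ζ (ub (4 ^ k1)) q S1 u ≤ Bm ^ q := by
        refine gi_le_const hq0.le (hboxae.mono fun x hx => ?_)
        have hcard : (img S1 l1).card ≤ N1 := (hA.mono (Finset.filter_subset _ _)).card_img hk1
        refine (gg_le_card ζ S1 u l1 N1 hcard x).trans ?_
        rw [Finset.mul_sum]
        refine sum_small _ _ hcard hN1p fun β hβ => ?_
        have hns : ¬ sig β := by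
          obtain ⟨l, hl, h⟩ := mem_img.1 hβ
          rw [← h]; exact (Finset.mem_filter.1 hl).2
        have hle : T * b β ≤ Bm := (not_le.1 hns).le
        refine le_trans ?_ hle
        have hsub : fib S1 l1 β = fib S l1 β := by
          ext l
          simp only [mem_fib, hS1, Finset.mem_filter]
          constructor
          · rintro ⟨⟨h1, _⟩, h2⟩; exact ⟨h1, h2⟩
          · rintro ⟨h1, h2⟩; exact ⟨⟨h1, by rw [h2]; exact hns⟩, h2⟩
        rw [hsub]
        calc (N1:ℝ≥0∞) * (N1 * gg ζ u (fib S l1 β) x) ≤ N1 * (N1 * (CK * b β)) := by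
              gcongr; exact hbern I ζ u _ (hSb _ fib_sub) x hx
          _ = T * b β := by rw [hTdef]; ring
      calc (gi ζ (ub (4 ^ k1)) q S1 u) ^ (1 / q) ≤ (Bm ^ q) ^ (1 / q) := by gcongr
        _ = Bm := by rw [← ENNReal.rpow_mul, mul_one_div_cancel hq0.ne', ENNReal.rpow_one]
        _ ≤ Y := hBY
    have hS0b : (gi ζ (ub (4 ^ k1)) q S0 u) ^ (1 / q) ≤ C * 2 ^ (ε * (k1:ℝ)) * Y := by
      rcases Finset.eq_empty_or_nonempty S0 with he | hne
      · rw [he]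
        have : gi ζ (ub (4 ^ k1)) q (∅ : Finset I) u = 0 := by
          simp [gi, gg, es, hq0]
        rw [this, ENNReal.zero_rpow_of_pos (by positivity)]; exact bot_le
      have hS0S : S0 ⊆ S := Finset.filter_subset _ _
      have hXne : X.Nonempty := by
        obtain ⟨l, hl⟩ := hne
        obtain ⟨hl', hs⟩ := Finset.mem_filter.1 hl
        exact ⟨_, l1 l, mem_img.2 ⟨l, hl', rfl⟩, hs, rfl⟩
      have hp2 : (1:ℝ) ≤ 2 ^ k1 := one_le_pow₀ (by norm_num)
      obtain ⟨N', c0, hN', hc0⟩ := slab_geom hτ.le (by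
        have : 1 / (2:ℝ) ^ k1 ≤ 1 := by rw [div_le_one (by positivity)]; exact hp2
        linarith) hN hXne hX1 (fun c hc => hslab _ ⟨c, hc, rfl⟩)
      have h := hnar k1 m I ζ S0 k (hA.mono hS0S) hk1 N' c0 hN' (by
        intro l hl
        obtain ⟨hlS, hs⟩ := Finset.mem_filter.1 hl
        have hβ : l1 l ∈ img S l1 := mem_img.2 ⟨l, hlS, rfl⟩
        obtain ⟨⟨l0, hl0, h01, h02⟩, _⟩ := hAA _ hβ
        have e1 := hc0 _ ⟨l1 l, hβ, hs, rfl⟩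
        have e2 : |ph N' ((fun j => ζ l (Sum.inl j)) - cen k2 (A (l1 l)))| ≤ (d + 1 : ℕ) * (1 * (3 * (B + 1) / 2 ^ k1)) := by
          have := abs_ph_le N' ((fun j => ζ l (Sum.inl j)) - cen k2 (A (l1 l))) (x := 1) (y := 3 * (B + 1) / 2 ^ k1) zero_le_one
            (unit_abs_le hN') (fun j => by
              have a1 := hA.near hB hk1 hlS j
              have a2 := hA.near hB hk1 hl0 j
              have a3 := hA.near hB hk2 hl0 j
              rw [← hl1, h01] at a2
              rw [← hl2, h02] at a3
              rw [← hl1] at a1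
              have a4 : (B + 1) / (2:ℝ) ^ k2 ≤ (B + 1) / 2 ^ k1 := by
                gcongr; norm_num
              simp only [Pi.sub_apply]
              have : 3 * (B + 1) / (2:ℝ) ^ k1 = (B + 1) / 2 ^ k1 + (B + 1) / 2 ^ k1 + (B + 1) / 2 ^ k1 := by ring
              rw [this]
              rw [_root_.abs_le] at *
              constructor <;> linarith [a1.1, a1.2, a2.1, a2.2, a3.1, a3.2])
          rwa [Fintype.card_fin] at this
        rw [ph_sub_right] at e2
        have e3 : |ph N' (fun j => ζ l (Sum.inl j)) - c0| ≤ (1 + 2 * ((d + 1 : ℕ):ℝ)) * (1 / 2 ^ k1 / 2) + (d + 1 : ℕ) * (1 * (3 * (B + 1) / 2 ^ k1)) := by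
          have := abs_add_le (ph N' (cen k2 (A (l1 l))) - c0) (ph N' (fun j => ζ l (Sum.inl j)) - ph N' (cen k2 (A (l1 l))))
          have e : ph N' (cen k2 (A (l1 l))) - c0 + (ph N' (fun j => ζ l (Sum.inl j)) - ph N' (cen k2 (A (l1 l)))) = ph N' (fun j => ζ l (Sum.inl j)) - c0 := by ring
          rw [e] at this
          exact this.trans (add_le_add e1 e2)
        refine e3.trans ?_
        rw [hCs, add_div]
        refine add_le_add ?_ (le_of_eq (by ring))
        rw [← mul_one_div (1 + 2 * ((d + 1 : ℕ):ℝ))]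
        refine mul_le_mul_of_nonneg_left ?_ (by positivity)
        have : 0 < 1 / (2:ℝ) ^ k1 := by positivity
        linarith) u
      refine h.trans ?_
      gcongr
      calc ∑ J ∈ img S0 (lab m k1 k), (gi ζ (omp (4 ^ k1)) q (fib S0 (lab m k1 k) J) u) ^ (1 / q)
          = ∑ J ∈ img S0 l1, (gi ζ ν q (fib S l1 J) u) ^ (1 / q) := by
            refine Finset.sum_congr rfl fun β hβ => ?_
            have hs : sig β := by
              obtain ⟨l, hl, h⟩ := mem_img.1 hβ
              rw [← h]; exact (Finset.mem_filter.1 hl).2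
            have : fib S0 l1 β = fib S l1 β := by
              ext l
              simp only [mem_fib, hS0, Finset.mem_filter]
              constructor
              · rintro ⟨⟨h1, _⟩, h2⟩; exact ⟨h1, h2⟩
              · rintro ⟨h1, h2⟩; exact ⟨⟨h1, by rw [h2]; exact hs⟩, h2⟩
            rw [← hl1, this]
        _ ≤ Y := Finset.sum_le_sum_of_subset (fun β hβ => by
            obtain ⟨l, hl, h⟩ := mem_img.1 hβ
            exact mem_img.2 ⟨l, hS0S hl, h⟩)
    have h2k : (1:ℝ≥0∞) ≤ 2 ^ (ε * (k1:ℝ)) := by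
      have := two_rpow_mono (x := 0) (y := ε * (k1:ℝ)) (by positivity)
      rwa [ENNReal.rpow_zero] at this
    have hfin : (gi ζ (ub (4 ^ k1)) q S u) ^ (1 / q) ≤ 2 * (C + 1) * 2 ^ (ε * (k1:ℝ)) * Y := by
      refine (gi_split hq ζ _ S S0 S1 u (fun x => by
        simp only [es, hS0, hS1]; rw [Finset.sum_filter_add_sum_filter_not])).trans ?_
      calc _ ≤ 2 * (C * 2 ^ (ε * (k1:ℝ)) * Y + 2 ^ (ε * (k1:ℝ)) * Y) := by
            refine mul_le_mul' le_rfl (add_le_add hS0b (hS1b.trans ?_))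
            exact le_mul_of_one_le_left bot_le h2k
        _ = _ := by ring
    calc gi ζ (ub (4 ^ k1)) q S u = ((gi ζ (ub (4 ^ k1)) q S u) ^ (1 / q)) ^ q := by
          rw [← ENNReal.rpow_mul, one_div_mul_cancel hq0.ne', ENNReal.rpow_one]
      _ ≤ _ := ENNReal.rpow_le_rpow hfin hq0.le
  · -- broad case
    refine le_add_of_nonneg_of_le bot_le ?_
    have hex : ∀ i, ∃ β, β ∈ img S l1 ∧ sig β ∧ bb i = bvec (cen k2 (A β)) := by
      intro i
      obtain ⟨x, ⟨β, h1, h2, h3⟩, h4⟩ := hbb i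
      exact ⟨β, h1, h2, by rw [← h4, h3]⟩
    choose β hβ hβs hβe using hex
    have hmem : (fun i => A (β i)) ∈ tup (d + 1) Θ k2 := by
      rw [mem_tup]
      refine ⟨fun i j => hmemA _ (hβ i) j, ?_⟩
      have : (fun i => bvec (cen k2 (A (β i)))) = bb := by funext i; rw [hβe]
      rw [this]; exact hTR
    have hBi : ∀ i, Bm ≤ T * (N2 * N2) * gi ζ ν 1 (fib S l2 (A (β i))) u := fun i =>
      calc Bm ≤ T * b (β i) := hβs i
        _ ≤ T * (N2 * N2 * gi ζ ν 1 (fib S l2 (A (β i))) u) := by gcongr; exact (hAA _ (hβ i)).2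
        _ = _ := by ring
    have hn0 : 0 < Fintype.card (Fin (d + 1) ⊕ Unit) := Fintype.card_pos
    have hBq : Bm ^ q ≤ (T * (N2 * N2)) ^ q * ∏ i, (gi ζ ν 1 (fib S l2 (A (β i))) u) ^ (q / Fintype.card (Fin (d + 1) ⊕ Unit)) := by
      rw [← prod_pow_div hn0 rfl hq0.le Bm, ← prod_pow_div hn0 rfl hq0.le (T * (N2 * N2)), ← Finset.prod_mul_distrib]
      refine Finset.prod_le_prod' fun i _ => ?_
      rw [← ENNReal.mul_rpow_of_nonneg _ _ (by positivity)]
      exact ENNReal.rpow_le_rpow (hBi i) (by positivity)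
    have h1 : gi ζ (ub (4 ^ k1)) q S u ≤ (N1 * CK * Bm) ^ q := by
      refine gi_le_const hq0.le (hboxae.mono fun x hx => ?_)
      refine (gg_le_card ζ S u l1 N1 hc1 x).trans ?_
      rw [mul_assoc, hBm, Finset.mul_sum (a := CK)]
      gcongr with β hβ
      exact hbern I ζ u _ (hSb _ fib_sub) x hx
    refine h1.trans ?_
    rw [ENNReal.mul_rpow_of_nonneg _ _ hq0.le, mul_assoc ((N1 * CK) ^ q : ℝ≥0∞)]
    gcongr
    refine hBq.trans ?_
    gcongr
    exact Finset.single_le_sum (f := fun α : Fin (d + 1) ⊕ Unit → Fin (d + 1) → ℤ => ∏ i, (gi ζ ν 1 (fib S l2 (α i)) u) ^ (q / Fintype.card (Fin (d + 1) ⊕ Unit))) (fun _ _ => bot_le) hmem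

end DR

namespace DR
open scoped ENNReal NNReal
open scoped Classical
variable {ι : Type} [Fintype ι] {I : Type}

theorem exists_pow_ge {C : ℝ≥0∞} (hC : C ≠ ⊤) {x : ℝ} (hx : 0 < x) : ∃ k : ℕ, 1 ≤ k ∧ C ≤ 2 ^ (x * (k:ℝ)) := by
  have h1 : (1:ℝ) < 2 ^ x := Real.one_lt_rpow (by norm_num) hx
  obtain ⟨k, hk⟩ := pow_unbounded_of_one_lt C.toReal h1
  refine ⟨k + 1, by omega, ?_⟩
  have h2 : C.toReal ≤ 2 ^ (x * ((k + 1 : ℕ):ℝ)) := by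
    rw [Real.rpow_mul (by norm_num), Real.rpow_natCast]
    refine hk.le.trans (pow_le_pow_right₀ h1.le (by omega))
  rw [← ENNReal.ofReal_toReal hC]
  refine (ENNReal.ofReal_le_ofReal h2).trans ?_
  rw [← ENNReal.ofReal_rpow_of_pos (by norm_num)]
  simp

theorem bn_int {d : ℕ} {q : ℝ} (hq : 1 ≤ q) (hT : TT d q) {B ε : ℝ} (hB : 0 ≤ B) (hε : 0 < ε) :
    ∃ C' : ℝ≥0∞, C' ≠ ⊤ ∧ ∀ k1 : ℕ, ∃ Θ : ℝ, 0 ≤ Θ ∧ ∀ k2, k1 ≤ k2 → ∃ CB : ℝ≥0∞, CB ≠ ⊤ ∧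
      ∀ (I : Type) (μ : Measure (I → ℂ)) (_ : SFinite μ) (ζ : I → Fin (d + 1) ⊕ Unit → ℝ) (S : Finset I) (k : I → Fin (d + 1) → ℤ) (m : ℕ),
        Stat μ ζ → Adm (d + 1) B m ζ S k → k2 ≤ m →
        NN q μ S ^ q ≤ (C' * 2 ^ (ε * (k1:ℝ)) * S2 q μ S (lab m k1 k)) ^ q
          + CB * ∑ α ∈ tup (d + 1) Θ k2, ∫⁻ u, ∏ i, (gi ζ (omp (4 ^ k1)) 1 (fib S (lab m k2 k) (α i)) u) ^ (q / Fintype.card (Fin (d + 1) ⊕ Unit)) ∂μ := by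
  have hq0 : 0 < q := by linarith
  obtain ⟨C', hC', h⟩ := bn hq hT hB hε
  refine ⟨C', hC', fun k1 => ?_⟩
  obtain ⟨Θ, hΘ, h⟩ := h k1
  refine ⟨Θ, hΘ, fun k2 hk2 => ?_⟩
  obtain ⟨CB, hCB, h⟩ := h k2 hk2
  refine ⟨CB, hCB, ?_⟩
  intro I μ hμ ζ S k m hst hA hm
  have hR : (0:ℝ) < 4 ^ k1 := by positivity
  haveI := omp_prob (ι := Fin (d + 1) ⊕ Unit) hR
  haveI := ub_prob (ι := Fin (d + 1) ⊕ Unit) hR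
  have hmg : ∀ r S', Measurable (fun u => gi ζ (omp (4 ^ k1)) r S' u) := fun r S' => measurable_gi ζ _ r S'
  have hm1 : Measurable (fun u => (∑ J ∈ img S (lab m k1 k), (gi ζ (omp (4 ^ k1)) q (fib S (lab m k1 k) J) u) ^ (1 / q)) ^ q) :=
    (Finset.measurable_sum _ fun J _ => (hmg q _).pow_const _).pow_const _
  have hm2 : ∀ α : Fin (d + 1) ⊕ Unit → Fin (d + 1) → ℤ, Measurable (fun u => ∏ i, (gi ζ (omp (4 ^ k1)) 1 (fib S (lab m k2 k) (α i)) u) ^ (q / Fintype.card (Fin (d + 1) ⊕ Unit))) :=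
    fun α => Finset.measurable_prod _ fun i _ => (hmg 1 _).pow_const _
  have hm3 : Measurable (fun u => ∑ α ∈ tup (d + 1) Θ k2, ∏ i, (gi ζ (omp (4 ^ k1)) 1 (fib S (lab m k2 k) (α i)) u) ^ (q / Fintype.card (Fin (d + 1) ⊕ Unit))) :=
    Finset.measurable_sum _ fun α _ => hm2 α
  rw [← lintegral_gi hst hq0 (ub (4 ^ k1)) S]
  calc ∫⁻ u, gi ζ (ub (4 ^ k1)) q S u ∂μ
      ≤ ∫⁻ u, ((C' * 2 ^ (ε * (k1:ℝ))) ^ q * (∑ J ∈ img S (lab m k1 k), (gi ζ (omp (4 ^ k1)) q (fib S (lab m k1 k) J) u) ^ (1 / q)) ^ q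
        + CB * ∑ α ∈ tup (d + 1) Θ k2, ∏ i, (gi ζ (omp (4 ^ k1)) 1 (fib S (lab m k2 k) (α i)) u) ^ (q / Fintype.card (Fin (d + 1) ⊕ Unit))) ∂μ := by
        refine lintegral_mono fun u => ?_
        have := h I ζ S k m hA hm u
        rwa [ENNReal.mul_rpow_of_nonneg _ _ hq0.le] at this
    _ = (C' * 2 ^ (ε * (k1:ℝ))) ^ q * ∫⁻ u, (∑ J ∈ img S (lab m k1 k), (gi ζ (omp (4 ^ k1)) q (fib S (lab m k1 k) J) u) ^ (1 / q)) ^ q ∂μ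
        + CB * ∑ α ∈ tup (d + 1) Θ k2, ∫⁻ u, ∏ i, (gi ζ (omp (4 ^ k1)) 1 (fib S (lab m k2 k) (α i)) u) ^ (q / Fintype.card (Fin (d + 1) ⊕ Unit)) ∂μ := by
        rw [lintegral_add_left (hm1.const_mul _), lintegral_const_mul _ hm1, lintegral_const_mul _ hm3,
          lintegral_finset_sum _ fun α _ => hm2 α]
    _ ≤ _ := by
        gcongr ?_ + _
        rw [ENNReal.mul_rpow_of_nonneg _ (S2 q μ S (lab m k1 k)) hq0.le]
        gcongr
        exact lintegral_sumgi hq hst (omp (4 ^ k1)) (img S (lab m k1 k)) (fun J => fib S (lab m k1 k) J)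

/-- The decoupling exponent predicate. -/
def EE (d : ℕ) (q B η : ℝ) : Prop := ∃ C : ℝ≥0∞, C ≠ ⊤ ∧ ∀ m : ℕ, DecB d q B m (C * 2 ^ (η * (m:ℝ)))

theorem NN_triv_adm {d : ℕ} {q B : ℝ} (hq : 1 ≤ q) {m : ℕ} {μ : Measure (I → ℂ)} {ζ : I → Fin d ⊕ Unit → ℝ} {S : Finset I}
    {k : I → Fin d → ℤ} (hA : Adm d B m ζ S k) : NN q μ S ≤ ((2 ^ (m * d) : ℕ) : ℝ≥0∞) * S2 q μ S k := by
  have h := hA.card_img le_rfl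
  rw [lab_self] at h
  exact NN_triv hq μ S k h

theorem EE_triv {d : ℕ} {q B : ℝ} (hq : 1 ≤ q) : EE d q B d := by
  refine ⟨1, by simp, fun m I μ _ ζ S k hst hA => ?_⟩
  refine (NN_triv_adm hq hA).trans (le_of_eq ?_)
  rw [one_mul]
  congr 1
  rw [show (d:ℝ) * m = ((m * d : ℕ) : ℝ) by push_cast; ring, ENNReal.rpow_natCast]
  push_cast; rfl

theorem EE_mono {d : ℕ} {q B η η' : ℝ} (h : EE d q B η) (hη : η ≤ η') : EE d q B η' := by
  obtain ⟨C, hC, h⟩ := h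
  refine ⟨C, hC, fun m I μ hμ ζ S k hst hA => (h m I μ hμ ζ S k hst hA).trans ?_⟩
  gcongr
  norm_num

theorem EE_step {d : ℕ} {q : ℝ} (hq : 1 ≤ q) (hT : TT d q) (hqd : q * ((d + 1 : ℕ):ℝ) ≤ (d + 1 : ℕ) + 2) {B η0 : ℝ} (hB : 0 ≤ B) (hη0 : 0 < η0) :
    ∃ c : ℝ, 0 < c ∧ ∀ η, η0 ≤ η → EE (d + 1) q B η → EE (d + 1) q B (η - c) := by
  have hq0 : 0 < q := by linarith
  obtain ⟨c, hc, hmult⟩ := mult (d := d + 1) (by omega) hq hqd hB hη0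
  obtain ⟨C', hC', hbn⟩ := bn_int hq hT hB (ε := η0 / 4) (by positivity)
  obtain ⟨k1, hk1, hC1⟩ := exists_pow_ge (C := 2 * C') (ENNReal.mul_ne_top (by simp) hC') (x := η0 / 4) (by positivity)
  obtain ⟨Θ, hΘ, hbn⟩ := hbn k1
  obtain ⟨k2, hk2, Cm, hCm, hmult⟩ := hmult Θ hΘ k1
  obtain ⟨CB, hCB, hbn⟩ := hbn k2 hk2
  refine ⟨min c (η0 / 2), lt_min hc (by positivity), fun η hη hE => ?_⟩
  obtain ⟨Cη, hCη, hE⟩ := hE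
  set c' := min c (η0 / 2) with hc'
  have hc1 : c' ≤ c := min_le_left _ _
  have hc2 : c' ≤ η0 / 2 := min_le_right _ _
  set K : ℝ≥0∞ := (CB * ((tup (d + 1) Θ k2).card * Cm)) ^ (1 / q) * Cη with hK
  have hKt : K ≠ ⊤ := ENNReal.mul_ne_top (ENNReal.rpow_ne_top_of_nonneg (by positivity)
    (ENNReal.mul_ne_top hCB (ENNReal.mul_ne_top (by simp) hCm))) hCη
  set K0 : ℝ≥0∞ := ((2 ^ (k2 * (d + 1)) : ℕ) : ℝ≥0∞) with hK0
  have hK0t : K0 ≠ ⊤ := ENNReal.natCast_ne_top _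
  refine ⟨2 * (K + K0), ENNReal.mul_ne_top (by simp) (ENNReal.add_ne_top.2 ⟨hKt, hK0t⟩), fun m => ?_⟩
  induction m using Nat.strong_induction_on with
  | _ m ih =>
  intro I μ hμ ζ S k hst hA
  by_cases hm : m < k2
  · refine (NN_triv_adm hq hA).trans ?_
    gcongr
    have h1 : ((2 ^ (m * (d + 1)) : ℕ) : ℝ≥0∞) ≤ K0 := by
      rw [hK0]
      exact_mod_cast Nat.pow_le_pow_right (by norm_num) (Nat.mul_le_mul_right _ hm.le)
    have h2 : (1:ℝ≥0∞) ≤ 2 ^ ((η - c') * (m:ℝ)) := by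
      have := two_rpow_mono (x := 0) (y := (η - c') * (m:ℝ)) (mul_nonneg (by linarith) (by positivity))
      rwa [ENNReal.rpow_zero] at this
    calc _ ≤ K0 := h1
      _ ≤ K + K0 := le_add_self
      _ ≤ 2 * (K + K0) := le_mul_of_one_le_left bot_le (by norm_num)
      _ ≤ _ := le_mul_of_one_le_right bot_le h2
  push Not at hm
  have hk1m : k1 ≤ m := hk2.trans hm
  set s := S2 q μ S k with hs
  have hG : ∀ a, a ≤ m → S2 q μ S (lab m a k) ≤ (Cη * s) * 2 ^ (η * ((m:ℝ) - a)) := by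
    intro a ha
    refine (rescale_sum ha (hE (m - a)) hst hA).trans (le_of_eq ?_)
    rw [Nat.cast_sub ha]; ring
  have hI : S2 q μ S (lab m k1 k) ≤ 2 * (K + K0) * 2 ^ ((η - c') * ((m:ℝ) - k1)) * s := by
    refine (rescale_sum hk1m (ih (m - k1) (by omega)) hst hA).trans (le_of_eq ?_)
    rw [Nat.cast_sub hk1m]
  have hR : (0:ℝ) < 4 ^ k1 := by positivity
  haveI := omp_prob (ι := Fin (d + 1) ⊕ Unit) hR
  have h1 := hbn I μ hμ ζ S k m hst hA hm
  have h2 : ∑ α ∈ tup (d + 1) Θ k2, ∫⁻ u, ∏ i, (gi ζ (omp (4 ^ k1)) 1 (fib S (lab m k2 k) (α i)) u) ^ (q / Fintype.card (Fin (d + 1) ⊕ Unit)) ∂μ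
      ≤ (tup (d + 1) Θ k2).card * (Cm * ((Cη * s) ^ q * 2 ^ (q * (η - c) * m))) := by
    rw [← nsmul_eq_mul]
    refine Finset.sum_le_card_nsmul _ _ _ fun α hα => ?_
    rw [mem_tup] at hα
    exact hmult I μ hμ ζ S k m α hst hA hm hα.1 hα.2 η (Cη * s) hη hG _ inferInstance
  have h3 : NN q μ S ≤ C' * 2 ^ (η0 / 4 * (k1:ℝ)) * S2 q μ S (lab m k1 k) +
      (CB * ((tup (d + 1) Θ k2).card * (Cm * ((Cη * s) ^ q * 2 ^ (q * (η - c) * m))))) ^ (1 / q) := by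
    calc NN q μ S = (NN q μ S ^ q) ^ (1 / q) := by rw [← ENNReal.rpow_mul, mul_one_div_cancel hq0.ne', ENNReal.rpow_one]
      _ ≤ ((C' * 2 ^ (η0 / 4 * (k1:ℝ)) * S2 q μ S (lab m k1 k)) ^ q + CB * ((tup (d + 1) Θ k2).card * (Cm * ((Cη * s) ^ q * 2 ^ (q * (η - c) * m))))) ^ (1 / q) := by
          refine ENNReal.rpow_le_rpow (h1.trans (add_le_add le_rfl (mul_le_mul' le_rfl h2))) (by positivity)
      _ ≤ _ := ENNReal.rpow_add_le_add_rpow _ _ (by positivity) (by rw [div_le_one hq0]; exact hq)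
      _ = _ := by
          rw [← ENNReal.rpow_mul, mul_one_div_cancel hq0.ne', ENNReal.rpow_one]
  have h4 : (CB * ((tup (d + 1) Θ k2).card * (Cm * ((Cη * s) ^ q * 2 ^ (q * (η - c) * m))))) ^ (1 / q) ≤ K * 2 ^ ((η - c') * (m:ℝ)) * s := by
    have e : CB * ((tup (d + 1) Θ k2).card * (Cm * ((Cη * s) ^ q * 2 ^ (q * (η - c) * m)))) =
        (CB * ((tup (d + 1) Θ k2).card * Cm)) * ((Cη * s) ^ q * (2 ^ ((η - c) * (m:ℝ))) ^ q) := by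
      rw [← ENNReal.rpow_mul 2, show (η - c) * (m:ℝ) * q = q * (η - c) * m by ring]; ring
    rw [e, ENNReal.mul_rpow_of_nonneg _ _ (by positivity : 0 ≤ 1 / q), ← ENNReal.mul_rpow_of_nonneg _ _ hq0.le,
      ← ENNReal.rpow_mul _ q, mul_one_div_cancel hq0.ne', ENNReal.rpow_one]
    calc _ = K * 2 ^ ((η - c) * (m:ℝ)) * s := by rw [hK]; ring
      _ ≤ _ := by
        refine mul_le_mul' (mul_le_mul' le_rfl (two_rpow_mono ?_)) le_rfl
        gcongr
  have h5 : C' * 2 ^ (η0 / 4 * (k1:ℝ)) * S2 q μ S (lab m k1 k) ≤ (K + K0) * 2 ^ ((η - c') * (m:ℝ)) * s := by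
    calc _ ≤ C' * 2 ^ (η0 / 4 * (k1:ℝ)) * (2 * (K + K0) * 2 ^ ((η - c') * ((m:ℝ) - k1)) * s) := by gcongr
      _ = (2 * C') * (2 ^ (η0 / 4 * (k1:ℝ)) * 2 ^ ((η - c') * ((m:ℝ) - k1))) * ((K + K0) * s) := by ring
      _ ≤ 2 ^ (η0 / 4 * (k1:ℝ)) * (2 ^ (η0 / 4 * (k1:ℝ)) * 2 ^ ((η - c') * ((m:ℝ) - k1))) * ((K + K0) * s) := by gcongr
      _ = 2 ^ (η0 / 4 * (k1:ℝ) + (η0 / 4 * (k1:ℝ) + (η - c') * ((m:ℝ) - k1))) * ((K + K0) * s) := by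
          rw [two_rpow_add, two_rpow_add]
      _ ≤ 2 ^ ((η - c') * (m:ℝ)) * ((K + K0) * s) := by
          refine mul_le_mul' (two_rpow_mono ?_) le_rfl
          have : (0:ℝ) ≤ k1 := by positivity
          nlinarith
      _ = _ := by ring
  refine (h3.trans (add_le_add h5 h4)).trans ?_
  rw [← add_mul, ← add_mul]
  gcongr
  rw [two_mul]
  gcongr
  exact le_self_add

theorem TT_step {d : ℕ} {q : ℝ} (hq : 1 ≤ q) (hT : TT d q) (hqd : q * ((d + 1 : ℕ):ℝ) ≤ (d + 1 : ℕ) + 2) : TT (d + 1) q := by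
  intro B hB ε hε
  obtain ⟨c, hc, h⟩ := EE_step hq hT hqd hB hε
  have key : ∀ j : ℕ, EE (d + 1) q B ((d + 1 : ℕ) - j * c) ∨ EE (d + 1) q B ε := by
    intro j
    induction j with
    | zero => left; simpa using EE_triv (d := d + 1) (B := B) hq
    | succ j ih =>
      rcases ih with ih | ih
      · rcases le_or_gt ε ((d + 1 : ℕ) - j * c) with hle | hlt
        · left
          have := h _ hle ih
          rwa [show ((d + 1 : ℕ):ℝ) - ((j + 1 : ℕ):ℝ) * c = (d + 1 : ℕ) - j * c - c by push_cast; ring]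
        · right; exact EE_mono ih hlt.le
      · right; exact ih
  obtain ⟨j, hj⟩ := exists_nat_gt (((d + 1 : ℕ):ℝ) / c)
  rcases key j with h | h
  · refine EE_mono h ?_
    rw [div_lt_iff₀ hc] at hj
    linarith
  · exact h

theorem TT_zero {q : ℝ} (hq : 1 ≤ q) : TT 0 q := by
  intro B hB ε hε
  have := EE_mono (EE_triv (d := 0) (B := B) hq) (η' := ε) (by simpa using hε.le)
  exact this

/-- ℓ² decoupling for the paraboloid. -/
theorem TT_all {q : ℝ} (hq : 1 ≤ q) (d : ℕ) (hqd : q * (d:ℝ) ≤ d + 2) : TT d q := by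
  induction d with
  | zero => exact TT_zero hq
  | succ d ih =>
    refine TT_step hq (ih ?_) hqd
    push_cast at hqd
    nlinarith

end DR

namespace DR
open scoped ENNReal NNReal
open scoped Classical
variable {ι : Type} [Fintype ι] {I : Type}

/-- Admissible frequency sets. -/
structure Gd (d : ℕ) (δ : ℝ) (S : Finset (Rsp d)) : Prop where
  h1 : ∀ ξ ∈ S, ∀ i, |ξ (Sum.inl i)| ≤ 1 / 2
  h2 : ∀ ξ ∈ S, ξ (Sum.inr ()) = ∑ i, ξ (Sum.inl i) ^ 2
  h3 : ∀ ξ ∈ S, ∀ η ∈ S, ξ ≠ η → Real.sqrt δ ≤ dist ξ η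

def zt (d : ℕ) (ξ : Rsp d) : Fin d ⊕ Unit → ℝ := fun j => ξ j

def kl {d : ℕ} (m : ℕ) (ξ : Rsp d) : Fin d → ℤ := fun j => min (2 ^ m - 1) ⌊(2:ℝ) ^ m * (ξ (Sum.inl j) + 1 / 2)⌋

theorem kl_spec {d m : ℕ} {ξ : Rsp d} {j : Fin d} (h : |ξ (Sum.inl j)| ≤ 1 / 2) :
    0 ≤ kl m ξ j ∧ kl m ξ j < 2 ^ m ∧ |2 ^ m * (ξ (Sum.inl j) + 1 / 2) - kl m ξ j| ≤ 1 := by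
  have hp : (1:ℝ) ≤ 2 ^ m := one_le_pow₀ (by norm_num)
  have hpz : (1:ℤ) ≤ 2 ^ m := one_le_pow₀ (by norm_num)
  rw [_root_.abs_le] at h
  set y := (2:ℝ) ^ m * (ξ (Sum.inl j) + 1 / 2) with hy
  have hy0 : 0 ≤ y := mul_nonneg (by positivity) (by linarith)
  have hy1 : y ≤ 2 ^ m := by rw [hy]; nlinarith
  have hf0 : 0 ≤ ⌊y⌋ := Int.floor_nonneg.2 hy0
  have e1 := Int.floor_le y
  have e2 := Int.lt_floor_add_one y
  unfold kl
  rw [← hy]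
  refine ⟨le_min (by omega) hf0, lt_of_le_of_lt (min_le_left _ _) (by omega), ?_⟩
  rcases min_cases (2 ^ m - 1 : ℤ) ⌊y⌋ with ⟨h1, h2⟩ | ⟨h1, h2⟩
  · rw [h1]
    have : ((2 ^ m - 1 : ℤ) : ℝ) ≤ (⌊y⌋ : ℝ) := by exact_mod_cast h2
    push_cast at this ⊢
    rw [_root_.abs_le]; constructor <;> linarith
  · rw [h1, _root_.abs_le]; constructor <;> linarith

theorem dist_sq {d : ℕ} (ξ η : Rsp d) : dist ξ η ^ 2 = ∑ j, (ξ j - η j) ^ 2 := by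
  rw [EuclideanSpace.dist_eq, Real.sq_sqrt (Finset.sum_nonneg fun _ _ => by positivity)]
  refine Finset.sum_congr rfl fun j _ => ?_
  rw [Real.dist_eq, sq_abs]

theorem kl_inj {d m : ℕ} {δ : ℝ} {S : Finset (Rsp d)} (hS : Gd d δ S) (hδ : 0 < δ) (hd : 1 ≤ d) (hm : 8 * (d:ℝ) ^ 2 / δ < 4 ^ m)
    {ξ η : Rsp d} (hξ : ξ ∈ S) (hη : η ∈ S) (h : kl m ξ = kl m η) : ξ = η := by
  by_contra hne
  have h1 := hS.h3 ξ hξ η hη hne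
  have hp : (0:ℝ) < 2 ^ m := by positivity
  have hdiff : ∀ j, |ξ (Sum.inl j) - η (Sum.inl j)| ≤ 2 / 2 ^ m := by
    intro j
    have a := (kl_spec (m := m) (hS.h1 ξ hξ j)).2.2
    have b := (kl_spec (m := m) (hS.h1 η hη j)).2.2
    rw [h] at a
    have e : |ξ (Sum.inl j) - η (Sum.inl j)| * 2 ^ m = |(ξ (Sum.inl j) - η (Sum.inl j)) * 2 ^ m| := by
      rw [abs_mul, abs_of_pos hp]
    rw [le_div_iff₀ hp, e]
    rw [_root_.abs_le] at a b ⊢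
    constructor <;> nlinarith
  have hinr : |ξ (Sum.inr ()) - η (Sum.inr ())| ≤ d * (2 / 2 ^ m) := by
    rw [hS.h2 ξ hξ, hS.h2 η hη, ← Finset.sum_sub_distrib]
    refine (Finset.abs_sum_le_sum_abs _ _).trans ?_
    have : ∀ j ∈ (Finset.univ : Finset (Fin d)), |ξ (Sum.inl j) ^ 2 - η (Sum.inl j) ^ 2| ≤ 2 / 2 ^ m := by
      intro j _
      have a := hS.h1 ξ hξ j
      have b := hS.h1 η hη j
      have e : ξ (Sum.inl j) ^ 2 - η (Sum.inl j) ^ 2 = (ξ (Sum.inl j) - η (Sum.inl j)) * (ξ (Sum.inl j) + η (Sum.inl j)) := by ring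
      rw [e, abs_mul]
      have c : |ξ (Sum.inl j) + η (Sum.inl j)| ≤ 1 := (abs_add_le _ _).trans (by linarith)
      exact (mul_le_mul (hdiff j) c (abs_nonneg _) (by positivity)).trans (le_of_eq (mul_one _))
    refine (Finset.sum_le_card_nsmul _ _ _ this).trans ?_
    simp
  have h2 : δ ≤ dist ξ η ^ 2 := by
    rw [← Real.sq_sqrt hδ.le]; gcongr
  rw [dist_sq, Fintype.sum_sum_type] at h2
  have h3 : ∑ j, (ξ (Sum.inl j) - η (Sum.inl j)) ^ 2 ≤ d * (2 / 2 ^ m) ^ 2 := by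
    refine (Finset.sum_le_card_nsmul _ _ ((2 / 2 ^ m) ^ 2) fun j _ => ?_).trans (by simp)
    rw [← sq_abs]; gcongr; exact hdiff j
  have h4 : ∑ j : Unit, (ξ (Sum.inr j) - η (Sum.inr j)) ^ 2 ≤ (d * (2 / 2 ^ m)) ^ 2 := by
    rw [Fintype.sum_unique, ← sq_abs]; gcongr
  have h5 : ((2:ℝ) / 2 ^ m) ^ 2 = 4 / 4 ^ m := by
    rw [four_eq]; field_simp; norm_num
  rw [div_lt_iff₀ hδ] at hm
  rw [mul_pow, h5] at h4
  rw [h5] at h3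
  have h6 : δ ≤ (d * 4 + (d:ℝ) ^ 2 * 4) / 4 ^ m := by
    refine h2.trans ((add_le_add h3 h4).trans (le_of_eq (by ring)))
  rw [le_div_iff₀ (by positivity)] at h6
  have : (1:ℝ) ≤ d := by exact_mod_cast hd
  nlinarith

theorem exists_m {d : ℕ} (hd : 1 ≤ d) {δ : ℝ} (hδ : 0 < δ) (hδ1 : δ < 1) :
    ∃ m : ℕ, 8 * (d:ℝ) ^ 2 / δ < 4 ^ m ∧ (4:ℝ) ^ m ≤ 32 * d ^ 2 / δ := by
  have h1 : (1:ℝ) ≤ d := by exact_mod_cast hd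
  obtain ⟨n, h2, h3⟩ := exists_nat_pow_near (x := 8 * (d:ℝ) ^ 2 / δ) (y := 4) (by
    rw [le_div_iff₀ hδ]; nlinarith) (by norm_num)
  refine ⟨n + 1, h3, ?_⟩
  rw [pow_succ, show 32 * (d:ℝ) ^ 2 / δ = 8 * d ^ 2 / δ * 4 by ring]
  gcongr

theorem locH {d : ℕ} (hd : 1 ≤ d) {q : ℝ} {m : ℕ} {δ R : ℝ} {S : Finset (Rsp d)} (hS : Gd d δ S) (hδ : 0 < δ) (hδ1 : δ < 1)
    (hR : δ⁻¹ ≤ R) (hm : (4:ℝ) ^ m ≤ 32 * d ^ 2 / δ) {D : ℝ≥0∞} (hD : DecB d q (1 + 32 * d ^ 2 * (1 + 2 * d)) m D) :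
    LocH q R D (zt d) S (kl m) := by
  intro I' pr ζ' S' μ' hμ hst hpr hnear
  have hd1 : (1:ℝ) ≤ d := by exact_mod_cast hd
  have hR0 : 0 < R := lt_of_lt_of_le (by positivity) hR
  have hRδ : 1 / R ≤ δ := by
    rw [one_div]; exact inv_le_of_inv_le₀ hδ hR
  have h4R : (4:ℝ) ^ m * (1 / R) ≤ 32 * d ^ 2 := by
    calc (4:ℝ) ^ m * (1 / R) ≤ 32 * d ^ 2 / δ * δ := by gcongr
      _ = _ := by field_simp
  have h24 : (2:ℝ) ^ m ≤ 4 ^ m := by gcongr; norm_num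
  set A : Fin d ⊕ Unit → Fin d ⊕ Unit → ℝ := Sum.elim (fun j => Pi.single (Sum.inl j) 1) (fun _ => fun _ => 1) with hA
  set v : Fin d ⊕ Unit → ℝ := Sum.elim (fun _ => 1 / 2) (fun _ => (d:ℝ) / 4) with hv
  have hs := hst.affine A v
  have e1 : ∀ l j, ph (A (Sum.inl j)) (ζ' l) + v (Sum.inl j) = ζ' l (Sum.inl j) + 1 / 2 := by
    intro l j
    simp [hA, hv, ph, Pi.single_apply]
  have e2 : ∀ l, ph (A (Sum.inr ())) (ζ' l) + v (Sum.inr ()) = ζ' l (Sum.inr ()) + ∑ j, ζ' l (Sum.inl j) + d / 4 := by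
    intro l
    simp [hA, hv, ph, Fintype.sum_sum_type]; ring
  refine hD I' μ' hμ _ S' _ hs ⟨?_, ?_, ?_, ?_⟩
  · intro l hl j; exact (kl_spec (hS.h1 _ (hpr l hl) j)).1
  · intro l hl j; exact (kl_spec (hS.h1 _ (hpr l hl) j)).2.1
  · intro l hl j
    simp only [e1]
    have a := (kl_spec (m := m) (hS.h1 _ (hpr l hl) j)).2.2
    have b := hnear l hl (Sum.inl j)
    have e : 2 ^ m * (ζ' l (Sum.inl j) + 1 / 2) - (kl m (pr l) j : ℝ) =
      (2 ^ m * ((pr l) (Sum.inl j) + 1 / 2) - kl m (pr l) j) + 2 ^ m * (ζ' l (Sum.inl j) - zt d (pr l) (Sum.inl j)) := by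
      unfold zt; ring
    rw [e]
    refine (abs_add_le _ _).trans ?_
    rw [abs_mul, abs_of_pos (by positivity : (0:ℝ) < 2 ^ m)]
    have c : (2:ℝ) ^ m * |ζ' l (Sum.inl j) - zt d (pr l) (Sum.inl j)| ≤ 32 * d ^ 2 := by
      refine le_trans ?_ h4R
      gcongr
    have : 32 * (d:ℝ) ^ 2 ≤ 32 * d ^ 2 * (1 + 2 * d) := le_mul_of_one_le_right (by positivity) (by linarith)
    linarith
  · intro l hl
    simp only [e1, e2]
    have hR1 : 1 / R ≤ 1 := hRδ.trans hδ1.le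
    have key : |ζ' l (Sum.inr ()) + ∑ j, ζ' l (Sum.inl j) + d / 4 - ∑ j, (ζ' l (Sum.inl j) + 1 / 2) ^ 2| ≤ (1 + 2 * d) * (1 / R) := by
      have e : ζ' l (Sum.inr ()) + ∑ j, ζ' l (Sum.inl j) + d / 4 - ∑ j, (ζ' l (Sum.inl j) + 1 / 2) ^ 2 =
          (ζ' l (Sum.inr ()) - zt d (pr l) (Sum.inr ())) - ∑ j, (ζ' l (Sum.inl j) ^ 2 - (pr l) (Sum.inl j) ^ 2) := by
        have h := hS.h2 _ (hpr l hl)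
        unfold zt
        rw [h, Finset.sum_sub_distrib]
        have : ∑ j, (ζ' l (Sum.inl j) + 1 / 2) ^ 2 = ∑ j, ζ' l (Sum.inl j) ^ 2 + ∑ j, ζ' l (Sum.inl j) + d / 4 := by
          have : ∀ j : Fin d, (ζ' l (Sum.inl j) + 1 / 2) ^ 2 = ζ' l (Sum.inl j) ^ 2 + ζ' l (Sum.inl j) + 1 / 4 := fun j => by ring
          simp_rw [this, Finset.sum_add_distrib]
          simp; ring
        rw [this]; ring
      rw [e]
      refine (abs_sub _ _).trans ?_
      have b1 := hnear l hl (Sum.inr ())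
      have b2 : |∑ j, (ζ' l (Sum.inl j) ^ 2 - (pr l) (Sum.inl j) ^ 2)| ≤ d * (2 * (1 / R)) := by
        refine (Finset.abs_sum_le_sum_abs _ _).trans ((Finset.sum_le_card_nsmul _ _ (2 * (1 / R)) fun j _ => ?_).trans (by simp))
        have a := hS.h1 _ (hpr l hl) j
        have b := hnear l hl (Sum.inl j)
        unfold zt at b
        have e : ζ' l (Sum.inl j) ^ 2 - (pr l) (Sum.inl j) ^ 2 = (ζ' l (Sum.inl j) - (pr l) (Sum.inl j)) * ((ζ' l (Sum.inl j) - (pr l) (Sum.inl j)) + 2 * (pr l) (Sum.inl j)) := by ring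
        rw [e, abs_mul]
        have c : |ζ' l (Sum.inl j) - (pr l) (Sum.inl j) + 2 * (pr l) (Sum.inl j)| ≤ 2 := by
          rw [_root_.abs_le] at *
          constructor <;> linarith
        exact (mul_le_mul b c (abs_nonneg _) (by positivity)).trans (le_of_eq (mul_comm _ _))
      calc _ ≤ 1 / R + d * (2 * (1 / R)) := add_le_add b1 b2
        _ = _ := by ring
    calc _ ≤ (4:ℝ) ^ m * ((1 + 2 * d) * (1 / R)) := by gcongr
      _ = (4:ℝ) ^ m * (1 / R) * (1 + 2 * d) := by ring
      _ ≤ 32 * d ^ 2 * (1 + 2 * d) := by gcongr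
      _ ≤ _ := by linarith

theorem gg_single (ζ : I → ι → ℝ) (u : I → ℂ) (l : I) (x : ι → ℝ) : gg ζ u {l} x = ‖u l‖ₑ ^ 2 := by
  simp [gg, es, enorm_ee]

theorem sum_img_inj {Λ : Type*} (S : Finset I) (k : I → Λ) (h : ∀ ξ ∈ S, ∀ η ∈ S, k ξ = k η → ξ = η) (f : Λ → ℝ≥0∞) :
    ∑ J ∈ img S k, f J = ∑ l ∈ S, f (k l) := by
  unfold img
  exact Finset.sum_image fun ξ hξ η hη hh => h ξ hξ η hη hh

theorem upperU {d : ℕ} (hd : 1 ≤ d) {q : ℝ} (hq : 1 ≤ q) (hqd : q * (d:ℝ) ≤ d + 2) {ε : ℝ} (hε : 0 < ε) :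
    ∃ C : ℝ≥0∞, C ≠ ⊤ ∧ ∀ (δ : ℝ) (S : Finset (Rsp d)) (u : Rsp d → ℂ) (R : ℝ), 0 < δ → δ < 1 → Gd d δ S → δ⁻¹ ≤ R →
      (gi (zt d) (ub R) q S u) ^ (1 / q) ≤ C * ENNReal.ofReal (δ ^ (-ε)) * ∑ l ∈ S, ‖u l‖ₑ ^ 2 := by
  have hq0 : 0 < q := by linarith
  obtain ⟨C, hC, h⟩ := TT_all hq d hqd (1 + 32 * d ^ 2 * (1 + 2 * d)) (by positivity) (2 * ε) (by positivity)
  refine ⟨locC (Fin d ⊕ Unit) q * (C * ENNReal.ofReal ((32 * d ^ 2) ^ ε)), ENNReal.mul_ne_top (locC_ne hq) (ENNReal.mul_ne_top hC (by simp)), ?_⟩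
  intro δ S u R hδ hδ1 hS hR
  have hR0 : 0 < R := lt_of_lt_of_le (by positivity) hR
  obtain ⟨m, hm1, hm2⟩ := exists_m hd hδ hδ1
  have hD : C * 2 ^ (2 * ε * (m:ℝ)) ≠ ⊤ := ENNReal.mul_ne_top hC (two_rpow_ne_top _)
  have hl := loc hq hR0 hD (locH hd hS hδ hδ1 hR hm2 (h m)) u
  have hinj : ∀ ξ ∈ S, ∀ η ∈ S, kl m ξ = kl m η → ξ = η := fun ξ hξ η hη hh => kl_inj hS hδ hd hm1 hξ hη hh
  haveI := omp_prob (ι := Fin d ⊕ Unit) hR0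
  have hsum : ∑ J ∈ img S (kl m), (gi (zt d) (omp R) q (fib S (kl m) J) u) ^ (1 / q) = ∑ l ∈ S, ‖u l‖ₑ ^ 2 := by
    have e : ∑ J ∈ img S (kl m), (gi (zt d) (omp R) q (fib S (kl m) J) u) ^ (1 / q) = ∑ l ∈ S, (gi (zt d) (omp R) q (fib S (kl m) (kl m l)) u) ^ (1 / q) :=
      sum_img_inj S _ hinj _
    rw [e]
    refine Finset.sum_congr rfl fun l hl => ?_
    have : fib S (kl m) (kl m l) = {l} := by
      ext l'
      rw [mem_fib, Finset.mem_singleton]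
      constructor
      · rintro ⟨a, b⟩; exact hinj _ a _ hl b
      · rintro rfl; exact ⟨hl, rfl⟩
    rw [this]
    simp only [gi, gg_single, lintegral_const, measure_univ, mul_one]
    rw [← ENNReal.rpow_mul, mul_one_div_cancel hq0.ne', ENNReal.rpow_one]
  rw [hsum] at hl
  refine hl.trans ?_
  have h2 : (2:ℝ≥0∞) ^ (2 * ε * (m:ℝ)) ≤ ENNReal.ofReal ((32 * d ^ 2) ^ ε) * ENNReal.ofReal (δ ^ (-ε)) := by
    have e : (2:ℝ≥0∞) ^ (2 * ε * (m:ℝ)) = ENNReal.ofReal (((4:ℝ) ^ m) ^ ε) := by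
      rw [show (4:ℝ) ^ m = 2 ^ (2 * (m:ℝ)) by
        rw [Real.rpow_mul (by norm_num), Real.rpow_natCast]; norm_num, ← Real.rpow_mul (by norm_num),
        ← ENNReal.ofReal_rpow_of_pos (by norm_num)]
      simp only [ENNReal.ofReal_ofNat]
      congr 1; ring
    rw [e, ← ENNReal.ofReal_mul (by positivity)]
    refine ENNReal.ofReal_le_ofReal ?_
    calc ((4:ℝ) ^ m) ^ ε ≤ (32 * d ^ 2 / δ) ^ ε := by gcongr
      _ = _ := by rw [Real.div_rpow (by positivity) hδ.le, Real.rpow_neg hδ.le, div_eq_mul_inv]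
  calc _ ≤ locC (Fin d ⊕ Unit) q * (C * (ENNReal.ofReal ((32 * d ^ 2) ^ ε) * ENNReal.ofReal (δ ^ (-ε)))) * ∑ l ∈ S, ‖u l‖ₑ ^ 2 := by gcongr
    _ = _ := by ring

end DR

namespace DR
open scoped ENNReal NNReal
open scoped Classical
variable {ι : Type} [Fintype ι] {I : Type}

/-- The centred cube. -/
def bx (R : ℝ) : Set (ι → ℝ) := Set.univ.pi (fun _ => Set.Icc (-R) R)

theorem mem_bx {R : ℝ} {x : ι → ℝ} : x ∈ bx R ↔ ∀ j, |x j| ≤ R := by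
  simp only [bx, Set.mem_pi, Set.mem_univ, true_implies, Set.mem_Icc, _root_.abs_le]

theorem measurableSet_bx (R : ℝ) : MeasurableSet (bx R : Set (ι → ℝ)) :=
  MeasurableSet.univ_pi fun _ => measurableSet_Icc

theorem vol_bx (R : ℝ) : volume (bx R : Set (ι → ℝ)) = ENNReal.ofReal (2 * R) ^ (Fintype.card ι) := by
  unfold bx
  rw [volume_pi_pi]
  simp only [Real.volume_Icc, Finset.prod_const, Finset.card_univ]
  congr 2; ring

theorem ub_eq {R : ℝ} (hR : 0 < R) :
    (ub R : Measure (ι → ℝ)) = ((ENNReal.ofReal (2 * R))⁻¹ ^ (Fintype.card ι)) • volume.restrict (bx R) := by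
  haveI := lam_prob hR
  unfold ub
  refine Measure.pi_eq fun s hs => ?_
  rw [Measure.smul_apply, bx, volume_pi, Measure.restrict_pi_pi, Measure.pi_pi]
  simp only [lam, Measure.smul_apply, smul_eq_mul, Finset.prod_mul_distrib, Finset.prod_const, Finset.card_univ]

theorem ub_lint {R : ℝ} (hR : 0 < R) (g : (ι → ℝ) → ℝ≥0∞) :
    ∫⁻ x, g x ∂(ub R) = (ENNReal.ofReal (2 * R))⁻¹ ^ (Fintype.card ι) * ∫⁻ x in bx R, g x := by
  rw [ub_eq hR, lintegral_smul_measure, smul_eq_mul]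

theorem bx_mono {R R' : ℝ} (h : R ≤ R') : (bx R : Set (ι → ℝ)) ⊆ bx R' := by
  intro x hx
  rw [mem_bx] at *
  exact fun j => (hx j).trans h

theorem ub_mono {R R' : ℝ} (hR : 0 < R) (h : R ≤ R') (g : (ι → ℝ) → ℝ≥0∞) :
    ∫⁻ x, g x ∂(ub R) ≤ ENNReal.ofReal (R' / R) ^ (Fintype.card ι) * ∫⁻ x, g x ∂(ub R') := by
  have hR' : 0 < R' := hR.trans_le h
  rw [ub_lint hR, ub_lint hR', ← mul_assoc, ← mul_pow]
  have : (ENNReal.ofReal (2 * R))⁻¹ = ENNReal.ofReal (R' / R) * (ENNReal.ofReal (2 * R'))⁻¹ := by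
    rw [← ENNReal.ofReal_inv_of_pos (by positivity), ← ENNReal.ofReal_inv_of_pos (by positivity),
      ← ENNReal.ofReal_mul (by positivity)]
    congr 1; field_simp
  rw [this]
  gcongr
  exact bx_mono h

theorem bx_shift {R r : ℝ} {s : ι → ℝ} (hs : ∀ j, |s j| ≤ r) {g : (ι → ℝ) → ℝ≥0∞} (hg : Measurable g) :
    ∫⁻ z in bx R, g (z + s) ≤ ∫⁻ z in bx (R + r), g z := by
  rw [← lintegral_indicator (measurableSet_bx _), ← lintegral_indicator (measurableSet_bx _),
    ← lintegral_add_right_eq_self ((bx (R + r)).indicator g) s]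
  refine lintegral_mono fun z => ?_
  by_cases hz : z ∈ bx R
  · have : z + s ∈ bx (R + r) := by
      rw [mem_bx] at *
      intro j
      exact (abs_add_le _ _).trans (add_le_add (hz j) (hs j))
    simp [Set.indicator_of_mem, hz, this]
  · simp [Set.indicator_of_notMem, hz]

theorem ub_shift {R : ℝ} (hR : 0 < R) {s : ι → ℝ} (hs : ∀ j, |s j| ≤ R) {g : (ι → ℝ) → ℝ≥0∞} (hg : Measurable g) :
    ∫⁻ z, g (z + s) ∂(ub R) ≤ 2 ^ (Fintype.card ι) * ∫⁻ z, g z ∂(ub (2 * R)) := by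
  rw [ub_lint hR, ub_lint (by positivity), ← mul_assoc, ← mul_pow]
  have : (ENNReal.ofReal (2 * R))⁻¹ = 2 * (ENNReal.ofReal (2 * (2 * R)))⁻¹ := by
    rw [← ENNReal.ofReal_inv_of_pos (by positivity), ← ENNReal.ofReal_inv_of_pos (by positivity),
      show (2:ℝ≥0∞) = ENNReal.ofReal 2 by simp, ← ENNReal.ofReal_mul (by positivity)]
    congr 1; field_simp
  rw [this]
  have h2 := bx_shift (R := R) hs hg
  rw [← two_mul] at h2
  gcongr

theorem ub_le_omp {R : ℝ} (hR : 0 < R) {g : (ι → ℝ) → ℝ≥0∞} (hg : Measurable g) :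
    ∫⁻ x, g x ∂(ub R) ≤ omC ^ (Fintype.card ι) * ∫⁻ x, g x ∂(omp R) := by
  refine le_trans ?_ (omp_ge hR hg)
  rw [ub_lint hR, ← lintegral_indicator (measurableSet_bx _), ← lintegral_const_mul' _ _ (by
    refine ENNReal.pow_ne_top (ENNReal.inv_ne_top.2 (by simp [hR])))]
  refine lintegral_mono fun x => ?_
  by_cases hx : x ∈ bx R
  · rw [Set.indicator_of_mem hx]
    rw [mem_bx] at hx
    gcongr
    unfold kk
    rw [← Finset.card_univ, ← Finset.prod_const]
    refine Finset.prod_le_prod' fun j _ => ?_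
    rw [← ENNReal.ofReal_inv_of_pos (by positivity)]
    refine ENNReal.ofReal_le_ofReal ?_
    unfold kap
    rw [pow_one, mul_inv, mul_comm]
    gcongr
    have : (x j / R) ^ 2 ≤ 1 := by
      rw [div_pow, div_le_one (by positivity), ← sq_abs]
      have := hx j
      gcongr
    linarith
  · rw [Set.indicator_of_notMem hx, mul_zero]; exact bot_le

theorem kap_tail {r A s : ℝ} (hr : 0 < r) (hA : 0 < A) (hs : A ≤ |s|) : kap 1 r s ≤ 2 * r / A * kap 1 A s := by
  unfold kap
  have h : A ^ 2 ≤ s ^ 2 := by rw [← sq_abs s]; gcongr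
  have hs0 : 0 < s ^ 2 := lt_of_lt_of_le (by positivity) h
  have e1 : r⁻¹ * ((1 + (s / r) ^ 2)⁻¹) ^ 1 = r / (r ^ 2 + s ^ 2) := by field_simp
  have e2 : 2 * r / A * (A⁻¹ * ((1 + (s / A) ^ 2)⁻¹) ^ 1) = 2 * r / (A ^ 2 + s ^ 2) := by field_simp
  rw [e1, e2, div_le_div_iff₀ (by positivity) (by positivity)]
  nlinarith [mul_le_mul_of_nonneg_left h hr.le, pow_pos hr 3]

theorem om_tail {r A : ℝ} (hr : 0 < r) (hA : 0 < A) :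
    om r {s | A < |s|} ≤ omC ^ 2 * ENNReal.ofReal (2 * r / A) := by
  have hm : MeasurableSet {s : ℝ | A < |s|} := measurableSet_lt measurable_const (by fun_prop)
  haveI := (om_spec hA).1
  have h1 := (om_spec hr).2.2.2 ({s | A < |s|}.indicator 1) (measurable_one.indicator hm)
  have h2 := (om_spec hA).2.2.1 1 measurable_one
  rw [lintegral_indicator_one hm] at h1
  simp only [Pi.one_apply, mul_one, lintegral_one, measure_univ] at h2
  refine h1.trans ?_
  calc _ ≤ omC * ∫⁻ s, ENNReal.ofReal (2 * r / A) * ENNReal.ofReal (kap 1 A s) := by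
        refine mul_le_mul_right (lintegral_mono fun s => ?_) _
        by_cases hs : A < |s|
        · rw [Set.indicator_of_mem (by exact hs), Pi.one_apply, mul_one, ← ENNReal.ofReal_mul (by positivity)]
          exact ENNReal.ofReal_le_ofReal (kap_tail hr hA hs.le)
        · rw [Set.indicator_of_notMem (by exact hs), mul_zero]; exact bot_le
    _ = omC * (ENNReal.ofReal (2 * r / A) * ∫⁻ s, ENNReal.ofReal (kap 1 A s)) := by
        rw [lintegral_const_mul' _ _ ENNReal.ofReal_ne_top]
    _ ≤ omC * (ENNReal.ofReal (2 * r / A) * omC) := by gcongr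
    _ = _ := by ring

theorem omp_tail {r A : ℝ} (hr : 0 < r) (hA : 0 < A) :
    (omp r : Measure (ι → ℝ)) (bx A)ᶜ ≤ Fintype.card ι * (omC ^ 2 * ENNReal.ofReal (2 * r / A)) := by
  haveI := (om_spec hr).1
  have hsub : (bx A : Set (ι → ℝ))ᶜ ⊆ ⋃ j, (Function.eval j) ⁻¹' {s | A < |s|} := by
    intro x hx
    rw [Set.mem_compl_iff, mem_bx] at hx
    push Not at hx
    simpa using hx
  refine (measure_mono hsub).trans ((measure_iUnion_fintype_le _ _).trans ?_)
  have hm : MeasurableSet {s : ℝ | A < |s|} := measurableSet_lt measurable_const (by fun_prop)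
  refine (Finset.sum_le_card_nsmul _ _ (omC ^ 2 * ENNReal.ofReal (2 * r / A)) fun j _ => ?_).trans (by simp)
  have := (measurePreserving_eval (fun _ : ι => om r) j).measure_preimage hm.nullMeasurableSet
  unfold omp
  rw [this]
  exact om_tail hr hA

theorem orth_id {L : ℝ} (hL : 0 < L) (ζ : I → ι → ℝ) (u : I → ℂ) (S : Finset I)
    (hsep : ∀ l ∈ S, ∀ l' ∈ S, l ≠ l' → ∃ j, 1 / L ≤ |ζ l j - ζ l' j|) (x : ι → ℝ) :
    ∫⁻ s, gg ζ u S (x + s) ∂(omp L) = ∑ l ∈ S, ‖u l‖ₑ ^ 2 := by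
  haveI := omp_prob (ι := ι) hL
  rw [orth1 hL ζ u S id hsep x]
  have e : S.image id = S := Finset.image_id
  rw [e]
  refine Finset.sum_congr rfl fun l hl => ?_
  have : S.filter (id · = l) = {l} := by
    ext l'; simp only [id, Finset.mem_filter, Finset.mem_singleton]
    constructor
    · exact fun h => h.2
    · rintro rfl; exact ⟨hl, rfl⟩
  rw [this]
  simp only [gg_single, lintegral_const, measure_univ, mul_one]

theorem L2lower (ι : Type) [Fintype ι] : ∃ K : ℝ, 2 ≤ K ∧ ∀ (I : Type) (ζ : I → ι → ℝ) (u : I → ℂ) (S : Finset I) (r R : ℝ), 0 < r →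
    (∀ l ∈ S, ∀ l' ∈ S, l ≠ l' → ∃ j, 1 / r ≤ |ζ l j - ζ l' j|) → K * r ≤ R →
    ∑ l ∈ S, ‖u l‖ₑ ^ 2 ≤ 2 ^ (Fintype.card ι + 1) * gi ζ (ub R) 1 S u := by
  set N := Fintype.card ι with hN
  set c : ℝ≥0∞ := omC ^ N * (N * omC ^ 2) with hc
  have hcT : c ≠ ⊤ := ENNReal.mul_ne_top (ENNReal.pow_ne_top omC_ne) (ENNReal.mul_ne_top (by simp) (ENNReal.pow_ne_top omC_ne))
  refine ⟨8 * c.toReal + 2, by linarith [ENNReal.toReal_nonneg (a := c)], ?_⟩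
  intro I ζ u S r R hr hsep hR
  have hc0 : 0 ≤ c.toReal := ENNReal.toReal_nonneg
  set A := R / 2 with hA
  have hRA : 2 * A = R := by rw [hA]; ring
  have hrA : r ≤ A := by nlinarith
  have hA0 : 0 < A := hr.trans_le hrA
  haveI := omp_prob (ι := ι) hr
  haveI := ub_prob (ι := ι) hA0
  set X := ∑ l ∈ S, ‖u l‖ₑ ^ 2 with hX
  have hXT : X ≠ ⊤ := by
    rw [hX]; exact ENNReal.sum_ne_top.2 fun l _ => by simp
  have hmeas : Measurable (gg ζ u S) := measurable_gg_right ζ S u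
  have h1 : X = ∫⁻ s, ∫⁻ z, gg ζ u S (z + s) ∂(ub A) ∂(omp r) := by
    rw [lintegral_lintegral_swap (by
      have : Measurable (fun p : (ι → ℝ) × (ι → ℝ) => gg ζ u S (p.2 + p.1)) := hmeas.comp (by fun_prop)
      exact this.aemeasurable)]
    simp only [orth_id hr ζ u S hsep, lintegral_const, measure_univ, mul_one, hX]
  have hin : ∀ s, ∫⁻ z, gg ζ u S (z + s) ∂(ub A) ≤ 2 ^ N * gi ζ (ub R) 1 S u + (bx A)ᶜ.indicator (fun _ => omC ^ N * X) s := by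
    intro s
    by_cases hs : s ∈ bx A
    · rw [Set.indicator_of_notMem (by simpa using hs), add_zero]
      refine (ub_shift hA0 (mem_bx.1 hs) hmeas).trans ?_
      rw [hRA]
      simp only [gi, ENNReal.rpow_one]; exact le_rfl
    · rw [Set.indicator_of_mem (by simpa using hs)]
      refine le_trans ?_ le_add_self
      have hm2 : Measurable (fun z => gg ζ u S (z + s)) := hmeas.comp (by fun_prop)
      refine (ub_le_omp hA0 hm2).trans ?_
      have := orth_id hA0 ζ u S (fun l hl l' hl' h => by
        obtain ⟨j, hj⟩ := hsep l hl l' hl' h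
        exact ⟨j, le_trans (by gcongr) hj⟩) s
      simp only [add_comm _ s, this, hX]; exact le_rfl
  have h2 : X ≤ 2 ^ N * gi ζ (ub R) 1 S u + (omC ^ N * X) * omp r (bx A : Set (ι → ℝ))ᶜ := by
    calc X = _ := h1
      _ ≤ _ := lintegral_mono hin
      _ = _ := by
        rw [lintegral_add_left measurable_const, lintegral_indicator_const (measurableSet_bx A).compl]
        simp
  have h3 : (omC ^ N * X) * omp r (bx A : Set (ι → ℝ))ᶜ ≤ X / 2 := by
    have hlt : c * ENNReal.ofReal (2 * r / A) ≤ 1 / 2 := by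
      rw [← ENNReal.ofReal_toReal hcT, ← ENNReal.ofReal_mul hc0, show (1/2 : ℝ≥0∞) = ENNReal.ofReal (1/2) by
        rw [ENNReal.ofReal_div_of_pos (by norm_num)]; simp]
      refine ENNReal.ofReal_le_ofReal ?_
      rw [← mul_div_assoc, div_le_iff₀ hA0]
      nlinarith
    calc (omC ^ N * X) * omp r (bx A : Set (ι → ℝ))ᶜ ≤ (omC ^ N * X) * (N * (omC ^ 2 * ENNReal.ofReal (2 * r / A))) := by
          gcongr; exact omp_tail hr hA0
      _ = X * (c * ENNReal.ofReal (2 * r / A)) := by rw [hc]; ring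
      _ ≤ X * (1 / 2) := by gcongr
      _ = X / 2 := by rw [one_div, div_eq_mul_inv]
  have h4 : X / 2 + X / 2 ≤ 2 ^ N * gi ζ (ub R) 1 S u + X / 2 := by
    rw [ENNReal.add_halves]; exact h2.trans (by gcongr)
  have h5 : X / 2 ≤ 2 ^ N * gi ζ (ub R) 1 S u :=
    ENNReal.le_of_add_le_add_right (ENNReal.div_ne_top hXT (by norm_num)) h4
  calc X = 2 * (X / 2) := by rw [two_mul, ENNReal.add_halves]
    _ ≤ 2 * (2 ^ N * gi ζ (ub R) 1 S u) := by gcongr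
    _ = _ := by rw [pow_succ]; ring

end DR

namespace DR
open scoped ENNReal NNReal
open scoped Classical
variable {ι : Type} [Fintype ι] {I : Type}

theorem ann (ζ : I → ι → ℝ) (l0 : I) {ρ r : ℝ} {c : ℝ≥0∞} (S : Finset I) : l0 ∉ S →
    (∀ l ∈ S, ∃ y : ι → ℝ, (∀ j, |y j| ≤ ρ) ∧ c ≤ ‖ee (ph (ζ l0) y) - ee (ph (ζ l) y)‖ₑ) → ∀ u : I → ℂ,
    c ^ S.card * ‖u l0‖ₑ * volume (bx r : Set (ι → ℝ)) ≤ 2 ^ S.card * ∫⁻ x in bx (r + S.card * ρ), ‖es ζ u (insert l0 S) x‖ₑ := by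
  induction S using Finset.induction_on with
  | empty =>
    intro _ _ u
    simp [es, enorm_mul, enorm_ee]
  | insert l1 S hl1 ih =>
    intro h0 hy u
    have h01 : l0 ≠ l1 := fun h => h0 (by simp [h])
    have h0S : l0 ∉ S := fun h => h0 (by simp [h])
    obtain ⟨y, hyρ, hyc⟩ := hy l1 (by simp)
    have hρ : ∀ x : ι → ℝ, 0 ≤ ρ ∨ IsEmpty ι := by
      intro x
      rcases isEmpty_or_nonempty ι with h | ⟨⟨j⟩⟩
      · exact Or.inr h
      · exact Or.inl ((abs_nonneg _).trans (hyρ j))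
    set u' : I → ℂ := fun l => (ee (ph (ζ l) y) - ee (ph (ζ l1) y)) * u l with hu'
    have h := ih h0S (fun l hl => hy l (by simp [hl])) u'
    have e : ∀ x, es ζ u' (insert l0 S) x = es ζ u (insert l0 (insert l1 S)) (x + y) - ee (ph (ζ l1) y) * es ζ u (insert l0 (insert l1 S)) x := by
      intro x
      rw [Finset.insert_comm]
      have hn : l1 ∉ insert l0 S := by
        rw [Finset.mem_insert]; rintro (h | h)
        · exact h01 h.symm
        · exact hl1 h
      have e1 : es ζ u' (insert l0 S) x = es ζ u' (insert l1 (insert l0 S)) x := by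
        unfold es
        rw [Finset.sum_insert hn]
        simp [hu']
      rw [e1]
      unfold es
      rw [Finset.mul_sum, ← Finset.sum_sub_distrib]
      refine Finset.sum_congr rfl fun l _ => ?_
      rw [ph_add_right, ee_add]
      simp only [hu']; ring
    set F : (ι → ℝ) → ℝ≥0∞ := fun x => ‖es ζ u (insert l0 (insert l1 S)) x‖ₑ with hF
    have hFm : Measurable F := (continuous_es_right ζ _ u).measurable.enorm
    have hFs : Measurable (fun x => F (x + y)) := hFm.comp (by fun_prop)
    rw [Finset.card_insert_of_notMem hl1]
    have hb : ∫⁻ x in bx (r + S.card * ρ), ‖es ζ u' (insert l0 S) x‖ₑ ≤ 2 * ∫⁻ x in bx (r + (S.card + 1 : ℕ) * ρ), F x := by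
      calc _ ≤ ∫⁻ x in bx (r + S.card * ρ), (F (x + y) + F x) := by
            refine lintegral_mono fun x => ?_
            rw [e]
            refine (enorm_sub_le).trans ?_
            rw [enorm_mul, enorm_ee, one_mul]
        _ = (∫⁻ x in bx (r + S.card * ρ), F (x + y)) + ∫⁻ x in bx (r + S.card * ρ), F x := lintegral_add_left hFs _
        _ ≤ (∫⁻ x in bx (r + (S.card + 1 : ℕ) * ρ), F x) + ∫⁻ x in bx (r + (S.card + 1 : ℕ) * ρ), F x := by
            have e3 : r + (S.card + 1 : ℕ) * ρ = r + S.card * ρ + ρ := by push_cast; ring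
            refine add_le_add ?_ ?_
            · rw [e3]; exact bx_shift hyρ hFm
            · rw [e3]
              refine lintegral_mono_set ?_
              intro x hx
              rw [mem_bx] at *
              intro j
              have := (abs_nonneg _).trans (hyρ j)
              linarith [hx j]
        _ = _ := by rw [two_mul]
    calc c ^ (S.card + 1) * ‖u l0‖ₑ * volume (bx r : Set (ι → ℝ)) = c ^ S.card * (c * ‖u l0‖ₑ) * volume (bx r : Set (ι → ℝ)) := by ring
      _ ≤ c ^ S.card * ‖u' l0‖ₑ * volume (bx r : Set (ι → ℝ)) := by
          gcongr
          simp only [hu', enorm_mul]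
          gcongr
      _ ≤ _ := h
      _ ≤ 2 ^ S.card * (2 * ∫⁻ x in bx (r + (S.card + 1 : ℕ) * ρ), F x) := by gcongr
      _ = _ := by rw [pow_succ]; ring

theorem ee_sub_lower {a b : ℝ} (h : |a - b| ≤ 1 / 2) : 4 * |a - b| ≤ ‖ee a - ee b‖ := by
  have e : ee a - ee b = ee b * (ee (a - b) - 1) := by
    rw [mul_sub, ← ee_add]; simp
  rw [e, norm_mul, norm_ee, one_mul]
  have e2 : ee (a - b) = Complex.exp (Complex.I * ((2 * Real.pi * (a - b) : ℝ) : ℂ)) := by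
    unfold ee; congr 1; push_cast; ring
  rw [e2, Complex.norm_exp_I_mul_ofReal_sub_one, Real.norm_eq_abs, abs_mul]
  have h2 := Real.mul_abs_le_abs_sin (x := 2 * Real.pi * (a - b) / 2) (by
    rw [show 2 * Real.pi * (a - b) / 2 = Real.pi * (a - b) by ring, abs_mul, abs_of_pos Real.pi_pos]
    nlinarith [Real.pi_pos])
  rw [show 2 * Real.pi * (a - b) / 2 = Real.pi * (a - b) by ring, abs_mul, abs_of_pos Real.pi_pos] at h2
  rw [show 2 * Real.pi * (a - b) / 2 = Real.pi * (a - b) by ring]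
  have h3 : 2 / Real.pi * (Real.pi * |a - b|) = 2 * |a - b| := by field_simp
  rw [h3] at h2
  rw [abs_of_pos (by norm_num : (0:ℝ) < 2)]; linarith

end DR

namespace DR
open scoped ENNReal NNReal
open scoped Classical
variable {ι : Type} [Fintype ι] {I : Type}

theorem coord_sep {d : ℕ} {δ : ℝ} {S : Finset (Rsp d)} (hS : Gd d δ S) (hδ : 0 < δ)
    {ξ η : Rsp d} (hξ : ξ ∈ S) (hη : η ∈ S) (h : ξ ≠ η) : ∃ j, Real.sqrt δ / (d + 1) ≤ |zt d ξ j - zt d η j| := by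
  by_contra hne
  push Not at hne
  have h1 := hS.h3 ξ hξ η hη h
  have h2 : δ ≤ dist ξ η ^ 2 := by
    rw [← Real.sq_sqrt hδ.le]; gcongr
  rw [dist_sq] at h2
  have h3 : ∑ j, (ξ j - η j) ^ 2 < ∑ j : Fin d ⊕ Unit, δ / (d + 1) ^ 2 := by
    refine Finset.sum_lt_sum_of_nonempty ⟨Sum.inr (), Finset.mem_univ _⟩ fun j _ => ?_
    have := hne j
    unfold zt at this
    rw [← sq_abs, ← Real.sq_sqrt hδ.le, ← div_pow]
    gcongr
  rw [Finset.sum_const, Finset.card_univ] at h3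
  simp only [Fintype.card_sum, Fintype.card_fin, Fintype.card_unit, nsmul_eq_mul, Nat.cast_add, Nat.cast_one] at h3
  have h4 : ((d:ℝ) + 1) * (δ / (d + 1) ^ 2) ≤ δ := by
    rw [pow_two, mul_div_assoc', div_le_iff₀ (by positivity)]
    have : (0:ℝ) ≤ d := by positivity
    nlinarith [mul_nonneg this hδ.le, mul_nonneg (mul_nonneg this this) hδ.le]
  linarith

theorem card_bound {d m : ℕ} {δ : ℝ} {S : Finset (Rsp d)} (hS : Gd d δ S) (hδ : 0 < δ) (hd : 1 ≤ d) (hm : 8 * (d:ℝ) ^ 2 / δ < 4 ^ m) :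
    S.card ≤ (2 ^ m) ^ d := by
  have h := Finset.card_le_card_of_injOn (s := S) (t := Fintype.piFinset (fun _ : Fin d => Finset.Ico (0:ℤ) (2 ^ m))) (kl m) (by
    intro ξ hξ
    rw [Finset.mem_coe, Fintype.mem_piFinset]
    intro j
    have := kl_spec (m := m) (hS.h1 ξ hξ j)
    exact Finset.mem_Ico.2 ⟨this.1, this.2.1⟩) (fun ξ hξ η hη hh => kl_inj hS hδ hd hm hξ hη hh)
  refine h.trans (le_of_eq ?_)
  rw [Fintype.card_piFinset]
  simp only [Int.card_Ico, sub_zero, Finset.prod_const, Finset.card_univ, Fintype.card_fin]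
  congr 1

theorem zt_diff {d : ℕ} (hd : 1 ≤ d) {δ : ℝ} {S : Finset (Rsp d)} (hS : Gd d δ S)
    {ξ η : Rsp d} (hξ : ξ ∈ S) (hη : η ∈ S) (j : Fin d ⊕ Unit) : |zt d ξ j - zt d η j| ≤ d := by
  have hd1 : (1:ℝ) ≤ d := by exact_mod_cast hd
  have key : ∀ ξ ∈ S, |zt d ξ j| ≤ d / 2 := by
    intro ξ hξ
    unfold zt
    rcases j with j | ⟨⟩
    · have := hS.h1 ξ hξ j; linarith
    · rw [hS.h2 ξ hξ]
      refine (Finset.abs_sum_le_sum_abs _ _).trans ?_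
      refine (Finset.sum_le_card_nsmul _ _ (1 / 2) fun j _ => ?_).trans (le_of_eq (by simp; ring))
      have := hS.h1 ξ hξ j
      rw [abs_pow]
      nlinarith [abs_nonneg (ξ (Sum.inl j))]
  refine (abs_sub _ _).trans ?_
  linarith [key ξ hξ, key η hη]

theorem ann' (ζ : I → ι → ℝ) {ρ r : ℝ} {c : ℝ≥0∞} {S : Finset I} {l0 : I} (h0 : l0 ∈ S)
    (h : ∀ l ∈ S, l ≠ l0 → ∃ y : ι → ℝ, (∀ j, |y j| ≤ ρ) ∧ c ≤ ‖ee (ph (ζ l0) y) - ee (ph (ζ l) y)‖ₑ) (u : I → ℂ) :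
    ∃ k ≤ S.card, c ^ k * ‖u l0‖ₑ * volume (bx r : Set (ι → ℝ)) ≤ 2 ^ k * ∫⁻ x in bx (r + k * ρ), ‖es ζ u S x‖ₑ := by
  have h1 := ann ζ l0 (ρ := ρ) (r := r) (c := c) (S.erase l0) (Finset.notMem_erase _ _)
    (fun l hl => h l (Finset.mem_erase.1 hl).2 (Finset.mem_erase.1 hl).1) u
  rw [Finset.insert_erase h0] at h1
  exact ⟨_, Finset.card_le_card (Finset.erase_subset _ _), h1⟩

theorem ph_single [DecidableEq ι] (z : ι → ℝ) (j : ι) (t : ℝ) : ph z (Pi.single j t) = z j * t := by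
  simp [ph, Pi.single_apply]

theorem gg_half (ζ : I → ι → ℝ) (u : I → ℂ) (S : Finset I) (x : ι → ℝ) : (gg ζ u S x) ^ (1 / 2 : ℝ) = ‖es ζ u S x‖ₑ := by
  unfold gg
  rw [← ENNReal.rpow_natCast, ← ENNReal.rpow_mul]
  norm_num

theorem gi_half (ζ : I → ι → ℝ) (u : I → ℂ) (S : Finset I) (ν : Measure (ι → ℝ)) : gi ζ ν (1 / 2) S u = ∫⁻ x, ‖es ζ u S x‖ₑ ∂ν := by
  unfold gi
  simp only [gg_half]

theorem smallcase {d : ℕ} (hd : 1 ≤ d) {δ R0 : ℝ} (hδ : 0 < δ) (hδ1 : δ < 1) (hR0 : 0 < R0) :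
    ∃ C : ℝ≥0∞, C ≠ ⊤ ∧ ∀ (S : Finset (Rsp d)) (u : Rsp d → ℂ) (R : ℝ), Gd d δ S → R0 ≤ R →
      (∑ l ∈ S, ‖u l‖ₑ ^ 2) ^ (1 / 2 : ℝ) ≤ C * gi (zt d) (ub R) (1 / 2) S u := by
  obtain ⟨m, hm1, hm2⟩ := exists_m hd hδ hδ1
  set M : ℕ := (2 ^ m) ^ d with hM
  have hM1 : 1 ≤ M := Nat.one_le_iff_ne_zero.2 (by positivity)
  have hM1' : (1:ℝ) ≤ M := by exact_mod_cast hM1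
  have hd1 : (1:ℝ) ≤ d := by exact_mod_cast hd
  set ρ : ℝ := min (1 / (2 * d)) (R0 / (2 * M)) with hρ
  have hρ0 : 0 < ρ := lt_min (by positivity) (by positivity)
  have hρ1 : ρ ≤ 1 / (2 * d) := min_le_left _ _
  have hρ2 : ρ ≤ R0 / (2 * M) := min_le_right _ _
  set c0 : ℝ := min 1 (4 * ((Real.sqrt δ / (d + 1)) * ρ)) with hc0
  have hsq : 0 < Real.sqrt δ := Real.sqrt_pos.2 hδ
  have hc0p : 0 < c0 := lt_min (by norm_num) (by positivity)
  set c : ℝ≥0∞ := ENNReal.ofReal c0 with hc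
  have hcne : c ≠ 0 := by simp [hc, hc0p]
  have hc1 : c ≤ 1 := by rw [hc]; exact ENNReal.ofReal_le_one.2 (min_le_left _ _)
  have hcT : c ≠ ⊤ := ENNReal.ofReal_ne_top
  set N := Fintype.card (Fin d ⊕ Unit) with hN
  set K : ℝ≥0∞ := (c ^ M)⁻¹ * 2 ^ M * 2 ^ N with hK
  have hKT : K ≠ ⊤ := by
    rw [hK]
    exact ENNReal.mul_ne_top (ENNReal.mul_ne_top (ENNReal.inv_ne_top.2 (pow_ne_zero _ hcne)) (by finiteness)) (by finiteness)
  refine ⟨M * K, ENNReal.mul_ne_top (by simp) hKT, ?_⟩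
  intro S u R hS hR
  have hRp : 0 < R := hR0.trans_le hR
  have hcard : S.card ≤ M := card_bound hS hδ hd hm1
  have key : ∀ l0 ∈ S, ‖u l0‖ₑ ≤ K * gi (zt d) (ub R) (1 / 2) S u := by
    intro l0 hl0
    obtain ⟨k, hk, h⟩ := ann' (zt d) (ρ := ρ) (r := R / 2) (c := c) hl0 (by
      intro l hlS hl
      obtain ⟨j, hj⟩ := coord_sep hS hδ hl0 hlS (Ne.symm hl)
      refine ⟨Pi.single j ρ, ?_, ?_⟩
      · intro i
        by_cases hi : i = j
        · subst hi; simp [abs_of_pos hρ0]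
        · simp [hi, hρ0.le]
      · rw [ph_single, ph_single, hc, ← ofReal_norm_eq_enorm]
        refine ENNReal.ofReal_le_ofReal ?_
        have e : |zt d l0 j * ρ - zt d l j * ρ| = |zt d l0 j - zt d l j| * ρ := by
          rw [← sub_mul, abs_mul, abs_of_pos hρ0]
        refine le_trans ?_ (ee_sub_lower ?_)
        · refine (min_le_right _ _).trans ?_
          rw [e]; gcongr
        · rw [e]
          calc _ ≤ (d:ℝ) * (1 / (2 * d)) := by
                have := zt_diff hd hS hl0 hlS j
                gcongr
            _ = 1 / 2 := by field_simp) u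
    have hkM : k ≤ M := hk.trans hcard
    have hbx : R / 2 + k * ρ ≤ R := by
      have h1 : (k:ℝ) * ρ ≤ M * (R0 / (2 * M)) := by
        have : (k:ℝ) ≤ M := by exact_mod_cast hkM
        gcongr
      have h2 : (M:ℝ) * (R0 / (2 * M)) = R0 / 2 := by field_simp
      linarith
    rw [vol_bx, show 2 * (R / 2) = R by ring] at h
    have hV : ENNReal.ofReal R ≠ 0 := by simp [hRp]
    have h1 : c ^ M * ‖u l0‖ₑ * ENNReal.ofReal R ^ N ≤ 2 ^ M * ∫⁻ x in bx R, ‖es (zt d) u S x‖ₑ := by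
      calc _ ≤ c ^ k * ‖u l0‖ₑ * ENNReal.ofReal R ^ N := by
            gcongr ?_ * _ * _
            exact pow_le_pow_of_le_one bot_le hc1 hkM
        _ ≤ _ := h
        _ ≤ _ := by
            gcongr
            · norm_num
            · exact bx_mono hbx
    rw [gi_half, ub_lint hRp]
    have e2 : (2:ℝ≥0∞) ^ N * (ENNReal.ofReal (2 * R))⁻¹ ^ N = (ENNReal.ofReal R ^ N)⁻¹ := by
      rw [← mul_pow, ENNReal.inv_pow]
      congr 1
      rw [← ENNReal.ofReal_inv_of_pos (by positivity), ← ENNReal.ofReal_inv_of_pos (by positivity),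
        show (2:ℝ≥0∞) = ENNReal.ofReal 2 by simp, ← ENNReal.ofReal_mul (by positivity)]
      congr 1; field_simp
    have e3 : K * ((ENNReal.ofReal (2 * R))⁻¹ ^ N * ∫⁻ x in bx R, ‖es (zt d) u S x‖ₑ) =
        (c ^ M * ENNReal.ofReal R ^ N)⁻¹ * (2 ^ M * ∫⁻ x in bx R, ‖es (zt d) u S x‖ₑ) := by
      rw [ENNReal.mul_inv (Or.inl (pow_ne_zero _ hcne)) (Or.inl (by finiteness)), ← e2, hK]; ring
    rw [e3]
    have e4 : ‖u l0‖ₑ = (c ^ M * ENNReal.ofReal R ^ N)⁻¹ * ((c ^ M * ENNReal.ofReal R ^ N) * ‖u l0‖ₑ) := by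
      rw [← mul_assoc, ENNReal.inv_mul_cancel (mul_ne_zero (pow_ne_zero _ hcne) (pow_ne_zero _ hV)) (by finiteness), one_mul]
    have h5 : (c ^ M * ENNReal.ofReal R ^ N) * ‖u l0‖ₑ ≤ 2 ^ M * ∫⁻ x in bx R, ‖es (zt d) u S x‖ₑ :=
      le_of_eq_of_le (by ring) h1
    rw [e4]
    exact mul_le_mul_right h5 _
  set G := gi (zt d) (ub R) (1 / 2) S u with hG
  have hs : ∑ l ∈ S, ‖u l‖ₑ ^ 2 ≤ (M * K * G) ^ 2 := by
    calc _ ≤ ∑ l ∈ S, (K * G) ^ 2 := by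
          refine Finset.sum_le_sum fun l hl => ?_
          gcongr; exact key l hl
      _ = S.card * (K * G) ^ 2 := by simp
      _ ≤ (M:ℝ≥0∞) ^ 2 * (K * G) ^ 2 := by
          gcongr
          have : S.card ≤ M ^ 2 := hcard.trans (Nat.le_self_pow (by norm_num) M)
          exact_mod_cast this
      _ = _ := by ring
  calc _ ≤ ((M * K * G) ^ 2) ^ (1 / 2 : ℝ) := by gcongr
    _ = _ := by
      rw [← ENNReal.rpow_natCast, ← ENNReal.rpow_mul]; norm_num

end DR

namespace DR
open scoped ENNReal NNReal
open scoped Classical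
variable {ι : Type} [Fintype ι] {I : Type}

theorem gi_holder {a b q : ℝ} (ha : 0 ≤ a) (hb : 0 ≤ b) (hq : 0 ≤ q) (hab : a + b = 1) (h : 1 / 2 * a + q * b = 1) (ζ : I → ι → ℝ)
    (ν : Measure (ι → ℝ)) (S : Finset I) (u : I → ℂ) :
    gi ζ ν 1 S u ≤ (gi ζ ν (1 / 2) S u) ^ a * (gi ζ ν q S u) ^ b := by
  have hm := measurable_gg_right ζ S u
  have h1 := ENNReal.lintegral_mul_norm_pow_le (μ := ν) (f := fun x => gg ζ u S x ^ (1 / 2 : ℝ)) (g := fun x => gg ζ u S x ^ q)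
    (hm.pow_const _).aemeasurable (hm.pow_const _).aemeasurable ha hb hab
  refine le_trans (le_of_eq ?_) h1
  unfold gi
  refine lintegral_congr fun x => ?_
  rw [← ENNReal.rpow_mul, ← ENNReal.rpow_mul, ← ENNReal.rpow_add_of_nonneg _ _ (by positivity) (by positivity), h]

theorem lowerBig {d : ℕ} (hd : 1 ≤ d) {K : ℝ} (hK2 : 2 ≤ K)
    (hK : ∀ (I : Type) (ζ : I → Fin d ⊕ Unit → ℝ) (u : I → ℂ) (S : Finset I) (r R : ℝ), 0 < r →
    (∀ l ∈ S, ∀ l' ∈ S, l ≠ l' → ∃ j, 1 / r ≤ |ζ l j - ζ l' j|) → K * r ≤ R →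
    ∑ l ∈ S, ‖u l‖ₑ ^ 2 ≤ 2 ^ (Fintype.card (Fin d ⊕ Unit) + 1) * gi ζ (ub R) 1 S u) {ε : ℝ} (hε : 0 < ε) :
    ∃ C : ℝ≥0∞, C ≠ ⊤ ∧ ∀ (δ : ℝ) (S : Finset (Rsp d)) (u : Rsp d → ℂ) (R : ℝ), 0 < δ → δ < 1 → K * (d + 1) ^ 2 * Real.sqrt δ ≤ 1 → Gd d δ S → δ⁻¹ ≤ R →
      (∑ l ∈ S, ‖u l‖ₑ ^ 2) ^ (1 / 2 : ℝ) ≤ C * ENNReal.ofReal (δ ^ (-ε)) * gi (zt d) (ub (R / (d + 1))) (1 / 2) S u := by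
  have hd1 : (1:ℝ) ≤ d := by exact_mod_cast hd
  set q : ℝ := (d + 2) / d with hq
  have hq1 : 1 ≤ q := by rw [hq, one_le_div (by positivity)]; linarith
  obtain ⟨C, hC, hU⟩ := upperU hd hq1 (by rw [hq]; field_simp; linarith) (ε := ε * (4 / (d + 2))) (by positivity)
  set N := Fintype.card (Fin d ⊕ Unit) with hN
  set a : ℝ := 4 / (d + 4) with ha
  set b : ℝ := d / (d + 4) with hb
  set e : ℝ := (d + 2) / (d + 4) with he
  have ha0 : 0 < a := by positivity
  have hb0 : 0 < b := by positivity
  have he0 : 0 < e := by positivity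
  have hab : a + b = 1 := by rw [ha, hb]; field_simp; ring
  have hqb : q * b = e := by rw [hq, hb, he]; field_simp
  have h12 : 1 / 2 * a + q * b = 1 := by rw [hqb, ha, he]; field_simp; ring
  have hea : 1 / 2 * a + e = 1 := by rw [← hqb]; exact h12
  have he4 : e * (1 / a) = (d + 2) / 4 := by rw [he, ha]; field_simp
  set P : ℝ≥0∞ := 2 ^ (N + 1) * (ENNReal.ofReal (d + 1) ^ N) ^ b with hP
  have hPT : P ≠ ⊤ := by
    rw [hP]
    exact ENNReal.mul_ne_top (by finiteness) (ENNReal.rpow_ne_top_of_nonneg hb0.le (by finiteness))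
  refine ⟨P ^ (1 / a) * C ^ (e * (1 / a)), ENNReal.mul_ne_top (ENNReal.rpow_ne_top_of_nonneg (by positivity) hPT)
    (ENNReal.rpow_ne_top_of_nonneg (by positivity) hC), ?_⟩
  intro δ S u R hδ hδ1 hδK hS hR
  have hR0 : 0 < R := lt_of_lt_of_le (by positivity) hR
  have hsq : 0 < Real.sqrt δ := Real.sqrt_pos.2 hδ
  set R1 := R / (d + 1) with hR1
  have hR10 : 0 < R1 := by positivity
  set X := ∑ l ∈ S, ‖u l‖ₑ ^ 2 with hX
  have hXT : X ≠ ⊤ := ENNReal.sum_ne_top.2 fun l _ => by simp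
  by_cases hX0 : X = 0
  · rw [hX0, ENNReal.zero_rpow_of_pos (by norm_num)]; exact bot_le
  set Gh := gi (zt d) (ub R1) (1 / 2) S u with hGh
  set D := ENNReal.ofReal (δ ^ (-(ε * (4 / (d + 2))))) with hD
  have s1 : X ≤ 2 ^ (N + 1) * gi (zt d) (ub R1) 1 S u := by
    refine hK _ (zt d) u S ((d + 1) / Real.sqrt δ) R1 (by positivity) ?_ ?_
    · intro l hl l' hl' h
      rw [one_div_div]
      exact coord_sep hS hδ hl hl' h
    · rw [hR1, le_div_iff₀ (by positivity)]
      refine le_trans ?_ hR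
      rw [← mul_div_assoc, div_mul_eq_mul_div, div_le_iff₀ hsq]
      have : δ⁻¹ * Real.sqrt δ = 1 / Real.sqrt δ := by
        nth_rw 1 [← Real.sq_sqrt hδ.le]; field_simp
      rw [this, le_div_iff₀ hsq]
      nlinarith
  have s2 := gi_holder ha0.le hb0.le (by linarith) hab h12 (zt d) (ub R1) S u
  have s3 : gi (zt d) (ub R1) q S u ≤ ENNReal.ofReal (d + 1) ^ N * (C * D * X) ^ q := by
    refine (ub_mono hR10 (R' := R) (by rw [hR1]; exact div_le_self hR0.le (by linarith)) _).trans ?_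
    rw [show R / R1 = d + 1 by rw [hR1]; field_simp]
    refine mul_le_mul_right ?_ _
    have := ENNReal.rpow_le_rpow (hU δ S u R hδ hδ1 hS hR) (z := q) (by linarith)
    rw [← ENNReal.rpow_mul, one_div_mul_cancel (by linarith), ENNReal.rpow_one] at this
    exact this
  have s4 : X ≤ P * Gh ^ a * (C * D) ^ e * X ^ e := by
    calc X ≤ _ := s1
      _ ≤ 2 ^ (N + 1) * (Gh ^ a * (ENNReal.ofReal (d + 1) ^ N * (C * D * X) ^ q) ^ b) := by
          refine mul_le_mul_right (s2.trans ?_) _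
          gcongr
      _ = _ := by
          rw [ENNReal.mul_rpow_of_nonneg (ENNReal.ofReal (d + 1) ^ N) _ hb0.le, ← ENNReal.rpow_mul (C * D * X), hqb,
            ENNReal.mul_rpow_of_nonneg (C * D) X he0.le, hP]
          ring
  have hXe0 : X ^ e ≠ 0 := by simp [hX0, hXT]
  have hXeT : X ^ e ≠ ⊤ := ENNReal.rpow_ne_top_of_nonneg he0.le hXT
  have s5 : X ^ (1 / 2 * a) ≤ P * Gh ^ a * (C * D) ^ e := by
    have e1 : X = X ^ (1 / 2 * a) * X ^ e := by
      rw [← ENNReal.rpow_add _ _ hX0 hXT, hea, ENNReal.rpow_one]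
    have e2 : X ^ (1 / 2 * a) * X ^ e ≤ P * Gh ^ a * (C * D) ^ e * X ^ e := e1 ▸ s4
    exact (ENNReal.mul_le_mul_iff_left hXe0 hXeT).1 e2
  have s6 := ENNReal.rpow_le_rpow s5 (z := 1 / a) (by positivity)
  rw [← ENNReal.rpow_mul, mul_assoc (1/2 : ℝ) a, mul_one_div_cancel ha0.ne', mul_one] at s6
  refine s6.trans (le_of_eq ?_)
  rw [ENNReal.mul_rpow_of_nonneg _ _ (by positivity), ENNReal.mul_rpow_of_nonneg P _ (by positivity), ← ENNReal.rpow_mul Gh,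
    mul_one_div_cancel ha0.ne', ENNReal.rpow_one, ← ENNReal.rpow_mul (C * D), ENNReal.mul_rpow_of_nonneg C _ (by positivity)]
  have hDD : D ^ (e * (1 / a)) = ENNReal.ofReal (δ ^ (-ε)) := by
    rw [hD, ENNReal.ofReal_rpow_of_pos (by positivity), ← Real.rpow_mul hδ.le, he4]
    congr 2; field_simp
  rw [hDD]; ring

theorem lowerU {d : ℕ} (hd : 1 ≤ d) {ε : ℝ} (hε : 0 < ε) :
    ∃ C : ℝ≥0∞, C ≠ ⊤ ∧ ∀ (δ : ℝ) (S : Finset (Rsp d)) (u : Rsp d → ℂ) (R : ℝ), 0 < δ → δ < 1 → Gd d δ S → δ⁻¹ ≤ R →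
      (∑ l ∈ S, ‖u l‖ₑ ^ 2) ^ (1 / 2 : ℝ) ≤ C * ENNReal.ofReal (δ ^ (-ε)) * gi (zt d) (ub (R / (d + 1))) (1 / 2) S u := by
  have hd1 : (1:ℝ) ≤ d := by exact_mod_cast hd
  obtain ⟨K, hK2, hK⟩ := L2lower (Fin d ⊕ Unit)
  obtain ⟨C1, hC1, h1⟩ := lowerBig hd hK2 hK hε
  set κ : ℝ := K * (d + 1) ^ 2 with hκ
  have hκ1 : 1 < κ := by rw [hκ]; nlinarith
  have hκ0 : 0 < κ := by linarith
  set δ0 : ℝ := (κ⁻¹) ^ 2 with hδ0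
  have hδ0p : 0 < δ0 := by positivity
  have hδ01 : δ0 < 1 := by
    rw [hδ0]; exact pow_lt_one₀ (by positivity) (inv_lt_one_of_one_lt₀ hκ1) (by norm_num)
  obtain ⟨C2, hC2, h2⟩ := smallcase hd hδ0p hδ01 (R0 := 1 / (d + 1)) (by positivity)
  refine ⟨C1 + C2, ENNReal.add_ne_top.2 ⟨hC1, hC2⟩, ?_⟩
  intro δ S u R hδ hδ1 hS hR
  by_cases h : κ * Real.sqrt δ ≤ 1
  · refine (h1 δ S u R hδ hδ1 h hS hR).trans ?_
    gcongr; exact le_self_add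
  · push Not at h
    have hle : Real.sqrt δ0 ≤ Real.sqrt δ := by
      rw [hδ0, Real.sqrt_sq (by positivity), inv_le_iff_one_le_mul₀ hκ0]
      linarith [mul_comm κ (Real.sqrt δ)]
    have hS' : Gd d δ0 S := ⟨hS.h1, hS.h2, fun ξ hξ η hη hne => hle.trans (hS.h3 ξ hξ η hη hne)⟩
    have hR1 : 1 ≤ R := le_trans (by rw [one_le_inv₀ hδ]; exact hδ1.le) hR
    refine (h2 S u (R / (d + 1)) hS' (by gcongr)).trans ?_
    have hone : 1 ≤ ENNReal.ofReal (δ ^ (-ε)) := by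
      rw [ENNReal.one_le_ofReal]
      exact Real.one_le_rpow_of_pos_of_le_one_of_nonpos hδ hδ1.le (by linarith)
    calc _ = C2 * 1 * gi (zt d) (ub (R / (d + 1))) (1 / 2) S u := by rw [mul_one]
      _ ≤ _ := by gcongr; exact le_add_self

end DR

namespace DR
open scoped ENNReal NNReal
open scoped Classical
variable {ι : Type} [Fintype ι] {I : Type}

/-- The Euclidean ball, as a set of plain vectors. -/
def Bs (d : ℕ) (R : ℝ) : Set (Fin d ⊕ Unit → ℝ) := {z | ∑ j, z j ^ 2 < R ^ 2}

theorem measurableSet_Bs (d : ℕ) (R : ℝ) : MeasurableSet (Bs d R) :=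
  measurableSet_lt (by fun_prop) measurable_const

theorem mem_ball_iff {d : ℕ} {c x : Rsp d} {R : ℝ} (hR : 0 < R) : x ∈ Metric.ball c R ↔ zt d x - zt d c ∈ Bs d R := by
  rw [Metric.mem_ball, ← sq_lt_sq₀ dist_nonneg hR.le, dist_sq]
  rfl

theorem ball_int {d : ℕ} (c : Rsp d) {R : ℝ} (hR : 0 < R) {f : (Fin d ⊕ Unit → ℝ) → ℝ≥0∞} (hf : Measurable f) :
    ∫⁻ x in Metric.ball c R, f (zt d x) = ∫⁻ z in Bs d R, f (zt d c + z) := by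
  rw [← lintegral_indicator Metric.isOpen_ball.measurableSet, ← lintegral_indicator (measurableSet_Bs d R)]
  have hm : Measurable ((fun y => (Bs d R).indicator (fun z => f (zt d c + z)) (y - zt d c))) := by
    have h1 : Measurable (fun z => f (zt d c + z)) := hf.comp (by fun_prop)
    exact (h1.indicator (measurableSet_Bs d R)).comp (by fun_prop)
  have h := (PiLp.volume_preserving_ofLp (Fin d ⊕ Unit)).lintegral_comp hm
  rw [← lintegral_sub_right_eq_self _ (zt d c), ← h]
  refine lintegral_congr fun x => ?_
  by_cases hx : x ∈ Metric.ball c R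
  · have h2 := (mem_ball_iff hR).1 hx
    rw [Set.indicator_of_mem hx, Set.indicator_of_mem (by exact h2)]
    congr 1
    funext j
    simp [zt]
  · have h2 := (mem_ball_iff hR).not.1 hx
    rw [Set.indicator_of_notMem hx, Set.indicator_of_notMem (by exact h2)]

theorem Bs_sub {d : ℕ} {R : ℝ} (hR : 0 < R) : Bs d R ⊆ bx R := by
  intro z hz
  rw [mem_bx]
  intro j
  have h1 : z j ^ 2 ≤ ∑ j, z j ^ 2 := Finset.single_le_sum (f := fun j => z j ^ 2) (fun _ _ => by positivity) (Finset.mem_univ j)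
  have h2 : z j ^ 2 < R ^ 2 := lt_of_le_of_lt h1 hz
  exact (abs_lt_of_sq_lt_sq h2 hR.le).le

theorem sub_Bs {d : ℕ} (hd : 1 ≤ d) {R : ℝ} (hR : 0 < R) : bx (R / (d + 1)) ⊆ Bs d R := by
  intro z hz
  rw [mem_bx] at hz
  have hd1 : (1:ℝ) ≤ d := by exact_mod_cast hd
  have h1 : ∑ j, z j ^ 2 ≤ (d + 1) * (R / (d + 1)) ^ 2 := by
    refine (Finset.sum_le_card_nsmul _ _ ((R / (d + 1)) ^ 2) fun j _ => ?_).trans (le_of_eq (by simp))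
    rw [← sq_abs]
    have := hz j
    gcongr
  refine lt_of_le_of_lt h1 ?_
  rw [div_pow, pow_two ((d:ℝ) + 1), ← mul_div_assoc, mul_div_mul_left _ _ (by positivity), div_lt_iff₀ (by positivity)]
  nlinarith [pow_pos hR 2]

theorem vol_ball {d : ℕ} (c : Rsp d) {R : ℝ} (hR : 0 < R) : volume (Metric.ball c R) = volume (Bs d R) := by
  have := ball_int c hR (f := fun _ => 1) measurable_const
  simpa using this

theorem cN {R D : ℝ} (hR : 0 < R) (hD : 0 < D) (N : ℕ) :
    (ENNReal.ofReal (2 * (R / D)))⁻¹ ^ N = ENNReal.ofReal D ^ N * (ENNReal.ofReal (2 * R))⁻¹ ^ N := by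
  rw [← mul_pow, ← ENNReal.ofReal_inv_of_pos (by positivity), ← ENNReal.ofReal_inv_of_pos (by positivity),
    ← ENNReal.ofReal_mul (by positivity)]
  congr 2; field_simp

theorem avg_le {d : ℕ} (hd : 1 ≤ d) {R : ℝ} (hR : 0 < R) (h : (Fin d ⊕ Unit → ℝ) → ℝ≥0∞) :
    (volume (Bs d R))⁻¹ * ∫⁻ z in Bs d R, h z ≤ ENNReal.ofReal (d + 1) ^ (Fintype.card (Fin d ⊕ Unit)) * ∫⁻ z, h z ∂(ub R) := by
  have hd1 : (0:ℝ) < d + 1 := by positivity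
  rw [ub_lint hR, ← mul_assoc, ← cN hR hd1, ← ENNReal.inv_pow, ← vol_bx]
  gcongr
  · exact sub_Bs hd hR
  · exact Bs_sub hR

theorem le_avg {d : ℕ} (hd : 1 ≤ d) {R : ℝ} (hR : 0 < R) (h : (Fin d ⊕ Unit → ℝ) → ℝ≥0∞) :
    ∫⁻ z, h z ∂(ub (R / (d + 1))) ≤ ENNReal.ofReal (d + 1) ^ (Fintype.card (Fin d ⊕ Unit)) * ((volume (Bs d R))⁻¹ * ∫⁻ z in Bs d R, h z) := by
  have hd1 : (0:ℝ) < d + 1 := by positivity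
  rw [ub_lint (by positivity), cN hR hd1, mul_assoc, ← ENNReal.inv_pow, ← vol_bx]
  gcongr
  · exact Bs_sub hR
  · exact sub_Bs hd hR

theorem inner_zt {d : ℕ} (ξ x : Rsp d) : inner ℝ ξ x = ph (zt d ξ) (zt d x) := by
  simp [PiLp.inner_apply, ph, zt, mul_comm]

theorem F_eq {d : ℕ} (S : Finset (Rsp d)) (a : Rsp d → ℂ) (x : Rsp d) :
    ∑ ξ ∈ S, a ξ * ee (inner ℝ ξ x) = es (zt d) a S (zt d x) := by
  simp only [inner_zt, es]

theorem enorm_sh {d : ℕ} (c : Fin d ⊕ Unit → ℝ) (a : Rsp d → ℂ) (l : Rsp d) : ‖sh (zt d) c 0 a l‖ₑ = ‖a l‖ₑ := by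
  simp [sh, enorm_mul, enorm_ee]

theorem enorm_es_sh {d : ℕ} (c z : Fin d ⊕ Unit → ℝ) (a : Rsp d → ℂ) (S : Finset (Rsp d)) :
    ‖es (zt d) a S (c + z)‖ₑ = ‖es (zt d) (sh (zt d) c 0 a) S z‖ₑ := by
  rw [es_sh, enorm_mul, enorm_ee, one_mul]

/-- normalised averages over the ball -/
def av (d : ℕ) (R p : ℝ) (S : Finset (Rsp d)) (u : Rsp d → ℂ) : ℝ≥0∞ :=
  (volume (Bs d R))⁻¹ * ∫⁻ z in Bs d R, ‖es (zt d) u S z‖ₑ ^ p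

theorem av_mono {d : ℕ} (hd : 1 ≤ d) {R : ℝ} (hR : 0 < R) {p p' : ℝ} (hp : 0 < p) (hpp : p ≤ p') (S : Finset (Rsp d)) (u : Rsp d → ℂ) :
    (av d R p S u) ^ (1 / p) ≤ (av d R p' S u) ^ (1 / p') := by
  have hp' : 0 < p' := hp.trans_le hpp
  have hv0 : volume (Bs d R) ≠ 0 := by
    refine ne_of_gt (lt_of_lt_of_le ?_ (measure_mono (sub_Bs hd hR)))
    rw [vol_bx]
    exact pos_iff_ne_zero.2 (pow_ne_zero _ (by simp; positivity))
  have hvT : volume (Bs d R) ≠ ⊤ := by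
    refine ne_of_lt (lt_of_le_of_lt (measure_mono (Bs_sub hR)) ?_)
    rw [vol_bx]; finiteness
  set ν : Measure (Fin d ⊕ Unit → ℝ) := (volume (Bs d R))⁻¹ • volume.restrict (Bs d R) with hν
  haveI : IsProbabilityMeasure ν := ⟨by
    rw [hν, Measure.smul_apply, Measure.restrict_apply_univ, smul_eq_mul, ENNReal.inv_mul_cancel hv0 hvT]⟩
  have e : ∀ t, av d R t S u = ∫⁻ z, ‖es (zt d) u S z‖ₑ ^ t ∂ν := by
    intro t
    rw [hν, lintegral_smul_measure, smul_eq_mul]; rfl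
  rw [e, e]
  have hm : Measurable (fun z => ‖es (zt d) u S z‖ₑ ^ p) := (continuous_es_right (zt d) S u).measurable.enorm.pow_const _
  have h := ENNReal.rpow_le_rpow (jensen_le ν (r := p' / p) ((one_le_div hp).2 hpp) hm) (z := 1 / p) (by positivity)
  refine h.trans (le_of_eq ?_)
  simp only [← ENNReal.rpow_mul]
  rw [mul_div_cancel₀ _ hp.ne', show 1 / (p' / p) * (1 / p) = 1 / p' by field_simp]

theorem core {d : ℕ} (hd : 1 ≤ d) {p ε : ℝ} (hp1 : 1 ≤ p) (hp : p * d ≤ 2 * (d + 2)) (hε : 0 < ε) :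
    ∃ C : ℝ≥0∞, C ≠ ⊤ ∧ ∀ (δ : ℝ) (S : Finset (Rsp d)) (u : Rsp d → ℂ) (R : ℝ), 0 < δ → δ < 1 → Gd d δ S → δ⁻¹ ≤ R →
      (∑ l ∈ S, ‖u l‖ₑ ^ 2) ^ (1 / 2 : ℝ) ≤ C * ENNReal.ofReal (δ ^ (-ε)) * (av d R p S u) ^ (1 / p) ∧
      (av d R p S u) ^ (1 / p) ≤ C * ENNReal.ofReal (δ ^ (-ε)) * (∑ l ∈ S, ‖u l‖ₑ ^ 2) ^ (1 / 2 : ℝ) := by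
  have hd1 : (1:ℝ) ≤ d := by exact_mod_cast hd
  set q : ℝ := (d + 2) / d with hq
  have hq1 : 1 ≤ q := by rw [hq, one_le_div (by positivity)]; linarith
  have hq0 : 0 < q := by linarith
  have hpq : p ≤ 2 * q := by
    rw [hq, ← mul_div_assoc, le_div_iff₀ (by positivity)]; exact hp
  obtain ⟨C1, hC1, h1⟩ := upperU hd hq1 (by rw [hq]; field_simp; linarith) (ε := 2 * ε) (by positivity)
  obtain ⟨C2, hC2, h2⟩ := lowerU hd hε
  set B : ℝ≥0∞ := ENNReal.ofReal (d + 1) ^ (Fintype.card (Fin d ⊕ Unit)) with hB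
  have hBT : B ≠ ⊤ := by rw [hB]; finiteness
  refine ⟨C2 * B + B ^ (1 / (2 * q)) * C1 ^ (1 / 2 : ℝ), ENNReal.add_ne_top.2 ⟨ENNReal.mul_ne_top hC2 hBT, ENNReal.mul_ne_top
    (ENNReal.rpow_ne_top_of_nonneg (by positivity) hBT) (ENNReal.rpow_ne_top_of_nonneg (by positivity) hC1)⟩, ?_⟩
  intro δ S u R hδ hδ1 hS hR
  have hR0 : 0 < R := lt_of_lt_of_le (by positivity) hR
  constructor
  · refine (h2 δ S u R hδ hδ1 hS hR).trans ?_
    have h3 : gi (zt d) (ub (R / (d + 1))) (1 / 2) S u ≤ B * (av d R p S u) ^ (1 / p) := by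
      rw [gi_half]
      refine (le_avg hd hR0 _).trans ?_
      refine mul_le_mul_right ?_ _
      have := av_mono hd hR0 one_pos hp1 S u
      refine le_trans (le_of_eq ?_) this
      simp [av]
    calc _ ≤ C2 * ENNReal.ofReal (δ ^ (-ε)) * (B * (av d R p S u) ^ (1 / p)) := by gcongr
      _ = C2 * B * ENNReal.ofReal (δ ^ (-ε)) * (av d R p S u) ^ (1 / p) := by ring
      _ ≤ _ := by gcongr; exact le_self_add
  · refine (av_mono hd hR0 (by linarith) hpq S u).trans ?_
    set X := ∑ l ∈ S, ‖u l‖ₑ ^ 2 with hX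
    have e : ∀ z, ‖es (zt d) u S z‖ₑ ^ (2 * q) = gg (zt d) u S z ^ q := by
      intro z
      rw [ENNReal.rpow_mul, gg]; norm_num
    have h3 : av d R (2 * q) S u ≤ B * gi (zt d) (ub R) q S u := by
      unfold av
      simp only [e]
      exact avg_le hd hR0 _
    calc _ ≤ (B * gi (zt d) (ub R) q S u) ^ (1 / (2 * q)) := by gcongr
      _ = B ^ (1 / (2 * q)) * ((gi (zt d) (ub R) q S u) ^ (1 / q)) ^ (1 / 2 : ℝ) := by
          rw [ENNReal.mul_rpow_of_nonneg _ _ (by positivity), ← ENNReal.rpow_mul]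
          congr 2; field_simp
      _ ≤ B ^ (1 / (2 * q)) * (C1 * ENNReal.ofReal (δ ^ (-(2 * ε))) * X) ^ (1 / 2 : ℝ) := by
          gcongr; exact h1 δ S u R hδ hδ1 hS hR
      _ = B ^ (1 / (2 * q)) * C1 ^ (1 / 2 : ℝ) * ENNReal.ofReal (δ ^ (-ε)) * X ^ (1 / 2 : ℝ) := by
          rw [ENNReal.mul_rpow_of_nonneg (C1 * ENNReal.ofReal (δ ^ (-(2 * ε)))) _ (by norm_num),
            ENNReal.mul_rpow_of_nonneg C1 _ (by norm_num), ENNReal.ofReal_rpow_of_pos (by positivity), ← Real.rpow_mul hδ.le,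
            show -(2 * ε) * (1 / 2) = -ε by ring]
          ring
      _ ≤ _ := by gcongr; exact le_add_self

theorem real_av {d : ℕ} {R p : ℝ} (hR : 0 < R) (hp : 1 ≤ p) (S : Finset (Rsp d)) (a : Rsp d → ℂ) (c : Rsp d) :
    ((volume (Metric.ball c R)).toReal⁻¹ * ∫ x in Metric.ball c R, ‖∑ ξ ∈ S, a ξ * ee (inner ℝ ξ x)‖ ^ p) ^ (1 / p) =
      ((av d R p S (sh (zt d) (zt d c) 0 a)) ^ (1 / p)).toReal := by
  rw [← ENNReal.toReal_rpow]
  congr 1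
  have hzt : Continuous (zt d) := by unfold zt; fun_prop
  have hcont : Continuous (fun x : Rsp d => ∑ ξ ∈ S, a ξ * ee (inner ℝ ξ x)) := by
    simp only [F_eq]
    exact (continuous_es_right (zt d) S a).comp hzt
  rw [av, ENNReal.toReal_mul, ENNReal.toReal_inv, vol_ball c hR]
  congr 1
  rw [integral_eq_lintegral_of_nonneg_ae (Filter.Eventually.of_forall fun x => by positivity)
    (hcont.norm.measurable.pow_const p).aestronglyMeasurable]
  congr 1
  have hm : Measurable (fun y => ‖es (zt d) a S y‖ₑ ^ p) := (continuous_es_right (zt d) S a).measurable.enorm.pow_const _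
  have h := ball_int c hR hm
  simp only [enorm_es_sh] at h
  rw [← h]
  refine lintegral_congr fun x => ?_
  rw [F_eq, ← ENNReal.ofReal_rpow_of_nonneg (norm_nonneg _) (by linarith), ofReal_norm_eq_enorm]

end DR

theorem discrete_restriction_two_sided (n : ℕ) (hn : 2 ≤ n) (p : ℝ)
    (hp1 : 1 ≤ p) (hp : p ≤ 2 * ((n : ℝ) + 1) / ((n : ℝ) - 1)) :
    ∀ ε > (0 : ℝ), ∃ C : ℝ, 1 ≤ C ∧ ∀ δ : ℝ, 0 < δ → δ < 1 →
      ∀ Λ : Finset (Rsp (n - 1)), Λ.Nonempty → ↑Λ ⊆ parabSurf n →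
        (∀ ξ ∈ Λ, ∀ η ∈ Λ, ξ ≠ η → Real.sqrt δ ≤ dist ξ η) →
        ∀ a : Rsp (n - 1) → ℂ, ∀ R : ℝ, δ⁻¹ ≤ R → ∀ c : Rsp (n - 1),
          C⁻¹ * δ ^ ε * (∑ ξ ∈ Λ, ‖a ξ‖ ^ 2) ^ (1 / 2 : ℝ) ≤
              ((volume (Metric.ball c R)).toReal⁻¹ *
                ∫ x in Metric.ball c R, ‖∑ ξ ∈ Λ, a ξ * ee ⟪ξ, x⟫‖ ^ p) ^ (1 / p) ∧
            ((volume (Metric.ball c R)).toReal⁻¹ *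
                ∫ x in Metric.ball c R, ‖∑ ξ ∈ Λ, a ξ * ee ⟪ξ, x⟫‖ ^ p) ^ (1 / p) ≤
              C * δ ^ (-ε) * (∑ ξ ∈ Λ, ‖a ξ‖ ^ 2) ^ (1 / 2 : ℝ) := by
  intro ε hε
  have hn2 : (2:ℝ) ≤ n := by exact_mod_cast hn
  have hcast : ((n - 1 : ℕ) : ℝ) = (n : ℝ) - 1 := by
    rw [Nat.cast_sub (by omega)]; simp
  have hp2 : p * ((n - 1 : ℕ) : ℝ) ≤ 2 * (((n - 1 : ℕ) : ℝ) + 2) := by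
    rw [hcast]
    rw [le_div_iff₀ (by linarith)] at hp
    linarith
  obtain ⟨C, hC, h⟩ := DR.core (d := n - 1) (by omega) hp1 hp2 hε
  refine ⟨max 1 C.toReal, le_max_left _ _, ?_⟩
  intro δ hδ hδ1 Λ _ hΛ hsep a R hR c
  have hR0 : 0 < R := lt_of_lt_of_le (by positivity) hR
  have hG : DR.Gd (n - 1) δ Λ := ⟨fun ξ hξ => (hΛ hξ).1, fun ξ hξ => (hΛ hξ).2, hsep⟩
  obtain ⟨hl, hu⟩ := h δ Λ (DR.sh (DR.zt (n - 1)) (DR.zt (n - 1) c) 0 a) R hδ hδ1 hG hR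
  rw [DR.real_av hR0 hp1 Λ a c]
  simp only [DR.enorm_sh] at hl hu
  set A := (DR.av (n - 1) R p Λ (DR.sh (DR.zt (n - 1)) (DR.zt (n - 1) c) 0 a)) ^ (1 / p) with hA
  set X := (∑ l ∈ Λ, ‖a l‖ₑ ^ 2) ^ (1 / 2 : ℝ) with hX
  have hXT : X ≠ ⊤ := ENNReal.rpow_ne_top_of_nonneg (by norm_num) (ENNReal.sum_ne_top.2 fun l _ => by finiteness)
  have hx : X.toReal = (∑ ξ ∈ Λ, ‖a ξ‖ ^ 2) ^ (1 / 2 : ℝ) := by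
    rw [hX, ← ENNReal.toReal_rpow, ENNReal.toReal_sum (fun l _ => by finiteness)]
    simp
  have hCd : C * ENNReal.ofReal (δ ^ (-ε)) ≠ ⊤ := ENNReal.mul_ne_top hC ENNReal.ofReal_ne_top
  have hAT : A ≠ ⊤ := ne_top_of_le_ne_top (ENNReal.mul_ne_top hCd hXT) hu
  have hδe : 0 < δ ^ (-ε) := by positivity
  have hl' := ENNReal.toReal_mono (ENNReal.mul_ne_top hCd hAT) hl
  have hu' := ENNReal.toReal_mono (ENNReal.mul_ne_top hCd hXT) hu
  rw [ENNReal.toReal_mul, ENNReal.toReal_mul, ENNReal.toReal_ofReal hδe.le] at hl' hu'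
  rw [← hx]
  have hM : C.toReal ≤ max 1 C.toReal := le_max_right _ _
  have hM0 : 0 < max 1 C.toReal := lt_of_lt_of_le one_pos (le_max_left _ _)
  set M := max 1 C.toReal
  have hA0 : 0 ≤ A.toReal := ENNReal.toReal_nonneg
  have hX0 : 0 ≤ X.toReal := ENNReal.toReal_nonneg
  constructor
  · have h1 : X.toReal ≤ M * δ ^ (-ε) * A.toReal := hl'.trans (by gcongr)
    calc M⁻¹ * δ ^ ε * X.toReal ≤ M⁻¹ * δ ^ ε * (M * δ ^ (-ε) * A.toReal) := by gcongr
      _ = (M⁻¹ * M) * (δ ^ ε * δ ^ (-ε)) * A.toReal := by ring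
      _ = A.toReal := by
        rw [← Real.rpow_add hδ, inv_mul_cancel₀ hM0.ne']; simp
  · exact hu'.trans (by gcongr)

end
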